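/- Any two finite groups G and H, each of order 2^6 · 3 · 5^4 · 7^6 · 13 · 181 and each having prime graph degrees deg(2) = 3, deg(3) = 2, deg(5) = 3, deg(7) = 2, deg(13) = 1, deg(181) = 1, are isomorphic. -/

import Mathlib

/-- The degree of the prime `p` in the prime graph (Gruenberg–Kegel graph) `GK(G)` of the
group `G`: the number of primes `q ≠ p` such that `G` contains an element of order `p * q`
(two distinct primes being adjacent in `GK(G)` iff `G` has an element of order their
product). -/
noncomputable def gkDegree (G : Type*) [Group G] (p : ℕ) : ℕ :=
  Nat.card {q : ℕ // p ≠ q ∧ p.Prime ∧ q.Prime ∧ ∃ g : G, orderOf g = p * q}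

section CharacterTheory

open Representation

variable {G : Type*} [Group G] [Fintype G] {k : Type*} [Field k]

/-- The function `χ` is the character of a finite-dimensional representation, with norm one;
over an algebraically closed field of characteristic zero this says that `χ` is an irreducible
character. -/
def IsIrrChar (χ : G → k) : Prop :=
  (∃ (n : ℕ) (ρ : Representation k G (Fin n → k)), ρ.character = χ) ∧
    ∑ g, χ g * χ g⁻¹ = Nat.card G

theorem isIrrChar_character {V : Type*} [AddCommGroup V] [Module k V] [FiniteDimensional k V]
    (ρ : Representation k G V) (h : ∑ g, ρ.character g * ρ.character g⁻¹ = Nat.card G) :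
    IsIrrChar ρ.character := by
  let e : V ≃ₗ[k] (Fin (Module.finrank k V) → k) := (Module.finBasis k V).equivFun
  let σ : Representation k G (Fin (Module.finrank k V) → k) :=
    (e.conjRingEquiv).toMonoidHom.comp ρ
  refine ⟨⟨_, σ, ?_⟩, h⟩
  ext g
  exact LinearMap.trace_conj' (ρ g) e

variable [CharZero k]

@[reducible] noncomputable def invertibleNatCard (G k : Type*) [Finite G] [Nonempty G] [Field k] [CharZero k] :
    Invertible (Nat.card G : k) := invertibleOfNonzero (by simp [Nat.card_pos.ne'])

theorem isIrreducible_of_norm_one {V : Type*} [AddCommGroup V] [Module k V]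
    [FiniteDimensional k V] (ρ : Representation k G V)
    (h : ∑ g, ρ.character g * ρ.character g⁻¹ = Nat.card G) : ρ.IsIrreducible := by
  let _ := invertibleNatCard G k
  have h1 := card_inv_mul_sum_char_mul_char_eq_finrank ρ ρ
  rw [h, inv_mul_cancel₀ (Invertible.ne_zero _)] at h1
  have h2 : Module.finrank k (IntertwiningMap ρ ρ) = 1 := by exact_mod_cast h1.symm
  rw [(IntertwiningMap.equivAlgEnd (ρ := ρ)).toLinearEquiv.finrank_eq] at h2
  rw [irreducible_iff_isSimpleModule_asModule]
  have hss : IsSemisimpleModule (MonoidAlgebra k G) ρ.asModule := by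
    rw [← isSemisimpleRepresentation_iff_isSemisimpleModule_asModule]
    infer_instance
  have h3 := (finrank_eq_one_iff_of_nonzero' (K := k)
    (1 : Module.End (MonoidAlgebra k G) ρ.asModule) ?_).1 h2
  · have : Nontrivial ρ.asModule := by
      by_contra hn
      rw [not_nontrivial_iff_subsingleton] at hn
      have : Subsingleton (Module.End (MonoidAlgebra k G) ρ.asModule) :=
        ⟨fun a b => by ext x; exact Subsingleton.elim _ _⟩
      rw [Module.finrank_zero_of_subsingleton] at h2
      exact zero_ne_one h2
    rw [isSimpleModule_iff]
    refine ⟨fun N => ?_⟩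
    obtain ⟨N', hN⟩ := exists_isCompl N
    obtain ⟨c, hc⟩ := h3 (N.subtype ∘ₗ N.projectionOnto N' hN)
    by_cases hc0 : c = 0
    · left
      rw [eq_bot_iff]
      intro x hx
      have := LinearMap.congr_fun hc x
      rw [hc0] at this
      simpa [Submodule.projectionOnto_apply_left hN ⟨x, hx⟩] using this.symm
    · right
      rw [eq_top_iff]
      intro x _
      have := LinearMap.congr_fun hc x
      have h4 : c • x ∈ N := by
        have h5 : c • x = N.subtype (N.projectionOnto N' hN x) := this
        rw [h5]
        exact Submodule.coe_mem _
      have h5 : (algebraMap k (MonoidAlgebra k G) c⁻¹) • (c • x) ∈ N := N.smul_mem _ h4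
      rwa [algebraMap_smul, smul_smul, inv_mul_cancel₀ hc0, one_smul] at h5
  · intro h0
    have : Subsingleton (Module.End (MonoidAlgebra k G) ρ.asModule) :=
      subsingleton_of_zero_eq_one h0.symm
    rw [Module.finrank_zero_of_subsingleton] at h2
    exact zero_ne_one h2

namespace IsIrrChar

variable {χ ψ : G → k}

theorem exists_rep (h : IsIrrChar χ) : ∃ (n : ℕ) (ρ : Representation k G (Fin n → k)),
    ρ.IsIrreducible ∧ ρ.character = χ := by
  obtain ⟨⟨n, ρ, rfl⟩, h2⟩ := h
  exact ⟨n, ρ, isIrreducible_of_norm_one ρ h2, rfl⟩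

theorem sum_mul_inv [IsAlgClosed k] (hχ : IsIrrChar χ) (hψ : IsIrrChar ψ) (hne : χ ≠ ψ) :
    ∑ g, χ g * ψ g⁻¹ = 0 := by
  let _ := invertibleNatCard G k
  obtain ⟨n, ρ, hρ, rfl⟩ := hχ.exists_rep
  obtain ⟨m, σ, hσ, rfl⟩ := hψ.exists_rep
  have := char_orthonormal ρ σ
  rw [if_neg (fun ⟨e⟩ => hne (char_iso e).symm)] at this
  exact (mul_eq_zero.1 this).resolve_left (inv_ne_zero (Invertible.ne_zero _))

omit [CharZero k] in
theorem conj (hχ : IsIrrChar χ) (g h : G) : χ (h * g * h⁻¹) = χ g := by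
  obtain ⟨⟨n, ρ, rfl⟩, h2⟩ := hχ
  exact char_conj ρ g h

theorem exists_degree (hχ : IsIrrChar χ) : ∃ n : ℕ, 0 < n ∧ χ 1 = n := by
  obtain ⟨n, ρ, h, rfl⟩ := hχ.exists_rep
  have h3 := (irreducible_iff_isSimpleModule_asModule ρ).1 h
  have : Nontrivial (Fin n → k) := IsSimpleModule.nontrivial (MonoidAlgebra k G) ρ.asModule
  refine ⟨n, ?_, by simp⟩
  rcases n.eq_zero_or_pos with rfl | h
  · exact absurd this (not_nontrivial _)
  · exact h

omit [CharZero k] in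
theorem one : IsIrrChar (1 : G → k) := by
  have : (Representation.trivial k G (Fin 1 → k)).character = 1 := by
    ext g; simp [character]
  rw [← this]
  refine isIrrChar_character _ ?_
  rw [this]; simp

omit [CharZero k] in
theorem inv (hχ : IsIrrChar χ) : IsIrrChar (fun g => χ g⁻¹) := by
  obtain ⟨⟨n, ρ, rfl⟩, h2⟩ := hχ
  have : ρ.dual.character = fun g => ρ.character g⁻¹ := by ext g; simp
  rw [← this]
  refine isIrrChar_character _ ?_
  rw [this, ← h2]
  exact Finset.sum_congr rfl fun g _ => mul_comm _ _ |>.trans (by simp [Nat.card_pos.ne'])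

omit [CharZero k] in
theorem map (hχ : IsIrrChar χ) (σ : k ≃+* k) : IsIrrChar (fun g => σ (χ g)) := by
  obtain ⟨⟨n, ρ, rfl⟩, h2⟩ := hχ
  let m : (Module.End k (Fin n → k)) →* Module.End k (Fin n → k) :=
    (LinearMap.toMatrixAlgEquiv' (R := k) (n := Fin n)).symm.toAlgHom.toRingHom.comp
      ((σ.toRingHom.mapMatrix).comp
        (LinearMap.toMatrixAlgEquiv' (R := k) (n := Fin n)).toAlgHom.toRingHom)
  refine ⟨⟨n, m.comp ρ, ?_⟩, ?_⟩
  · ext g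
    change LinearMap.trace k _ (Matrix.toLin' _) = σ (LinearMap.trace k _ (ρ g))
    rw [Matrix.trace_toLin'_eq, LinearMap.trace_eq_matrix_trace k (Pi.basisFun k (Fin n))]
    exact (AddMonoidHom.map_trace σ.toRingHom.toAddMonoidHom _).symm
  · have := congr_arg σ h2
    simpa [map_sum] using this

end IsIrrChar

end CharacterTheory

section CharacterTheory

open Representation

variable {G : Type*} [Group G] [Fintype G] {k : Type*} [Field k] [CharZero k] [IsAlgClosed k]

namespace IsIrrChar

variable {χ ψ : G → k}

omit [CharZero k] in
theorem exists_central_scalar {V : Type*} [AddCommGroup V] [Module k V] [FiniteDimensional k V]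
    (ρ : Representation k G V) [ρ.IsIrreducible] (f : G → k)
    (hf : ∀ g h, f (h * g * h⁻¹) = f g) : ∃ c : k, ∑ g, f g • ρ g = c • 1 := by
  have hcomm : ∀ h, (∑ g, f g • ρ g) * ρ h = ρ h * ∑ g, f g • ρ g := by
    intro h
    rw [Finset.sum_mul, Finset.mul_sum]
    refine Fintype.sum_equiv (MulAut.conj h⁻¹).toEquiv _ _ fun g => ?_
    have h1 : f (h⁻¹ * (g * h)) = f g := by simpa [mul_assoc] using hf g h⁻¹
    simp [h1, ← map_mul, mul_assoc]
  obtain ⟨c, hc⟩ := (IsIrreducible.algebraMap_intertwiningMap_bijective_of_isAlgClosed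
    (ρ := ρ)).2
    ((∑ g, f g • ρ g).intertwiningMap_of_isIntertwiningMap ρ ρ
      fun h v => LinearMap.congr_fun (hcomm h) v)
  refine ⟨c, ?_⟩
  ext v
  exact (congr_arg (fun F : IntertwiningMap ρ ρ => F v) hc).symm

theorem sum_mul_sum_mul (hχ : IsIrrChar χ) (f₁ f₂ : G → k)
    (hf₁ : ∀ g h, f₁ (h * g * h⁻¹) = f₁ g) (hf₂ : ∀ g h, f₂ (h * g * h⁻¹) = f₂ g) :
    (∑ x, ∑ y, f₁ x * f₂ y * χ (x * y)) * χ 1 = (∑ x, f₁ x * χ x) * ∑ y, f₂ y * χ y := by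
  obtain ⟨n, ρ, hρ, rfl⟩ := hχ.exists_rep
  obtain ⟨c₁, hc₁⟩ := exists_central_scalar ρ f₁ hf₁
  obtain ⟨c₂, hc₂⟩ := exists_central_scalar ρ f₂ hf₂
  have h₁ : ∑ x, f₁ x * ρ.character x = c₁ * ρ.character 1 := by
    simpa [character] using congr_arg (LinearMap.trace k _) hc₁
  have h₂ : ∑ x, f₂ x * ρ.character x = c₂ * ρ.character 1 := by
    simpa [character] using congr_arg (LinearMap.trace k _) hc₂
  have h₃ : ∑ x, ∑ y, f₁ x * f₂ y * ρ.character (x * y) = c₁ * c₂ * ρ.character 1 := by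
    have h4 : (∑ g, f₁ g • ρ g) * (∑ g, f₂ g • ρ g) = (c₁ * c₂) • 1 := by
      rw [hc₁, hc₂]; rw [smul_mul_smul_comm, one_mul]
    rw [Finset.sum_mul_sum] at h4
    simpa [character, smul_smul, ← map_mul, mul_comm, mul_left_comm] using
      congr_arg (LinearMap.trace k _) h4
  rw [h₁, h₂, h₃]; ring

omit [CharZero k] in
theorem isIntegral_character {V : Type*} [AddCommGroup V] [Module k V] [FiniteDimensional k V]
    (ρ : Representation k G V) (g : G) : IsIntegral ℤ (ρ.character g) := by
  let b := Module.finBasis k V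
  rw [character, LinearMap.trace_eq_matrix_trace k b,
    Matrix.trace_eq_sum_roots_charpoly]
  refine IsIntegral.multiset_sum fun μ hμ => ?_
  have h1 : Module.End.HasEigenvalue (ρ g) μ := by
    rw [Module.End.hasEigenvalue_iff_isRoot_charpoly, ← LinearMap.charpoly_toMatrix (ρ g) b]
    exact Polynomial.isRoot_of_mem_roots hμ
  obtain ⟨v, hv⟩ := h1.exists_hasEigenvector
  have h2 : (ρ g ^ orderOf g) v = μ ^ orderOf g • v := hv.pow_apply _
  rw [← map_pow, pow_orderOf_eq_one, map_one, Module.End.one_apply] at h2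
  have h3 : μ ^ orderOf g = 1 := by
    have : (μ ^ orderOf g - 1) • v = 0 := by rw [sub_smul, ← h2]; simp
    exact sub_eq_zero.1 ((smul_eq_zero.1 this).resolve_right hv.2)
  exact IsIntegral.of_pow (orderOf_pos g) (by rw [h3]; exact isIntegral_one)

omit [CharZero k] in
theorem isIntegral (hχ : IsIrrChar χ) (g : G) : IsIntegral ℤ (χ g) := by
  obtain ⟨⟨n, ρ, rfl⟩, -⟩ := hχ
  exact isIntegral_character ρ g

theorem isIntegral_sum_div (hχ : IsIrrChar χ) (f : G → k) (hf : ∀ g h, f (h * g * h⁻¹) = f g)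
    (hfi : ∀ g, IsIntegral ℤ (f g)) : IsIntegral ℤ ((∑ g, f g * χ g) / χ 1) := by
  obtain ⟨d, hd, hd1⟩ := hχ.exists_degree
  obtain ⟨n, ρ, hρ, rfl⟩ := hχ.exists_rep
  obtain ⟨c, hc⟩ := exists_central_scalar ρ f hf
  have h₁ : ∑ x, f x * ρ.character x = c * ρ.character 1 := by
    simpa [character] using congr_arg (LinearMap.trace k _) hc
  have hd0 : ρ.character 1 ≠ 0 := by rw [hd1]; exact_mod_cast hd.ne'
  rw [h₁, mul_div_cancel_right₀ _ hd0]
  let O := integralClosure ℤ k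
  let F : MonoidAlgebra O G := ∑ g, MonoidAlgebra.single g ⟨f g, hfi g⟩
  have hF : IsIntegral O F := IsIntegral.of_finite O F
  let φ : MonoidAlgebra O G →ₐ[O] Module.End k (Fin n → k) := MonoidAlgebra.lift O _ G ρ
  have h2 : φ F = algebraMap k _ c := by
    have : φ F = ∑ g, f g • ρ g := by
      simp only [φ, F, map_sum, MonoidAlgebra.lift_single]
      rfl
    rw [this, hc, Algebra.algebraMap_eq_smul_one]
  have h3 := hF.map φ
  rw [h2] at h3
  have : Nontrivial (Module.End k (Fin n → k)) := by
    by_contra hn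
    rw [not_nontrivial_iff_subsingleton] at hn
    apply hd0
    rw [character, Subsingleton.elim (ρ 1) 0, map_zero]
  rw [isIntegral_algebraMap_iff (algebraMap k (Module.End k (Fin n → k))).injective] at h3
  exact isIntegral_trans c h3

theorem degree_dvd (hχ : IsIrrChar χ) {n : ℕ} (hn : χ 1 = n) : n ∣ Nat.card G := by
  obtain ⟨d, hd, hd1⟩ := hχ.exists_degree
  have : d = n := by exact_mod_cast hd1.symm.trans hn
  subst this
  have h1 := hχ.isIntegral_sum_div (fun g => χ g⁻¹)
    (fun g h => by simpa [mul_assoc] using hχ.conj g⁻¹ h) (fun g => hχ.isIntegral _)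
  have h2 : ∑ g, χ g⁻¹ * χ g = (Nat.card G : k) := by
    rw [← hχ.2]; exact Finset.sum_congr rfl fun _ _ => mul_comm _ _
  rw [h2, hn] at h1
  have h3 : ((Nat.card G : k) / d) = algebraMap ℚ k ((Nat.card G : ℚ) / d) := by simp
  rw [h3, isIntegral_algebraMap_iff (algebraMap ℚ k).injective] at h1
  obtain ⟨z, hz⟩ := IsIntegrallyClosed.isIntegral_iff.1 h1
  have hd' : (d : ℚ) ≠ 0 := by exact_mod_cast hd.ne'
  have h4 : (z : ℚ) * d = Nat.card G := by
    rw [eq_div_iff hd'] at hz; simpa using hz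
  have h5 : z * d = Nat.card G := by exact_mod_cast h4
  exact_mod_cast Dvd.intro_left z h5

end IsIrrChar

theorem sum_smul_eq_zero (f : G → k) (hf : ∀ g h, f (h * g * h⁻¹) = f g)
    (h : ∀ χ : G → k, IsIrrChar χ → ∑ g, f g * χ g = 0) (n : ℕ) :
    ∀ {V : Type*} [AddCommGroup V] [Module k V] [FiniteDimensional k V]
      (ρ : Representation k G V), Module.finrank k V ≤ n → ∑ g, f g • ρ g = 0 := by
  have hinv : NeZero (Nat.card G : k) := ⟨by simp⟩
  let _ := invertibleNatCard G k
  induction n with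
  | zero =>
    intro V _ _ _ ρ hV
    have : Subsingleton V := Module.finrank_zero_iff.1 (Nat.le_zero.1 hV)
    ext v
    exact Subsingleton.elim _ _
  | succ n ih =>
    intro V _ _ _ ρ hV
    rcases subsingleton_or_nontrivial V with hs | hnt
    · ext v
      exact Subsingleton.elim _ _
    by_cases hρ : ρ.IsIrreducible
    · obtain ⟨c, hc⟩ := IsIrrChar.exists_central_scalar ρ f hf
      have h₁ : ∑ x, f x * ρ.character x = c * ρ.character 1 := by
        simpa [character] using congr_arg (LinearMap.trace k _) hc
      have h₂ : IsIrrChar ρ.character := by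
        refine isIrrChar_character ρ ?_
        have := char_orthonormal ρ ρ
        rw [if_pos ⟨Representation.Equiv.refl _⟩, inv_mul_eq_one₀ (Invertible.ne_zero _)] at this
        exact this.symm
      rw [h _ h₂, char_one] at h₁
      have : c = 0 := by
        refine (mul_eq_zero.1 h₁.symm).resolve_right ?_
        exact_mod_cast Module.finrank_pos.ne'
      rw [hc, this, zero_smul]
    · have : Nontrivial (Subrepresentation ρ) := by
        refine ⟨⊥, ⊤, fun h => ?_⟩
        obtain ⟨v, hv⟩ := exists_ne (0 : V)
        have : v ∈ (⊤ : Subrepresentation ρ) := trivial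
        rw [← h] at this
        exact hv this
      obtain ⟨W, hW⟩ : ∃ W : Subrepresentation ρ, ¬ (W = ⊥ ∨ W = ⊤) := by
        by_contra! hcon
        exact hρ ⟨hcon⟩
      push Not at hW
      obtain ⟨W', hW'⟩ := exists_isCompl W
      have hlt : ∀ W : Subrepresentation ρ, W ≠ ⊤ → ∀ v ∈ W, (∑ g, f g • ρ g) v = 0 := by
        intro W hW v hv
        have h1 : Module.finrank k W.toSubmodule ≤ n := by
          have : Module.finrank k W.toSubmodule < Module.finrank k V := by
            refine Submodule.finrank_lt fun h => hW ?_
            exact Subrepresentation.toSubmodule_injective h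
          omega
        have h2 := congr_arg (fun F => (F ⟨v, hv⟩ : W.toSubmodule).1) (ih W.toRepresentation h1)
        simpa [Subrepresentation.toRepresentation] using h2
      ext v
      have h3 : v ∈ W.toSubmodule ⊔ W'.toSubmodule := by
        rw [← Subrepresentation.toSubmodule_sup, hW'.sup_eq_top]; trivial
      obtain ⟨a, ha, b, hb, rfl⟩ := Submodule.mem_sup.1 h3
      have hW'2 : W' ≠ ⊤ := by
        rintro rfl
        exact hW.1 (by simpa using hW'.inf_eq_bot)
      rw [map_add, hlt W hW.2 a ha, hlt W' hW'2 b hb]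
      simp

/-- A class function orthogonal to all irreducible characters vanishes. -/
theorem eq_zero_of_forall_sum_mul_eq_zero (f : G → k) (hf : ∀ g h, f (h * g * h⁻¹) = f g)
    (h : ∀ χ : G → k, IsIrrChar χ → ∑ g, f g * χ g = 0) : f = 0 := by
  classical
  have h1 := sum_smul_eq_zero f hf h _ (leftRegular k G) le_rfl
  ext g
  have := LinearMap.congr_fun h1 (.single 1 1)
  have h2 := congr_arg (fun F : MonoidAlgebra k G => F.coeff g) this
  simpa [Finsupp.single_apply, Finsupp.finsetSum_apply, MonoidAlgebra.coeff_sum] using h2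

end CharacterTheory

section CharacterTheory

open Representation

variable {G : Type*} [Group G] [Fintype G] {k : Type*} [Field k] [CharZero k] [IsAlgClosed k]

theorem finite_setOf_isIrrChar : {χ : G → k | IsIrrChar χ}.Finite := by
  have hli : LinearIndependent k (fun χ : {χ : G → k | IsIrrChar χ} => (χ : G → k)) := by
    rw [linearIndependent_iff']
    intro s c hc χ hχ
    have h1 : ∑ g, (∑ ψ ∈ s, c ψ • (ψ : G → k)) g * χ.1 g⁻¹ = 0 := by
      rw [hc]; simp
    simp only [Finset.sum_apply, Pi.smul_apply, smul_eq_mul, Finset.sum_mul] at h1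
    rw [Finset.sum_comm, Finset.sum_eq_single χ] at h1
    · simp only [mul_assoc, ← Finset.mul_sum] at h1
      rw [χ.2.2] at h1
      simpa using h1
    · intro ψ _ hne
      simp only [mul_assoc, ← Finset.mul_sum]
      rw [ψ.2.sum_mul_inv χ.2 (fun h => hne (Subtype.ext h)), mul_zero]
    · exact fun h => absurd hχ h
  exact Set.finite_coe_iff.1 hli.finite

/-- The finite set of irreducible characters of `G` over `k`. -/
noncomputable def irrChars (G k : Type*) [Group G] [Fintype G] [Field k] [CharZero k]
    [IsAlgClosed k] : Finset (G → k) :=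
  (finite_setOf_isIrrChar (G := G) (k := k)).toFinset

theorem mem_irrChars {χ : G → k} : χ ∈ irrChars G k ↔ IsIrrChar χ := by
  simp [irrChars]

/-- The coefficient of the irreducible character `χ` in the class function `f`. -/
noncomputable def charCoeff (f χ : G → k) : k := (Nat.card G : k)⁻¹ * ∑ g, f g * χ g⁻¹

theorem eq_sum_charCoeff_smul (f : G → k) (hf : ∀ g h, f (h * g * h⁻¹) = f g) :
    f = ∑ χ ∈ irrChars G k, charCoeff f χ • χ := by
  classical
  have hG : (Nat.card G : k) ≠ 0 := by simp
  rw [← sub_eq_zero]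
  refine eq_zero_of_forall_sum_mul_eq_zero _ ?_ ?_
  · intro g h
    simp only [Pi.sub_apply, Finset.sum_apply, Pi.smul_apply, hf]
    congr 1
    exact Finset.sum_congr rfl fun χ hχ => by rw [(mem_irrChars.1 hχ).conj]
  · intro χ hχ
    have hχ' := hχ.inv
    simp only [Pi.sub_apply, Finset.sum_apply, Pi.smul_apply, smul_eq_mul, sub_mul,
      Finset.sum_sub_distrib, Finset.sum_mul]
    rw [Finset.sum_comm, Finset.sum_eq_single (fun g => χ g⁻¹)]
    · have := hχ'.2
      simp only [inv_inv] at this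
      simp only [mul_assoc, ← Finset.mul_sum, this, charCoeff, inv_inv]
      field_simp
      simp
    · intro ψ hψ hne
      have := (mem_irrChars.1 hψ).sum_mul_inv hχ' hne
      simp only [inv_inv] at this
      simp only [mul_assoc, ← Finset.mul_sum, this, mul_zero]
    · exact fun h => absurd (mem_irrChars.2 hχ') h

theorem sum_mul_inv_eq_sum_charCoeff (f₁ f₂ : G → k)
    (hf₂ : ∀ g h, f₂ (h * g * h⁻¹) = f₂ g) :
    ∑ g, f₁ g * f₂ g⁻¹ = Nat.card G * ∑ χ ∈ irrChars G k, charCoeff f₁ χ * charCoeff f₂ χ := by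
  have h2 : ∀ g, f₂ g = ∑ χ ∈ irrChars G k, charCoeff f₂ χ * χ g := fun g => by
    conv_lhs => rw [eq_sum_charCoeff_smul f₂ hf₂]
    simp
  have hG : (Nat.card G : k) ≠ 0 := by simp
  simp only [h2 _⁻¹, Finset.mul_sum]
  rw [Finset.sum_comm]
  refine Finset.sum_congr rfl fun χ _ => ?_
  have : ∑ g, f₁ g * (charCoeff f₂ χ * χ g⁻¹) = charCoeff f₂ χ * ∑ g, f₁ g * χ g⁻¹ := by
    rw [Finset.mul_sum]; exact Finset.sum_congr rfl fun _ _ => by ring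
  rw [this, charCoeff.eq_1 f₁]
  field_simp

theorem sum_sq_degree : ∑ χ ∈ irrChars G k, χ 1 ^ 2 = Nat.card G := by
  classical
  have hG : (Nat.card G : k) ≠ 0 := by simp
  have h := sum_mul_inv_eq_sum_charCoeff (G := G) (k := k) (Pi.single 1 1) (Pi.single 1 1)
    (by intro g h; simp [Pi.single_apply])
  have h1 : ∀ χ : G → k, charCoeff (Pi.single 1 1) χ = (Nat.card G : k)⁻¹ * χ 1 := by
    intro χ; simp [charCoeff, Pi.single_apply]
  simp only [h1] at h
  simp [Pi.single_apply] at h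
  have h3 : ∑ x ∈ irrChars G k, (Fintype.card G : k)⁻¹ * x 1 * ((Fintype.card G : k)⁻¹ * x 1)
      = (Fintype.card G : k)⁻¹ ^ 2 * ∑ χ ∈ irrChars G k, χ 1 ^ 2 := by
    rw [Finset.mul_sum]; exact Finset.sum_congr rfl fun _ _ => by ring
  rw [h3] at h
  rw [Nat.card_eq_fintype_card] at hG ⊢
  field_simp at h
  exact h.symm

namespace IsIrrChar

variable {χ : G → k}

omit [IsAlgClosed k] in
theorem exists_multiplicity (hχ : IsIrrChar χ) {S : Type*} [Group S] [Fintype S] (φ : S →* G)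
    (μ : S →* k) : ∃ n : ℕ, ∑ s, χ (φ s) * μ s⁻¹ = Nat.card S * n := by
  obtain ⟨⟨n, ρ, rfl⟩, -⟩ := hχ
  let _ := invertibleNatCard S k
  let σ : Representation k S (Fin n → k) :=
    { toFun := fun s => μ s⁻¹ • ρ (φ s)
      map_one' := by simp
      map_mul' := fun a b => by
        rw [mul_inv_rev, map_mul, map_mul, map_mul, mul_comm (μ _), smul_mul_smul_comm] }
  have := card_inv_mul_sum_char_eq_finrank σ
  rw [inv_mul_eq_iff_eq_mul₀ (Invertible.ne_zero _)] at this
  refine ⟨_, Eq.trans ?_ this⟩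
  exact Finset.sum_congr rfl fun s _ => by simp [character, σ, mul_comm]

omit [IsAlgClosed k] in
theorem exists_hom_of_degree_one (hχ : IsIrrChar χ) (h1 : χ 1 = 1) :
    ∃ φ : G →* k, ∀ g, φ g = χ g := by
  obtain ⟨⟨n, ρ, rfl⟩, -⟩ := hχ
  have hn : n = 1 := by simpa using h1
  subst hn
  refine ⟨Matrix.detMonoidHom.comp ((LinearMap.toMatrixAlgEquiv' (R := k) (n := Fin 1)).toAlgHom.toRingHom.toMonoidHom.comp ρ), fun g => ?_⟩
  rw [character, LinearMap.trace_eq_matrix_trace k (Pi.basisFun k (Fin 1))]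
  simp [Matrix.trace]

theorem modEq_degree (hχ : IsIrrChar χ) {p j : ℕ} [Fact p.Prime] {g : G} (hg : g ^ p ^ j = 1)
    {m : ℤ} {d : ℕ} (hm : χ g = m) (hd : χ 1 = d) : m ≡ d [ZMOD p] := by
  obtain ⟨⟨n, ρ, rfl⟩, -⟩ := hχ
  have hn : n = d := by simpa using hd
  subst hn
  let b := Module.finBasis k (Fin n → k)
  let M := LinearMap.toMatrix b b (ρ g)
  let O := integralClosure ℤ k
  have hroot : ∀ μ ∈ M.charpoly.roots, μ ^ p ^ j = 1 := by
    intro μ hμ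
    have h1 : Module.End.HasEigenvalue (ρ g) μ := by
      rw [Module.End.hasEigenvalue_iff_isRoot_charpoly, ← LinearMap.charpoly_toMatrix (ρ g) b]
      exact Polynomial.isRoot_of_mem_roots hμ
    obtain ⟨v, hv⟩ := h1.exists_hasEigenvector
    have h2 : (ρ g ^ p ^ j) v = μ ^ p ^ j • v := hv.pow_apply _
    rw [← map_pow, hg, map_one, Module.End.one_apply] at h2
    have : (μ ^ p ^ j - 1) • v = 0 := by rw [sub_smul, ← h2]; simp
    exact sub_eq_zero.1 ((smul_eq_zero.1 this).resolve_right hv.2)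
  have htr : (M.charpoly.roots).sum = m := by
    rw [← hm, character, LinearMap.trace_eq_matrix_trace k b, Matrix.trace_eq_sum_roots_charpoly]
  have hcard : Multiset.card M.charpoly.roots = n := by
    rw [← (IsAlgClosed.splits M.charpoly).natDegree_eq_card_roots, Matrix.charpoly_natDegree_eq_dim]
    simp
  have hnu : ∀ z : ℤ, (∃ o : O, (z : k) = p * o) → (p : ℤ) ∣ z := by
    rintro z ⟨o, ho⟩
    have hp : (p : k) ≠ 0 := by exact_mod_cast (Fact.out : p.Prime).ne_zero
    have h3 : algebraMap ℚ k (z / p) = o := by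
      simp only [map_div₀, map_intCast, map_natCast, ho]; field_simp
    have h4 : IsIntegral ℤ (algebraMap ℚ k (z / p)) := h3 ▸ o.2
    rw [isIntegral_algebraMap_iff (algebraMap ℚ k).injective] at h4
    obtain ⟨y, hy⟩ := IsIntegrallyClosed.isIntegral_iff.1 h4
    have hp' : (p : ℚ) ≠ 0 := by exact_mod_cast (Fact.out : p.Prime).ne_zero
    refine ⟨y, ?_⟩
    simp only [algebraMap_int_eq, eq_intCast] at hy
    field_simp at hy
    exact_mod_cast hy.symm.trans (mul_comm _ _)
  have hchar : CharP (O ⧸ Ideal.span {(p : O)}) p := by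
    refine CharP.quotient O p fun hu => ?_
    obtain ⟨o, ho⟩ := isUnit_iff_exists_inv.1 hu
    have h5 := hnu 1 ⟨o, by have := congr_arg (fun x : O => (x : k)) ho; simpa using this.symm⟩
    have h6 : p ∣ 1 := by exact_mod_cast h5
    exact (Fact.out : p.Prime).one_lt.ne' (Nat.dvd_one.1 h6)
  have h_int : ∀ μ ∈ M.charpoly.roots, IsIntegral ℤ μ := fun μ hμ =>
    IsIntegral.of_pow (pow_pos (Fact.out : p.Prime).pos j) (by rw [hroot μ hμ]; exact isIntegral_one)
  obtain ⟨s, hs⟩ : ∃ s : Multiset O, s.map (fun o : O => (o : k)) = M.charpoly.roots :=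
    CanLift.prf (β := Multiset O) (coe := Multiset.map (fun o : O => (o : k)))
      (cond := fun s => ∀ x ∈ s, IsIntegral ℤ x) M.charpoly.roots h_int
  have hsum : s.sum = (m : O) := by
    apply Subtype.ext
    have : ((s.sum : O) : k) = (s.map (fun o : O => (o : k))).sum :=
      map_multiset_sum O.subtype s
    rw [this, hs, htr]; simp
  have hpow : (s.map (fun o : O => o ^ p ^ j)).sum = (n : O) := by
    have : s.map (fun o : O => o ^ p ^ j) = s.map (fun _ => (1 : O)) := by
      refine Multiset.map_congr rfl fun o ho => ?_
      apply Subtype.ext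
      have : (o : k) ∈ M.charpoly.roots := by rw [← hs]; exact Multiset.mem_map_of_mem _ ho
      simpa using hroot _ this
    rw [this]
    rw [Multiset.map_const', Multiset.sum_replicate, ← hcard, ← hs, Multiset.card_map]; simp
  let q := Ideal.Quotient.mk (Ideal.span {(p : O)})
  have h7 : q (m : O) ^ p ^ j = q (n : O) := by
    rw [← hsum, ← hpow, ← iterateFrobenius_def, map_multiset_sum, map_multiset_sum,
      map_multiset_sum, Multiset.map_map, Multiset.map_map]
    exact congr_arg _ (Multiset.map_congr rfl fun o _ => by simp [iterateFrobenius_def])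
  have h8 : (p : ℤ) ∣ m ^ p ^ j - n := by
    apply hnu
    rw [← map_pow, Ideal.Quotient.eq, Ideal.mem_span_singleton] at h7
    obtain ⟨o, ho⟩ := h7
    refine ⟨o, ?_⟩
    have := congr_arg (fun x : O => (x : k)) ho
    simpa using this
  have h9 : (m : ZMod p) ^ p ^ j = m := ZMod.pow_card_pow _
  rw [← ZMod.intCast_zmod_eq_zero_iff_dvd] at h8
  rw [← ZMod.intCast_eq_intCast_iff, ← h9]
  push_cast at h8 ⊢
  exact sub_eq_zero.1 h8

end IsIrrChar

end CharacterTheory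

section Sunflower

open Finset

/-- Five sets of size three meeting pairwise in two points share two points with every set
that meets each of them in two points or coincides with it. -/
theorem exists_pair_subset_of_card_inter {α : Type*} [DecidableEq α] {ι : Type*}
    (F : ι → Finset α) (h3 : ∀ i, #(F i) = 3) (h2 : ∀ i j, F i ≠ F j → #(F i ∩ F j) = 2)
    (s : Fin 5 → ι) (hs : Function.Injective fun a => F (s a)) :
    ∃ K : Finset α, #K = 2 ∧ ∀ i, K ⊆ F i := by
  let A := F (s 0)
  let B := F (s 1)
  have hAB : A ≠ B := fun h => absurd (hs h) (by decide)
  refine ⟨A ∩ B, h2 _ _ hAB, ?_⟩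
  by_contra! hcon
  obtain ⟨i, hi⟩ := hcon
  let C := F i
  have hK : #(A ∩ B) = 2 := h2 _ _ hAB
  have hA : #A = 3 := h3 _
  have hB : #B = 3 := h3 _
  have hC : #C = 3 := h3 _
  have hCA : C ≠ A := fun h => hi (by rw [show F i = A from h]; exact inter_subset_left)
  have hCB : C ≠ B := fun h => hi (by rw [show F i = B from h]; exact inter_subset_right)
  have hCA2 : #(C ∩ A) = 2 := h2 _ _ hCA
  have hCB2 : #(C ∩ B) = 2 := h2 _ _ hCB
  have hU : #(A ∪ B) = 4 := by have := card_union_add_card_inter A B; omega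
  have hlt : ∀ D : Finset α, ¬ (A ∩ B ⊆ D) → #(D ∩ A ∩ B) ≤ 1 := by
    intro D hD
    have h5 : D ∩ A ∩ B ⊂ A ∩ B := by
      refine ⟨fun x hx => by simp at hx ⊢; tauto, fun h => hD fun x hx => ?_⟩
      have := h hx; simp at this; tauto
    have := card_lt_card h5; omega
  have hsub : ∀ D : Finset α, #D = 3 → #(D ∩ A) = 2 → #(D ∩ B) = 2 → ¬ (A ∩ B ⊆ D) →
      D ⊆ A ∪ B := by
    intro D hD hDA hDB hn
    have h6 := hlt D hn
    have h7 : #(D ∩ (A ∪ B)) = 3 := by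
      have e1 := card_union_add_card_inter (D ∩ A) (D ∩ B)
      have e2 : (D ∩ A) ∩ (D ∩ B) = D ∩ A ∩ B := by ext; simp; tauto
      rw [← inter_union_distrib_left, e2] at e1
      have := card_le_card (inter_subset_left : D ∩ (A ∪ B) ⊆ D)
      omega
    have := eq_of_subset_of_card_le (inter_subset_left : D ∩ (A ∪ B) ⊆ D) (by omega)
    rw [← this]; exact inter_subset_right
  have hCU : C ⊆ A ∪ B := hsub C hC hCA2 hCB2 hi
  have hall : ∀ a, F (s a) ⊆ A ∪ B := by
    intro a
    by_cases hDA : F (s a) = A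
    · rw [hDA]; exact subset_union_left
    by_cases hDB : F (s a) = B
    · rw [hDB]; exact subset_union_right
    by_cases hDC : F (s a) = C
    · rw [hDC]; exact hCU
    by_cases hK' : A ∩ B ⊆ F (s a)
    · by_contra hnot
      have hD := h3 (s a)
      have hDA2 : #(F (s a) ∩ A) = 2 := h2 _ _ hDA
      have hDC2 : #(F (s a) ∩ C) = 2 := h2 _ _ hDC
      have hDB2 : #(F (s a) ∩ B) = 2 := h2 _ _ hDB
      have e1 : F (s a) ∩ A = A ∩ B :=
        (eq_of_subset_of_card_le (subset_inter hK' inter_subset_left) (by omega)).symm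
      have e2 : F (s a) ∩ B = A ∩ B :=
        (eq_of_subset_of_card_le (subset_inter hK' inter_subset_right) (by omega)).symm
      have e3 : F (s a) ∩ C ⊆ C ∩ A ∩ B := by
        intro x hx
        have hxC := (mem_inter.1 hx).2
        have hxD := (mem_inter.1 hx).1
        have hxAB : x ∈ A ∩ B := by
          rcases mem_union.1 (hCU hxC) with h | h
          · rw [← e1]; exact mem_inter.2 ⟨hxD, h⟩
          · rw [← e2]; exact mem_inter.2 ⟨hxD, h⟩
        simp only [mem_inter] at hxAB ⊢
        tauto
      have := card_le_card e3
      have := hlt C hi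
      omega
    · exact hsub _ (h3 _) (h2 _ _ hDA) (h2 _ _ hDB) hK'
  have h8 : #(univ.image fun a => F (s a)) ≤ #((A ∪ B).powersetCard 3) := by
    refine card_le_card fun D hD => ?_
    obtain ⟨a, -, rfl⟩ := mem_image.1 hD
    exact mem_powersetCard.2 ⟨hall a, h3 _⟩
  rw [card_image_of_injective _ hs, card_powersetCard, hU] at h8
  exact absurd h8 (by decide)

/-- A family of integral vectors of norm three, with all other inner products equal to two. -/
theorem exists_common_support {ι I : Type*} [DecidableEq I] (S : Finset I) (c : ι → I → ℤ)
    (h3 : ∀ i, ∑ x ∈ S, c i x ^ 2 = 3)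
    (h2 : ∀ i j, (∃ x ∈ S, c i x ≠ c j x) → ∑ x ∈ S, c i x * c j x = 2)
    (s : Fin 5 → ι) (hs : ∀ a b, a ≠ b → ∃ x ∈ S, c (s a) x ≠ c (s b) x) :
    ∃ X ∈ S, ∃ Y ∈ S, X ≠ Y ∧ ∃ ε₁ ε₂ : ℤ, ε₁ ^ 2 = 1 ∧ ε₂ ^ 2 = 1 ∧ ∀ i,
      c i X = ε₁ ∧ c i Y = ε₂ ∧ ∃ Z ∈ S, Z ≠ X ∧ Z ≠ Y ∧ c i Z ^ 2 = 1 ∧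
        ∀ x ∈ S, x ≠ X → x ≠ Y → x ≠ Z → c i x = 0 := by
  have hsq : ∀ i, ∀ x ∈ S, c i x ≠ 0 → c i x ^ 2 = 1 := by
    intro i x hx h0
    have h4 : c i x ^ 2 ≤ 3 := by
      rw [← h3 i]; exact single_le_sum (f := fun x => c i x ^ 2) (fun _ _ => sq_nonneg _) hx
    have h5 : c i x ≤ 1 := by nlinarith
    have h6 : -1 ≤ c i x := by nlinarith
    interval_cases c i x <;> simp_all
  let T : ι → Finset I := fun i => {x ∈ S | c i x ≠ 0}
  have hT : ∀ i, #(T i) = 3 := by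
    intro i
    have : ∑ x ∈ T i, c i x ^ 2 = 3 := by
      rw [← h3 i]
      refine sum_subset (filter_subset _ _) fun x hx hx' => ?_
      have : c i x = 0 := by by_contra h; exact hx' (mem_filter.2 ⟨hx, h⟩)
      simp [this]
    rw [sum_congr rfl fun x hx => hsq i x (mem_filter.1 hx).1 (mem_filter.1 hx).2] at this
    simp only [sum_const, nsmul_eq_mul, mul_one] at this
    exact_mod_cast this
  let F : ι → Finset (I × ℤ) := fun i => (T i).image fun x => (x, c i x)
  have hmem : ∀ i x z, (x, z) ∈ F i ↔ x ∈ S ∧ c i x ≠ 0 ∧ z = c i x := by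
    intro i x z
    simp only [F, T, mem_image, mem_filter, Prod.mk.injEq]
    constructor
    · rintro ⟨y, ⟨h1, h2⟩, rfl, rfl⟩; exact ⟨h1, h2, rfl⟩
    · rintro ⟨h1, h2, rfl⟩; exact ⟨x, ⟨h1, h2⟩, rfl, rfl⟩
  have hF3 : ∀ i, #(F i) = 3 := by
    intro i
    rw [card_image_of_injective _ (fun x y h => (Prod.mk.inj h).1), hT]
  have hne : ∀ i j, (∃ x ∈ S, c i x ≠ c j x) → F i ≠ F j := by
    rintro i j ⟨x, hx, hne⟩ he
    by_cases h0 : c i x = 0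
    · have : (x, c j x) ∈ F j := (hmem _ _ _).2 ⟨hx, by rw [← h0]; exact hne.symm, rfl⟩
      rw [← he] at this
      exact hne ((hmem _ _ _).1 this).2.2.symm
    · have : (x, c i x) ∈ F i := (hmem _ _ _).2 ⟨hx, h0, rfl⟩
      rw [he] at this
      exact hne ((hmem _ _ _).1 this).2.2
  have hF2 : ∀ i j, F i ≠ F j → #(F i ∩ F j) = 2 := by
    intro i j hij
    have hex : ∃ x ∈ S, c i x ≠ c j x := by
      by_contra! h
      apply hij
      ext ⟨x, z⟩
      rw [hmem, hmem]
      refine and_congr_right fun hx => by rw [h x hx]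
    have hsum := h2 i j hex
    let P := {x ∈ S | c i x ≠ 0 ∧ c i x = c j x}
    have hP : F i ∩ F j = P.image fun x => (x, c i x) := by
      ext ⟨x, z⟩
      simp only [mem_inter, hmem, P, mem_image, mem_filter, Prod.mk.injEq]
      constructor
      · rintro ⟨⟨h1, h2, h3⟩, h4, h5, h6⟩; exact ⟨x, ⟨h1, h2, by rw [← h3, h6]⟩, rfl, h3.symm⟩
      · rintro ⟨y, ⟨h1, h2, h3⟩, rfl, rfl⟩; exact ⟨⟨h1, h2, rfl⟩, h1, by rwa [← h3], h3⟩
    rw [hP, card_image_of_injective _ (fun x y h => (Prod.mk.inj h).1)]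
    let Q := {x ∈ S | c i x ≠ 0 ∧ c j x ≠ 0 ∧ c i x ≠ c j x}
    have hprod : ∀ x ∈ S, c i x * c j x = (if x ∈ P then 1 else 0) - if x ∈ Q then 1 else 0 := by
      intro x hx
      by_cases h0 : c i x = 0
      · simp [P, Q, h0]
      by_cases h0' : c j x = 0
      · simp [P, Q, h0']
      have e1 := hsq i x hx h0
      have e2 := hsq j x hx h0'
      rcases (sq_eq_sq_iff_eq_or_eq_neg.1 (e1.trans (one_pow 2).symm)) with e | e <;>
      rcases (sq_eq_sq_iff_eq_or_eq_neg.1 (e2.trans (one_pow 2).symm)) with e' | e' <;> simp [P, Q, hx, e, e']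
    rw [sum_congr rfl hprod, sum_sub_distrib] at hsum
    have hPS : S.filter (· ∈ P) = P := by ext x; simp [P]
    have hQS : S.filter (· ∈ Q) = Q := by ext x; simp [Q]
    rw [← sum_filter, ← sum_filter, hPS, hQS] at hsum
    simp only [sum_const, nsmul_eq_mul, mul_one] at hsum
    have hdisj : #P + #Q ≤ 3 := by
      rw [← card_union_of_disjoint, ← hT i]
      · refine card_le_card fun x hx => ?_
        simp only [P, Q, T, mem_union, mem_filter] at hx ⊢
        tauto
      · rw [disjoint_left]; intro x; simp only [P, Q, mem_filter]; tauto
    omega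
  obtain ⟨K, hK2, hK⟩ := exists_pair_subset_of_card_inter F hF3 hF2 s fun a b hab => by
    by_contra hne'
    exact hne _ _ (hs a b hne') hab
  obtain ⟨⟨X, ε₁⟩, ⟨Y, ε₂⟩, hXY, rfl⟩ := card_eq_two.1 hK2
  have hX : ∀ i, X ∈ S ∧ c i X ≠ 0 ∧ ε₁ = c i X := fun i => (hmem _ _ _).1 (hK i (by simp))
  have hY : ∀ i, Y ∈ S ∧ c i Y ≠ 0 ∧ ε₂ = c i Y := fun i => (hmem _ _ _).1 (hK i (by simp))
  have hne' : X ≠ Y := by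
    rintro rfl
    exact hXY (by rw [(hX (s 0)).2.2, (hY (s 0)).2.2])
  refine ⟨X, (hX (s 0)).1, Y, (hY (s 0)).1, hne', ε₁, ε₂, ?_, ?_, fun i => ?_⟩
  · rw [(hX (s 0)).2.2]; exact hsq _ _ (hX (s 0)).1 (hX (s 0)).2.1
  · rw [(hY (s 0)).2.2]; exact hsq _ _ (hY (s 0)).1 (hY (s 0)).2.1
  refine ⟨(hX i).2.2.symm, (hY i).2.2.symm, ?_⟩
  have hsubT : ({X, Y} : Finset I) ⊆ T i := by
    intro x hx
    rcases mem_insert.1 hx with rfl | hx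
    · exact mem_filter.2 ⟨(hX i).1, (hX i).2.1⟩
    · rw [mem_singleton.1 hx]; exact mem_filter.2 ⟨(hY i).1, (hY i).2.1⟩
  have hcard : #(T i \ {X, Y}) = 1 := by
    rw [card_sdiff_of_subset hsubT, hT, card_pair hne']
  obtain ⟨Z, hZ⟩ := card_eq_one.1 hcard
  have hZm : Z ∈ T i \ {X, Y} := by rw [hZ]; simp
  simp only [T, mem_sdiff, mem_filter, mem_insert, mem_singleton, not_or] at hZm
  refine ⟨Z, hZm.1.1, hZm.2.1, hZm.2.2, hsq _ _ hZm.1.1 hZm.1.2, fun x hx h1 h2 h3 => ?_⟩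
  by_contra h0
  have : x ∈ T i \ {X, Y} := by simp [T, hx, h0, h1, h2]
  rw [hZ, mem_singleton] at this
  exact h3 this

end Sunflower

section Coherence

open Finset

variable {G : Type*} [Group G] {n : ℕ} {k : Type*} [Field k]

/-- A cyclic self-centralising subgroup `{a i}`, two nontrivial elements of which are conjugate
exactly when they lie in one orbit of multiplication by `κ`, where `κ` has order three. -/
structure IsTorus (n : ℕ) (a : Multiplicative (ZMod n) →* G) (κ : ZMod n) : Prop where
  card_centralizer : ∀ i ≠ 0, Nat.card (Subgroup.centralizer {a (.ofAdd i)}) = n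
  cube : κ ^ 3 = 1
  unit : IsUnit (κ - 1)
  conj : ∀ i ≠ 0, ∀ m, IsConj (a (.ofAdd i)) (a (.ofAdd m)) ↔ m = i ∨ m = κ * i ∨ m = κ ^ 2 * i

namespace IsTorus

variable {a : Multiplicative (ZMod n) →* G} {κ : ZMod n} (h : IsTorus n a κ)

include h in
theorem mul_ne {i : ZMod n} (hi : i ≠ 0) : κ * i ≠ i ∧ κ ^ 2 * i ≠ i ∧ κ ^ 2 * i ≠ κ * i := by
  have h1 : ∀ j, κ * j = j → j = 0 := by
    intro j hj
    have : (κ - 1) * j = 0 := by rw [sub_mul, hj, one_mul, sub_self]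
    exact (h.unit.mul_right_eq_zero).1 this
  have h3 := h.cube
  refine ⟨fun e => hi (h1 _ e), fun e => hi (h1 _ ?_), fun e => hi (h1 _ ?_)⟩
  · calc κ * i = κ * (κ ^ 2 * i) := by rw [e]
      _ = κ ^ 3 * i := by ring
      _ = i := by rw [h3, one_mul]
  · have : κ ^ 2 * (κ ^ 2 * i) = κ ^ 2 * (κ * i) := by rw [e]
    calc κ * i = κ ^ 3 * (κ * i) := by rw [h3, one_mul]
      _ = κ ^ 2 * (κ ^ 2 * i) := by ring
      _ = κ ^ 2 * (κ * i) := this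
      _ = κ ^ 3 * i := by ring
      _ = i := by rw [h3, one_mul]

end IsTorus

open Classical in
/-- The class function on `G` induced from the function `f` on the subgroup `{a i}`. -/
noncomputable def indFun [Fintype G] [NeZero n] (a : Multiplicative (ZMod n) →* G)
    (f : ZMod n → k) (g : G) : k :=
  (n : k)⁻¹ * ∑ h : G, ∑ i : ZMod n, if a (.ofAdd i) = h⁻¹ * g * h then f i else 0

variable [Fintype G] [NeZero n] (a : Multiplicative (ZMod n) →* G)

theorem indFun_conj (f : ZMod n → k) (g h : G) :
    indFun a f (h * g * h⁻¹) = indFun a f g := by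
  classical
  unfold indFun
  congr 1
  refine (Fintype.sum_equiv (Equiv.mulLeft h) _ _ fun x => ?_).symm
  refine sum_congr rfl fun i _ => ?_
  congr 2
  simp; group

theorem sum_indFun_mul (f : ZMod n → k) (F : G → k) (hF : ∀ g h, F (h * g * h⁻¹) = F g) :
    ∑ g, indFun a f g * F g = (Nat.card G : k) * ((n : k)⁻¹ * ∑ i, f i * F (a (.ofAdd i))) := by
  classical
  have h1 : ∀ h : G, ∑ g, (∑ i : ZMod n, if a (.ofAdd i) = h⁻¹ * g * h then f i else 0) * F g
      = ∑ i, f i * F (a (.ofAdd i)) := by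
    intro h
    simp only [sum_mul]
    rw [sum_comm]
    refine sum_congr rfl fun i _ => ?_
    rw [sum_eq_single (h * a (.ofAdd i) * h⁻¹)]
    · rw [hF, if_pos (by group)]
    · intro g _ hg
      rw [if_neg, zero_mul]
      intro e; apply hg; rw [e]; group
    · simp
  unfold indFun
  calc _ = (n : k)⁻¹ * ∑ h : G, ∑ g, (∑ i : ZMod n,
        if a (.ofAdd i) = h⁻¹ * g * h then f i else 0) * F g := by
        rw [sum_comm, mul_sum]
        exact sum_congr rfl fun g _ => by rw [← sum_mul, mul_assoc]
    _ = _ := by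
        rw [sum_congr rfl fun h _ => h1 h, sum_const, card_univ, nsmul_eq_mul,
          Nat.card_eq_fintype_card]
        ring

theorem indFun_eq_zero (f : ZMod n → k) (g : G) (hg : ∀ i, ¬ IsConj g (a (.ofAdd i))) :
    indFun a f g = 0 := by
  classical
  unfold indFun
  rw [sum_eq_zero, mul_zero]
  intro h _
  refine sum_eq_zero fun i _ => if_neg fun e => hg i ?_
  rw [isConj_iff]
  exact ⟨h⁻¹, by rw [e]; group⟩

theorem card_conjugators (g g' : G) (hc : IsConj g g') :
    Nat.card {h : G // g' = h⁻¹ * g * h} = Nat.card (Subgroup.centralizer {g}) := by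
  obtain ⟨c, hc⟩ := isConj_iff.1 hc
  refine Nat.card_congr ((Equiv.mulRight c).subtypeEquiv fun h => ?_)
  rw [Subgroup.mem_centralizer_singleton_iff, ← hc, Equiv.coe_mulRight]
  constructor
  · intro e
    have e' := congrArg (fun x => h * x * c) e
    simp only [mul_assoc, inv_mul_cancel, mul_one, mul_inv_cancel_left] at e' ⊢
    exact e'
  · intro e
    have e' := congrArg (fun x => h⁻¹ * x * c⁻¹) e
    simp only [mul_assoc, mul_inv_cancel, mul_one, inv_mul_cancel_left] at e' ⊢
    exact e'

theorem IsTorus.indFun_apply [CharZero k] {a : Multiplicative (ZMod n) →* G} {κ : ZMod n}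
    (h : IsTorus n a κ) (f : ZMod n → k) (h0 : f 0 = 0) (m : ZMod n) :
    indFun a f (a (.ofAdd m)) = f m + f (κ * m) + f (κ ^ 2 * m) := by
  classical
  have hn : (n : k) ≠ 0 := by exact_mod_cast NeZero.ne n
  have h1 : ∀ i, f i ≠ 0 → ∀ m, IsConj (a (.ofAdd m)) (a (.ofAdd i)) ↔
      i = m ∨ i = κ * m ∨ i = κ ^ 2 * m := by
    intro i hi m
    have hi0 : i ≠ 0 := by rintro rfl; exact hi h0
    by_cases hm : m = 0
    · subst hm
      rw [isConj_comm, h.conj i hi0]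
      have h3 : IsUnit κ := IsUnit.of_mul_eq_one (κ ^ 2) (by rw [← h.cube]; ring)
      simp only [mul_zero]
      refine ⟨?_, fun e => absurd (by simpa using e) hi0⟩
      rintro (e | e | e)
      · exact absurd e.symm hi0
      · exact absurd (h3.mul_right_eq_zero.1 e.symm) hi0
      · exact absurd ((h3.pow 2).mul_right_eq_zero.1 e.symm) hi0
    · exact h.conj m hm i
  unfold indFun
  rw [sum_comm]
  have h2 : ∀ i : ZMod n, (∑ x : G, if a (.ofAdd i) = x⁻¹ * a (.ofAdd m) * x then f i else 0)
      = n * if i = m ∨ i = κ * m ∨ i = κ ^ 2 * m then f i else 0 := by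
    intro i
    by_cases hi : f i = 0
    · simp [hi]
    rw [← sum_filter, sum_const, nsmul_eq_mul]
    have e : #{x : G | a (.ofAdd i) = x⁻¹ * a (.ofAdd m) * x} =
        Nat.card {x : G // a (.ofAdd i) = x⁻¹ * a (.ofAdd m) * x} := by
      rw [Nat.card_eq_fintype_card, Fintype.card_subtype]
    rw [e]
    split_ifs with hc
    · have hm : m ≠ 0 := by
        rintro rfl
        simp at hc; exact hi (by rw [hc, h0])
      rw [card_conjugators _ _ ((h1 i hi m).2 hc), h.card_centralizer m hm]
    · have : IsEmpty {x : G // a (.ofAdd i) = x⁻¹ * a (.ofAdd m) * x} := by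
        refine ⟨fun x => hc ((h1 i hi m).1 (isConj_iff.2 ⟨x.1⁻¹, ?_⟩))⟩
        rw [inv_inv]; exact x.2.symm
      simp
  rw [sum_congr rfl fun i _ => h2 i, ← mul_sum, inv_mul_cancel_left₀ hn]
  by_cases hm : m = 0
  · subst hm
    simp [h0]
  obtain ⟨e1, e2, e3⟩ := h.mul_ne hm
  rw [← sum_filter]
  have : ({i | i = m ∨ i = κ * m ∨ i = κ ^ 2 * m} : Finset (ZMod n)) =
      {m, κ * m, κ ^ 2 * m} := by ext; simp
  rw [this, sum_insert (by simp [e1.symm, e2.symm]), sum_insert (by simp [e3.symm]),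
    sum_singleton, add_assoc]

end Coherence

section Coherence

open Finset

variable {G : Type*} [Group G] [Fintype G] {n : ℕ} [NeZero n] {k : Type*} [Field k] [CharZero k]
  {a : Multiplicative (ZMod n) →* G} {κ : ZMod n} {ψ : AddChar (ZMod n) k}

theorem AddChar.IsPrimitive.sum_apply_mul (hψ : ψ.IsPrimitive) (b : ZMod n) [Decidable (b = 0)] :
    ∑ x, ψ (x * b) = if b = 0 then (n : k) else 0 := by
  classical
  rw [AddChar.sum_mulShift b hψ, ZMod.card]
  split_ifs <;> simp

/-- Fourier inversion for functions with constant nontrivial Fourier coefficients. -/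
theorem AddChar.IsPrimitive.eq_of_forall_sum (hψ : ψ.IsPrimitive) (F : ZMod n → k) (D : k)
    (h : ∀ j ≠ 0, ∑ i, (1 - ψ (i * j)) * F i = n * D) (m : ZMod n) (hm : m ≠ 0) : F m = D := by
  classical
  have hn : (n : k) ≠ 0 := by exact_mod_cast NeZero.ne n
  have e1 : ∑ j, ψ (j * (-m)) * ∑ i, (1 - ψ (i * j)) * F i = - (n * D) := by
    have : ∀ j, ψ (j * (-m)) * ∑ i, (1 - ψ (i * j)) * F i =
        ψ (j * (-m)) * (n * D) - if j = 0 then n * D else 0 := by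
      intro j
      split_ifs with hj
      · subst hj; simp
      · rw [h j hj, sub_zero]
    rw [sum_congr rfl fun j _ => this j, sum_sub_distrib, ← sum_mul, hψ.sum_apply_mul]
    simp [hm]
  have e2 : ∑ j, ψ (j * (-m)) * ∑ i, (1 - ψ (i * j)) * F i = - (n * F m) := by
    simp only [mul_sum]
    rw [sum_comm]
    have : ∀ i, ∑ j, ψ (j * (-m)) * ((1 - ψ (i * j)) * F i) =
        (∑ j, ψ (j * (-m)) - ∑ j, ψ (j * (i - m))) * F i := by
      intro i
      rw [← sum_sub_distrib, sum_mul]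
      refine sum_congr rfl fun j _ => ?_
      rw [show j * (i - m) = j * (-m) + i * j by ring, AddChar.map_add_eq_mul]
      ring
    rw [sum_congr rfl fun i _ => this i]
    simp only [hψ.sum_apply_mul, neg_eq_zero, hm, if_false, zero_sub, sub_eq_zero]
    simp
  have : (n : k) * F m = n * D := by rw [← neg_inj, ← e1, ← e2]
  exact mul_left_cancel₀ hn this

/-- The class function induced from the difference of the trivial character and the linear
character `i ↦ ψ (i * j)` of the torus. -/
noncomputable def torusFun (a : Multiplicative (ZMod n) →* G) (ψ : AddChar (ZMod n) k)
    (j : ZMod n) : G → k :=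
  indFun a fun i => 1 - ψ (i * j)

theorem torusFun_conj (j : ZMod n) (g x : G) :
    torusFun a ψ j (x * g * x⁻¹) = torusFun a ψ j g :=
  indFun_conj _ _ _ _

theorem sum_torusFun_mul (j : ZMod n) (F : G → k) (hF : ∀ g h, F (h * g * h⁻¹) = F g) :
    ∑ g, torusFun a ψ j g * F g =
      Nat.card G * ((n : k)⁻¹ * ∑ i, (1 - ψ (i * j)) * F (a (.ofAdd i))) :=
  sum_indFun_mul a _ F hF

theorem IsTorus.torusFun_apply (h : IsTorus n a κ) (j m : ZMod n) :
    torusFun a ψ j (a (.ofAdd m)) =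
      3 - ψ (m * j) - ψ (κ * m * j) - ψ (κ ^ 2 * m * j) := by
  rw [torusFun, h.indFun_apply _ (by simp)]
  ring

theorem IsTorus.sum_torusFun_mul_inv (h : IsTorus n a κ) (hψ : ψ.IsPrimitive) (j l : ZMod n)
    (hj : j ≠ 0) (hl : l ≠ 0) [Decidable (j = l)] [Decidable (j = κ * l)]
    [Decidable (j = κ ^ 2 * l)] :
    ∑ g, torusFun a ψ j g * torusFun a ψ l g⁻¹ =
      Nat.card G * (3 + (if j = l then 1 else 0) + (if j = κ * l then 1 else 0) +
        if j = κ ^ 2 * l then 1 else 0) := by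
  classical
  have hn : (n : k) ≠ 0 := by exact_mod_cast NeZero.ne n
  have hκ : IsUnit κ := IsUnit.of_mul_eq_one (κ ^ 2) (by rw [← h.cube]; ring)
  rw [sum_torusFun_mul j (fun g => torusFun a ψ l g⁻¹)]
  swap
  · intro g x
    rw [show (x * g * x⁻¹)⁻¹ = x * g⁻¹ * x⁻¹ by group]
    exact indFun_conj _ _ _ _
  have e : ∀ i : ZMod n, torusFun a ψ l (a (.ofAdd i))⁻¹ =
      3 - ψ (i * (-l)) - ψ (i * (-(κ * l))) - ψ (i * (-(κ ^ 2 * l))) := by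
    intro i
    rw [← map_inv, ← ofAdd_neg, h.torusFun_apply]
    rw [show -i * l = i * -l by ring, show κ * -i * l = i * -(κ * l) by ring,
      show κ ^ 2 * -i * l = i * -(κ ^ 2 * l) by ring]
  have e2 : ∀ i : ZMod n, (1 - ψ (i * j)) * torusFun a ψ l (a (.ofAdd i))⁻¹ =
      3 - ψ (i * (-l)) - ψ (i * (-(κ * l))) - ψ (i * (-(κ ^ 2 * l)))
      - 3 * ψ (i * j) + ψ (i * (j - l)) + ψ (i * (j - κ * l)) + ψ (i * (j - κ ^ 2 * l)) := by
    intro i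
    rw [e, show i * (j - l) = i * j + i * (-l) by ring,
      show i * (j - κ * l) = i * j + i * (-(κ * l)) by ring,
      show i * (j - κ ^ 2 * l) = i * j + i * (-(κ ^ 2 * l)) by ring]
    simp only [AddChar.map_add_eq_mul]
    ring
  congr 1
  rw [sum_congr rfl fun i _ => e2 i]
  simp only [sum_add_distrib, sum_sub_distrib, ← mul_sum, hψ.sum_apply_mul, sum_const, card_univ,
    ZMod.card, nsmul_eq_mul, neg_eq_zero, hl, hj, if_false, hκ.mul_right_eq_zero,
    (hκ.pow 2).mul_right_eq_zero, sub_eq_zero]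
  split_ifs <;> field_simp <;> ring

variable [IsAlgClosed k]

theorem charCoeff_torusFun (j : ZMod n) (χ : G → k) (hχ : ∀ g h, χ (h * g * h⁻¹) = χ g) :
    charCoeff (torusFun a ψ j) χ =
      (n : k)⁻¹ * ∑ i, (1 - ψ (i * (-j))) * χ (a (.ofAdd i)) := by
  have hG : (Nat.card G : k) ≠ 0 := by simp
  rw [charCoeff, sum_torusFun_mul j fun g => χ g⁻¹, inv_mul_cancel_left₀ hG]
  · congr 1
    refine Fintype.sum_equiv (Equiv.neg _) _ _ fun i => ?_
    simp [← map_inv, ← ofAdd_neg]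
  · intro g x
    rw [show (x * g * x⁻¹)⁻¹ = x * g⁻¹ * x⁻¹ by group, hχ]

theorem IsIrrChar.exists_sum_mul_eq {χ : G → k} (hχ : IsIrrChar χ) (j : ZMod n) :
    ∃ N : ℕ, ∑ i : ZMod n, ψ (i * j) * χ (a (.ofAdd i)) = n * N := by
  let μ : Multiplicative (ZMod n) →* k :=
    { toFun := fun s => ψ (s.toAdd * (-j))
      map_one' := by simp
      map_mul' := fun x y => by
        rw [← AddChar.map_add_eq_mul, toAdd_mul, add_mul] }
  obtain ⟨N, hN⟩ := hχ.exists_multiplicity a μ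
  refine ⟨N, ?_⟩
  have : Nat.card (Multiplicative (ZMod n)) = n := by
    rw [Nat.card_congr Multiplicative.toAdd, Nat.card_zmod]
  rw [this] at hN
  rw [← hN]
  refine Fintype.sum_equiv Multiplicative.ofAdd _ _ fun i => ?_
  simp [μ, mul_comm]

theorem IsIrrChar.exists_charCoeff_torusFun {χ : G → k} (hχ : IsIrrChar χ) (j : ZMod n) :
    ∃ c : ℤ, charCoeff (torusFun a ψ j) χ = c := by
  have hn : (n : k) ≠ 0 := by exact_mod_cast NeZero.ne n
  obtain ⟨N, hN⟩ := hχ.exists_sum_mul_eq (a := a) (ψ := ψ) 0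
  obtain ⟨M, hM⟩ := hχ.exists_sum_mul_eq (a := a) (ψ := ψ) (-j)
  refine ⟨N - M, ?_⟩
  rw [charCoeff_torusFun j χ fun g h => hχ.conj g h]
  simp only [mul_zero, AddChar.map_zero_eq_one, one_mul] at hN
  simp only [sub_mul, one_mul, sum_sub_distrib, hN, hM]
  push_cast
  field_simp

end Coherence

section Coherence

open Finset

variable {G : Type*} [Group G] [Fintype G] {n : ℕ} [NeZero n] {k : Type*} [Field k] [CharZero k]
  {a : Multiplicative (ZMod n) →* G} {κ : ZMod n} {ψ : AddChar (ZMod n) k} [IsAlgClosed k]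

theorem charCoeff_torusFun_one (hψ : ψ.IsPrimitive) {j : ZMod n} (hj : j ≠ 0) :
    charCoeff (torusFun a ψ j) (1 : G → k) = 1 := by
  classical
  have hn : (n : k) ≠ 0 := by exact_mod_cast NeZero.ne n
  rw [charCoeff_torusFun j _ (by simp)]
  simp only [Pi.one_apply, mul_one, sum_sub_distrib, hψ.sum_apply_mul, neg_eq_zero, hj, if_false]
  simp [ZMod.card, hn]

/-- The decomposition of the class functions induced from a torus. -/
theorem IsTorus.exists_decomposition (h : IsTorus n a κ) (hψ : ψ.IsPrimitive) (hn : 13 < n) :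
    ∃ X Y : G → k, IsIrrChar X ∧ IsIrrChar Y ∧ X ≠ 1 ∧ Y ≠ 1 ∧ X ≠ Y ∧
      ∃ ε₁ ε₂ : ℤ, ε₁ ^ 2 = 1 ∧ ε₂ ^ 2 = 1 ∧
      ∃ (Z : ZMod n → G → k) (ε : ZMod n → ℤ), ∀ j ≠ 0,
        IsIrrChar (Z j) ∧ Z j ≠ 1 ∧ Z j ≠ X ∧ Z j ≠ Y ∧ ε j ^ 2 = 1 ∧
        charCoeff (torusFun a ψ j) X = ε₁ ∧ charCoeff (torusFun a ψ j) Y = ε₂ ∧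
        charCoeff (torusFun a ψ j) (Z j) = ε j ∧
        (∀ χ, IsIrrChar χ → χ ≠ 1 → χ ≠ X → χ ≠ Y → χ ≠ Z j →
          charCoeff (torusFun a ψ j) χ = 0) ∧
        (∀ g, torusFun a ψ j g = 1 + ε₁ * X g + ε₂ * Y g + ε j * Z j g) ∧
        ∀ i ≠ 0, Z i = Z j → i = j ∨ i = κ * j ∨ i = κ ^ 2 * j := by
  classical
  have hG : (Nat.card G : k) ≠ 0 := by simp
  have hc : ∀ (j : ZMod n) (χ : G → k), ∃ c : ℤ, IsIrrChar χ → charCoeff (torusFun a ψ j) χ = c := by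
    intro j χ
    by_cases hχ : IsIrrChar χ
    · obtain ⟨c, hc⟩ := hχ.exists_charCoeff_torusFun (a := a) (ψ := ψ) j
      exact ⟨c, fun _ => hc⟩
    · exact ⟨0, fun h => absurd h hχ⟩
  choose c hc using hc
  let S : Finset (G → k) := (irrChars G k).erase 1
  have hS : ∀ χ, χ ∈ S ↔ χ ≠ 1 ∧ IsIrrChar χ := fun χ => by simp [S, mem_irrChars]
  have h1 : (1 : G → k) ∈ irrChars G k := mem_irrChars.2 IsIrrChar.one
  have hc1 : ∀ j ≠ 0, c j 1 = 1 := by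
    intro j hj
    have := (hc j 1 IsIrrChar.one).symm.trans (charCoeff_torusFun_one hψ hj)
    exact_mod_cast this
  have hsum : ∀ j l : ZMod n, j ≠ 0 → l ≠ 0 → ∑ χ ∈ S, c j χ * c l χ =
      2 + (if j = l then 1 else 0) + (if j = κ * l then 1 else 0) +
        if j = κ ^ 2 * l then 1 else 0 := by
    intro j l hj hl
    have e := h.sum_torusFun_mul_inv hψ j l hj hl
    rw [sum_mul_inv_eq_sum_charCoeff _ _ fun g x => torusFun_conj _ _ _] at e
    have e := mul_left_cancel₀ hG e
    rw [sum_congr rfl fun χ hχ => by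
      rw [hc j χ (mem_irrChars.1 hχ), hc l χ (mem_irrChars.1 hχ)]] at e
    have e' : ∑ χ ∈ irrChars G k, c j χ * c l χ = 3 + (if j = l then 1 else 0) +
      (if j = κ * l then 1 else 0) + if j = κ ^ 2 * l then 1 else 0 := by
      have e2 : ((∑ χ ∈ irrChars G k, c j χ * c l χ : ℤ) : k) = ((3 + (if j = l then 1 else 0) +
        (if j = κ * l then 1 else 0) + if j = κ ^ 2 * l then 1 else 0 : ℤ) : k) := by
        push_cast; exact e
      exact_mod_cast e2
    rw [← add_sum_erase _ _ h1, hc1 j hj, hc1 l hl] at e'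
    linarith
  have hne : ∀ j : ZMod n, j ≠ 0 → j ≠ κ * j ∧ j ≠ κ ^ 2 * j := fun j hj =>
    ⟨(h.mul_ne hj).1.symm, (h.mul_ne hj).2.1.symm⟩
  have hself : ∀ j : ZMod n, j ≠ 0 → ∑ χ ∈ S, c j χ * c j χ = 3 := by
    intro j hj
    rw [hsum j j hj hj]; simp [hne j hj]
  have hrel : ∀ j l : ZMod n, j ≠ 0 → l ≠ 0 → (j = l ∨ j = κ * l ∨ j = κ ^ 2 * l) →
      ∀ χ ∈ S, c j χ = c l χ := by
    intro j l hj hl hjl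
    have e1 : 3 ≤ ∑ χ ∈ S, c j χ * c l χ := by
      rw [hsum j l hj hl]
      split_ifs <;> first | omega | tauto
    have e2 : ∑ χ ∈ S, (c j χ - c l χ) ^ 2 ≤ 0 := by
      have : ∑ χ ∈ S, (c j χ - c l χ) ^ 2 = ∑ χ ∈ S, c j χ * c j χ + ∑ χ ∈ S, c l χ * c l χ
          - 2 * ∑ χ ∈ S, c j χ * c l χ := by
        rw [mul_sum, ← sum_add_distrib, ← sum_sub_distrib]
        exact sum_congr rfl fun χ _ => by ring
      rw [this, hself j hj, hself l hl]; linarith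
    intro χ hχ
    have e3 := (sum_eq_zero_iff_of_nonneg fun χ _ => sq_nonneg (c j χ - c l χ)).1
      (le_antisymm e2 (sum_nonneg fun χ _ => sq_nonneg _)) χ hχ
    have := pow_eq_zero_iff (two_ne_zero) |>.1 e3
    linarith
  have hnrel : ∀ j l : ZMod n, j ≠ 0 → l ≠ 0 → ¬ (j = l ∨ j = κ * l ∨ j = κ ^ 2 * l) →
      ∑ χ ∈ S, c j χ * c l χ = 2 := by
    intro j l hj hl hjl
    push Not at hjl
    rw [hsum j l hj hl]; simp [hjl]
  have hdiff : ∀ j l : ZMod n, j ≠ 0 → l ≠ 0 → ¬ (j = l ∨ j = κ * l ∨ j = κ ^ 2 * l) →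
      ∃ χ ∈ S, c j χ ≠ c l χ := by
    intro j l hj hl hjl
    by_contra! hcon
    have e1 := hnrel j l hj hl hjl
    rw [sum_congr rfl fun χ hχ => by rw [hcon χ hχ], hself l hl] at e1
    omega
  let ι := {j : ZMod n // j ≠ 0}
  obtain ⟨s, hs⟩ : ∃ s : Fin 5 → ι, ∀ p q, p ≠ q →
      ¬ ((s p : ZMod n) = s q ∨ (s p : ZMod n) = κ * s q ∨ (s p : ZMod n) = κ ^ 2 * s q) := by
    let T : Finset (ZMod n) := univ.erase 0
    have hT : #T = n - 1 := by simp [T, ZMod.card]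
    let f : ZMod n → (G → k) → ℤ := fun j χ => if χ ∈ S then c j χ else 0
    have hf : #T ≤ 3 * #(T.image f) := by
      refine card_le_mul_card_image _ _ fun b hb => ?_
      obtain ⟨l, hl, rfl⟩ := mem_image.1 hb
      have : {j ∈ T | f j = f l} ⊆ {l, κ * l, κ ^ 2 * l} := by
        intro j hj
        have hj' := mem_filter.1 hj
        by_contra hcon
        obtain ⟨χ, hχ, hne⟩ := hdiff j l (by simpa [T] using hj'.1) (by simpa [T] using hl)
          (by simpa using hcon)
        apply hne
        have := congrFun hj'.2 χ
        simpa [f, hχ] using this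
      exact (card_le_card this).trans card_le_three
    have h5 : 5 ≤ #(T.image f) := by omega
    obtain ⟨U, hU, hU5⟩ := exists_subset_card_eq h5
    let e := (U.equivFinOfCardEq hU5).symm
    have hU' : ∀ p : Fin 5, ∃ j ∈ T, f j = e p := fun p => mem_image.1 (hU (e p).2)
    choose t ht ht' using hU'
    have ht0 : ∀ p, t p ≠ 0 := fun p => by simpa [T] using ht p
    refine ⟨fun p => ⟨t p, ht0 p⟩, fun p q hpq hcon => hpq (e.injective (Subtype.ext ?_))⟩
    rw [← ht', ← ht']
    funext χ
    by_cases hχ : χ ∈ S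
    · simpa [f, hχ] using hrel _ _ (ht0 p) (ht0 q) hcon χ hχ
    · simp [f, hχ]
  obtain ⟨X, hX, Y, hY, hXY, ε₁, ε₂, hε₁, hε₂, hall⟩ :=
    exists_common_support S (fun (j : ι) χ => c j χ)
      (fun j => by simpa [sq] using hself j j.2)
      (fun j l hjl => hnrel j l j.2 l.2 fun hcon => by
        obtain ⟨χ, hχ, hne⟩ := hjl
        exact hne (hrel _ _ j.2 l.2 hcon χ hχ))
      s (fun p q hpq => hdiff _ _ (s p).2 (s q).2 (hs p q hpq))
  have hall' : ∀ j : ZMod n, ∃ Z : G → k, j ≠ 0 → c j X = ε₁ ∧ c j Y = ε₂ ∧ Z ∈ S ∧ Z ≠ X ∧ Z ≠ Y ∧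
      c j Z ^ 2 = 1 ∧ ∀ x ∈ S, x ≠ X → x ≠ Y → x ≠ Z → c j x = 0 := by
    intro j
    by_cases hj : j = 0
    · exact ⟨X, fun h => absurd hj h⟩
    · obtain ⟨e1, e2, Z, e3⟩ := hall ⟨j, hj⟩
      exact ⟨Z, fun _ => ⟨e1, e2, e3⟩⟩
  choose Z hZ using hall'
  have hX' := (hS X).1 hX
  have hY' := (hS Y).1 hY
  have hsumS : ∀ j ≠ 0, ∀ F : (G → k) → k, (∀ χ ∈ S, χ ≠ X → χ ≠ Y → χ ≠ Z j → F χ = 0) →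
      ∑ χ ∈ S, F χ = F X + F Y + F (Z j) := by
    intro j hj F hF
    obtain ⟨-, -, hZS, hZX, hZY, -⟩ := hZ j hj
    rw [← sum_subset (s₁ := {X, Y, Z j})]
    · rw [sum_insert (by simp [hXY, hZX.symm]), sum_insert (by simp [hZY.symm]), sum_singleton,
        add_assoc]
    · intro χ hχ
      simp only [mem_insert, mem_singleton] at hχ
      rcases hχ with rfl | rfl | rfl <;> assumption
    · intro χ hχ hχ'
      simp only [mem_insert, mem_singleton, not_or] at hχ'
      exact hF χ hχ hχ'.1 hχ'.2.1 hχ'.2.2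
  refine ⟨X, Y, hX'.2, hY'.2, hX'.1, hY'.1, hXY, ε₁, ε₂, hε₁, hε₂, Z, fun j => c j (Z j), ?_⟩
  intro j hj
  obtain ⟨hjX, hjY, hZS, hZX, hZY, hZ1, hZ0⟩ := hZ j hj
  have hZ' := (hS _).1 hZS
  refine ⟨hZ'.2, hZ'.1, hZX, hZY, hZ1, ?_, ?_, hc _ _ hZ'.2, ?_, ?_, ?_⟩
  · rw [hc j X hX'.2, hjX]
  · rw [hc j Y hY'.2, hjY]
  · intro χ hχ e1 e2 e3 e4
    rw [hc j χ hχ, hZ0 χ ((hS χ).2 ⟨e1, hχ⟩) e2 e3 e4, Int.cast_zero]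
  · intro g
    rw [eq_sum_charCoeff_smul (torusFun a ψ j) fun g x => torusFun_conj _ _ _]
    rw [Finset.sum_apply, ← add_sum_erase _ _ h1, hsumS j hj]
    · simp only [Pi.smul_apply, smul_eq_mul, Pi.one_apply, mul_one]
      rw [hc j X hX'.2, hc j Y hY'.2, hc j _ hZ'.2, hc j 1 IsIrrChar.one, hc1 j hj, hjX, hjY]
      push_cast; ring
    · intro χ hχ e1 e2 e3
      rw [hc j χ ((hS χ).1 hχ).2, hZ0 χ hχ e1 e2 e3]; simp
  · intro i hi hij
    obtain ⟨hiX, hiY, -, -, -, hi1, hi0⟩ := hZ i hi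
    by_contra hcon
    have e := hnrel i j hi hj hcon
    have e' : ((∑ χ ∈ S, c i χ * c j χ : ℤ) : k) = ((2 : ℤ) : k) := by rw [e]
    push_cast at e'
    rw [hsumS j hj _ fun χ hχ e1 e2 e3 => by simp [hZ0 χ hχ e1 e2 e3]] at e'
    rw [hiX, hiY, hjX, hjY] at e'
    have e'' : ε₁ * ε₁ + ε₂ * ε₂ + c i (Z j) * c j (Z j) = 2 :=
      Int.cast_injective (α := k) (by push_cast; exact e')
    rw [← hij] at e'' hZ1
    have e3 : c i (Z i) * c j (Z i) = 0 := by nlinarith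
    rcases mul_eq_zero.1 e3 with e4 | e4
    · rw [e4] at hi1; norm_num at hi1
    · rw [e4] at hZ1; norm_num at hZ1

end Coherence

section Coherence

open Finset

variable {G : Type*} [Group G] [Fintype G] {n : ℕ} [NeZero n] {k : Type*} [Field k] [CharZero k]
  {a : Multiplicative (ZMod n) →* G} {κ : ZMod n} {ψ : AddChar (ZMod n) k} [IsAlgClosed k]

theorem apply_torus_eq (hψ : ψ.IsPrimitive) {χ : G → k} (hχ : ∀ g h, χ (h * g * h⁻¹) = χ g)
    {D : k} (h : ∀ j ≠ 0, charCoeff (torusFun a ψ j) χ = D) (m : ZMod n) (hm : m ≠ 0) :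
    χ (a (.ofAdd m)) = D := by
  have hn : (n : k) ≠ 0 := by exact_mod_cast NeZero.ne n
  refine hψ.eq_of_forall_sum (fun i => χ (a (.ofAdd i))) D (fun j hj => ?_) m hm
  have := h (-j) (neg_ne_zero.2 hj)
  rw [charCoeff_torusFun _ _ hχ, neg_neg] at this
  rw [← this, mul_inv_cancel_left₀ hn]

theorem charCoeff_torusFun_of_const (hψ : ψ.IsPrimitive) {χ : G → k}
    (hχ : ∀ g h, χ (h * g * h⁻¹) = χ g)
    {D : k} (h : ∀ m ≠ 0, χ (a (.ofAdd m)) = D) (j : ZMod n) (hj : j ≠ 0) :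
    charCoeff (torusFun a ψ j) χ = D := by
  have hn : (n : k) ≠ 0 := by exact_mod_cast NeZero.ne n
  have : ∀ i, (1 - ψ (i * -j)) * χ (a (.ofAdd i)) = (1 - ψ (i * -j)) * D := by
    intro i
    by_cases hi : i = 0
    · simp [hi]
    · rw [h i hi]
  classical
  rw [charCoeff_torusFun _ _ hχ, sum_congr rfl fun i _ => this i, ← sum_mul, sum_sub_distrib,
    hψ.sum_apply_mul, if_neg (neg_ne_zero.2 hj)]
  simp [ZMod.card, hn]

theorem IsIrrChar.exists_degree_eq {χ : G → k} (hχ : IsIrrChar χ) {D : k}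
    (h : ∑ m ∈ univ.erase (0 : ZMod n), χ (a (.ofAdd m)) = D) : ∃ N : ℕ, χ 1 + D = n * N := by
  obtain ⟨N, hN⟩ := hχ.exists_sum_mul_eq (a := a) (ψ := (1 : AddChar (ZMod n) k)) 0
  refine ⟨N, ?_⟩
  rw [← hN, ← h]
  simp only [AddChar.one_apply, one_mul]
  rw [← add_sum_erase _ _ (mem_univ 0)]
  simp

theorem IsTorus.sum_torusFun_apply (h : IsTorus n a κ) (hψ : ψ.IsPrimitive) {j : ZMod n}
    (hj : j ≠ 0) : ∑ m ∈ univ.erase (0 : ZMod n), torusFun a ψ j (a (.ofAdd m)) = 3 * n := by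
  classical
  have hκ : IsUnit κ := IsUnit.of_mul_eq_one (κ ^ 2) (by rw [← h.cube]; ring)
  have : ∑ m : ZMod n, torusFun a ψ j (a (.ofAdd m)) = 3 * n := by
    have e : ∀ m, torusFun a ψ j (a (.ofAdd m)) =
        3 - ψ (m * j) - ψ (m * (κ * j)) - ψ (m * (κ ^ 2 * j)) := by
      intro m
      rw [h.torusFun_apply, show m * (κ * j) = κ * m * j by ring,
        show m * (κ ^ 2 * j) = κ ^ 2 * m * j by ring]
    rw [sum_congr rfl fun m _ => e m]
    simp only [sum_sub_distrib, hψ.sum_apply_mul, hj, if_false, hκ.mul_right_eq_zero,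
      (hκ.pow 2).mul_right_eq_zero]
    simp [ZMod.card, mul_comm]
  rw [← this, ← add_sum_erase _ _ (mem_univ (0 : ZMod n)), h.torusFun_apply]
  simp; ring

/-- Degrees of the constituents of the class functions induced from a torus. -/
theorem IsTorus.exists_degrees (h : IsTorus n a κ) (hψ : ψ.IsPrimitive) (hn : 13 < n) :
    ∃ X Y : G → k, IsIrrChar X ∧ IsIrrChar Y ∧ X ≠ 1 ∧ Y ≠ 1 ∧ X ≠ Y ∧
      ∃ (ε₁ ε₂ ε₃ : ℤ) (x y z : ℕ), ε₁ ^ 2 = 1 ∧ ε₂ ^ 2 = 1 ∧ ε₃ ^ 2 = 1 ∧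
        X 1 = x ∧ Y 1 = y ∧ 0 < x ∧ 0 < y ∧ 0 < z ∧ 1 + ε₁ * x + ε₂ * y + ε₃ * z = 0 ∧
        (n : ℤ) ∣ x - ε₁ ∧ (n : ℤ) ∣ y - ε₂ ∧ (n : ℤ) ∣ z + 3 * ε₃ ∧
        x ∣ Nat.card G ∧ y ∣ Nat.card G ∧ z ∣ Nat.card G ∧
        1 + x ^ 2 + y ^ 2 + (n - 1) / 3 * z ^ 2 ≤ Nat.card G ∧
        ∃ Z : ZMod n → G → k, ∀ j ≠ 0,
        IsIrrChar (Z j) ∧ Z j 1 = z ∧ Z j ≠ 1 ∧ Z j ≠ X ∧ Z j ≠ Y ∧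
        charCoeff (torusFun a ψ j) X = ε₁ ∧ charCoeff (torusFun a ψ j) Y = ε₂ ∧
        (∀ χ, IsIrrChar χ → χ ≠ 1 → χ ≠ X → χ ≠ Y → χ ≠ Z j →
          charCoeff (torusFun a ψ j) χ = 0) ∧
        (∀ g, torusFun a ψ j g = 1 + ε₁ * X g + ε₂ * Y g + ε₃ * Z j g) := by
  classical
  obtain ⟨X, Y, hX, hY, hX1, hY1, hXY, ε₁, ε₂, hε₁, hε₂, Z, ε, hZ⟩ :=
    h.exists_decomposition hψ hn
  obtain ⟨x, hx0, hx⟩ := hX.exists_degree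
  obtain ⟨y, hy0, hy⟩ := hY.exists_degree
  have hsq1 : ∀ e : ℤ, e ^ 2 = 1 → e = 1 ∨ e = -1 := fun e he =>
    sq_eq_sq_iff_eq_or_eq_neg.1 (he.trans (one_pow 2).symm)
  have hzero : ∀ j, torusFun a ψ j 1 = 0 := by
    intro j
    have := h.torusFun_apply (ψ := ψ) j 0
    rw [ofAdd_zero, map_one] at this
    rw [this]; simp; ring
  have hdeg : ∀ j ≠ 0, ∃ z : ℕ, 0 < z ∧ Z j 1 = z ∧ 1 + ε₁ * x + ε₂ * y + ε j * z = 0 := by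
    intro j hj
    obtain ⟨hZj, -, -, -, -, -, -, -, -, hdec, -⟩ := hZ j hj
    obtain ⟨z, hz0, hz⟩ := hZj.exists_degree
    refine ⟨z, hz0, hz, ?_⟩
    have := hdec 1
    rw [hzero, hx, hy, hz] at this
    refine Int.cast_injective (α := k) ?_
    push_cast
    exact this.symm
  have h10 : (1 : ZMod n) ≠ 0 := by
    have : Fact (1 < n) := ⟨by omega⟩
    exact one_ne_zero
  obtain ⟨z, hz0, hz, hzd⟩ := hdeg 1 h10
  have hconst : ∀ j ≠ 0, ε j = ε 1 ∧ Z j 1 = z := by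
    intro j hj
    obtain ⟨z', hz0', hz', hzd'⟩ := hdeg j hj
    have e0 : ε j * z' = ε 1 * z := by linarith
    rw [hz']
    have hzpos : (0 : ℤ) < z := by exact_mod_cast hz0
    have hzpos' : (0 : ℤ) < z' := by exact_mod_cast hz0'
    rcases hsq1 _ (hZ j hj).2.2.2.2.1 with e1 | e1 <;>
    rcases hsq1 _ (hZ 1 h10).2.2.2.2.1 with e2 | e2 <;> rw [e1, e2] at e0 ⊢
    · exact ⟨rfl, by have : z' = z := by omega
                     rw [this]⟩
    · omega
    · omega
    · exact ⟨rfl, by have : z' = z := by omega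
                     rw [this]⟩
  have hXv := apply_torus_eq hψ (fun g h => hX.conj g h) fun j hj => (hZ j hj).2.2.2.2.2.1
  have hYv := apply_torus_eq hψ (fun g h => hY.conj g h) fun j hj => (hZ j hj).2.2.2.2.2.2.1
  have hcard : #(univ.erase (0 : ZMod n)) = n - 1 := by simp [ZMod.card]
  have hn1 : ((n - 1 : ℕ) : k) = n - 1 := by rw [Nat.cast_sub (by omega)]; simp
  have hmod : ∀ (χ : G → k) (d : ℕ) (e : ℤ), IsIrrChar χ → χ 1 = d →
      (∀ m ≠ 0, χ (a (.ofAdd m)) = e) → (n : ℤ) ∣ d - e := by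
    intro χ d e hχ hd hv
    obtain ⟨N, hN⟩ := hχ.exists_degree_eq (a := a) rfl
    rw [sum_congr rfl fun m hm => hv m (by simpa using hm), sum_const, hcard, nsmul_eq_mul, hn1,
      hd] at hN
    refine ⟨N - e, Int.cast_injective (α := k) ?_⟩
    push_cast
    linear_combination hN
  have hmodz : (n : ℤ) ∣ z + 3 * ε 1 := by
    obtain ⟨hZ1, -, -, -, hε, -, -, -, -, hdec, -⟩ := hZ 1 h10
    obtain ⟨N, hN⟩ := hZ1.exists_degree_eq (a := a) rfl
    have e1 := h.sum_torusFun_apply hψ h10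
    have e2 : ∀ m ∈ univ.erase (0 : ZMod n), torusFun a ψ 1 (a (.ofAdd m)) =
        3 + ε 1 * Z 1 (a (.ofAdd m)) := by
      intro m hm
      have hm : m ≠ 0 := by simpa using hm
      have c1 : (ε₁ : k) ^ 2 = 1 := by exact_mod_cast congrArg (Int.cast (R := k)) hε₁
      have c2 : (ε₂ : k) ^ 2 = 1 := by exact_mod_cast congrArg (Int.cast (R := k)) hε₂
      rw [hdec, hXv m hm, hYv m hm]
      linear_combination c1 + c2
    rw [sum_congr rfl e2, sum_add_distrib, ← mul_sum, sum_const, hcard, nsmul_eq_mul, hn1] at e1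
    have c3 : (ε 1 : k) ^ 2 = 1 := by exact_mod_cast congrArg (Int.cast (R := k)) hε
    refine ⟨N, Int.cast_injective (α := k) ?_⟩
    push_cast
    rw [hz] at hN
    have e3 : (ε 1 : k) * ∑ m ∈ univ.erase (0 : ZMod n), Z 1 (a (.ofAdd m)) = 3 := by
      linear_combination e1
    have e4 : ∑ m ∈ univ.erase (0 : ZMod n), Z 1 (a (.ofAdd m)) = 3 * ε 1 := by
      linear_combination (ε 1 : k) * e3 - (∑ m ∈ univ.erase (0 : ZMod n), Z 1 (a (.ofAdd m))) * c3
    rw [e4] at hN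
    exact hN
  have hsq : 1 + x ^ 2 + y ^ 2 + (n - 1) / 3 * z ^ 2 ≤ Nat.card G := by
    have hd : ∀ χ : G → k, ∃ d : ℕ, IsIrrChar χ → χ 1 = d := by
      intro χ
      by_cases hχ : IsIrrChar χ
      · obtain ⟨d, -, hd⟩ := hχ.exists_degree; exact ⟨d, fun _ => hd⟩
      · exact ⟨0, fun h => absurd h hχ⟩
    choose d hd using hd
    have e1 : ∑ χ ∈ irrChars G k, d χ ^ 2 = Nat.card G := by
      have := sum_sq_degree (G := G) (k := k)
      rw [sum_congr rfl fun χ hχ => by rw [hd χ (mem_irrChars.1 hχ)]] at this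
      exact_mod_cast this
    let T := (univ.erase (0 : ZMod n)).image Z
    have hT : n - 1 ≤ 3 * #T := by
      rw [← hcard]
      refine card_le_mul_card_image _ _ fun b hb => ?_
      obtain ⟨l, hl, rfl⟩ := mem_image.1 hb
      have hl0 : l ≠ 0 := by simpa using hl
      have : {j ∈ univ.erase (0 : ZMod n) | Z j = Z l} ⊆ {l, κ * l, κ ^ 2 * l} := by
        intro j hj
        have hj' := mem_filter.1 hj
        simpa using (hZ l hl0).2.2.2.2.2.2.2.2.2.2 j (by simpa using hj'.1) hj'.2
      exact (card_le_card this).trans card_le_three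
    have hTz : ∀ χ ∈ T, χ ∈ irrChars G k ∧ d χ = z ∧ χ ≠ 1 ∧ χ ≠ X ∧ χ ≠ Y := by
      intro χ hχ
      obtain ⟨l, hl, rfl⟩ := mem_image.1 hχ
      have hl0 : l ≠ 0 := by simpa using hl
      obtain ⟨e1, e2, e3, e4, -⟩ := hZ l hl0
      refine ⟨mem_irrChars.2 e1, ?_, e2, e3, e4⟩
      have := (hd _ e1).symm.trans (hconst l hl0).2
      exact_mod_cast this
    have hsub : insert 1 (insert X (insert Y T)) ⊆ irrChars G k := by
      intro χ hχ
      simp only [mem_insert] at hχ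
      rcases hχ with rfl | rfl | rfl | hχ
      · exact mem_irrChars.2 IsIrrChar.one
      · exact mem_irrChars.2 hX
      · exact mem_irrChars.2 hY
      · exact (hTz χ hχ).1
    have e2 := sum_le_sum_of_subset (f := fun χ => d χ ^ 2) hsub
    rw [e1, sum_insert, sum_insert, sum_insert, sum_congr rfl fun χ hχ => by rw [(hTz χ hχ).2.1],
      sum_const, smul_eq_mul] at e2
    · have f1 : d 1 = 1 := by
        have := hd 1 IsIrrChar.one
        simpa using this.symm
      have f2 : d X = x := by exact_mod_cast (hd X hX).symm.trans hx
      have f3 : d Y = y := by exact_mod_cast (hd Y hY).symm.trans hy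
      rw [f1, f2, f3] at e2
      have : (n - 1) / 3 ≤ #T := by omega
      have := Nat.mul_le_mul_right (z ^ 2) this
      omega
    · intro hc; exact (hTz _ hc).2.2.2.2 rfl
    · simp only [mem_insert, not_or]
      exact ⟨hXY, fun hc => (hTz _ hc).2.2.2.1 rfl⟩
    · simp only [mem_insert, not_or]
      exact ⟨hX1.symm, hY1.symm, fun hc => (hTz _ hc).2.2.1 rfl⟩
  refine ⟨X, Y, hX, hY, hX1, hY1, hXY, ε₁, ε₂, ε 1, x, y, z, hε₁, hε₂, (hZ 1 h10).2.2.2.2.1,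
    hx, hy, hx0, hy0, hz0, hzd, hmod X x ε₁ hX hx hXv, hmod Y y ε₂ hY hy hYv, hmodz,
    hX.degree_dvd hx, hY.degree_dvd hy, (hZ 1 h10).1.degree_dvd hz, hsq, Z, fun j hj => ?_⟩
  obtain ⟨e1, e2, e3, e4, e5, e6, e7, e8, e9, e10, e11⟩ := hZ j hj
  exact ⟨e1, (hconst j hj).2, e2, e3, e4, e6, e7, e9, by rw [← (hconst j hj).1]; exact e10⟩

end Coherence

section Numerics

theorem dvd_order_of_coprime {d : ℕ} (hd : d ∣ 2 ^ 6 * 3 * 5 ^ 4 * 7 ^ 6 * 13 * 181)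
    {e : ℤ} (he : e = 1 ∨ e = -1 ∨ e = 3 ∨ e = -3) (h : (2353 : ℤ) ∣ d - e) :
    ∃ i < 7, ∃ j < 2, ∃ l < 5, ∃ m < 7, d = 2 ^ i * 3 ^ j * 5 ^ l * 7 ^ m := by
  have hc : ∀ p : ℕ, (p = 13 ∨ p = 181) → ¬ p ∣ d := by
    intro p hp hpd
    have h1 : (p : ℤ) ∣ d := by exact_mod_cast hpd
    have h2 : (p : ℤ) ∣ d - e := dvd_trans (by rcases hp with rfl | rfl <;> norm_num) h
    have h3 : (p : ℤ) ∣ e := by have := dvd_sub h1 h2; simpa using this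
    rcases hp with rfl | rfl <;> rcases he with rfl | rfl | rfl | rfl <;> revert h3 <;> decide
  have h13 : Nat.Coprime d 13 := ((Nat.Prime.coprime_iff_not_dvd (by norm_num)).2 (hc 13 (by simp))).symm
  have h181 : Nat.Coprime d 181 := ((Nat.Prime.coprime_iff_not_dvd (by norm_num)).2 (hc 181 (by simp))).symm
  have hd' : d ∣ 2 ^ 6 * 3 * 5 ^ 4 * 7 ^ 6 := h13.dvd_of_dvd_mul_right (h181.dvd_of_dvd_mul_right hd)
  obtain ⟨d₁, d₂, h₁, h₂, rfl⟩ := (Nat.dvd_mul).1 hd'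
  obtain ⟨d₃, d₄, h₃, h₄, rfl⟩ := (Nat.dvd_mul).1 h₁
  obtain ⟨d₅, d₆, h₅, h₆, rfl⟩ := (Nat.dvd_mul).1 h₃
  obtain ⟨i, hi, rfl⟩ := (Nat.dvd_prime_pow Nat.prime_two).1 h₅
  obtain ⟨j, hj, rfl⟩ := (Nat.dvd_prime_pow (m := 1) Nat.prime_three).1 h₆
  obtain ⟨l, hl, rfl⟩ := (Nat.dvd_prime_pow Nat.prime_five).1 h₄
  obtain ⟨m, hm, rfl⟩ := (Nat.dvd_prime_pow (by norm_num : Nat.Prime 7)).1 h₂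
  exact ⟨i, by omega, j, by omega, l, by omega, m, by omega, rfl⟩

set_option synthInstance.maxHeartbeats 400000 in
set_option synthInstance.maxSize 2000 in
theorem degree_cases_aux : ∀ i < 7, ∀ j < 2, ∀ l < 5, ∀ m < 7,
    (2 ^ i * 3 ^ j * 5 ^ l * 7 ^ m) ^ 2 ≤ 2 ^ 6 * 3 * 5 ^ 4 * 7 ^ 6 * 13 * 181 →
    ((2 ^ i * 3 ^ j * 5 ^ l * 7 ^ m) % 2353 = 1 → 2 ^ i * 3 ^ j * 5 ^ l * 7 ^ m = 1) ∧
    ((2 ^ i * 3 ^ j * 5 ^ l * 7 ^ m) % 2353 = 2352 → 2 ^ i * 3 ^ j * 5 ^ l * 7 ^ m = 2352 ∨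
      2 ^ i * 3 ^ j * 5 ^ l * 7 ^ m = 117649 ∨ 2 ^ i * 3 ^ j * 5 ^ l * 7 ^ m = 40000) ∧
    (784 * (2 ^ i * 3 ^ j * 5 ^ l * 7 ^ m) ^ 2 ≤ 2 ^ 6 * 3 * 5 ^ 4 * 7 ^ 6 * 13 * 181 →
    ((2 ^ i * 3 ^ j * 5 ^ l * 7 ^ m) % 2353 = 3 → 2 ^ i * 3 ^ j * 5 ^ l * 7 ^ m = 3) ∧
    ((2 ^ i * 3 ^ j * 5 ^ l * 7 ^ m) % 2353 = 2350 → 2 ^ i * 3 ^ j * 5 ^ l * 7 ^ m = 120000)) := by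
  decide +kernel

theorem degrees_eq {x y z : ℕ} {ε₁ ε₂ ε₃ : ℤ} (hε₁ : ε₁ ^ 2 = 1) (hε₂ : ε₂ ^ 2 = 1)
    (hε₃ : ε₃ ^ 2 = 1) (hsum : 1 + ε₁ * x + ε₂ * y + ε₃ * z = 0)
    (hx : (2353 : ℤ) ∣ x - ε₁) (hy : (2353 : ℤ) ∣ y - ε₂) (hz : (2353 : ℤ) ∣ z + 3 * ε₃)
    (hxd : x ∣ 2 ^ 6 * 3 * 5 ^ 4 * 7 ^ 6 * 13 * 181)
    (hyd : y ∣ 2 ^ 6 * 3 * 5 ^ 4 * 7 ^ 6 * 13 * 181)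
    (hzd : z ∣ 2 ^ 6 * 3 * 5 ^ 4 * 7 ^ 6 * 13 * 181)
    (hsq : 1 + x ^ 2 + y ^ 2 + 784 * z ^ 2 ≤ 2 ^ 6 * 3 * 5 ^ 4 * 7 ^ 6 * 13 * 181)
    (hx1 : x ≠ 1) (hy1 : y ≠ 1) :
    ε₁ = -1 ∧ ε₂ = -1 ∧ ε₃ = 1 ∧ z = 120000 ∧
      (x = 2352 ∧ y = 117649 ∨ x = 117649 ∧ y = 2352) := by
  have hsq1 : ∀ e : ℤ, e ^ 2 = 1 → e = 1 ∨ e = -1 := fun e he =>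
    sq_eq_sq_iff_eq_or_eq_neg.1 (he.trans (one_pow 2).symm)
  have key : ∀ (d : ℕ) (e : ℤ), d ∣ 2 ^ 6 * 3 * 5 ^ 4 * 7 ^ 6 * 13 * 181 → e ^ 2 = 1 →
      (2353 : ℤ) ∣ d - e → d ^ 2 ≤ 2 ^ 6 * 3 * 5 ^ 4 * 7 ^ 6 * 13 * 181 → d ≠ 1 →
      e = -1 ∧ (d = 2352 ∨ d = 117649 ∨ d = 40000) := by
    intro d e hd he hde hd2 hd1
    obtain ⟨i, hi, j, hj, l, hl, m, hm, hdd⟩ := dvd_order_of_coprime hd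
      (by rcases hsq1 e he with h | h <;> simp [h]) hde
    have := degree_cases_aux i hi j hj l hl m hm
    rw [← hdd] at this
    have h := this hd2
    rcases hsq1 e he with rfl | rfl
    · exact absurd (h.1 (by omega)) hd1
    · exact ⟨rfl, h.2.1 (by omega)⟩
  obtain ⟨hex, hx'⟩ := key x ε₁ hxd hε₁ hx (by omega) hx1
  obtain ⟨hey, hy'⟩ := key y ε₂ hyd hε₂ hy (by omega) hy1
  obtain ⟨i, hi, j, hj, l, hl, m, hm, hdd⟩ := dvd_order_of_coprime hzd (e := -3 * ε₃)
      (by rcases hsq1 ε₃ hε₃ with h | h <;> simp [h]) (by simpa using hz)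
  have h := degree_cases_aux i hi j hj l hl m hm
  rw [← hdd] at h
  have h := (h (by omega)).2.2 (by omega)
  rcases hsq1 ε₃ hε₃ with rfl | rfl
  · have := h.2 (by omega)
    subst hex hey this
    refine ⟨rfl, rfl, rfl, rfl, ?_⟩
    omega
  · have := h.1 (by omega)
    subst hex hey this
    omega

end Numerics

section Coherence

open Finset

/-- The properties of the two nontrivial real constituents of the class functions induced from
a torus of order 2353 that are used below. -/
structure IsUnitaryPair {G : Type*} [Group G] [Fintype G] (a : Multiplicative (ZMod 2353) →* G)
    (X Y : G → ℤ) : Prop where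
  conjX : ∀ g h, X (h * g * h⁻¹) = X g
  conjY : ∀ g h, Y (h * g * h⁻¹) = Y g
  oneX : X 1 = 2352
  oneY : Y 1 = 117649
  torusX : ∀ m ≠ 0, X (a (.ofAdd m)) = -1
  torusY : ∀ m ≠ 0, Y (a (.ofAdd m)) = -1
  sumX : ∑ g, X g = 0
  sumY : ∑ g, Y g = 0
  sumXX : ∑ g, X g ^ 2 = Nat.card G
  sumYY : ∑ g, Y g ^ 2 = Nat.card G
  sumXY : ∑ g, X g * Y g = 0
  dvdX : ∀ g, (Nat.card (Subgroup.centralizer {g}) * 2352 : ℤ) ∣ X g * Nat.card G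
  dvdY : ∀ g, (Nat.card (Subgroup.centralizer {g}) * 117649 : ℤ) ∣ Y g * Nat.card G
  dvdZ : ∀ g, (∀ m, ¬ IsConj g (a (.ofAdd m))) →
    (Nat.card (Subgroup.centralizer {g}) * 120000 : ℤ) ∣ (X g + Y g - 1) * Nat.card G
  struct : ∀ g, (∀ m, ¬ IsConj g (a (.ofAdd m))) → ∃ N : ℕ,
    (N : ℚ) * Nat.card (Subgroup.centralizer {g}) ^ 2 = Nat.card G *
      (1 - X g ^ 2 / 2352 - Y g ^ 2 / 117649 + (X g + Y g - 1) ^ 2 / 120000)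
  modX : ∀ u : G, ∀ j : ℕ, u ^ 7 ^ j = 1 → 7 ∣ X u
  modY : ∀ u : G, ∀ j : ℕ, u ^ 7 ^ j = 1 → 7 ∣ Y u
  mult : ∀ (S : Subgroup G) [Fintype S], ∃ N : ℕ, ∑ s : S, X s = Nat.card S * N

theorem exists_int_of_forall_fixed {x : AlgebraicClosure ℚ} (hx : IsIntegral ℤ x)
    (h : ∀ σ : AlgebraicClosure ℚ ≃+* AlgebraicClosure ℚ, σ x = x) : ∃ m : ℤ, x = m := by
  have : Algebra.IsAlgebraic ℚ (AlgebraicClosure ℚ) := by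
    convert! AlgebraicClosure.isAlgebraic ℚ
  have : IsAlgClosure ℚ (AlgebraicClosure ℚ) := ⟨inferInstance, inferInstance⟩
  have : Normal ℚ (AlgebraicClosure ℚ) := IsAlgClosure.normal ℚ _
  have : IsGalois ℚ (AlgebraicClosure ℚ) := ⟨⟩
  obtain ⟨q, hq⟩ := (InfiniteGalois.mem_range_algebraMap_iff_fixed (k := ℚ) x).2
    fun σ => h σ.toRingEquiv
  rw [← hq] at hx
  have hq' : IsIntegral ℤ q :=
    (isIntegral_algebraMap_iff (algebraMap ℚ (AlgebraicClosure ℚ)).injective).1 hx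
  obtain ⟨m, hm⟩ := IsIntegrallyClosed.algebraMap_eq_of_integral hq'
  refine ⟨m, ?_⟩
  rw [← hq, ← hm]
  simp

variable {G : Type*} [Group G] [Fintype G]

theorem card_isConj_mul_card_centralizer (g : G) :
    Nat.card {x : G // IsConj g x} * Nat.card (Subgroup.centralizer {g}) = Nat.card G := by
  classical
  have h := MulAction.card_orbit_mul_card_stabilizer_eq_card_group (ConjAct G) g
  have e1 : Nat.card {x : G // IsConj g x} = Fintype.card (MulAction.orbit (ConjAct G) g) := by
    rw [← Nat.card_eq_fintype_card]
    refine Nat.card_congr (Equiv.subtypeEquivRight fun x => ?_)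
    rw [ConjAct.mem_orbit_conjAct, isConj_comm]
  have e2 : Nat.card (Subgroup.centralizer {g}) =
      Fintype.card (MulAction.stabilizer (ConjAct G) g) := by
    rw [← Nat.card_eq_fintype_card, ConjAct.stabilizer_eq_centralizer]
    rfl
  rw [e1, e2, h, Nat.card_eq_fintype_card]
  rfl

section ClassSum

variable {k : Type*} [Field k] [CharZero k] [IsAlgClosed k]

open Classical in
theorem sum_ite_isConj_mul {χ : G → k} (hχ : ∀ g h, χ (h * g * h⁻¹) = χ g) (g : G) :
    ∑ x, (if IsConj g x then (1 : k) else 0) * χ x = Nat.card {x : G // IsConj g x} * χ g := by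
  simp only [ite_mul, one_mul, zero_mul]
  rw [← sum_filter, sum_congr rfl (g := fun _ => χ g), sum_const, nsmul_eq_mul,
    Nat.card_eq_fintype_card, Fintype.card_subtype]
  intro x hx
  obtain ⟨c, hc⟩ := isConj_iff.1 (mem_filter.1 hx).2
  rw [← hc, hχ]

theorem ite_isConj_conj {α : Type*} [One α] [Zero α] (g x h : G) [Decidable (IsConj g x)]
    [Decidable (IsConj g (h * x * h⁻¹))] :
    (if IsConj g (h * x * h⁻¹) then (1 : α) else 0) = if IsConj g x then 1 else 0 := by
  have : IsConj g (h * x * h⁻¹) ↔ IsConj g x :=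
    ⟨fun e => e.trans (isConj_iff.2 ⟨h⁻¹, by group⟩), fun e => e.trans (isConj_iff.2 ⟨h, rfl⟩)⟩
  simp only [this]

theorem IsIrrChar.dvd_mul_card {χ : G → AlgebraicClosure ℚ} (hχ : IsIrrChar χ) {d : ℕ}
    (hd0 : 0 < d) (hd : χ 1 = d) {g : G} {m : ℤ} (hm : χ g = m) :
    (Nat.card (Subgroup.centralizer {g}) * d : ℤ) ∣ m * Nat.card G := by
  classical
  have h := hχ.isIntegral_sum_div (fun x => if IsConj g x then 1 else 0)
    (fun x h => ite_isConj_conj g x h) (fun x => by split_ifs; exacts [isIntegral_one, isIntegral_zero])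
  rw [sum_ite_isConj_mul (fun g h => hχ.conj g h), hd, hm] at h
  have hd0' : (d : AlgebraicClosure ℚ) ≠ 0 := by exact_mod_cast hd0.ne'
  obtain ⟨r, hr⟩ := exists_int_of_forall_fixed h fun σ => by simp
  rw [div_eq_iff hd0'] at hr
  have hr' : (Nat.card {x : G // IsConj g x} : ℤ) * m = r * d := by
    have : ((Nat.card {x : G // IsConj g x} * m : ℤ) : AlgebraicClosure ℚ) = ((r * d : ℤ) : _) := by
      push_cast; exact hr
    exact_mod_cast this
  refine ⟨r, ?_⟩
  rw [← card_isConj_mul_card_centralizer g]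
  push_cast
  linear_combination (Nat.card (Subgroup.centralizer {g}) : ℤ) * hr'

open Classical in
/-- The number of ways to write `x` as a product of two conjugates of `g`. -/
noncomputable def classSq (k : Type*) [Field k] (g x : G) : k :=
  ∑ u, ∑ v, if u * v = x then
    (if IsConj g u then (1 : k) else 0) * if IsConj g v then 1 else 0 else 0

theorem exists_classSq_eq (g x : G) : ∃ N : ℕ, classSq k g x = N := by
  classical
  refine ⟨∑ u, ∑ v, if u * v = x then
    (if IsConj g u then 1 else 0) * if IsConj g v then 1 else 0 else 0, ?_⟩
  push_cast
  simp [classSq]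

theorem classSq_conj (g x h : G) : classSq k g (h * x * h⁻¹) = classSq k g x := by
  classical
  unfold classSq
  refine (Fintype.sum_equiv (MulAut.conj h).toEquiv _ _ fun u => ?_).symm
  refine Fintype.sum_equiv (MulAut.conj h).toEquiv _ _ fun v => ?_
  have : (MulAut.conj h).toEquiv u * (MulAut.conj h).toEquiv v = h * x * h⁻¹ ↔ u * v = x := by
    change h * u * h⁻¹ * (h * v * h⁻¹) = h * x * h⁻¹ ↔ u * v = x
    rw [show h * u * h⁻¹ * (h * v * h⁻¹) = h * (u * v) * h⁻¹ by group]
    simp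
  refine if_congr this.symm (congrArg₂ _ ?_ ?_) rfl
  · exact (ite_isConj_conj g u h).symm
  · exact (ite_isConj_conj g v h).symm

theorem IsIrrChar.sum_classSq_mul {χ : G → k} (hχ : IsIrrChar χ) (g : G) :
    ∑ x, classSq k g x * χ x = (Nat.card {x : G // IsConj g x} * χ g) ^ 2 / χ 1 := by
  classical
  obtain ⟨d, hd0, hd⟩ := hχ.exists_degree
  have h1 : χ 1 ≠ 0 := by rw [hd]; exact_mod_cast hd0.ne'
  have h := hχ.sum_mul_sum_mul (fun x => if IsConj g x then 1 else 0)
    (fun x => if IsConj g x then 1 else 0)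
    (fun x h => ite_isConj_conj g x h) (fun x h => ite_isConj_conj g x h)
  rw [sum_ite_isConj_mul (fun g h => hχ.conj g h)] at h
  rw [eq_div_iff h1, sq, ← h]
  congr 1
  simp only [classSq, sum_mul]
  rw [sum_comm]
  refine sum_congr rfl fun u _ => ?_
  rw [sum_comm]
  refine sum_congr rfl fun v _ => ?_
  simp only [ite_mul, zero_mul]
  rw [sum_ite_eq]
  simp

end ClassSum

end Coherence

section Unitary

open Finset

variable {G : Type*} [Group G] [Fintype G]

local notation "K" => AlgebraicClosure ℚ

theorem exists_real_of_forall_map {X : G → K} (hX : IsIrrChar X)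
    (h : ∀ χ : G → K, IsIrrChar χ → (∀ σ : K ≃+* K, χ = (fun g => σ (X g)) → χ = X) ∧
      (χ = (fun g => X g⁻¹) → χ = X)) :
    ∃ X' : G → ℤ, (∀ g, X g = X' g) ∧ ∀ g, X' g⁻¹ = X' g := by
  have h1 : ∀ g, ∃ m : ℤ, X g = m := fun g =>
    exists_int_of_forall_fixed (hX.isIntegral g) fun σ =>
      congrFun ((h _ (hX.map σ)).1 σ rfl) g
  choose X' hX' using h1
  refine ⟨X', hX', fun g => ?_⟩
  have := congrFun ((h _ hX.inv).2 rfl) g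
  simp only [hX'] at this
  exact_mod_cast this

theorem IsTorus.exists_isUnitaryPair {a : Multiplicative (ZMod 2353) →* G} {κ : ZMod 2353}
    (h : IsTorus 2353 a κ) (hcard : Nat.card G = 2 ^ 6 * 3 * 5 ^ 4 * 7 ^ 6 * 13 * 181)
    (hlin : ∀ φ : G →* K, φ = 1) : ∃ X Y : G → ℤ, IsUnitaryPair a X Y := by
  classical
  have hG0 : (Nat.card G : K) ≠ 0 := by simp
  obtain ⟨ζ, hζ⟩ := HasEnoughRootsOfUnity.exists_primitiveRoot K 2353
  set ψ := AddChar.zmodChar 2353 hζ.pow_eq_one with hψd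
  have hψ : ψ.IsPrimitive := AddChar.zmodChar_primitive_of_primitive_root 2353 hζ
  obtain ⟨X, Y, hX, hY, hX1, hY1, hXY, ε₁, ε₂, ε₃, x, y, z, e1, e2, e3, hx, hy, hx0, hy0, hz0,
    hsum, hxd, hyd, hzd, hxg, hyg, hzg, hsq, Z, hZ⟩ := h.exists_degrees hψ (by norm_num)
  have ne_one : ∀ {χ : G → K} {d : ℕ}, IsIrrChar χ → χ ≠ 1 → χ 1 = d → d ≠ 1 := by
    rintro χ d hχ h1 hd rfl
    obtain ⟨φ, hφ⟩ := hχ.exists_hom_of_degree_one (by simpa using hd)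
    refine h1 (funext fun g => ?_)
    rw [← hφ, hlin φ]; rfl
  rw [hcard] at hxg hyg hzg hsq
  rw [show (2353 - 1) / 3 = 784 by norm_num] at hsq
  have hdeg := degrees_eq e1 e2 e3 hsum
    (by exact_mod_cast hxd) (by exact_mod_cast hyd) (by exact_mod_cast hzd) hxg hyg hzg
    hsq (ne_one hX hX1 hx) (ne_one hY hY1 hy)
  obtain ⟨rfl, rfl, rfl, rfl, hxy⟩ := hdeg
  clear hsum hxd hyd hzd hxg hyg hzg hsq e1 e2 e3
  wlog hxy' : x = 2352 ∧ y = 117649 generalizing X Y x y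
  · refine this Y X hY hX hY1 hX1 hXY.symm y x hy hx hy0 hx0 
      (hxy.symm.imp And.symm And.symm) (fun j hj => ?_) (hxy.resolve_left hxy').symm
    obtain ⟨a1, a2, a3, a4, a5, a6, a7, a8, a9⟩ := hZ j hj
    exact ⟨a1, a2, a3, a5, a4, a7, a6, fun χ b1 b2 b3 b4 b5 => a8 χ b1 b2 b4 b3 b5, fun g => by
      rw [a9]; ring⟩
  obtain ⟨rfl, rfl⟩ := hxy'
  clear hxy
  have hXt : ∀ m ≠ 0, X (a (.ofAdd m)) = -1 := apply_torus_eq hψ hX.conj fun j hj => by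
    rw [(hZ j hj).2.2.2.2.2.1]; simp
  have hYt : ∀ m ≠ 0, Y (a (.ofAdd m)) = -1 := apply_torus_eq hψ hY.conj fun j hj => by
    rw [(hZ j hj).2.2.2.2.2.2.1]; simp
  obtain ⟨hZi, hZ1, -, -, -, -, -, hZ8, -⟩ := hZ 1 (by decide)
  have cand : ∀ χ : G → K, IsIrrChar χ → (∀ m ≠ 0, χ (a (.ofAdd m)) = -1) →
      χ = 1 ∨ χ = X ∨ χ = Y ∨ χ = Z 1 := by
    intro χ hχ ht
    by_contra! hne
    have h1 := charCoeff_torusFun_of_const hψ hχ.conj ht 1 (by decide)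
    rw [hZ8 χ hχ hne.1 hne.2.1 hne.2.2.1 hne.2.2.2] at h1
    simp at h1
  have hXu : ∀ χ : G → K, IsIrrChar χ → (∀ m ≠ 0, χ (a (.ofAdd m)) = -1) → χ 1 = 2352 →
      χ = X := by
    intro χ hχ ht h1
    rcases cand χ hχ ht with rfl | rfl | rfl | rfl
    · norm_num at h1
    · rfl
    · rw [hy] at h1; norm_num at h1
    · rw [hZ1] at h1; norm_num at h1
  have hYu : ∀ χ : G → K, IsIrrChar χ → (∀ m ≠ 0, χ (a (.ofAdd m)) = -1) → χ 1 = 117649 →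
      χ = Y := by
    intro χ hχ ht h1
    rcases cand χ hχ ht with rfl | rfl | rfl | rfl
    · norm_num at h1
    · rw [hx] at h1; norm_num at h1
    · rfl
    · rw [hZ1] at h1; norm_num at h1
  have hinv : ∀ m : ZMod 2353, (a (.ofAdd m))⁻¹ = a (.ofAdd (-m)) := fun m => by
    rw [ofAdd_neg, map_inv]
  obtain ⟨X', hX', hXi⟩ := exists_real_of_forall_map hX fun χ hχ =>
    ⟨fun σ e => hXu χ hχ (fun m hm => by simp only [e]; rw [hXt m hm, map_neg, map_one]) (by
      simp only [e]; rw [hx, map_natCast]; norm_num),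
     fun e => hXu χ hχ (fun m hm => by
      simp only [e, hinv]; exact hXt _ (neg_ne_zero.2 hm)) (by
      simp only [e, inv_one]; rw [hx]; norm_num)⟩
  obtain ⟨Y', hY', hYi⟩ := exists_real_of_forall_map hY fun χ hχ =>
    ⟨fun σ e => hYu χ hχ (fun m hm => by simp only [e]; rw [hYt m hm, map_neg, map_one]) (by
      simp only [e]; rw [hy, map_natCast]; norm_num),
     fun e => hYu χ hχ (fun m hm => by
      simp only [e, hinv]; exact hYt _ (neg_ne_zero.2 hm)) (by
      simp only [e, inv_one]; rw [hy]; norm_num)⟩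
  have hx' : X' 1 = 2352 := by rw [hX'] at hx; exact_mod_cast hx
  have hy' : Y' 1 = 117649 := by rw [hY'] at hy; exact_mod_cast hy
  have hZv : ∀ g, (∀ m, ¬ IsConj g (a (.ofAdd m))) → ∀ j ≠ 0,
      Z j g = ((X' g + Y' g - 1 : ℤ) : K) := by
    intro g hg j hj
    have h1 := (hZ j hj).2.2.2.2.2.2.2.2 g
    have h0 : torusFun a ψ j g = 0 := indFun_eq_zero _ _ _ hg
    rw [h0, hX', hY'] at h1
    push_cast at h1 ⊢
    linear_combination -h1
  have cast_inj : ∀ {m n : ℤ}, (m : K) = n → m = n := fun h => by exact_mod_cast h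
  refine ⟨X', Y', ?_, ?_, hx', hy', ?_, ?_, ?_, ?_, ?_, ?_, ?_, ?_, ?_, ?_, ?_, ?_, ?_, ?_⟩
  · intro g h; apply cast_inj; rw [← hX', ← hX', hX.conj]
  · intro g h; apply cast_inj; rw [← hY', ← hY', hY.conj]
  · intro m hm; apply cast_inj; rw [← hX', hXt m hm]; simp
  · intro m hm; apply cast_inj; rw [← hY', hYt m hm]; simp
  · apply cast_inj; simpa [hX'] using hX.sum_mul_inv IsIrrChar.one hX1
  · apply cast_inj; simpa [hY'] using hY.sum_mul_inv IsIrrChar.one hY1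
  · apply cast_inj; simpa [hX', hXi, sq] using hX.2
  · apply cast_inj; simpa [hY', hYi, sq] using hY.2
  · apply cast_inj; simpa [hX', hY', hYi] using hX.sum_mul_inv hY hXY
  · exact fun g => by simpa using hX.dvd_mul_card hx0 hx (hX' g)
  · exact fun g => by simpa using hY.dvd_mul_card hy0 hy (hY' g)
  · exact fun g hg => by
      simpa using hZi.dvd_mul_card hz0 hZ1 (hZv g hg 1 (by decide))
  · intro g hg
    have hg' : ∀ m, ¬ IsConj g⁻¹ (a (.ofAdd m)) := by
      intro m hm
      refine hg (-m) ?_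
      obtain ⟨c, hc⟩ := isConj_iff.1 hm
      refine isConj_iff.2 ⟨c, ?_⟩
      rw [← hinv, ← hc]; group
    have hinvsum : ∀ {χ : G → K}, IsIrrChar χ → ∑ u, χ u * classSq K g u⁻¹ =
        (Nat.card {x : G // IsConj g x} * χ g⁻¹) ^ 2 / χ 1 := by
      intro χ hχ
      have := hχ.inv.sum_classSq_mul g
      simp only [inv_one] at this
      rw [← this]
      refine Fintype.sum_equiv (Equiv.inv G) _ _ fun u => ?_
      simp [mul_comm]
    have hD : ∀ j ≠ 0, charCoeff (torusFun a ψ j) (classSq K g) =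
        (Nat.card G : K)⁻¹ * ((Nat.card {x : G // IsConj g x}) ^ 2 *
          (1 - X' g ^ 2 / 2352 - Y' g ^ 2 / 117649 + (X' g + Y' g - 1) ^ 2 / 120000)) := by
      intro j hj
      obtain ⟨b1, b2, b3, b4, b5, b6, b7, b8, b9⟩ := hZ j hj
      have s1 := hinvsum (IsIrrChar.one (G := G) (k := K))
      have s2 := hinvsum hX
      have s3 := hinvsum hY
      have s4 := hinvsum b1
      rw [hX', hXi, hx] at s2
      rw [hY', hYi, hy] at s3
      rw [hZv _ hg' j hj, hXi, hYi, b2] at s4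
      rw [charCoeff]
      congr 1
      have : ∀ u, torusFun a ψ j u * classSq K g u⁻¹ = (1 : G → K) u * classSq K g u⁻¹ -
          X u * classSq K g u⁻¹ - Y u * classSq K g u⁻¹ + Z j u * classSq K g u⁻¹ := fun u => by
        rw [b9]; push_cast; simp only [Pi.one_apply]; ring
      rw [sum_congr rfl fun u _ => this u, sum_add_distrib, sum_sub_distrib, sum_sub_distrib,
        s1, s2, s3, s4]
      simp only [Pi.one_apply]
      push_cast
      ring
    obtain ⟨N, hN⟩ := exists_classSq_eq (k := K) g (a (.ofAdd 1))
    have h1 := apply_torus_eq hψ (fun u v => classSq_conj g u v) hD 1 (by decide)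
    rw [hN] at h1
    have hc := card_isConj_mul_card_centralizer g
    refine ⟨N, ?_⟩
    have hc' : (Nat.card {x : G // IsConj g x} : K) * Nat.card (Subgroup.centralizer {g}) =
      Nat.card G := by exact_mod_cast hc
    have hfin : ((N * Nat.card (Subgroup.centralizer {g}) ^ 2 : ℚ) : K) = ((Nat.card G *
      (1 - X' g ^ 2 / 2352 - Y' g ^ 2 / 117649 + (X' g + Y' g - 1) ^ 2 / 120000) : ℚ) : K) := by
      push_cast
      rw [h1, inv_mul_eq_div, div_mul_eq_mul_div, div_eq_iff hG0, ← hc']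
      ring
    exact_mod_cast hfin
  · intro u j hu
    have : Fact (Nat.Prime 7) := ⟨by norm_num⟩
    have := hX.modEq_degree hu (hX' u) hx
    exact (Int.modEq_zero_iff_dvd).1 (this.trans (by decide))
  · intro u j hu
    have : Fact (Nat.Prime 7) := ⟨by norm_num⟩
    have := hY.modEq_degree hu (hY' u) hy
    exact (Int.modEq_zero_iff_dvd).1 (this.trans (by decide))
  · intro S _
    obtain ⟨N, hN⟩ := hX.exists_multiplicity S.subtype 1
    refine ⟨N, cast_inj ?_⟩
    simpa [hX'] using hN

end Unitary

section Torus

open Finset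

variable {G : Type*} [Group G] [Fintype G]

open scoped Pointwise in
omit [Fintype G] in
theorem exists_conj_mem_zpowers [Finite G] {p : ℕ} [hp : Fact p.Prime]
    (hp2 : ¬ p ^ 2 ∣ Nat.card G) {x y : G} (hx : orderOf x = p) (hy : orderOf y = p) :
    ∃ c, c * x * c⁻¹ ∈ Subgroup.zpowers y := by
  have hpG : p ∣ Nat.card G := hx ▸ orderOf_dvd_natCard x
  have hf : (Nat.card G).factorization p = 1 := by
    have h0 : Nat.card G ≠ 0 := Nat.card_pos.ne'
    have h1 := (hp.out.dvd_iff_one_le_factorization h0).1 hpG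
    have h2 := mt (hp.out.pow_dvd_iff_le_factorization h0).2 hp2
    omega
  obtain ⟨c, hc⟩ := MulAction.exists_smul_eq G
    (Sylow.ofCard (p := p) (Subgroup.zpowers x) (by rw [Nat.card_zpowers, hx, hf, pow_one]))
    (Sylow.ofCard (p := p) (Subgroup.zpowers y) (by rw [Nat.card_zpowers, hy, hf, pow_one]))
  refine ⟨c, ?_⟩
  have h3 : Subgroup.zpowers y = MulAut.conj c • Subgroup.zpowers x :=
    (congrArg Sylow.toSubgroup hc).symm
  rw [h3]
  exact ⟨x, Subgroup.mem_zpowers x, rfl⟩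

namespace IsTorus

variable {n : ℕ} [NeZero n] {a : Multiplicative (ZMod n) →* G} {κ : ZMod n} (h : IsTorus n a κ)

include h

open Classical in
theorem three_mul_card :
    3 * n * #{g | ∃ m ≠ 0, IsConj g (a (.ofAdd m))} = (n - 1) * Nat.card G := by
  have h1 : ∑ m ∈ univ.erase (0 : ZMod n), #{g | IsConj (a (.ofAdd m)) g} =
      3 * #{g | ∃ m ≠ 0, IsConj g (a (.ofAdd m))} := by
    simp only [card_filter]
    rw [sum_comm, mul_sum]
    refine sum_congr rfl fun g _ => ?_
    split_ifs with hg
    · obtain ⟨i, hi, hgi⟩ := hg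
      obtain ⟨n1, n2, n3⟩ := h.mul_ne hi
      have e1 : ∀ m, (if IsConj (a (.ofAdd m)) g then 1 else 0) =
          if m ∈ ({i, κ * i, κ ^ 2 * i} : Finset (ZMod n)) then 1 else 0 := by
        intro m
        refine if_congr ?_ rfl rfl
        simp only [mem_insert, mem_singleton]
        rw [← h.conj i hi m]
        exact ⟨fun e => (e.trans hgi).symm, fun e => (hgi.trans e).symm⟩
      rw [sum_congr rfl fun m _ => e1 m, sum_boole]
      have e2 : ({m ∈ univ.erase (0 : ZMod n) | m ∈ ({i, κ * i, κ ^ 2 * i} : Finset (ZMod n))}) =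
          {i, κ * i, κ ^ 2 * i} := by
        ext m
        simp only [mem_filter, mem_erase, mem_univ, and_true, and_iff_right_iff_imp]
        rintro hm rfl
        have hz : κ * i ≠ 0 := fun e => hi (by
          calc i = κ ^ 3 * i := by rw [h.cube, one_mul]
            _ = κ ^ 2 * (κ * i) := by ring
            _ = 0 := by rw [e, mul_zero])
        have hz2 : κ ^ 2 * i ≠ 0 := fun e => hi (by
          calc i = κ ^ 3 * i := by rw [h.cube, one_mul]
            _ = κ * (κ ^ 2 * i) := by ring
            _ = 0 := by rw [e, mul_zero])
        simp only [mem_insert, mem_singleton] at hm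
        rcases hm with e | e | e
        exacts [hi e.symm, hz e.symm, hz2 e.symm]
      rw [e2, card_insert_of_notMem, card_pair n3.symm]
      · ring
      · simp [n1.symm, n2.symm]
    · rw [sum_eq_zero, mul_zero]
      exact fun m hm => if_neg fun e => hg ⟨m, (mem_erase.1 hm).1, e.symm⟩
  have h2 : ∀ m ≠ 0, #{g | IsConj (a (.ofAdd m)) g} * n = Nat.card G := by
    intro m hm
    rw [← card_isConj_mul_card_centralizer (a (.ofAdd m)), h.card_centralizer m hm,
      Nat.card_eq_fintype_card, Fintype.card_subtype]
  calc _ = (∑ m ∈ univ.erase (0 : ZMod n), #{g | IsConj (a (.ofAdd m)) g}) * n := by rw [h1]; ring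
    _ = ∑ m ∈ univ.erase (0 : ZMod n), Nat.card G := by
        rw [sum_mul]
        exact sum_congr rfl fun m hm => h2 m (mem_erase.1 hm).1
    _ = _ := by rw [sum_const, card_erase_of_mem (mem_univ _), card_univ, ZMod.card, smul_eq_mul]

theorem injective (hn : Nat.card G ≠ n) : Function.Injective a := by
  rw [injective_iff_map_eq_one]
  intro x hx
  by_contra hne
  have := h.card_centralizer (Multiplicative.toAdd x) (by simpa using hne)
  rw [ofAdd_toAdd, hx] at this
  apply hn
  rw [← this, Subgroup.centralizer_eq_top_iff_subset.2 (by simp [Subgroup.one_mem]), Subgroup.card_top]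

theorem centralizer_eq_range (hn : Nat.card G ≠ n) {m : ZMod n} (hm : m ≠ 0) :
    Subgroup.centralizer {a (.ofAdd m)} = a.range := by
  refine (Subgroup.eq_of_le_of_card_ge ?_ ?_).symm
  · rintro _ ⟨x, rfl⟩
    rw [Subgroup.mem_centralizer_singleton_iff, ← map_mul, ← map_mul, mul_comm]
  · rw [h.card_centralizer m hm, ← Nat.card_congr (MonoidHom.ofInjective (h.injective hn)).toEquiv]
    simp

theorem exists_isConj_of_dvd (hn : Nat.card G ≠ n) {p : ℕ} [Fact p.Prime] (hp : p ∣ n)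
    (hp2 : ¬ p ^ 2 ∣ Nat.card G) {g : G} (hg : p ∣ Nat.card (Subgroup.centralizer {g})) :
    ∃ m, IsConj g (a (.ofAdd m)) := by
  have hp1 : p.Prime := Fact.out
  obtain ⟨⟨x, hxg⟩, hx⟩ := exists_prime_orderOf_dvd_card' p hg
  rw [Subgroup.orderOf_mk] at hx
  obtain ⟨d, rfl⟩ := hp
  have hd : d ≠ 0 := by rintro rfl; exact NeZero.ne (p * 0) rfl
  set y : Multiplicative (ZMod (p * d)) := .ofAdd (d : ZMod (p * d)) with hyd
  have hy : orderOf (a y) = p := by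
    rw [orderOf_injective _ (h.injective hn), hyd, orderOf_ofAdd_eq_addOrderOf,
      ZMod.addOrderOf_coe' _ hd, Nat.gcd_mul_left_left, Nat.mul_div_cancel _ (by omega)]
  obtain ⟨c, hc⟩ := exists_conj_mem_zpowers hp2 hx hy
  rw [← MonoidHom.map_zpowers] at hc
  obtain ⟨w, -, hw⟩ := hc
  have hw0 : Multiplicative.toAdd w ≠ 0 := by
    intro e
    have e1 : w = 1 := e
    rw [e1, map_one] at hw
    have : x = 1 := by simpa using hw.symm
    rw [this, orderOf_one] at hx
    exact hp1.one_lt.ne hx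
  have hmem : c * g * c⁻¹ ∈ Subgroup.centralizer {a w} := by
    rw [Subgroup.mem_centralizer_singleton_iff] at hxg ⊢
    rw [hw]
    calc c * g * c⁻¹ * (c * x * c⁻¹) = c * (g * x) * c⁻¹ := by group
      _ = c * (x * g) * c⁻¹ := by rw [hxg]
      _ = _ := by group
  have := h.centralizer_eq_range hn hw0
  rw [ofAdd_toAdd] at this
  rw [this] at hmem
  obtain ⟨m, hm⟩ := hmem
  exact ⟨Multiplicative.toAdd m, isConj_iff.2 ⟨c, by rw [ofAdd_toAdd, hm]⟩⟩

end IsTorus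

end Torus

section SevenElements

open Finset

theorem eq_zero_of_central_dvd {c : ℕ} (hc : c ∣ 40000) {y : ℤ}
    (hd : ((7 ^ 6 * c : ℕ) * 117649 : ℤ) ∣ y * (2 ^ 6 * 3 * 5 ^ 4 * 7 ^ 6 * 13 * 181 : ℕ))
    (hsq : y ^ 2 ≤ (7 ^ 6 * c : ℕ)) : y = 0 := by
  have h1 : (117649 : ℤ) ∣ y := by
    have : (117649 * 117649 : ℤ) ∣ 117649 * (y * 282360000) := by
      refine (Dvd.intro (c : ℤ) ?_).trans (hd.trans (Dvd.intro 1 ?_))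
      · push_cast; ring
      · push_cast; ring
    have h2 := (mul_dvd_mul_iff_left (by norm_num)).1 this
    exact (IsCoprime.dvd_of_dvd_mul_right (by
      rw [Int.isCoprime_iff_gcd_eq_one]; norm_num) h2)
  have h2 : c ≤ 40000 := Nat.le_of_dvd (by norm_num) hc
  obtain ⟨q, rfl⟩ := h1
  have h3 : (117649 * q) ^ 2 < 117649 ^ 2 := by
    refine hsq.trans_lt ?_
    push_cast
    have : (c : ℤ) ≤ 40000 := by exact_mod_cast h2
    linarith
  have h4 : q ^ 2 < 1 := by nlinarith
  have : q = 0 := by nlinarith [sq_nonneg q, Int.natAbs_sq q, Int.abs_lt_one_iff.1 ((sq_lt_one_iff_abs_lt_one q).1 h4)]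
  simp [this]

theorem central_values {c N : ℕ} (hc : c ∣ 40000) {x cl : ℤ} (hcl : cl * c = 282360000)
    (hX : ((7 ^ 6 * c : ℕ) * 2352 : ℤ) ∣ x * (2 ^ 6 * 3 * 5 ^ 4 * 7 ^ 6 * 13 * 181 : ℕ))
    (hZ : ((7 ^ 6 * c : ℕ) * 120000 : ℤ) ∣ (x - 1) * (2 ^ 6 * 3 * 5 ^ 4 * 7 ^ 6 * 13 * 181 : ℕ))
    (hle : cl * (x * (x - 1)) ≤ 120000 * 115297)
    (hN : (N : ℚ) * (7 ^ 6 * c : ℕ) ^ 2 = (2 ^ 6 * 3 * 5 ^ 4 * 7 ^ 6 * 13 * 181 : ℕ) *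
      (1 - (x : ℚ) ^ 2 / 2352 - 0 + ((x : ℚ) - 1) ^ 2 / 120000)) : x = -49 ∧ c = 50 := by
  have hc0 : (0 : ℤ) < c := by
    have : 0 < c := Nat.pos_of_dvd_of_pos hc (by norm_num)
    exact_mod_cast this
  have h49 : (49 : ℤ) ∣ x := by
    have : (7 ^ 6 * 48 * 49 : ℤ) ∣ 7 ^ 6 * 48 * (x * 5882500) := by
      refine (Dvd.intro (c : ℤ) ?_).trans (hX.trans (Dvd.intro 1 ?_))
      · push_cast; ring
      · push_cast; ring
    have h2 := (mul_dvd_mul_iff_left (by norm_num)).1 this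
    exact (IsCoprime.dvd_of_dvd_mul_right (by
      rw [Int.isCoprime_iff_gcd_eq_one]; norm_num) h2)
  have hcx : (c : ℤ) ∣ x - 1 := by
    have : (7 ^ 6 * 120000 * c : ℤ) ∣ 7 ^ 6 * 120000 * ((x - 1) * 2353) := by
      refine (Dvd.intro 1 ?_).trans (hZ.trans (Dvd.intro 1 ?_))
      · push_cast; ring
      · push_cast; ring
    have h2 := (mul_dvd_mul_iff_left (by norm_num)).1 this
    refine (IsCoprime.dvd_of_dvd_mul_right (IsCoprime.of_isCoprime_of_dvd_left
      (y := 40000) ?_ (by exact_mod_cast hc)) h2)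
    rw [Int.isCoprime_iff_gcd_eq_one]; norm_num
  have h1 : x * (x - 1) ≤ 49 * c := by nlinarith
  rcases lt_trichotomy x 0 with hx | hx | hx
  · have h2 : (c : ℤ) ≤ 1 - x := Int.le_of_dvd (by linarith) (by
      rw [← dvd_neg]; simpa using hcx)
    have h3 : -49 ≤ x := by nlinarith
    obtain ⟨q, rfl⟩ := h49
    have : q = -1 := by omega
    subst this
    refine ⟨rfl, ?_⟩
    have : (c : ℤ) = 50 := by norm_num at h1 h2; omega
    exact_mod_cast this
  · subst hx
    have : c = 1 := by
      have : (c : ℤ) ∣ 1 := by simpa using hcx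
      exact Nat.dvd_one.1 (by exact_mod_cast this)
    subst this
    exfalso
    have h5 : (N * 117649 : ℚ) = 2353 * 120001 := by
      push_cast at hN
      linear_combination hN / 117649
    have h6 : N * 117649 = 2353 * 120001 := by exact_mod_cast h5
    omega
  · have h2 : (c : ℤ) ≤ x - 1 := by
      refine Int.le_of_dvd ?_ hcx
      obtain ⟨q, rfl⟩ := h49
      omega
    have h3 : x ≤ 49 := by nlinarith
    obtain ⟨q, rfl⟩ := h49
    have : q = 1 := by omega
    subst this
    have : (c : ℤ) = 48 := by norm_num at h1 h2; omega
    have : c = 48 := by exact_mod_cast this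
    subst this
    norm_num at hc

theorem regular_values {C N : ℕ} (hC : C ∣ 7 ^ 6) (hC1 : C ≠ 1) {x y : ℤ} (hxy : x + y = 0)
    (hd : (C * 117649 : ℤ) ∣ y * (2 ^ 6 * 3 * 5 ^ 4 * 7 ^ 6 * 13 * 181 : ℕ))
    (hsq : y ^ 2 ≤ C)
    (hN : (N : ℚ) * C ^ 2 = (2 ^ 6 * 3 * 5 ^ 4 * 7 ^ 6 * 13 * 181 : ℕ) *
      (1 - (x : ℚ) ^ 2 / 2352 - (y : ℚ) ^ 2 / 117649 + 1 / 120000)) : x = 0 ∧ C ∣ 7 ^ 4 := by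
  have hcy : (C : ℤ) ∣ y := by
    have : (117649 * C : ℤ) ∣ 117649 * (y * 282360000) := by
      refine (Dvd.intro 1 ?_).trans (hd.trans (Dvd.intro 1 ?_))
      · push_cast; ring
      · push_cast; ring
    have h2 := (mul_dvd_mul_iff_left (by norm_num)).1 this
    refine (IsCoprime.dvd_of_dvd_mul_right (IsCoprime.of_isCoprime_of_dvd_left
      (y := 7 ^ 6) ?_ (by exact_mod_cast hC)) h2)
    rw [Int.isCoprime_iff_gcd_eq_one]; norm_num
  have hC0 : 0 < C := Nat.pos_of_dvd_of_pos hC (by norm_num)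
  have hC2 : (1 : ℤ) < C := by exact_mod_cast (by omega : 1 < C)
  have hy : y = 0 := by
    by_contra hy
    have h1 : (C : ℤ) ≤ |y| := Int.le_of_dvd (abs_pos.2 hy) ((dvd_abs _ _).2 hcy)
    rw [← sq_abs] at hsq
    nlinarith
  subst hy
  have hx : x = 0 := by simpa using hxy
  subst hx
  refine ⟨rfl, ?_⟩
  have h5 : (N * C ^ 2 : ℚ) = 117649 * 2353 * 120001 := by
    push_cast at hN
    linear_combination hN
  have h6 : N * C ^ 2 = 117649 * 2353 * 120001 := by exact_mod_cast h5
  obtain ⟨k, hk, rfl⟩ := (Nat.dvd_prime_pow (by norm_num)).1 hC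
  refine pow_dvd_pow 7 ?_
  by_contra! hk4
  interval_cases k <;> omega

end SevenElements

section SevenLocal

open Finset

/-- `z` and `u` represent the two classes of nontrivial `7`-elements, `z` being the central one. -/
structure IsSevenLocal {G : Type*} [Group G] (z u : G) : Prop where
  card_central : Nat.card (Subgroup.centralizer {z}) = 7 ^ 6 * 50
  card_regular : Nat.card (Subgroup.centralizer {u}) = 7 ^ 4
  cover : ∀ g ≠ 1, ∀ j : ℕ, g ^ 7 ^ j = 1 → IsConj z g ∨ IsConj u g
  count : ∀ U : Subgroup G, Nat.card U = 7 ^ 6 → Nat.card {x : U // IsConj z (x : G)} = 48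

theorem exists_central_orderOf {G : Type*} [Group G] [Finite G] {p n : ℕ} [hp : Fact p.Prime]
    (hn : n ≠ 0) (h : p ^ n ∣ Nat.card G) :
    ∃ z : G, orderOf z = p ∧ p ^ n ∣ Nat.card (Subgroup.centralizer {z}) := by
  obtain ⟨P, hP⟩ := Sylow.exists_subgroup_card_pow_prime p h
  have hPp : IsPGroup p P := IsPGroup.of_card hP
  have : Nontrivial P := by
    rw [← Finite.one_lt_card_iff_nontrivial, hP]
    exact Nat.one_lt_pow hn hp.out.one_lt
  have := hPp.center_nontrivial
  have hd : p ∣ Nat.card (Subgroup.center P) := by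
    obtain ⟨k, hk⟩ := IsPGroup.iff_card.1 (hPp.to_subgroup (Subgroup.center P))
    rw [hk]
    refine dvd_pow_self p ?_
    rintro rfl
    exact (Finite.one_lt_card (α := Subgroup.center P)).ne' (by rw [hk, pow_zero])
  obtain ⟨z, hz⟩ := exists_prime_orderOf_dvd_card' p hd
  refine ⟨z, by rw [← hz, Subgroup.orderOf_coe, Subgroup.orderOf_coe], ?_⟩
  rw [← hP]
  refine Subgroup.card_dvd_of_le fun x hx => ?_
  rw [Subgroup.mem_centralizer_singleton_iff]
  exact congrArg Subtype.val (Subgroup.mem_center_iff.1 z.2 ⟨x, hx⟩)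

variable {G : Type*} [Group G] [Fintype G] {a : Multiplicative (ZMod 2353) →* G} {κ : ZMod 2353}
  {X Y : G → ℤ}

theorem mul_add_one_nonneg (w : ℤ) : 0 ≤ w * (w + 1) := by
  rcases le_or_gt 0 w with h | h
  · positivity
  · nlinarith

theorem IsUnitaryPair.exists_isSevenLocal (h : IsUnitaryPair a X Y) (hT : IsTorus 2353 a κ)
    (hcard : Nat.card G = 2 ^ 6 * 3 * 5 ^ 4 * 7 ^ 6 * 13 * 181)
    (h7 : ∀ g : G, orderOf g = 7 → ∀ q ∈ ({3, 13, 181} : Finset ℕ),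
      ¬ q ∣ Nat.card (Subgroup.centralizer {g})) : ∃ z u : G, IsSevenLocal z u := by
  classical
  have hinj := hT.injective (by rw [hcard]; norm_num)
  set O : Finset G := {g | ∀ m, ¬ IsConj g (a (.ofAdd m))} with hO
  have hTcard : (#{g : G | ∃ m ≠ 0, IsConj g (a (.ofAdd m))} : ℤ) = 784 * 120000 * 117649 := by
    have := hT.three_mul_card
    rw [hcard] at this
    have : #{g : G | ∃ m ≠ 0, IsConj g (a (.ofAdd m))} = 784 * 120000 * 117649 := by omega
    exact_mod_cast this
  have hconj : ∀ {F : G → ℤ}, (∀ g h, F (h * g * h⁻¹) = F g) → ∀ {x y}, IsConj x y → F x = F y := by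
    intro F hF x y hxy
    obtain ⟨c, rfl⟩ := isConj_iff.1 hxy
    rw [hF]
  have hsum : ∀ (F : G → ℤ) (t : ℤ), (∀ g h, F (h * g * h⁻¹) = F g) →
      (∀ m ≠ 0, F (a (.ofAdd m)) = t) →
      ∑ g, F g = F 1 + 784 * 120000 * 117649 * t + ∑ g ∈ O, F g := by
    intro F t hF ht
    rw [← sum_filter_not_add_sum_filter univ (fun g : G => ∀ m, ¬ IsConj g (a (.ofAdd m))) F]
    congr 1
    refine (sum_congr (s₂ := insert 1 (univ.filter fun g : G => ∃ m ≠ 0, IsConj g (a (.ofAdd m)))) ?_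
      fun _ _ => rfl).trans ?_
    · ext g
      simp only [mem_filter, mem_univ, true_and, mem_insert]
      push Not
      constructor
      · rintro ⟨m, hm⟩
        by_cases h0 : m = 0
        · subst h0
          left
          rw [ofAdd_zero, map_one] at hm
          exact isConj_one_left.1 hm
        · exact Or.inr ⟨m, h0, hm⟩
      · rintro (rfl | ⟨m, -, hm⟩)
        · exact ⟨0, by rw [ofAdd_zero, map_one]⟩
        · exact ⟨m, hm⟩
    rw [sum_insert, ← hTcard, sum_congr rfl (g := fun _ => t), sum_const, nsmul_eq_mul]
    · intro g hg
      obtain ⟨m, hm, hgm⟩ := (mem_filter.1 hg).2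
      rw [hconj hF hgm, ht m hm]
    · intro hg
      obtain ⟨m, hm, hgm⟩ := (mem_filter.1 hg).2
      rw [isConj_one_right] at hgm
      exact hm (Multiplicative.ofAdd.injective (hinj (by rw [hgm, ofAdd_zero, map_one])))
  have hmemO : ∀ {g}, g ∈ O ↔ ∀ m, ¬ IsConj g (a (.ofAdd m)) := fun {g} => by simp [hO]
  have hclass : ∀ {F : G → ℤ}, (∀ g h, F (h * g * h⁻¹) = F g) → ∀ {g}, g ∈ O →
      ∑ x ∈ O, F x = Nat.card {x : G // IsConj g x} * F g + ∑ x ∈ O with ¬ IsConj g x, F x := by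
    intro F hF g hg
    rw [← sum_filter_add_sum_filter_not O (fun x => IsConj g x) F]
    congr 1
    rw [sum_congr rfl (g := fun _ => F g), sum_const, nsmul_eq_mul, Nat.card_eq_fintype_card,
      Fintype.card_subtype]
    · have e : O.filter (fun x => IsConj g x) = univ.filter fun x => IsConj g x := by
        ext x
        simp only [mem_filter, mem_univ, true_and, and_iff_right_iff_imp]
        exact fun hx => hmemO.2 fun m hm => hmemO.1 hg m (hx.trans hm)
      rw [e]
    · exact fun x hx => (hconj hF (mem_filter.1 hx).2).symm
  set W : G → ℤ := fun g => X g + Y g - 1 with hW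
  have hWc : ∀ g h, W (h * g * h⁻¹) = W g := fun g c => by simp only [hW, h.conjX, h.conjY]
  have hWWc : ∀ g h, W (h * g * h⁻¹) * (W (h * g * h⁻¹) + 1) = W g * (W g + 1) := fun g c => by
    rw [hWc]
  have hGZ : (Nat.card G : ℤ) = 120000 * 2353 * 117649 := by rw [hcard]; norm_num
  have hG : (Fintype.card G : ℤ) = 120000 * 2353 * 117649 := by
    rw [← Nat.card_eq_fintype_card]; exact hGZ
  have hS1 : ∑ g ∈ O, W g * (W g + 1) = 120000 * 115297 := by
    have e := hsum (fun g => W g * (W g + 1)) 6 hWWc (fun m hm => by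
      simp only [hW, h.torusX m hm, h.torusY m hm]; norm_num)
    have e2 : ∑ g, W g * (W g + 1) = 2 * (120000 * 2353 * 117649) := by
      calc _ = ∑ g, (X g ^ 2 + Y g ^ 2 + 2 * (X g * Y g) - X g - Y g) :=
            sum_congr rfl fun g _ => by simp only [hW]; ring
        _ = _ := by
          rw [sum_sub_distrib, sum_sub_distrib, sum_add_distrib, sum_add_distrib, ← mul_sum,
            h.sumX, h.sumY, h.sumXX, h.sumYY, h.sumXY, hGZ]
          ring
    rw [e2] at e
    simp only [hW, h.oneX, h.oneY] at e ⊢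
    linarith
  have hS2 : ∑ g ∈ O, W g = - (120000 * 2353 * 117649) - 120000 + 784 * 120000 * 117649 * 3 := by
    have e := hsum W (-3) hWc (fun m hm => by
      simp only [hW, h.torusX m hm, h.torusY m hm]; norm_num)
    have e2 : ∑ g, W g = - (120000 * 2353 * 117649) := by
      simp only [hW]
      rw [sum_sub_distrib, sum_add_distrib, h.sumX, h.sumY, sum_const, card_univ, nsmul_eq_mul, hG]
      ring
    rw [e2] at e
    simp only [hW, h.oneX, h.oneY] at e ⊢
    linarith
  have hcl : ∀ g : G, (Nat.card {x : G // IsConj g x} : ℤ) * Nat.card (Subgroup.centralizer {g}) =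
      120000 * 2353 * 117649 := fun g => by
    rw [← hGZ]; exact_mod_cast card_isConj_mul_card_centralizer g
  have hYsq : ∀ g ∈ O, Y g ^ 2 ≤ Nat.card (Subgroup.centralizer {g}) := by
    intro g hg
    have e1 : (Nat.card {x : G // IsConj g x} : ℤ) * Y g ^ 2 ≤ Nat.card G := by
      have := hclass (F := fun g => Y g ^ 2) (fun g c => by rw [h.conjY]) hg
      rw [← h.sumYY]
      refine le_trans ?_ (sum_le_sum_of_subset_of_nonneg (subset_univ O) fun i _ _ => sq_nonneg _)
      rw [this, le_add_iff_nonneg_right]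
      exact sum_nonneg fun i _ => sq_nonneg _
    rw [hGZ, ← hcl g] at e1
    refine le_of_mul_le_mul_left e1 ?_
    have : 0 < Nat.card {x : G // IsConj g x} := Nat.card_pos_iff.2 ⟨⟨g, IsConj.refl g⟩, inferInstance⟩
    exact_mod_cast this
  have : Fact (Nat.Prime 7) := ⟨by norm_num⟩
  obtain ⟨z, hz, hzC⟩ := exists_central_orderOf (G := G) (p := 7) (n := 6) (by norm_num)
    (by rw [hcard]; norm_num)
  have hsevenO : ∀ g ≠ 1, ∀ j : ℕ, g ^ 7 ^ j = 1 → g ∈ O := by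
    intro g hg j hgj
    rw [hmemO]
    intro m hm
    by_cases h0 : m = 0
    · subst h0
      rw [ofAdd_zero, map_one] at hm
      exact hg (isConj_one_left.1 hm)
    · have := h.modX g j hgj
      rw [hconj h.conjX hm, h.torusX m h0] at this
      norm_num at this
  have hz1 : z ≠ 1 := by rintro rfl; simp at hz
  have hzO : z ∈ O := hsevenO z hz1 1 (by rw [pow_one, ← hz, pow_orderOf_eq_one])
  obtain ⟨c, hc⟩ := hzC
  have hc4 : c ∣ 40000 := by
    have hc1 : c ∣ 40000 * (3 * 13 * 181) := by
      have := Subgroup.card_subgroup_dvd_card (Subgroup.centralizer {z})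
      rw [hc, hcard, show 2 ^ 6 * 3 * 5 ^ 4 * 7 ^ 6 * 13 * 181 = 7 ^ 6 * (40000 * (3 * 13 * 181)) by
        norm_num] at this
      exact Nat.dvd_of_mul_dvd_mul_left (by norm_num) this
    refine Nat.Coprime.dvd_of_dvd_mul_right ?_ hc1
    have hcop : ∀ q ∈ ({3, 13, 181} : Finset ℕ), q.Prime → Nat.Coprime c q := fun q hq hqp =>
      ((Nat.Prime.coprime_iff_not_dvd hqp).2 fun hd =>
        h7 z hz q hq (hc ▸ Dvd.dvd.mul_left hd _)).symm
    exact ((hcop 3 (by simp) (by norm_num)).mul_right (hcop 13 (by simp) (by norm_num))).mul_right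
      (hcop 181 (by simp) (by norm_num))
  have hYz : Y z = 0 := by
    refine eq_zero_of_central_dvd hc4 ?_ ?_
    · rw [← hc, ← hcard]; exact h.dvdY z
    · rw [← hc]; exact hYsq z hzO
  obtain ⟨N, hN⟩ := h.struct z (hmemO.1 hzO)
  obtain ⟨hXz, rfl⟩ := central_values (x := X z) (N := N)
    (cl := Nat.card {x : G // IsConj z x}) hc4 (by
      have := hcl z
      rw [hc] at this
      push_cast at this
      linarith) (by rw [← hc, ← hcard]; exact h.dvdX z) (by
      rw [← hc, ← hcard]; simpa [hYz] using h.dvdZ z (hmemO.1 hzO)) (by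
      rw [← hS1, hclass (F := fun g => W g * (W g + 1)) hWWc hzO]
      have e : W z * (W z + 1) = X z * (X z - 1) := by simp only [hW, hYz]; ring
      rw [e, le_add_iff_nonneg_right]
      exact sum_nonneg fun i _ => mul_add_one_nonneg _) (by
      rw [← hc, ← hcard, hN, hYz]; push_cast; ring)
  have hclz : (Nat.card {x : G // IsConj z x} : ℤ) = 5647200 := by
    have := hcl z
    rw [hc] at this
    push_cast at this
    linarith
  have hWz : W z = -50 := by simp only [hW, hYz, hXz]; norm_num
  have hrest : ∀ g ∈ O, ¬ IsConj z g → W g = 0 ∨ W g = -1 := by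
    have e := hclass (F := fun g => W g * (W g + 1)) hWWc hzO
    rw [hS1, hclz, hWz] at e
    have e0 : ∑ x ∈ O with ¬ IsConj z x, W x * (W x + 1) = 0 := by linarith
    rw [sum_eq_zero_iff_of_nonneg fun i _ => mul_add_one_nonneg _] at e0
    intro g hg hzg
    rcases mul_eq_zero.1 (e0 g (mem_filter.2 ⟨hg, hzg⟩)) with e1 | e1
    · exact Or.inl e1
    · right; linarith
  set N1 : Finset G := {x ∈ O | ¬ IsConj z x ∧ W x = -1} with hN1
  have hN1card : (#N1 : ℤ) = 120000 * 2353 * 49 := by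
    have e := hclass hWc hzO
    rw [hS2, hclz, hWz] at e
    have e0 : ∑ x ∈ O with ¬ IsConj z x, W x = -#N1 := by
      rw [hN1, ← filter_filter, card_filter, Nat.cast_sum, ← sum_neg_distrib]
      refine sum_congr rfl fun x hx => ?_
      rcases hrest x (mem_filter.1 hx).1 (mem_filter.1 hx).2 with e1 | e1 <;> simp [e1]
    rw [e0] at e
    linarith
  have hreg : ∀ g ∈ N1, X g = 0 ∧ Nat.card (Subgroup.centralizer {g}) ∣ 7 ^ 4 := by
    intro g hg
    obtain ⟨hgO, hgz, hgW⟩ := mem_filter.1 hg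
    obtain ⟨N, hN⟩ := h.struct g (hmemO.1 hgO)
    have hxy : X g + Y g = 0 := by simp only [hW] at hgW; linarith
    have hdd := h.dvdZ g (hmemO.1 hgO)
    have hnp : ∀ p, p.Prime → p ∣ 2353 → ¬ p ^ 2 ∣ Nat.card G →
        ¬ p ∣ Nat.card (Subgroup.centralizer {g}) := by
      intro p hp h1 h2 h3
      have : Fact p.Prime := ⟨hp⟩
      obtain ⟨m, hm⟩ := hT.exists_isConj_of_dvd (by rw [hcard]; norm_num) h1 h2 h3
      exact hmemO.1 hgO m hm
    refine regular_values (N := N) (y := Y g) ?_ ?_ hxy ?_ (hYsq g hgO) ?_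
    · rw [hxy, hGZ] at hdd
      have h1 : Nat.card (Subgroup.centralizer {g}) ∣ 7 ^ 6 * (13 * 181) := by
        have h2 : (Nat.card (Subgroup.centralizer {g}) : ℤ) ∣ 7 ^ 6 * (13 * 181) := by
          have h3 : (120000 : ℤ) * (Nat.card (Subgroup.centralizer {g})) ∣
              120000 * (7 ^ 6 * (13 * 181)) := by
            rw [← Int.dvd_neg]
            convert hdd using 1 <;> ring
          exact (mul_dvd_mul_iff_left (by norm_num)).1 h3
        exact_mod_cast h2
      refine Nat.Coprime.dvd_of_dvd_mul_right (Nat.Coprime.mul_right ?_ ?_) h1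
      · exact ((Nat.Prime.coprime_iff_not_dvd (by norm_num)).2
          (hnp 13 (by norm_num) (by norm_num) (by rw [hcard]; norm_num))).symm
      · exact ((Nat.Prime.coprime_iff_not_dvd (by norm_num)).2
          (hnp 181 (by norm_num) (by norm_num) (by rw [hcard]; norm_num))).symm
    · intro e
      have := Subgroup.mem_bot.1 ((Subgroup.card_eq_one.1 e) ▸
        (Subgroup.mem_centralizer_singleton_iff.2 rfl : g ∈ Subgroup.centralizer {g}))
      exact hmemO.1 hgO 0 (by rw [this, ofAdd_zero, map_one])
    · rw [← hcard]; exact h.dvdY g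
    · rw [hN, ← hcard]
      have : (X g : ℚ) + Y g = 0 := by exact_mod_cast hxy
      rw [this]; norm_num
  obtain ⟨u, hu⟩ : N1.Nonempty := by
    rw [← card_pos]
    have : (0 : ℤ) < #N1 := by rw [hN1card]; norm_num
    exact_mod_cast this
  obtain ⟨hXu, hCu⟩ := hreg u hu
  obtain ⟨huO, huz, huW⟩ := mem_filter.1 hu
  have hclN1 : ({x | IsConj u x} : Finset G) ⊆ N1 := by
    intro x hx
    have hx := (mem_filter.1 hx).2
    exact mem_filter.2 ⟨hmemO.2 fun m hm => hmemO.1 huO m (hx.trans hm),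
      fun hzx => huz (hzx.trans hx.symm), by rw [← hconj hWc hx, huW]⟩
  have hclu : #({x | IsConj u x} : Finset G) = Nat.card {x : G // IsConj u x} := by
    rw [Nat.card_eq_fintype_card, Fintype.card_subtype]
  have hC4 : Nat.card (Subgroup.centralizer {u}) = 7 ^ 4 := by
    have e1 := card_le_card hclN1
    rw [hclu] at e1
    have e2 := hcl u
    obtain ⟨k, hk, hk'⟩ := (Nat.dvd_prime_pow (by norm_num)).1 hCu
    rw [hk'] at e2 ⊢
    have e3 : (Nat.card {x : G // IsConj u x} : ℤ) ≤ 120000 * 2353 * 49 := by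
      rw [← hN1card]; exact_mod_cast e1
    interval_cases k <;> first | rfl | (exfalso; push_cast at e2; linarith)
  have hclN1' : ({x | IsConj u x} : Finset G) = N1 := by
    refine eq_of_subset_of_card_le hclN1 ?_
    have e2 := hcl u
    rw [hC4] at e2
    push_cast at e2
    rw [hclu]
    have : (#N1 : ℤ) ≤ Nat.card {x : G // IsConj u x} := by rw [hN1card]; linarith
    exact_mod_cast this
  have hcover : ∀ g ≠ 1, ∀ j : ℕ, g ^ 7 ^ j = 1 → IsConj z g ∨ IsConj u g := by
    intro g hg j hgj
    by_cases hzg : IsConj z g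
    · exact Or.inl hzg
    right
    have hgO := hsevenO g hg j hgj
    have : g ∈ N1 := by
      refine mem_filter.2 ⟨hgO, hzg, (hrest g hgO hzg).resolve_left fun e => ?_⟩
      simp only [hW] at e
      have := h.modX g j hgj
      have := h.modY g j hgj
      omega
    rw [← hclN1'] at this
    exact (mem_filter.1 this).2
  refine ⟨z, u, hc, hC4, hcover, fun U hU => ?_⟩
  obtain ⟨N, hN⟩ := h.mult U
  have hval : ∀ s : U, X s = (if s = 1 then 2352 else 0) + -49 * if IsConj z (s : G) then 1 else 0 := by
    intro s
    by_cases hs : s = 1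
    · subst hs
      rw [if_pos rfl, if_neg (by simpa using hz1), Subgroup.coe_one, h.oneX]; norm_num
    · rw [if_neg hs]
      have hs1 : (s : G) ≠ 1 := by simpa using hs
      have hs7 : (s : G) ^ 7 ^ 6 = 1 := by
        rw [← hU, ← Subgroup.coe_pow, pow_card_eq_one', Subgroup.coe_one]
      split_ifs with hzs
      · rw [← hconj h.conjX hzs, hXz]; norm_num
      · rw [← hconj h.conjX ((hcover s hs1 6 hs7).resolve_left hzs), hXu]; norm_num
  rw [sum_congr rfl fun s _ => hval s, sum_add_distrib, ← mul_sum, sum_boole, sum_ite_eq' univ (1 : U),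
    if_pos (mem_univ _), hU] at hN
  rw [Nat.card_eq_fintype_card, Fintype.card_subtype]
  push_cast at hN
  omega

end SevenLocal

section PrimeGraph

variable {G : Type*} [Group G]

theorem exists_orderOf_mul [Finite G] {p q : ℕ} (hq : q.Prime) (hpq : p.Coprime q) {x : G}
    (hx : orderOf x = p) (hd : q ∣ Nat.card (Subgroup.centralizer {x})) :
    ∃ g : G, orderOf g = p * q := by
  have : Fact q.Prime := ⟨hq⟩
  obtain ⟨⟨y, hy⟩, hyq⟩ := exists_prime_orderOf_dvd_card' q hd
  rw [Subgroup.orderOf_mk] at hyq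
  refine ⟨x * y, ?_⟩
  rw [Commute.orderOf_mul_eq_mul_orderOf_of_coprime, hx, hyq]
  · exact (Subgroup.mem_centralizer_singleton_iff.1 hy).symm
  · rwa [hx, hyq]

theorem exists_adj_of_gkDegree_eq_one {p : ℕ} (hp : p.Prime) (h : gkDegree G p = 1) :
    ∃ r, r.Prime ∧ p ≠ r ∧ (∃ g : G, orderOf g = p * r) ∧
      ∀ q, q.Prime → p ≠ q → (∃ g : G, orderOf g = p * q) → q = r := by
  rw [gkDegree, Nat.card_eq_one_iff_unique] at h
  obtain ⟨hs, ⟨⟨r, h1, h2, h3, h4⟩⟩⟩ := h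
  exact ⟨r, h3, h1, h4, fun q hq hpq hg => congrArg Subtype.val
    (hs.elim ⟨q, hpq, hp, hq, hg⟩ ⟨r, h1, h2, h3, h4⟩)⟩

theorem prime_dvd_cases {q : ℕ} (hq : q.Prime) (h : q ∣ 2 ^ 6 * 3 * 5 ^ 4 * 7 ^ 6 * 13 * 181) :
    q = 2 ∨ q = 3 ∨ q = 5 ∨ q = 7 ∨ q = 13 ∨ q = 181 := by
  simp only [hq.dvd_mul] at h
  have key : ∀ p n, p.Prime → q ∣ p ^ n → q = p := fun p n hp hd =>
    (Nat.prime_dvd_prime_iff_eq hq hp).1 (hq.dvd_of_dvd_pow hd)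
  rcases h with ((((h | h) | h) | h) | h) | h
  · exact Or.inl (key 2 6 (by norm_num) h)
  · exact Or.inr (Or.inl (key 3 1 (by norm_num) h))
  · exact Or.inr (Or.inr (Or.inl (key 5 4 (by norm_num) h)))
  · exact Or.inr (Or.inr (Or.inr (Or.inl (key 7 6 (by norm_num) h))))
  · exact Or.inr (Or.inr (Or.inr (Or.inr (Or.inl (key 13 1 (by norm_num) h)))))
  · exact Or.inr (Or.inr (Or.inr (Or.inr (Or.inr (key 181 1 (by norm_num) h)))))

theorem torus_arith : ∀ r ∈ ({2, 3, 5, 7, 13} : Finset ℕ), ∀ b ∈ Finset.range 7,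
    ∀ d ∈ Nat.divisors 180, b ≠ 0 → r ^ b * d % 181 = 39 →
      r ^ b * d ∣ 2 ^ 6 * 3 * 5 ^ 4 * 7 ^ 6 * 13 → r = 13 ∧ b = 1 ∧ d = 3 := by
  decide +kernel

end PrimeGraph

section Torus

variable {G : Type*} [Group G] [Finite G]

theorem card_centralizer_of_gkDegree (hcard : Nat.card G = 2 ^ 6 * 3 * 5 ^ 4 * 7 ^ 6 * 13 * 181)
    (h181 : gkDegree G 181 = 1) {x : G} (hx : orderOf x = 181) :
    Nat.card (Subgroup.centralizer {x}) = 13 * 181 ∧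
      Nat.card (Subgroup.normalizer (Subgroup.zpowers x : Set G)) = 3 * (13 * 181) := by
  obtain ⟨r, hr, hne, ⟨g0, hg0⟩, huniq⟩ := exists_adj_of_gkDegree_eq_one (by norm_num) h181
  have hp : Fact (Nat.Prime 181) := ⟨by norm_num⟩
  have hrG : r ∈ ({2, 3, 5, 7, 13} : Finset ℕ) := by
    have h1 : r ∣ Nat.card G := (Dvd.intro_left 181 hg0.symm).trans (orderOf_dvd_natCard g0)
    rw [hcard] at h1
    simp only [Finset.mem_insert, Finset.mem_singleton]
    rcases prime_dvd_cases hr h1 with h | h | h | h | h | h <;> omega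
  set C := Subgroup.centralizer {x} with hC
  set N := Subgroup.normalizer (Subgroup.zpowers x : Set G) with hN
  have hle : Subgroup.zpowers x ≤ C := by
    rw [Subgroup.zpowers_le, hC, Subgroup.mem_centralizer_singleton_iff]
  have hCeq : Subgroup.centralizer (Subgroup.zpowers x : Set G) = C := by
    rw [hC, Subgroup.zpowers_eq_closure, Subgroup.centralizer_closure]
  have hCN : C ≤ N := hCeq ▸ Subgroup.centralizer_le_normalizer _
  obtain ⟨m, hm⟩ : 181 ∣ Nat.card C := by
    have := Subgroup.card_dvd_of_le hle
    rwa [Nat.card_zpowers, hx] at this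
  have hmd : m ∣ 2 ^ 6 * 3 * 5 ^ 4 * 7 ^ 6 * 13 := by
    have := C.card_subgroup_dvd_card
    rw [hm, hcard, mul_comm] at this
    exact Nat.dvd_of_mul_dvd_mul_right (by norm_num) this
  have hm0 : m ≠ 0 := by rintro rfl; simp at hmd
  have hmr := Nat.eq_prime_pow_of_unique_prime_dvd hm0 (p := r) (fun {q} hq hqm => by
    have h0 : 181 ≠ q := by
      rintro rfl
      have := hqm.trans hmd
      norm_num at this
    exact huniq q hq h0 (exists_orderOf_mul hq ((Nat.coprime_primes hp.out hq).2 h0) hx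
      (hm ▸ Dvd.dvd.mul_left hqm _)))
  set b := m.primeFactorsList.length
  have hrC : r ∣ m := by
    have hx' : orderOf (g0 ^ r) = 181 := by
      rw [orderOf_pow, hg0, Nat.gcd_mul_left_left, Nat.mul_div_cancel _ hr.pos]
    obtain ⟨c, hc⟩ := exists_conj_mem_zpowers (by rw [hcard]; norm_num) hx hx'
    have h1 : c⁻¹ * g0 * c ∈ C := by
      obtain ⟨k, hk⟩ := Subgroup.mem_zpowers_iff.1 hc
      have h2 : Commute (g0) (c * x * c⁻¹) := by
        rw [← hk]
        exact ((Commute.refl g0).pow_right r).zpow_right k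
      rw [hC, Subgroup.mem_centralizer_singleton_iff]
      calc c⁻¹ * g0 * c * x = c⁻¹ * (g0 * (c * x * c⁻¹)) * c := by group
        _ = c⁻¹ * (c * x * c⁻¹ * g0) * c := by rw [h2.eq]
        _ = _ := by group
    have h3 : orderOf (c⁻¹ * g0 * c) = 181 * r := by
      rw [← hg0]
      have := orderOf_injective (MulAut.conj c⁻¹).toMonoidHom (MulAut.conj c⁻¹).injective g0
      simpa using this
    have h4 : 181 * r ∣ 181 * m := by
      rw [← hm, ← h3, ← Subgroup.orderOf_mk _ h1]
      exact orderOf_dvd_natCard _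
    exact Nat.dvd_of_mul_dvd_mul_left (by norm_num) h4
  have hb0 : b ≠ 0 := by
    intro hb
    rw [hb, pow_zero] at hmr
    rw [hmr] at hrC
    exact hr.one_lt.ne' (Nat.dvd_one.1 hrC)
  have hb7 : b ∈ Finset.range 7 := by
    rw [Finset.mem_range]
    by_contra hb
    have h1 : r ^ 7 ∣ 2 ^ 6 * 3 * 5 ^ 4 * 7 ^ 6 * 13 :=
      (pow_dvd_pow r (by omega)).trans (hmr ▸ hmd)
    simp only [Finset.mem_insert, Finset.mem_singleton] at hrG
    rcases hrG with h | h | h | h | h <;> rw [h] at h1 <;> norm_num at h1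
  obtain ⟨d, hd⟩ := Subgroup.card_dvd_of_le hCN
  have hd180 : d ∈ Nat.divisors 180 := by
    rw [Nat.mem_divisors]
    refine ⟨?_, by norm_num⟩
    have h1 := (Subgroup.zpowers x).normalizerMonoidHom.range.card_subgroup_dvd_card
    have h2 := Subgroup.card_mul_index (Subgroup.zpowers x).normalizerMonoidHom.ker
    rw [Subgroup.index_ker, Subgroup.normalizerMonoidHom_ker, hCeq,
      Nat.card_congr (Subgroup.subgroupOfEquivOfLe hCN).toEquiv] at h2
    replace h2 := h2.trans hd
    rw [Nat.eq_of_mul_eq_mul_left Nat.card_pos h2, IsCyclic.card_mulAut, Nat.card_zpowers, hx,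
      Nat.totient_prime hp.out] at h1
    exact h1
  have hf : (Nat.card G).factorization 181 = 1 := by
    have h0 : Nat.card G ≠ 0 := Nat.card_pos.ne'
    have h1 := (hp.out.pow_dvd_iff_le_factorization h0 (k := 1)).1 (by rw [hcard]; norm_num)
    have h2 := mt (hp.out.pow_dvd_iff_le_factorization h0 (k := 2)).2 (by rw [hcard]; norm_num)
    omega
  let P : Sylow 181 G := Sylow.ofCard (Subgroup.zpowers x) (by rw [Nat.card_zpowers, hx, hf, pow_one])
  have hsyl := card_sylow_modEq_one 181 G
  have hidx : N.index * (m * d) = 2 ^ 6 * 3 * 5 ^ 4 * 7 ^ 6 * 13 := by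
    have h1 := N.index_mul_card
    rw [hd, hm, hcard] at h1
    nlinarith
  have hn : N.index ≡ 1 [MOD 181] := by
    rw [P.card_eq_index_normalizer] at hsyl
    exact hsyl
  have hmod : m * d % 181 = 39 := by
    have h1 := hn.mul_right (m * d)
    rw [hidx, one_mul] at h1
    exact h1.symm.trans (show 2 ^ 6 * 3 * 5 ^ 4 * 7 ^ 6 * 13 ≡ 39 [MOD 181] by decide)
  rw [hmr] at hmod hidx
  obtain ⟨h1, h2, h3⟩ := torus_arith r hrG b hb7 d hd180 hb0 hmod (Dvd.intro_left _ hidx)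
  rw [h1, h2] at hmr
  rw [hd, hm, hmr, h3]
  norm_num

theorem card_centralizer_dvd_of_gkDegree
    (hcard : Nat.card G = 2 ^ 6 * 3 * 5 ^ 4 * 7 ^ 6 * 13 * 181)
    (h13 : gkDegree G 13 = 1) (h181 : gkDegree G 181 = 1) {y : G} (hy : orderOf y = 13) :
    Nat.card (Subgroup.centralizer {y}) ∣ 13 * 181 := by
  have hp : Fact (Nat.Prime 181) := ⟨by norm_num⟩
  obtain ⟨r, hr, hne, -, huniq⟩ := exists_adj_of_gkDegree_eq_one (by norm_num) h13
  have hr181 : 181 = r := by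
    obtain ⟨x, hx⟩ := exists_prime_orderOf_dvd_card' (G := G) 181 (by rw [hcard]; norm_num)
    obtain ⟨g, hg⟩ := exists_orderOf_mul (q := 13) (by norm_num) (by norm_num) hx
      (by rw [(card_centralizer_of_gkDegree hcard h181 hx).1]; norm_num)
    exact huniq 181 hp.out (by norm_num) ⟨g, by rw [hg, mul_comm]⟩
  have hd := (Subgroup.centralizer {y}).card_subgroup_dvd_card
  rw [hcard, show 2 ^ 6 * 3 * 5 ^ 4 * 7 ^ 6 * 13 * 181 = 13 * 181 * (2 ^ 6 * 3 * 5 ^ 4 * 7 ^ 6) by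
    norm_num] at hd
  have hcop : ∀ q, q.Prime → q ≠ 13 → q ≠ 181 →
      (Nat.card (Subgroup.centralizer {y})).Coprime q := by
    intro q hq h1 h2
    refine ((Nat.Prime.coprime_iff_not_dvd hq).2 fun hqd => h2 ?_).symm
    rw [hr181]
    exact huniq q hq h1.symm
      (exists_orderOf_mul hq ((Nat.coprime_primes (by norm_num) hq).2 h1.symm) hy hqd)
  refine Nat.Coprime.dvd_of_dvd_mul_right ?_ hd
  exact ((((hcop 2 (by norm_num) (by norm_num) (by norm_num)).pow_right 6).mul_right
    (hcop 3 (by norm_num) (by norm_num) (by norm_num))).mul_right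
    ((hcop 5 (by norm_num) (by norm_num) (by norm_num)).pow_right 4)).mul_right
    ((hcop 7 (by norm_num) (by norm_num) (by norm_num)).pow_right 6)

/-- The homomorphism from `ZMod n` sending `1` to an element of order dividing `n`. -/
def zmodPow (n : ℕ) (b : G) (hb : b ^ n = 1) : Multiplicative (ZMod n) →* G :=
  AddMonoidHom.toMultiplicativeLeft (ZMod.lift n ⟨zmultiplesHom (Additive G) (Additive.ofMul b), by
    simpa using congrArg Additive.ofMul hb⟩)

theorem zmodPow_intCast (n : ℕ) (b : G) (hb : b ^ n = 1) (k : ℤ) :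
    zmodPow n b hb (.ofAdd (k : ZMod n)) = b ^ k := by
  simp [zmodPow]

theorem exists_isTorus (hcard : Nat.card G = 2 ^ 6 * 3 * 5 ^ 4 * 7 ^ 6 * 13 * 181)
    (h13 : gkDegree G 13 = 1) (h181 : gkDegree G 181 = 1) :
    ∃ (a : Multiplicative (ZMod 2353) →* G) (κ : ZMod 2353), IsTorus 2353 a κ := by
  have hp : Fact (Nat.Prime 181) := ⟨by norm_num⟩
  have hp' : Fact (Nat.Prime 13) := ⟨by norm_num⟩
  obtain ⟨x, hx⟩ := exists_prime_orderOf_dvd_card' (G := G) 181 (by rw [hcard]; norm_num)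
  obtain ⟨hC, hN⟩ := card_centralizer_of_gkDegree hcard h181 hx
  obtain ⟨⟨y, hyx⟩, hy⟩ := exists_prime_orderOf_dvd_card' (G := Subgroup.centralizer {x}) 13
    (by rw [hC]; norm_num)
  rw [Subgroup.orderOf_mk] at hy
  have hxy : Commute x y := (Subgroup.mem_centralizer_singleton_iff.1 hyx).symm
  set b := x * y with hb
  have hbo : orderOf b = 2353 := by
    rw [hb, hxy.orderOf_mul_eq_mul_orderOf_of_coprime (by rw [hx, hy]; norm_num), hx, hy]
  have hb1 : b ^ 2353 = 1 := hbo ▸ pow_orderOf_eq_one b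
  set A := Subgroup.zpowers b with hA
  have hAcard : Nat.card A = 2353 := by rw [hA, Nat.card_zpowers, hbo]
  have hcent : ∀ g ∈ A, g ≠ 1 → Subgroup.centralizer {g} = A := by
    intro g hg hg1
    have hle : A ≤ Subgroup.centralizer {g} := by
      intro s hs
      rw [Subgroup.mem_centralizer_singleton_iff]
      obtain ⟨i, rfl⟩ := hs
      obtain ⟨j, rfl⟩ := hg
      exact ((Commute.refl b).zpow_left _).zpow_right _
    refine (Subgroup.eq_of_le_of_card_ge hle ?_).symm
    have hpow : ∀ k, Subgroup.centralizer {g} ≤ Subgroup.centralizer {g ^ k} := by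
      intro k s hs
      rw [Subgroup.mem_centralizer_singleton_iff] at hs ⊢
      exact Commute.pow_right hs k
    have hgo : orderOf g ∣ 13 * 181 := by
      have := Subgroup.orderOf_dvd_natCard _ hg
      rwa [hAcard] at this
    obtain ⟨q, hq, hqg⟩ := Nat.exists_prime_and_dvd (mt orderOf_eq_one_iff.1 hg1)
    obtain ⟨k, hk⟩ := hqg
    have hk0 : k ≠ 0 := by rintro rfl; exact (orderOf_pos g).ne' (by simpa using hk)
    have hgk : orderOf (g ^ k) = q := by
      rw [orderOf_pow, hk, Nat.gcd_mul_left_left, Nat.mul_div_cancel _ (by omega)]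
    refine (Nat.le_of_dvd Nat.card_pos (Subgroup.card_dvd_of_le (hpow k))).trans ?_
    rw [hAcard]
    rcases hq.dvd_mul.1 ((Dvd.intro k hk.symm).trans hgo) with h | h
    · rw [(Nat.prime_dvd_prime_iff_eq hq hp'.out).1 h] at hgk
      exact Nat.le_of_dvd (by norm_num) (card_centralizer_dvd_of_gkDegree hcard h13 h181 hgk)
    · rw [(Nat.prime_dvd_prime_iff_eq hq hp.out).1 h] at hgk
      exact (card_centralizer_of_gkDegree hcard h181 hgk).1.le
  have hbA : b ∈ A := Subgroup.mem_zpowers b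
  have hx1 : x ≠ 1 := by rintro rfl; simp at hx
  have hxb : ∀ g ∈ A, g ^ 181 = 1 → g ∈ Subgroup.zpowers x := by
    rintro _ ⟨j, rfl⟩ hj
    simp only at hj ⊢
    rw [← zpow_natCast, ← zpow_mul, ← orderOf_dvd_iff_zpow_eq_one, hbo] at hj
    have : (13 : ℤ) ∣ j := by
      have h2 : ((181 : ℕ) : ℤ) * 13 ∣ 181 * j := by
        rw [mul_comm _ j]; exact_mod_cast hj
      exact (mul_dvd_mul_iff_left (by norm_num)).1 h2
    obtain ⟨l, rfl⟩ := this
    have hb13 : b ^ (13 : ℤ) = x ^ (13 : ℤ) := by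
      have h3 : y ^ (13 : ℤ) = 1 := by exact_mod_cast hy ▸ pow_orderOf_eq_one y
      rw [hb, hxy.mul_zpow, h3, mul_one]
    rw [zpow_mul, hb13, ← zpow_mul]
    exact Subgroup.zpow_mem_zpowers x _
  have hxA : x ∈ A := by
    rw [← hcent b hbA (by rintro e; rw [e] at hbo; simp at hbo),
      Subgroup.mem_centralizer_singleton_iff, hb]
    exact ((Commute.refl x).mul_right hxy).eq
  have hCx := hcent x hxA hx1
  set N := Subgroup.normalizer (Subgroup.zpowers x : Set G) with hNdef
  have hCeq : Subgroup.centralizer (Subgroup.zpowers x : Set G) = A := by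
    rw [← hCx, Subgroup.zpowers_eq_closure, Subgroup.centralizer_closure]
  have hAN : A ≤ N := hCeq ▸ Subgroup.centralizer_le_normalizer _
  have hnorm : (A.subgroupOf N).Normal := by
    have := (Subgroup.zpowers x).normalizerMonoidHom_ker
    rw [hCeq] at this
    rw [← this]
    infer_instance
  have hindex : (A.subgroupOf N).index = 3 := by
    have := Subgroup.card_mul_index (A.subgroupOf N)
    rw [Nat.card_congr (Subgroup.subgroupOfEquivOfLe hAN).toEquiv, hAcard, hN] at this
    omega
  obtain ⟨n, hnN, hnA⟩ : ∃ n ∈ N, n ∉ A := by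
    by_contra! hcon
    have := Nat.le_of_dvd Nat.card_pos (Subgroup.card_dvd_of_le hcon)
    rw [hAcard, hN] at this
    omega
  have hconjA : ∀ s ∈ A, n * s * n⁻¹ ∈ A := fun s hs => hnorm.conj_mem ⟨s, hAN hs⟩ hs ⟨n, hnN⟩
  obtain ⟨k, hk⟩ := hconjA b hbA
  simp only at hk
  set κ : ZMod 2353 := (k : ZMod 2353) with hκ
  set a := zmodPow 2353 b hb1 with ha
  have hak : ∀ i : ℤ, a (.ofAdd (i : ZMod 2353)) = b ^ i := zmodPow_intCast _ _ _
  have haA : ∀ i, a (.ofAdd i) ∈ A := by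
    intro i
    obtain ⟨i, rfl⟩ := ZMod.intCast_surjective i
    rw [hak]
    exact Subgroup.zpow_mem_zpowers b i
  have ha1 : ∀ i, a (.ofAdd i) = 1 → i = 0 := by
    intro i
    obtain ⟨i, rfl⟩ := ZMod.intCast_surjective i
    rw [hak, ← orderOf_dvd_iff_zpow_eq_one, hbo, ZMod.intCast_zmod_eq_zero_iff_dvd]
    exact id
  have hinj : ∀ i j, a (.ofAdd i) = a (.ofAdd j) → i = j := fun i j e => by
    have := ha1 (i - j) (by rw [ofAdd_sub, map_div, e, div_self'])
    exact sub_eq_zero.1 this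
  have hna : ∀ i, n * a (.ofAdd i) * n⁻¹ = a (.ofAdd (κ * i)) := by
    intro i
    obtain ⟨i, rfl⟩ := ZMod.intCast_surjective i
    rw [hκ, ← Int.cast_mul, hak, hak, zpow_mul, hk, conj_zpow]
  have hnja : ∀ (j : ℕ) i, n ^ j * a (.ofAdd i) * (n ^ j)⁻¹ = a (.ofAdd (κ ^ j * i)) := by
    intro j
    induction j with
    | zero => simp
    | succ j ih =>
      intro i
      rw [pow_succ' κ, mul_assoc κ, ← hna, ← ih, pow_succ']
      group
  have hAcomm : ∀ s ∈ A, ∀ i, s * a (.ofAdd i) * s⁻¹ = a (.ofAdd i) := by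
    intro s hs i
    obtain ⟨i, rfl⟩ := ZMod.intCast_surjective i
    obtain ⟨l, rfl⟩ := hs
    rw [hak, mul_inv_eq_iff_eq_mul]
    exact ((Commute.refl b).zpow_left _).zpow_right _
  have hcube : κ ^ 3 = 1 := by
    have h1 := Subgroup.pow_index_mem (A.subgroupOf N) ⟨n, hnN⟩
    rw [hindex] at h1
    have h2 := hAcomm (n ^ 3) h1 1
    rw [hnja, mul_one] at h2
    exact hinj _ _ h2
  refine ⟨a, κ, fun i hi => ?_, hcube, ?_, fun i hi m => ⟨fun hc => ?_, fun hm => ?_⟩⟩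
  · rw [hcent _ (haA i) (mt (ha1 i) hi), hAcard]
  · rw [isUnit_iff_mem_nonZeroDivisors_of_finite, mem_nonZeroDivisors_iff_right]
    intro i hi
    by_contra hi0
    apply hnA
    rw [← hcent _ (haA i) (mt (ha1 i) hi0), Subgroup.mem_centralizer_singleton_iff,
      ← mul_inv_eq_iff_eq_mul, hna]
    congr 2
    rw [mul_comm]
    linear_combination hi
  · obtain ⟨c, hc⟩ := isConj_iff.1 hc
    have hm : m ≠ 0 := by
      rintro rfl
      rw [ofAdd_zero, map_one, conj_eq_one_iff] at hc
      exact hi (ha1 i hc)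
    have hcA : ∀ s, s ∈ A ↔ c * s * c⁻¹ ∈ A := by
      intro s
      have hA : ∀ l ≠ 0, ∀ s, s ∈ A ↔ s * a (.ofAdd l) = a (.ofAdd l) * s := fun l hl s => by
        rw [← hcent _ (haA l) (mt (ha1 l) hl), Subgroup.mem_centralizer_singleton_iff]
      rw [hA i hi, hA m hm, ← hc]
      constructor
      · intro e
        calc c * s * c⁻¹ * (c * a (.ofAdd i) * c⁻¹) = c * (s * a (.ofAdd i)) * c⁻¹ := by group
          _ = _ := by rw [e]; group
      · intro e
        have : c * (s * a (.ofAdd i)) * c⁻¹ = c * (a (.ofAdd i) * s) * c⁻¹ := by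
          calc _ = c * s * c⁻¹ * (c * a (.ofAdd i) * c⁻¹) := by group
            _ = _ := by rw [e]; group
        simpa using this
    have hxp : ∀ s, s ∈ Subgroup.zpowers x ↔ s ∈ A ∧ s ^ 181 = 1 := by
      intro s
      refine ⟨?_, fun h => hxb s h.1 h.2⟩
      rintro ⟨j, rfl⟩
      refine ⟨zpow_mem hxA j, ?_⟩
      simp only
      rw [← zpow_natCast, ← zpow_mul, mul_comm, zpow_mul, zpow_natCast, ← hx, pow_orderOf_eq_one,
        one_zpow]
    have hcN : c ∈ N := by
      rw [hNdef, Subgroup.mem_normalizer_iff]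
      intro s
      rw [hxp, hxp, conj_pow, conj_eq_one_iff, hcA]
    have : Fact (Nat.Prime 3) := ⟨Nat.prime_three⟩
    obtain ⟨j, hj⟩ := mem_powers_of_prime_card (p := 3) (G := N ⧸ A.subgroupOf N) hindex
      (g := QuotientGroup.mk ⟨n, hnN⟩) (g' := QuotientGroup.mk ⟨c, hcN⟩)
      (by rw [Ne, QuotientGroup.eq_one_iff]; exact hnA)
    simp only at hj
    rw [← QuotientGroup.mk_pow, QuotientGroup.eq] at hj
    have hs : (n ^ j)⁻¹ * c ∈ A := hj
    have h1 : a (.ofAdd m) = a (.ofAdd (κ ^ j * i)) := by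
      rw [← hc, ← hnja]
      nth_rewrite 2 [← hAcomm _ hs i]
      group
    have h2 : κ ^ j = κ ^ (j % 3) := by
      conv_lhs => rw [← Nat.div_add_mod j 3, pow_add, pow_mul, hcube, one_pow, one_mul]
    rw [hinj _ _ h1, h2]
    have h3 := Nat.mod_lt j (show 3 > 0 by norm_num)
    interval_cases j % 3 <;> simp
  · rcases hm with rfl | rfl | rfl
    · exact IsConj.refl _
    · exact isConj_iff.2 ⟨n, hna i⟩
    · exact isConj_iff.2 ⟨n ^ 2, hnja 2 i⟩

end Torus

section Linear

/-- If an element `x` of prime power order normalises a subgroup `Q`, then `|Q|` is congruent to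
the number of elements of `Q` commuting with `x`. -/
theorem card_modEq_card_commute {G : Type*} [Group G] [Finite G] {p : ℕ} [hp : Fact p.Prime]
    {x : G} (hx : orderOf x = p) (Q : Subgroup G) (hxQ : x ∈ Subgroup.normalizer (Q : Set G)) :
    Nat.card Q ≡ Nat.card {g : Q // x * g = g * x} [MOD p] := by
  let x' : Subgroup.normalizer (Q : Set G) := ⟨x, hxQ⟩
  let : MulAction (Subgroup.zpowers x') Q :=
    MulAction.compHom Q (Q.normalizerMonoidHom.comp (Subgroup.zpowers x').subtype)
  have hpg : IsPGroup p (Subgroup.zpowers x') :=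
    IsPGroup.of_card (n := 1) (by rw [Nat.card_zpowers, Subgroup.orderOf_mk, hx, pow_one])
  have hsmul : ∀ (s : Subgroup.zpowers x') (g : Q), ((s • g : Q) : G) = s * g * (s : G)⁻¹ :=
    fun s g => rfl
  refine (hpg.card_modEq_card_fixedPoints Q).trans (congrArg (· % p) ?_)
  refine Nat.card_congr (Equiv.subtypeEquivRight fun g => ?_)
  rw [MulAction.mem_fixedPoints]
  constructor
  · intro h
    have := congrArg Subtype.val (h ⟨x', Subgroup.mem_zpowers x'⟩)
    rw [hsmul] at this
    exact mul_inv_eq_iff_eq_mul.1 this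
  · rintro h ⟨s, j, rfl⟩
    refine Subtype.ext ?_
    rw [hsmul, mul_inv_eq_iff_eq_mul]
    have := (show Commute x (g : G) from h).zpow_left j
    simpa using this.eq

variable {G : Type*} [Group G] [Finite G] {a : Multiplicative (ZMod 2353) →* G} {κ : ZMod 2353}

theorem IsTorus.linear_eq_one (h : IsTorus 2353 a κ)
    (hcard : Nat.card G = 2 ^ 6 * 3 * 5 ^ 4 * 7 ^ 6 * 13 * 181) {M : Type*} [CommMonoid M]
    (φ₀ : G →* M) : φ₀ = 1 := by
  have hp : Fact (Nat.Prime 181) := ⟨by norm_num⟩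
  have hp7 : Fact (Nat.Prime 7) := ⟨by norm_num⟩
  have := Fintype.ofFinite G
  have hG : Nat.card G ≠ 2353 := by rw [hcard]; norm_num
  have hinj := h.injective hG
  have hone : (1 : ZMod 2353) ≠ 0 := by decide
  suffices hφ : φ₀.toHomUnits = 1 by
    ext g
    rw [← MonoidHom.coe_toHomUnits, hφ]
    rfl
  set φ := φ₀.toHomUnits
  obtain ⟨n, hn⟩ := isConj_iff.1 ((h.conj 1 hone κ).2 (Or.inr (Or.inl (mul_one κ).symm)))
  have hna : ∀ i, n * a (.ofAdd i) * n⁻¹ = a (.ofAdd (κ * i)) := by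
    intro i
    obtain ⟨i, rfl⟩ := ZMod.natCast_zmod_surjective i
    have e1 : ∀ j : ZMod 2353, a (.ofAdd (j * (i : ZMod 2353))) = a (.ofAdd j) ^ i := fun j => by
      rw [← map_pow, ← ofAdd_nsmul, nsmul_eq_mul, mul_comm]
    rw [e1 κ, ← hn, conj_pow, ← e1, one_mul]
  have hnja : ∀ (j : ℕ) i, n ^ j * a (.ofAdd i) * (n ^ j)⁻¹ = a (.ofAdd (κ ^ j * i)) := by
    intro j
    induction j with
    | zero => simp
    | succ j ih =>
      intro i
      rw [pow_succ' κ, mul_assoc κ, ← hna, ← ih, pow_succ']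
      group
  have haφ : ∀ g ∈ a.range, φ g = 1 := by
    rintro _ ⟨i, rfl⟩
    obtain ⟨j, hj⟩ := h.unit.exists_right_inv
    have e : i = .ofAdd (κ * (j * Multiplicative.toAdd i)) * (.ofAdd (j * Multiplicative.toAdd i))⁻¹ := by
      rw [← div_eq_mul_inv, ← ofAdd_sub]
      refine Multiplicative.toAdd.injective ?_
      rw [toAdd_ofAdd]
      linear_combination (-Multiplicative.toAdd i) * hj
    rw [e, map_mul, ← hna, map_inv, map_mul, map_mul, map_mul, map_inv, map_inv]
    simp
  set x := a (.ofAdd 13) with hxdef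
  have h13 : (13 : ZMod 2353) ≠ 0 := by decide
  have hx : orderOf x = 181 := by
    rw [hxdef, orderOf_injective _ hinj, orderOf_ofAdd_eq_addOrderOf,
      show (13 : ZMod 2353) = ((13 : ℕ) : ZMod 2353) by norm_num, ZMod.addOrderOf_coe' _ (by norm_num)]
    norm_num
  have hxφ : x ∈ φ.ker := haφ x ⟨_, rfl⟩
  have hfus : ∀ g, g * x * g⁻¹ ∈ Subgroup.zpowers x → ∃ j < 3, φ g = φ n ^ j ∧
      (j = 0 → g ∈ Subgroup.centralizer {x}) := by
    rintro g ⟨l, hl⟩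
    simp only at hl
    rw [hxdef, ← map_zpow, ← ofAdd_zsmul] at hl
    have hc := (h.conj 13 h13 _).1 (isConj_iff.2 ⟨g, hl.symm⟩)
    have : ∃ j < 3, l • (13 : ZMod 2353) = κ ^ j * 13 := by
      rcases hc with hc | hc | hc
      · exact ⟨0, by norm_num, by rw [hc, pow_zero, one_mul]⟩
      · exact ⟨1, by norm_num, by rw [hc, pow_one]⟩
      · exact ⟨2, by norm_num, hc⟩
    obtain ⟨j, hj, hlj⟩ := this
    rw [hlj, ← hnja] at hl
    have hm : (n ^ j)⁻¹ * g ∈ Subgroup.centralizer {x} := by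
      rw [Subgroup.mem_centralizer_singleton_iff, hxdef]
      calc (n ^ j)⁻¹ * g * a (.ofAdd 13) = (n ^ j)⁻¹ * (g * a (.ofAdd 13) * g⁻¹) * g := by group
        _ = _ := by rw [← hl]; group
    refine ⟨j, hj, ?_, ?_⟩
    · have := haφ _ (h.centralizer_eq_range hG h13 ▸ hm)
      rw [map_mul, map_inv, map_pow, inv_mul_eq_one] at this
      exact this.symm
    · rintro rfl
      simpa using hm
  have hn3 : φ n ^ 3 = 1 := by
    rw [← map_pow]
    refine haφ _ (h.centralizer_eq_range hG hone ▸ ?_)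
    rw [Subgroup.mem_centralizer_singleton_iff, ← mul_inv_eq_iff_eq_mul, hnja, h.cube, one_mul]
  have hspan : ∀ g, ∃ j < 3, φ g = φ n ^ j := by
    intro g
    have hgx : g * x * g⁻¹ ∈ φ.ker := by
      rw [MonoidHom.mem_ker, map_mul, map_mul, MonoidHom.mem_ker.1 hxφ, mul_one, map_inv, mul_inv_cancel]
    obtain ⟨c, hc⟩ := exists_conj_mem_zpowers (G := φ.ker) (p := 181)
      (fun hd => absurd (hd.trans φ.ker.card_subgroup_dvd_card) (by rw [hcard]; norm_num))
      (x := ⟨g * x * g⁻¹, hgx⟩) (y := ⟨x, hxφ⟩)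
      (by
        rw [Subgroup.orderOf_mk, ← hx]
        simpa using orderOf_injective (MulAut.conj g).toMonoidHom (MulAut.conj g).injective x)
      (by rw [Subgroup.orderOf_mk, hx])
    obtain ⟨l, hl⟩ := hc
    have hl' := congrArg Subtype.val hl
    obtain ⟨j, hj, hφ, -⟩ := hfus (c * g) ⟨l, by
      simp only [Subgroup.coe_zpow, Subgroup.coe_mul, Subgroup.coe_inv] at hl' ⊢
      rw [hl']; group⟩
    refine ⟨j, hj, ?_⟩
    rw [← hφ, map_mul, MonoidHom.mem_ker.1 c.2, one_mul]
  by_cases hn1 : φ n = 1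
  · ext1 g
    obtain ⟨j, -, hj⟩ := hspan g
    rw [hj, hn1, one_pow, MonoidHom.one_apply]
  exfalso
  have hord : orderOf (φ n) = 3 := orderOf_eq_prime hn3 hn1
  have hidx : φ.ker.index ∣ 3 := by
    rw [Subgroup.index_ker, ← hord, ← Nat.card_zpowers]
    refine Subgroup.card_dvd_of_le ?_
    rintro _ ⟨g, rfl⟩
    obtain ⟨j, -, hj⟩ := hspan g
    rw [hj]
    exact Subgroup.npow_mem_zpowers _ _
  have hK : 181 * 7 ^ 6 ∣ Nat.card φ.ker := by
    have h1 := φ.ker.card_mul_index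
    have h2 : 181 * 7 ^ 6 ∣ Nat.card φ.ker * φ.ker.index := by
      rw [h1, hcard]; norm_num
    refine Nat.Coprime.dvd_of_dvd_mul_right ?_ h2
    exact Nat.Coprime.coprime_dvd_right hidx (by norm_num)
  have hK2 : ∀ {m}, m ∣ Nat.card φ.ker → m ∣ Nat.card G := fun hm =>
    hm.trans φ.ker.card_subgroup_dvd_card
  have hf : (Nat.card φ.ker).factorization 181 = 1 := by
    have h0 : Nat.card φ.ker ≠ 0 := Nat.card_pos.ne'
    have h1 := (hp.out.pow_dvd_iff_le_factorization h0 (k := 1)).1 ((Dvd.intro _ rfl).trans hK)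
    have h2 := mt (hp.out.pow_dvd_iff_le_factorization h0 (k := 2)).2
      fun hd => absurd (hK2 hd) (by rw [hcard]; norm_num)
    omega
  set x' : φ.ker := ⟨x, hxφ⟩ with hx'
  have hx'o : orderOf x' = 181 := by rw [hx', Subgroup.orderOf_mk, hx]
  let P : Sylow 181 φ.ker :=
    Sylow.ofCard (Subgroup.zpowers x') (by rw [Nat.card_zpowers, hx'o, hf, pow_one])
  have hPc : Subgroup.normalizer ((P : Subgroup φ.ker) : Set φ.ker) ≤
      Subgroup.centralizer (P : Set φ.ker) := by
    intro s hs
    have h1 := (Subgroup.mem_normalizer_iff.1 hs x').1 (Subgroup.mem_zpowers x')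
    obtain ⟨l, hl⟩ := h1
    obtain ⟨j, hj, hφ, hj0⟩ := hfus s ⟨l, by
      have hl' := congrArg Subtype.val hl
      simpa using hl'⟩
    rw [MonoidHom.mem_ker.1 s.2] at hφ
    have h3 : orderOf (φ n) ∣ j := orderOf_dvd_of_pow_eq_one hφ.symm
    rw [hord] at h3
    have hs := hj0 (Nat.eq_zero_of_dvd_of_lt h3 hj)
    rw [Subgroup.mem_centralizer_singleton_iff] at hs
    rw [Subgroup.mem_centralizer_iff]
    rintro _ ⟨l, rfl⟩
    have : Commute s x' := Subtype.ext hs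
    exact (this.zpow_right l).eq.symm
  have hcomp := MonoidHom.ker_transferSylow_isComplement' P hPc
  set N := (MonoidHom.transferSylow P hPc).ker
  have hN : Nat.card N * 181 = Nat.card φ.ker := by
    have := hcomp.card_mul_card
    rwa [show Nat.card (P : Subgroup φ.ker) = 181 by
      exact (Nat.card_zpowers x').trans hx'o] at this
  have hNidx : N.index = 181 := by
    have := N.card_mul_index
    rw [← hN] at this
    exact Nat.eq_of_mul_eq_mul_left Nat.card_pos this
  obtain ⟨Q⟩ : Nonempty (Sylow 7 N) := inferInstance
  have hQ : Nat.card Q = 7 ^ 6 := by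
    rw [Q.card_eq_multiplicity]
    refine congrArg (7 ^ ·) ?_
    have h0 : Nat.card N ≠ 0 := Nat.card_pos.ne'
    have h1 := (hp7.out.pow_dvd_iff_le_factorization h0 (k := 6)).1 (by
      rw [← hN, mul_comm] at hK
      exact Nat.dvd_of_mul_dvd_mul_right (by norm_num) hK)
    have h2 := mt (hp7.out.pow_dvd_iff_le_factorization h0 (k := 7)).2
      fun hd => absurd (hK2 (hd.trans N.card_subgroup_dvd_card)) (by rw [hcard]; norm_num)
    omega
  set Q' := Subgroup.map N.subtype (Q : Subgroup N)
  have hQ' : Nat.card Q' = 7 ^ 6 := by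
    rw [← hQ]
    exact Nat.card_congr ((Q : Subgroup N).equivMapOfInjective _ N.subtype_injective).symm.toEquiv
  have h181 : 181 ∣ Nat.card (Subgroup.normalizer (Q' : Set φ.ker)) := by
    rw [← hNidx, ← Subgroup.relIndex_top_right, ← Sylow.normalizer_sup_eq_top Q,
      Subgroup.relIndex_sup_right]
    exact Subgroup.relIndex_dvd_card _ _
  obtain ⟨⟨y, hyQ⟩, hy⟩ := exists_prime_orderOf_dvd_card' 181 h181
  rw [Subgroup.orderOf_mk] at hy
  have hfix := card_modEq_card_commute hy Q' hyQ
  rw [hQ'] at hfix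
  have hnt : Nontrivial {g : Q' // y * g = g * y} := by
    rw [← Finite.one_lt_card_iff_nontrivial]
    by_contra! hle
    generalize Nat.card {g : Q' // y * g = g * y} = m at *
    interval_cases m <;> revert hfix <;> decide
  obtain ⟨⟨w, hw⟩, hw1⟩ := exists_ne (⟨1, by simp⟩ : {g : Q' // y * g = g * y})
  have hwne : ((w : φ.ker) : G) ≠ 1 := fun e => hw1 (Subtype.ext (Subtype.ext (Subtype.ext e)))
  have hw7 : ((w : φ.ker) : G) ^ 7 ^ 6 = 1 := by
    rw [← hQ', ← Subgroup.coe_pow, ← Subgroup.coe_pow, pow_card_eq_one']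
    rfl
  obtain ⟨m, hm⟩ := h.exists_isConj_of_dvd hG (p := 181) (by norm_num) (by rw [hcard]; norm_num)
    (g := ((w : φ.ker) : G)) (by
      have : ((y : φ.ker) : G) ∈ Subgroup.centralizer {((w : φ.ker) : G)} := by
        rw [Subgroup.mem_centralizer_singleton_iff]
        exact congrArg Subtype.val hw
      rw [← hy, ← Subgroup.orderOf_coe, ← Subgroup.orderOf_mk _ this]
      exact orderOf_dvd_natCard _)
  obtain ⟨c, hc⟩ := isConj_iff.1 hm
  have h1 : ((w : φ.ker) : G) ^ 2353 = 1 := by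
    have : (a (.ofAdd m)) ^ 2353 = 1 := by
      rw [← map_pow, ← ofAdd_nsmul, nsmul_eq_mul]
      simp [show ((2353 : ZMod 2353)) = 0 from rfl]
    rwa [← hc, conj_pow, conj_eq_one_iff] at this
  have h2 := Nat.dvd_gcd (orderOf_dvd_of_pow_eq_one hw7) (orderOf_dvd_of_pow_eq_one h1)
  rw [show Nat.gcd (7 ^ 6) 2353 = 1 by norm_num] at h2
  exact hwne (orderOf_eq_one_iff.1 (Nat.dvd_one.1 h2))

end Linear

section PrimeGraph

variable {G : Type*} [Group G] [Finite G]

theorem not_dvd_card_centralizer_of_orderOf_eq_seven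
    (hcard : Nat.card G = 2 ^ 6 * 3 * 5 ^ 4 * 7 ^ 6 * 13 * 181)
    (h2 : gkDegree G 2 = 3) (h3 : gkDegree G 3 = 2) (h5 : gkDegree G 5 = 3)
    (h13 : gkDegree G 13 = 1) (h181 : gkDegree G 181 = 1) {g : G} (hg : orderOf g = 7) :
    ∀ q ∈ ({3, 13, 181} : Finset ℕ), ¬ q ∣ Nat.card (Subgroup.centralizer {g}) := by
  let S (p : ℕ) : Set ℕ := {q | p ≠ q ∧ p.Prime ∧ q.Prime ∧ ∃ g : G, orderOf g = p * q}
  have hS : ∀ p, gkDegree G p = (S p).ncard := fun p => rfl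
  have hsymm : ∀ {p q}, p ∈ S q → q ∈ S p := fun {p q} ⟨h1, h2, h3, g, hg⟩ =>
    ⟨h1.symm, h3, h2, g, by rw [hg, mul_comm]⟩
  have hcases : ∀ {p q}, q ∈ S p → q = 2 ∨ q = 3 ∨ q = 5 ∨ q = 7 ∨ q = 13 ∨ q = 181 := by
    rintro p q ⟨-, -, hq, g, hg⟩
    exact prime_dvd_cases hq (hcard ▸ ((Dvd.intro_left p hg.symm).trans (orderOf_dvd_natCard g)))
  have hp : Fact (Nat.Prime 181) := ⟨by norm_num⟩
  have h : 13 ∈ S 181 := by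
    obtain ⟨x, hx⟩ := exists_prime_orderOf_dvd_card' (G := G) 181 (by rw [hcard]; norm_num)
    exact ⟨by norm_num, by norm_num, by norm_num,
      exists_orderOf_mul (q := 13) (by norm_num) (by norm_num) hx
      (by rw [(card_centralizer_of_gkDegree hcard h181 hx).1]; norm_num)⟩
  have hS181 : ∀ {q}, q ∈ S 181 → q = 13 := fun {q} hq => by
    rw [hS, Set.ncard_eq_one] at h181
    obtain ⟨r, hr⟩ := h181
    rw [hr] at h hq
    rw [Set.mem_singleton_iff.1 h, Set.mem_singleton_iff.1 hq]
  have hS13 : ∀ {q}, q ∈ S 13 → q = 181 := fun {q} hq => by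
    have h := hsymm h
    rw [hS, Set.ncard_eq_one] at h13
    obtain ⟨r, hr⟩ := h13
    rw [hr] at h hq
    rw [Set.mem_singleton_iff.1 h, Set.mem_singleton_iff.1 hq]
  have hne : ∀ {p q}, p ≠ 13 → p ≠ 181 → q ∈ S p → q ≠ 13 ∧ q ≠ 181 := by
    intro p q hp1 hp2 hq
    constructor
    · rintro rfl
      exact hp2 (hS13 (hsymm hq))
    · rintro rfl
      exact hp1 (hS181 (hsymm hq))
  have hS2 : S 2 = {3, 5, 7} := by
    refine Set.eq_of_subset_of_ncard_le ?_ ?_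
    · intro q hq
      have := hcases hq
      have := hne (by norm_num) (by norm_num) hq
      have := hq.1
      simp only [Set.mem_insert_iff, Set.mem_singleton_iff]
      omega
    · rw [← hS, h2, Set.ncard_eq_toFinset_card']
      simp
  have hS5 : S 5 = {2, 3, 7} := by
    refine Set.eq_of_subset_of_ncard_le ?_ ?_
    · intro q hq
      have := hcases hq
      have := hne (by norm_num) (by norm_num) hq
      have := hq.1
      simp only [Set.mem_insert_iff, Set.mem_singleton_iff]
      omega
    · rw [← hS, h5, Set.ncard_eq_toFinset_card']
      simp
  have hS3 : {2, 5} = S 3 := by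
    refine Set.eq_of_subset_of_ncard_le ?_ ?_ ?_
    · rintro q (rfl | rfl)
      · exact hsymm (hS2 ▸ by simp)
      · exact hsymm (hS5 ▸ by simp)
    · rw [← hS, h3, Set.ncard_eq_toFinset_card']
      simp
    · exact Set.finite_of_ncard_ne_zero (by rw [← hS, h3]; norm_num)
  intro q hq hqd
  have hq' : q.Prime ∧ (q = 3 ∨ q = 13 ∨ q = 181) := by
    simp only [Finset.mem_insert, Finset.mem_singleton] at hq
    refine ⟨?_, hq⟩
    rcases hq with rfl | rfl | rfl <;> norm_num
  have hqS : q ∈ S 7 := ⟨by rintro rfl; omega, by norm_num, hq'.1,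
    exists_orderOf_mul hq'.1 ((Nat.coprime_primes (by norm_num) hq'.1).2
      (by rintro rfl; omega)) hg hqd⟩
  rcases hq'.2 with rfl | rfl | rfl
  · have := hsymm hqS
    rw [← hS3] at this
    norm_num at this
  · exact absurd (hsymm hqS) fun h => absurd (hS13 h) (by norm_num)
  · exact absurd (hsymm hqS) fun h => absurd (hS181 h) (by norm_num)

theorem exists_isSevenLocal_of_gkDegree
    (hcard : Nat.card G = 2 ^ 6 * 3 * 5 ^ 4 * 7 ^ 6 * 13 * 181)
    (h2 : gkDegree G 2 = 3) (h3 : gkDegree G 3 = 2) (h5 : gkDegree G 5 = 3)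
    (h13 : gkDegree G 13 = 1) (h181 : gkDegree G 181 = 1) : ∃ z u : G, IsSevenLocal z u := by
  have := Fintype.ofFinite G
  obtain ⟨a, κ, hT⟩ := exists_isTorus hcard h13 h181
  obtain ⟨X, Y, h⟩ := hT.exists_isUnitaryPair hcard (hT.linear_eq_one hcard)
  exact h.exists_isSevenLocal hT hcard fun g hg =>
    not_dvd_card_centralizer_of_orderOf_eq_seven hcard h2 h3 h5 h13 h181 hg

end PrimeGraph

section OddIndex

/-- A subgroup of order twice an odd number has a subgroup of index two containing all its
subgroups of odd order. -/
theorem Subgroup.exists_le_of_card_eq_two_mul {G : Type*} [Group G] [Finite G] {C : Subgroup G}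
    {m : ℕ} (hm : Odd m) (hC : Nat.card C = 2 * m) :
    ∃ N ≤ C, Nat.card N = m ∧ ∀ D ≤ C, Odd (Nat.card D) → D ≤ N := by
  have hmin : (Nat.card C).minFac = 2 := by rw [Nat.minFac_eq_two_iff, hC]; exact Nat.dvd_mul_right _ _
  obtain ⟨P⟩ : Nonempty (Sylow (Nat.card C).minFac C) := inferInstance
  have hf : Fact (Nat.card C).minFac.Prime := ⟨by rw [hmin]; exact Nat.prime_two⟩
  have hP : Nat.card P = 2 := by
    rw [P.card_eq_multiplicity, hmin, hC, Nat.factorization_mul (by norm_num) (by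
      rintro rfl; simp at hm), Finsupp.add_apply, Nat.Prime.factorization_self Nat.prime_two,
      Nat.factorization_eq_zero_of_not_dvd hm.not_two_dvd_nat, add_zero, pow_one]
  have hcyc : IsCyclic P := by
    have : Fact (Nat.Prime 2) := ⟨Nat.prime_two⟩
    exact isCyclic_of_prime_card hP
  have hcomp := hcyc.isComplement' rfl
  set N := (MonoidHom.transferSylow P (hcyc.normalizer_le_centralizer rfl)).ker
  have hidx : N.index = 2 := by rw [hcomp.symm.index_eq_card]; exact hP
  have hN : Nat.card N = m := by
    have := N.card_mul_index
    rw [hidx, hC, mul_comm] at this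
    exact Nat.eq_of_mul_eq_mul_left (by norm_num) this
  refine ⟨N.map C.subtype, Subgroup.map_subtype_le N, ?_, fun D hD hodd x hx => ?_⟩
  · rw [← hN]
    exact Nat.card_congr (N.equivMapOfInjective _ C.subtype_injective).symm.toEquiv
  · refine ⟨⟨x, hD hx⟩, ?_, rfl⟩
    have h2 := N.pow_index_mem ⟨x, hD hx⟩
    rw [hidx] at h2
    obtain ⟨k, hk⟩ := hodd
    have h1 : (⟨x, hD hx⟩ : C) ^ (2 * k + 1) = 1 := by
      have h3 : x ^ Nat.card D = 1 := congrArg Subtype.val (pow_card_eq_one' (x := (⟨x, hx⟩ : D)))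
      exact Subtype.ext (by simpa [← hk] using h3)
    rw [pow_succ, pow_mul] at h1
    rw [SetLike.mem_coe, eq_inv_of_mul_eq_one_right h1]
    exact N.inv_mem (N.pow_mem h2 k)

end OddIndex

section SevenLocal

variable {G : Type*} [Group G] [Finite G] {z u : G}

theorem card_centralizer_eq_of_isConj {x y : G} (h : IsConj x y) :
    Nat.card (Subgroup.centralizer {x}) = Nat.card (Subgroup.centralizer {y}) := by
  obtain ⟨c, rfl⟩ := isConj_iff.1 h
  refine Nat.card_congr ((MulAut.conj c).toEquiv.subtypeEquiv fun g => ?_)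
  rw [Subgroup.mem_centralizer_singleton_iff, Subgroup.mem_centralizer_singleton_iff]
  change _ ↔ c * g * c⁻¹ * (c * x * c⁻¹) = c * x * c⁻¹ * (c * g * c⁻¹)
  rw [conj_mul, conj_mul, conj_injective.eq_iff]

variable [Fact (Nat.Prime 7)]

theorem card_sylow_seven (hcard : Nat.card G = 2 ^ 6 * 3 * 5 ^ 4 * 7 ^ 6 * 13 * 181)
    (P : Sylow 7 G) : Nat.card P = 7 ^ 6 := by
  have h7 : Nat.Prime 7 := Fact.out
  rw [P.card_eq_multiplicity]
  refine congrArg (7 ^ ·) ?_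
  have h0 : Nat.card G ≠ 0 := Nat.card_pos.ne'
  have h1 := (h7.pow_dvd_iff_le_factorization h0 (k := 6)).1 (by rw [hcard]; norm_num)
  have h2 := mt (h7.pow_dvd_iff_le_factorization h0 (k := 7)).2 (by rw [hcard]; norm_num)
  omega

namespace IsSevenLocal

variable (h : IsSevenLocal z u) (hcard : Nat.card G = 2 ^ 6 * 3 * 5 ^ 4 * 7 ^ 6 * 13 * 181)

include h

theorem card_centralizer_of_isConj_central {x : G} (hx : IsConj z x) :
    Nat.card (Subgroup.centralizer {x}) = 7 ^ 6 * 50 := by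
  rw [← card_centralizer_eq_of_isConj hx, h.card_central]

theorem card_centralizer_of_isConj_regular {x : G} (hx : IsConj u x) :
    Nat.card (Subgroup.centralizer {x}) = 7 ^ 4 := by
  rw [← card_centralizer_eq_of_isConj hx, h.card_regular]

include hcard

theorem sylow_eq_of_le_centralizer {x : G} (hx : IsConj z x) {P Q : Sylow 7 G}
    (hP : P ≤ Subgroup.centralizer {x}) (hQ : Q ≤ Subgroup.centralizer {x}) : P = Q := by
  obtain ⟨N, hN, hNc, hNo⟩ := Subgroup.exists_le_of_card_eq_two_mul (m := 7 ^ 6 * 25)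
    (C := Subgroup.centralizer {x}) (by decide)
    (by rw [h.card_centralizer_of_isConj_central hx]; norm_num)
  have hodd : ∀ R : Sylow 7 G, Odd (Nat.card R) := fun R => by
    rw [card_sylow_seven hcard R]; decide
  have hPN := hNo P hP (hodd P)
  have hQN := hNo Q hQ (hodd Q)
  suffices Subsingleton (Sylow 7 N) from
    Sylow.subtype_injective (hP := hPN) (hQ := hQN) (Subsingleton.elim _ _)
  rw [← Finite.card_le_one_iff_subsingleton]
  have h1 := card_sylow_modEq_one 7 N
  have h2 := (P.subtype hPN).card_dvd_index
  have h3 : ((P.subtype hPN : Sylow 7 N) : Subgroup N).index = 25 := by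
    have h4 := ((P.subtype hPN : Sylow 7 N) : Subgroup N).card_mul_index
    rw [hNc] at h4
    have h5 : Nat.card (P.subtype hPN : Sylow 7 N) = 7 ^ 6 := by
      rw [← card_sylow_seven hcard P]
      exact Nat.card_congr (Subgroup.subgroupOfEquivOfLe hPN).toEquiv
    rw [h5] at h4
    exact Nat.eq_of_mul_eq_mul_left (by norm_num) h4
  rw [h3] at h2
  have h6 : Nat.card (Sylow 7 N) ∈ Nat.divisors 25 := Nat.mem_divisors.2 ⟨h2, by norm_num⟩
  rw [show Nat.divisors 25 = {1, 5, 25} by decide] at h6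
  simp only [Finset.mem_insert, Finset.mem_singleton] at h6
  rcases h6 with e | e | e <;> rw [e] at h1 ⊢ <;> revert h1 <;> decide

end IsSevenLocal

end SevenLocal

section SevenLocal

open scoped Pointwise

variable {G : Type*} [Group G] [Finite G] {z u : G} [Fact (Nat.Prime 7)]

theorem Sylow.mem_smul_iff {p : ℕ} {P : Sylow p G} {g x : G} : x ∈ g • P ↔ g⁻¹ * x * g ∈ P := by
  change x ∈ MulAut.conj g • (P : Subgroup G) ↔ _
  rw [Subgroup.mem_pointwise_smul_iff_inv_smul_mem, ← map_inv, MulAut.smul_def, MulAut.conj_apply,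
    inv_inv]
  rfl

theorem Sylow.conj_mem_smul_iff {p : ℕ} {P : Sylow p G} {g x : G} :
    g * x * g⁻¹ ∈ g • P ↔ x ∈ P := by
  rw [Sylow.mem_smul_iff]
  group

namespace IsSevenLocal

variable (h : IsSevenLocal z u) (hcard : Nat.card G = 2 ^ 6 * 3 * 5 ^ 4 * 7 ^ 6 * 13 * 181)

include h hcard

theorem cover_sylow {P : Sylow 7 G} {x : G} (hx : x ∈ P) (hx1 : x ≠ 1) :
    IsConj z x ∨ IsConj u x := by
  refine h.cover x hx1 6 ?_
  have := congrArg Subtype.val (pow_card_eq_one' (x := (⟨x, hx⟩ : P)))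
  rw [← card_sylow_seven hcard P]
  exact this

theorem count_sylow (P : Sylow 7 G) : Nat.card {x : P // IsConj z (x : G)} = 48 :=
  h.count P (card_sylow_seven hcard P)

theorem exists_sylow_le_centralizer {x : G} (hx : IsConj z x) :
    ∃ P : Sylow 7 G, P ≤ Subgroup.centralizer {x} := by
  obtain ⟨D, hD⟩ := Sylow.exists_subgroup_card_pow_prime (G := Subgroup.centralizer {x}) 7 (n := 6)
    (by rw [h.card_centralizer_of_isConj_central hx]; exact Nat.dvd_mul_right _ _)
  set E := D.map (Subgroup.centralizer {x}).subtype
  have hE : Nat.card E = 7 ^ 6 := by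
    rw [← hD]
    exact Nat.card_congr (D.equivMapOfInjective _ (Subgroup.subtype_injective _)).symm.toEquiv
  obtain ⟨Q, hQ⟩ := (IsPGroup.of_card hE).exists_le_sylow
  refine ⟨Q, ?_⟩
  rw [← Subgroup.eq_of_le_of_card_ge hQ (by rw [hE, card_sylow_seven hcard Q])]
  exact Subgroup.map_subtype_le D

theorem isConj_central_of_commute {P : Sylow 7 G} {x f : G} (hx : x ∈ P) (hx1 : x ≠ 1)
    (hf1 : f ≠ 1) (hf : ¬ 7 ∣ orderOf f) (hc : f * x = x * f) : IsConj z x := by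
  refine (h.cover_sylow hcard hx hx1).resolve_right fun hu => ?_
  have h1 := Subgroup.orderOf_dvd_natCard (x := f) (Subgroup.centralizer {x})
    (Subgroup.mem_centralizer_singleton_iff.2 hc)
  rw [h.card_centralizer_of_isConj_regular hu] at h1
  obtain ⟨k, -, hk⟩ := (Nat.dvd_prime_pow (by norm_num)).1 h1
  rcases k with - | k
  · exact hf1 (orderOf_eq_one_iff.1 (by rw [hk, pow_zero]))
  · exact hf (by rw [hk]; exact dvd_pow_self _ (Nat.succ_ne_zero k))

theorem exists_center_aux : ∃ P : Sylow 7 G, Nat.card {x : P // ∀ y ∈ P, y * (x : G) = x * y} = 49 ∧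
    ∀ x ∈ P, IsConj z x → ∀ y ∈ P, y * x = x * y := by
  have h5 : Fact (Nat.Prime 5) := ⟨by norm_num⟩
  obtain ⟨P, hP⟩ := h.exists_sylow_le_centralizer hcard (IsConj.refl z)
  obtain ⟨f, hf⟩ := exists_prime_orderOf_dvd_card' (G := Subgroup.centralizer {z}) 5
    (by rw [h.card_central]; norm_num)
  obtain ⟨f, hfz⟩ := f
  rw [Subgroup.orderOf_mk] at hf
  have hfP : f • P = P := h.sylow_eq_of_le_centralizer hcard (IsConj.refl z)
    (Sylow.smul_le hP ⟨f, hfz⟩) hP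
  have hfP' : f ∈ Subgroup.normalizer (P : Set G) := Sylow.smul_eq_iff_mem_normalizer.1 hfP
  have hf1 : f ≠ 1 := by
    rintro rfl
    rw [orderOf_one] at hf
    norm_num at hf
  set D : Subgroup G := P ⊓ Subgroup.centralizer {f} with hD
  have hmem : ∀ {x}, x ∈ D ↔ x ∈ P ∧ f * x = x * f := by
    intro x
    rw [hD, Subgroup.mem_inf, Subgroup.mem_centralizer_singleton_iff, eq_comm]
    rfl
  have hDτ : ∀ x ∈ D, x ≠ 1 → IsConj z x := fun x hx hx1 =>
    h.isConj_central_of_commute hcard (hmem.1 hx).1 hx1 hf1 (by rw [hf]; norm_num) (hmem.1 hx).2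
  have hle : Nat.card D ≤ 49 := by
    classical
    let j : D → Option {x : P // IsConj z (x : G)} := fun x =>
      if hx : (x : G) = 1 then none else some ⟨⟨x, (hmem.1 x.2).1⟩, hDτ x x.2 hx⟩
    have hj : Function.Injective j := by
      intro x y hxy
      refine Subtype.ext ?_
      simp only [j] at hxy
      split_ifs at hxy with h1 h2 h2
      · rw [h1, h2]
      · simpa using hxy
    have := Nat.card_le_card_of_injective j hj
    rwa [Finite.card_option, h.count_sylow hcard P] at this
  have hpow : ∀ E : Subgroup G, E ≤ P → ∃ k ≤ 6, Nat.card E = 7 ^ k := fun E hE =>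
    (Nat.dvd_prime_pow (by norm_num)).1
      ((card_sylow_seven hcard P) ▸ Subgroup.card_dvd_of_le hE)
  have hcomm : ∀ E : Subgroup G, E ≤ P → f ∈ Subgroup.normalizer (E : Set G) → D ≤ E →
      Nat.card E ≡ Nat.card D [MOD 5] := by
    intro E hE hfE hDE
    convert card_modEq_card_commute hf E hfE using 1
    exact Nat.card_congr ⟨fun x => ⟨⟨x, hDE x.2⟩, (hmem.1 x.2).2⟩,
      fun x => ⟨x.1, hmem.2 ⟨hE x.1.2, x.2⟩⟩, fun _ => rfl, fun _ => rfl⟩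
  have hDcard : Nat.card D = 49 := by
    have h1 := hcomm P le_rfl hfP' inf_le_left
    obtain ⟨k, hk, hk'⟩ := hpow D inf_le_left
    rw [card_sylow_seven hcard P] at h1
    rw [hk'] at h1 hle ⊢
    interval_cases k <;> revert h1 hle <;> decide
  have hDcomm : ∀ x ∈ D, ∀ y ∈ D, x * y = y * x := by
    intro x hx y hy
    have := IsPGroup.isMulCommutative_of_card_eq_prime_sq (p := 7) (G := D) (by rw [hDcard]; norm_num)
    exact congrArg Subtype.val (this.is_comm.comm ⟨x, hx⟩ ⟨y, hy⟩)
  have hτD : ∀ x ∈ P, IsConj z x → x ∈ D := by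
    classical
    let j : {x : D // x ≠ 1} → {x : P // IsConj z (x : G)} := fun x =>
      ⟨⟨x.1, (hmem.1 x.1.2).1⟩, hDτ x.1 x.1.2 fun e => x.2 (Subtype.ext e)⟩
    have hj : Function.Injective j := fun x y hxy => by
      refine Subtype.ext (Subtype.ext ?_)
      exact congrArg (fun x => ((x.1 : P) : G)) hxy
    have hc : Nat.card {x : D // x ≠ 1} = 48 := by
      have h1 := Nat.card_congr (Equiv.sumCompl fun x : D => x ≠ 1)
      rw [Nat.card_sum, hDcard] at h1
      have h2 : Nat.card {x : D // ¬ x ≠ 1} = 1 := by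
        simp only [not_not]
        exact Nat.card_unique
      omega
    have hb := (Nat.bijective_iff_injective_and_card j).2
      ⟨hj, by rw [hc, h.count_sylow hcard P]⟩
    intro x hx hzx
    obtain ⟨y, hy⟩ := hb.2 ⟨⟨x, hx⟩, hzx⟩
    have : (y.1 : G) = x := congrArg (fun x => ((x.1 : P) : G)) hy
    rw [← this]
    exact y.1.2
  have hcen : ∀ x ∈ P, IsConj z x → ∀ y ∈ P, y * x = x * y := by
    intro x hx hzx
    have hxD := hτD x hx hzx
    have hxf := (hmem.1 hxD).2
    set E : Subgroup G := P ⊓ Subgroup.centralizer {x} with hE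
    have hfE : f ∈ Subgroup.normalizer (E : Set G) := by
      have hfP'' := Subgroup.mem_normalizer_iff.1 hfP'
      rw [Subgroup.mem_normalizer_iff]
      intro y
      have h1 : f * y * f⁻¹ * x = x * (f * y * f⁻¹) ↔ y * x = x * y := by
        have h2 : x = f * x * f⁻¹ := by rw [hxf]; group
        constructor
        · intro e
          rw [h2] at e
          have : f * (y * x) * f⁻¹ = f * (x * y) * f⁻¹ := by
            calc _ = f * y * f⁻¹ * (f * x * f⁻¹) := by group
              _ = f * x * f⁻¹ * (f * y * f⁻¹) := e
              _ = _ := by group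
          simpa using this
        · intro e
          rw [h2]
          calc f * y * f⁻¹ * (f * x * f⁻¹) = f * (y * x) * f⁻¹ := by group
            _ = f * (x * y) * f⁻¹ := by rw [e]
            _ = _ := by group
      rw [hE, Subgroup.mem_inf, Subgroup.mem_inf,
        Subgroup.mem_centralizer_singleton_iff, Subgroup.mem_centralizer_singleton_iff]
      exact and_congr (hfP'' y) h1.symm
    have hDE : D ≤ E := fun y hy => Subgroup.mem_inf.2 ⟨(hmem.1 hy).1,
      Subgroup.mem_centralizer_singleton_iff.2 (hDcomm y hy x hxD)⟩
    have h1 := hcomm E inf_le_left hfE hDE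
    obtain ⟨k, hk, hk'⟩ := hpow E inf_le_left
    have h2 : Nat.card P ≤ 48 * Nat.card E := by
      rw [← h.count_sylow hcard P, ← Nat.card_prod]
      classical
      have hy : ∀ y : {x : P // IsConj z (x : G)}, ∃ a : P, (∃ b : P, (b : G) * x * (b : G)⁻¹ = y) →
          (a : G) * x * (a : G)⁻¹ = y := by
        intro y
        by_cases hb : ∃ b : P, (b : G) * x * (b : G)⁻¹ = y
        · exact hb.imp fun b hb _ => hb
        · exact ⟨1, fun hb' => absurd hb' hb⟩
      choose a ha using hy
      have hcj : ∀ b : P, IsConj z ((b : G) * x * (b : G)⁻¹) := fun b =>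
        hzx.trans (isConj_iff.2 ⟨b, rfl⟩)
      let cj : P → {x : P // IsConj z (x : G)} := fun b => ⟨b * ⟨x, hx⟩ * b⁻¹, hcj b⟩
      have hac : ∀ b : P, (a (cj b) : G) * x * (a (cj b) : G)⁻¹ = b * x * (b : G)⁻¹ :=
        fun b => ha (cj b) ⟨b, rfl⟩
      have hEm : ∀ b : P, ((a (cj b))⁻¹ * b : G) ∈ E := fun b => by
        rw [hE, Subgroup.mem_inf, Subgroup.mem_centralizer_singleton_iff]
        refine ⟨mul_mem (inv_mem (a (cj b)).2) b.2, ?_⟩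
        have := hac b
        calc (a (cj b) : G)⁻¹ * b * x = (a (cj b) : G)⁻¹ * (b * x * (b : G)⁻¹) * b := by group
          _ = (a (cj b) : G)⁻¹ * (a (cj b) * x * (a (cj b) : G)⁻¹) * b := by rw [this]
          _ = _ := by simp [mul_assoc]
      refine Nat.card_le_card_of_injective (fun b : P => (cj b, (⟨_, hEm b⟩ : E))) fun b c e => ?_
      have e1 := congrArg Prod.fst e
      have e2 : (a (cj b) : G)⁻¹ * b = (a (cj c) : G)⁻¹ * c :=
        congrArg (fun y => (y.2 : G)) e
      dsimp only at e1
      rw [e1] at e2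
      exact Subtype.ext (mul_left_cancel e2)
    rw [card_sylow_seven hcard P, hk'] at h2
    rw [hk', hDcard] at h1
    have hk6 : k = 6 := by interval_cases k <;> revert h1 h2 <;> decide
    have hEP : E = P := Subgroup.eq_of_le_of_card_ge inf_le_left
      (by rw [hk', hk6, card_sylow_seven hcard P])
    intro y hy
    have : y ∈ E := by rw [hEP]; exact hy
    exact Subgroup.mem_centralizer_singleton_iff.1 (Subgroup.mem_inf.1 this).2
  refine ⟨P, ?_, hcen⟩
  rw [← hDcard]
  refine Nat.card_congr ⟨fun x => ⟨x.1, ?_⟩, fun x => ⟨⟨x, (hmem.1 x.2).1⟩, ?_⟩, fun _ => rfl,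
    fun _ => rfl⟩
  · by_cases hx1 : (x.1 : G) = 1
    · rw [hx1]; exact D.one_mem
    · refine hτD _ x.1.2 ((h.cover_sylow hcard x.1.2 hx1).resolve_right fun hu => ?_)
      have h1 := h.card_centralizer_of_isConj_regular hu
      have h2 : (P : Subgroup G) ≤ Subgroup.centralizer {(x.1 : G)} := fun y hy =>
        Subgroup.mem_centralizer_singleton_iff.2 (x.2 y hy)
      have h3 := Subgroup.card_le_of_le h2
      rw [h1, card_sylow_seven hcard P] at h3
      norm_num at h3
  · by_cases hx1 : (x : G) = 1
    · intro y _
      simp [hx1]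
    · exact hcen _ (hmem.1 x.2).1 (hDτ x x.2 hx1)

end IsSevenLocal

end SevenLocal

section SevenLocal

open scoped Pointwise

variable {G : Type*} [Group G]

/-- The centre of a subgroup, as a subgroup of the whole group. -/
def Subgroup.cen (P : Subgroup G) : Subgroup G := P ⊓ Subgroup.centralizer P

theorem Subgroup.mem_cen {P : Subgroup G} {x : G} : x ∈ P.cen ↔ x ∈ P ∧ ∀ y ∈ P, y * x = x * y :=
  Iff.rfl

variable [Finite G] {z u : G} [Fact (Nat.Prime 7)]

theorem Sylow.conj_mem_cen_iff {p : ℕ} {P : Sylow p G} {g x : G} :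
    g * x * g⁻¹ ∈ (g • P : Sylow p G).cen ↔ x ∈ P.cen := by
  rw [Subgroup.mem_cen, Subgroup.mem_cen]
  refine and_congr Sylow.conj_mem_smul_iff ⟨fun e y hy => ?_, fun e y hy => ?_⟩
  · have := e (g * y * g⁻¹) (Sylow.conj_mem_smul_iff.2 hy)
    rwa [conj_mul, conj_mul, conj_injective.eq_iff] at this
  · have := e _ (Sylow.mem_smul_iff.1 hy)
    calc y * (g * x * g⁻¹) = g * (g⁻¹ * y * g * x) * g⁻¹ := by group
      _ = g * (x * (g⁻¹ * y * g)) * g⁻¹ := by rw [this]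
      _ = _ := by group

namespace IsSevenLocal

variable (h : IsSevenLocal z u) (hcard : Nat.card G = 2 ^ 6 * 3 * 5 ^ 4 * 7 ^ 6 * 13 * 181)

include h hcard

theorem isConj_central_of_mem_cen {P : Sylow 7 G} {x : G} (hx : x ∈ P.cen) (hx1 : x ≠ 1) :
    IsConj z x := by
  refine (h.cover_sylow hcard hx.1 hx1).resolve_right fun hu => ?_
  have h2 : (P : Subgroup G) ≤ Subgroup.centralizer {x} := fun y hy =>
    Subgroup.mem_centralizer_singleton_iff.2 ((Subgroup.mem_cen.1 hx).2 y hy)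
  have h3 := Subgroup.card_le_of_le h2
  rw [h.card_centralizer_of_isConj_regular hu, card_sylow_seven hcard P] at h3
  norm_num at h3

theorem mem_cen_of_isConj {P : Sylow 7 G} {x : G} (hx : x ∈ P) (hzx : IsConj z x) :
    x ∈ P.cen := by
  obtain ⟨Q, -, hQ⟩ := h.exists_center_aux hcard
  obtain ⟨g, rfl⟩ := MulAction.exists_smul_eq G Q P
  have h1 := hQ _ (Sylow.mem_smul_iff.1 hx)
    (hzx.trans (isConj_iff.2 ⟨g⁻¹, by rw [inv_inv]⟩))
  have h2 : g⁻¹ * x * g ∈ Q.cen := ⟨Sylow.mem_smul_iff.1 hx, h1⟩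
  have := (Sylow.conj_mem_cen_iff (g := g)).2 h2
  convert this using 1
  group

theorem isConj_regular_of_notMem_cen {P : Sylow 7 G} {x : G} (hx : x ∈ P) (hxc : x ∉ P.cen) :
    IsConj u x :=
  (h.cover_sylow hcard hx fun e => hxc (by rw [e]; exact one_mem _)).resolve_left fun e =>
    hxc (h.mem_cen_of_isConj hcard hx e)

theorem card_cen (P : Sylow 7 G) : Nat.card P.cen = 49 := by
  obtain ⟨Q, hQ, -⟩ := h.exists_center_aux hcard
  obtain ⟨g, rfl⟩ := MulAction.exists_smul_eq G Q P
  rw [← hQ]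
  refine Nat.card_congr (Equiv.symm ?_)
  refine Equiv.trans (⟨fun x => ⟨x.1, x.1.2, x.2⟩, fun x => ⟨⟨x.1, x.2.1⟩, x.2.2⟩,
    fun _ => rfl, fun _ => rfl⟩ : _ ≃ Q.cen) ?_
  exact (MulAut.conj g).toEquiv.subtypeEquiv fun x => Sylow.conj_mem_cen_iff.symm

theorem exists_mem_cen (P : Sylow 7 G) : ∃ x ∈ P.cen, x ≠ 1 := by
  have : Nontrivial P.cen := by
    rw [← Finite.one_lt_card_iff_nontrivial, h.card_cen hcard]
    norm_num
  obtain ⟨x, hx⟩ := exists_ne (1 : P.cen)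
  exact ⟨x, x.2, fun e => hx (Subtype.ext e)⟩

theorem card_centralizer_cen {P : Sylow 7 G} {x : G} (hx : x ∈ P.cen) (hx1 : x ≠ 1) :
    Nat.card (Subgroup.centralizer {x}) = 7 ^ 6 * 50 :=
  h.card_centralizer_of_isConj_central (h.isConj_central_of_mem_cen hcard hx hx1)

theorem card_centralizer_of_notMem_cen {P : Sylow 7 G} {x : G} (hx : x ∈ P) (hxc : x ∉ P.cen) :
    Nat.card (Subgroup.centralizer {x}) = 7 ^ 4 :=
  h.card_centralizer_of_isConj_regular (h.isConj_regular_of_notMem_cen hcard hx hxc)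

theorem eq_of_mem_cen {P Q : Sylow 7 G} {x : G} (hx1 : x ≠ 1) (hP : x ∈ P.cen) (hQ : x ∈ Q) :
    P = Q := by
  have hzx := h.isConj_central_of_mem_cen hcard hP hx1
  refine h.sylow_eq_of_le_centralizer hcard hzx (fun y hy => ?_) (fun y hy => ?_)
  · exact Subgroup.mem_centralizer_singleton_iff.2 ((Subgroup.mem_cen.1 hP).2 y hy)
  · exact Subgroup.mem_centralizer_singleton_iff.2
      ((Subgroup.mem_cen.1 (h.mem_cen_of_isConj hcard hQ hzx)).2 y hy)

/-- Distinct Sylow `7`-subgroups intersect trivially. -/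
theorem eq_of_mem {P Q : Sylow 7 G} {x : G} (hx1 : x ≠ 1) (hP : x ∈ P) (hQ : x ∈ Q) : P = Q := by
  by_cases hx : x ∈ P.cen
  · exact h.eq_of_mem_cen hcard hx1 hx hQ
  have h1 : IsPGroup 7 (Subgroup.centralizer {x}) :=
    IsPGroup.of_card (h.card_centralizer_of_notMem_cen hcard hP hx)
  obtain ⟨R, hR⟩ := h1.exists_le_sylow
  have h2 : ∀ {P : Sylow 7 G}, x ∈ P → P = R := by
    intro P hP
    obtain ⟨v, hv, hv1⟩ := h.exists_mem_cen hcard P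
    refine h.eq_of_mem_cen hcard hv1 hv (hR ?_)
    exact Subgroup.mem_centralizer_singleton_iff.2 (hv.2 x hP).symm
  rw [h2 hP, h2 hQ]

theorem smul_eq_of_commute {P : Sylow 7 G} {x g : G} (hx1 : x ≠ 1) (hP : x ∈ P)
    (hg : g * x = x * g) : g • P = P := by
  refine h.eq_of_mem hcard hx1 (Sylow.mem_smul_iff.2 ?_) hP
  rwa [mul_assoc, ← hg, inv_mul_cancel_left]

theorem exists_conj_of_mem_cen {P : Sylow 7 G} {x y : G} (hx : x ∈ P.cen) (hx1 : x ≠ 1)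
    (hy : y ∈ P.cen) (hy1 : y ≠ 1) : ∃ g : G, g • P = P ∧ g * x * g⁻¹ = y := by
  obtain ⟨g, rfl⟩ := isConj_iff.1 ((h.isConj_central_of_mem_cen hcard hx hx1).symm.trans
    (h.isConj_central_of_mem_cen hcard hy hy1))
  exact ⟨g, h.eq_of_mem hcard hy1 (Sylow.conj_mem_smul_iff.2 hx.1) hy.1, rfl⟩

theorem card_stabilizer (P : Sylow 7 G) : Nat.card (MulAction.stabilizer G P) = 7 ^ 6 * 2400 := by
  obtain ⟨x, hx, hx1⟩ := h.exists_mem_cen hcard P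
  have key : ∀ y : {y : P.cen // y ≠ 1}, ∃ g : G, g • P = P ∧ g * x * g⁻¹ = y.1 := fun y =>
    h.exists_conj_of_mem_cen hcard hx hx1 y.1.2 fun e => y.2 (Subtype.ext e)
  choose c hc hcx using key
  have hcent : ∀ g ∈ Subgroup.centralizer {x}, g • P = P := fun g hg =>
    h.smul_eq_of_commute hcard hx1 hx.1 (Subgroup.mem_centralizer_singleton_iff.1 hg)
  have hmem : ∀ g : G, g • P = P → g * x * g⁻¹ ∈ P.cen := by
    intro g hg
    rw [← hg]
    exact Sylow.conj_mem_cen_iff.2 hx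
  have hne : ∀ g : G, g * x * g⁻¹ ≠ 1 := fun g => by simpa using hx1
  have e : MulAction.stabilizer G P ≃ {y : P.cen // y ≠ 1} × Subgroup.centralizer {x} :=
    { toFun := fun g => (⟨⟨g * x * (g : G)⁻¹, hmem g g.2⟩, fun e => hne _ (congrArg Subtype.val e)⟩,
        ⟨(c ⟨⟨g * x * (g : G)⁻¹, hmem g g.2⟩, fun e => hne _ (congrArg Subtype.val e)⟩)⁻¹ * g, by
          rw [Subgroup.mem_centralizer_singleton_iff]
          have := hcx ⟨⟨g * x * (g : G)⁻¹, hmem g g.2⟩, fun e => hne _ (congrArg Subtype.val e)⟩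
          dsimp only at this
          rw [mul_assoc, inv_mul_eq_iff_eq_mul, ← mul_assoc, ← mul_assoc, mul_inv_eq_iff_eq_mul.1 this]
          group⟩)
      invFun := fun y => ⟨c y.1 * y.2, by
        rw [MulAction.mem_stabilizer_iff, mul_smul, hcent _ y.2.2, hc]⟩
      left_inv := fun g => Subtype.ext (mul_inv_cancel_left _ _)
      right_inv := fun y => by
        have hy : c y.1 * y.2 * x * (c y.1 * y.2 : G)⁻¹ = y.1 := by
          rw [← hcx y.1, mul_assoc (c y.1), Subgroup.mem_centralizer_singleton_iff.1 y.2.2]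
          group
        refine Prod.ext (Subtype.ext (Subtype.ext hy)) (Subtype.ext ?_)
        dsimp only
        simp only [hy, inv_mul_cancel_left] }
  have h48 : Nat.card {y : P.cen // y ≠ 1} = 48 := by
    classical
    have h1 := Nat.card_congr (Equiv.sumCompl fun x : P.cen => x ≠ 1)
    rw [Nat.card_sum, h.card_cen hcard] at h1
    have h2 : Nat.card {x : P.cen // ¬ x ≠ 1} = 1 := by
      simp only [not_not]
      exact Nat.card_unique
    omega
  rw [Nat.card_congr e, Nat.card_prod, h48, h.card_centralizer_cen hcard hx hx1]
  norm_num

theorem card_sylow_points : Nat.card (Sylow 7 G) = 117650 := by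
  obtain ⟨P⟩ : Nonempty (Sylow 7 G) := inferInstance
  have h1 := Nat.card_congr (MulAction.orbitProdStabilizerEquivGroup G P)
  rw [Nat.card_prod, Sylow.orbit_eq_top, h.card_stabilizer hcard, hcard] at h1
  have h2 : Nat.card (⊤ : Set (Sylow 7 G)) = Nat.card (Sylow 7 G) := Nat.card_univ
  rw [h2] at h1
  norm_num at h1 ⊢
  omega

theorem eq_of_smul_eq {P Q : Sylow 7 G} {x : G} (hx : x ∈ P) (hx1 : x ≠ 1) (hQ : x • Q = Q) :
    P = Q := by
  have h1 := P.isPGroup'.inf_normalizer_sylow Q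
  have h2 : x ∈ (P : Subgroup G) ⊓ Subgroup.normalizer (Q : Set G) :=
    ⟨hx, Sylow.smul_eq_iff_mem_normalizer.1 hQ⟩
  rw [h1] at h2
  exact h.eq_of_mem hcard hx1 hx h2.2

omit h hcard in
theorem _root_.Sylow.smul_eq_of_mem {p : ℕ} {P : Sylow p G} {x : G} (hx : x ∈ P) : x • P = P :=
  Sylow.smul_eq_iff_mem_normalizer.2 (Subgroup.le_normalizer hx)

theorem existsUnique_smul_eq {P Q R : Sylow 7 G} (hQ : Q ≠ P) (hR : R ≠ P) :
    ∃! x : P, (x : G) • Q = R := by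
  have hfix : ∀ x : P, (x : G) • Q ≠ P := fun x e => hQ (by
    rw [← smul_left_cancel_iff (x : G), e, Sylow.smul_eq_of_mem x.2])
  let j : P → {Q : Sylow 7 G // Q ≠ P} := fun x => ⟨(x : G) • Q, hfix x⟩
  have hj : Function.Injective j := by
    intro x y hxy
    have h1 : (x : G) • Q = (y : G) • Q := congrArg Subtype.val hxy
    by_contra hne
    refine hQ (h.eq_of_smul_eq hcard (x := (y : G)⁻¹ * x) (mul_mem (inv_mem y.2) x.2) ?_ ?_).symm
    · intro e
      exact hne (Subtype.ext (inv_mul_eq_one.1 e).symm)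
    · rw [mul_smul, h1, inv_smul_smul]
  have hc : Nat.card {Q : Sylow 7 G // Q ≠ P} = 7 ^ 6 := by
    classical
    have h1 := Nat.card_congr (Equiv.sumCompl fun x : Sylow 7 G => x ≠ P)
    rw [Nat.card_sum, h.card_sylow_points hcard] at h1
    have h2 : Nat.card {x : Sylow 7 G // ¬ x ≠ P} = 1 := by
      simp only [not_not]
      exact Nat.card_unique
    omega
  have hb := (Nat.bijective_iff_injective_and_card j).2 ⟨hj, by
    rw [hc]; exact card_sylow_seven hcard P⟩
  obtain ⟨x, hx, hu⟩ := hb.existsUnique ⟨R, hR⟩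
  exact ⟨x, congrArg Subtype.val hx, fun y hy => hu y (Subtype.ext hy)⟩

end IsSevenLocal

end SevenLocal

section SevenTI

open scoped Pointwise

instance factPrimeSeven : Fact (Nat.Prime 7) := ⟨by norm_num⟩

/-- The action of `G` on its Sylow `7`-subgroups: they intersect pairwise trivially, each of them
is regular on the others, and its elements have centralizers of known orders. -/
class IsSevenTI (G : Type*) [Group G] : Prop where
  card_sylow : ∀ P : Sylow 7 G, Nat.card P = 7 ^ 6
  card_points : Nat.card (Sylow 7 G) = 117650
  card_stabilizer : ∀ P : Sylow 7 G, Nat.card (MulAction.stabilizer G P) = 7 ^ 6 * 2400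
  card_cen : ∀ P : Sylow 7 G, Nat.card P.cen = 49
  card_centralizer_cen : ∀ (P : Sylow 7 G), ∀ x ∈ P.cen, x ≠ 1 →
    Nat.card (Subgroup.centralizer {x}) = 7 ^ 6 * 50
  card_centralizer_notMem_cen : ∀ (P : Sylow 7 G), ∀ x ∈ P, x ∉ P.cen →
    Nat.card (Subgroup.centralizer {x}) = 7 ^ 4
  isConj_cen : ∀ (P : Sylow 7 G), ∀ x ∈ P.cen, x ≠ 1 → ∀ y ∈ P.cen, y ≠ 1 → IsConj x y
  eq_of_mem : ∀ (P Q : Sylow 7 G) (x : G), x ≠ 1 → x ∈ P → x ∈ Q → P = Q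
  eq_of_smul_eq : ∀ (P Q : Sylow 7 G), ∀ x ∈ P, x ≠ 1 → x • Q = Q → P = Q
  existsUnique_smul_eq : ∀ P Q R : Sylow 7 G, Q ≠ P → R ≠ P → ∃! x : P, (x : G) • Q = R

variable {G : Type*} [Group G] [Finite G]

theorem IsSevenLocal.isSevenTI {z u : G} (h : IsSevenLocal z u)
    (hcard : Nat.card G = 2 ^ 6 * 3 * 5 ^ 4 * 7 ^ 6 * 13 * 181) : IsSevenTI G where
  card_sylow := card_sylow_seven hcard
  card_points := h.card_sylow_points hcard
  card_stabilizer := h.card_stabilizer hcard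
  card_cen := h.card_cen hcard
  card_centralizer_cen _ _ := h.card_centralizer_cen hcard
  card_centralizer_notMem_cen _ _ := h.card_centralizer_of_notMem_cen hcard
  isConj_cen _ _ hx hx1 _ hy hy1 := (h.isConj_central_of_mem_cen hcard hx hx1).symm.trans
    (h.isConj_central_of_mem_cen hcard hy hy1)
  eq_of_mem _ _ _ := h.eq_of_mem hcard
  eq_of_smul_eq _ _ _ := h.eq_of_smul_eq hcard
  existsUnique_smul_eq _ _ _ := h.existsUnique_smul_eq hcard

variable [IsSevenTI G] {P Q : Sylow 7 G}

open IsSevenTI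

/-- The stabilizer of two points. -/
abbrev twoPoint (P Q : Sylow 7 G) : Subgroup G := MulAction.stabilizer G P ⊓ MulAction.stabilizer G Q

theorem mem_twoPoint {g : G} : g ∈ twoPoint P Q ↔ g • P = P ∧ g • Q = Q := Iff.rfl

theorem smul_eq_left {g : G} (hg : g ∈ twoPoint P Q) : g • P = P := hg.1

theorem smul_eq_right {g : G} (hg : g ∈ twoPoint P Q) : g • Q = Q := hg.2

theorem conj_mem_of_smul_eq {g x : G} (hg : g • P = P) (hx : x ∈ P) : g * x * g⁻¹ ∈ P := by
  rw [← hg]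
  exact Sylow.conj_mem_smul_iff.2 hx

theorem conj_mem_cen_of_smul_eq {g x : G} (hg : g • P = P) (hx : x ∈ P.cen) :
    g * x * g⁻¹ ∈ P.cen := by
  rw [← hg]
  exact Sylow.conj_mem_cen_iff.2 hx

theorem inv_smul_eq_of_smul_eq {g : G} (hg : g • P = P) : g⁻¹ • P = P := by
  rw [inv_smul_eq_iff, hg]

theorem cen_le : P.cen ≤ P := inf_le_left

theorem commute_of_mem_cen {x y : G} (hx : x ∈ P.cen) (hy : y ∈ P) : y * x = x * y :=
  hx.2 y hy

theorem exists_mem_smul_eq {R : Sylow 7 G} (hQ : Q ≠ P) (hR : R ≠ P) : ∃ x ∈ P, x • Q = R := by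
  obtain ⟨x, hx, -⟩ := existsUnique_smul_eq P Q R hQ hR
  exact ⟨x, x.2, hx⟩

theorem eq_of_smul_eq_smul {x y : G} (hQ : Q ≠ P) (hx : x ∈ P) (hy : y ∈ P) (h : x • Q = y • Q) :
    x = y := by
  by_contra hne
  refine hQ (eq_of_smul_eq P Q (y⁻¹ * x) (mul_mem (inv_mem hy) hx) ?_ ?_).symm
  · exact fun e => hne (inv_mul_eq_one.1 e).symm
  · rw [mul_smul, h, inv_smul_smul]

/-- The stabilizer of a point is the product of its Sylow subgroup and a two-point stabilizer. -/
theorem exists_mul_of_smul_eq (hQ : Q ≠ P) {g : G} (hg : g • P = P) :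
    ∃ x ∈ P, ∃ k ∈ twoPoint P Q, g = x * k := by
  obtain ⟨x, hx, hxQ⟩ := exists_mem_smul_eq hQ (R := g • Q) (fun e => hQ (by
    rw [← smul_left_cancel_iff g, e, hg]))
  refine ⟨x, hx, x⁻¹ * g, mem_twoPoint.2 ⟨?_, ?_⟩, (mul_inv_cancel_left _ _).symm⟩
  · rw [mul_smul, hg, inv_smul_eq_of_smul_eq (Sylow.smul_eq_of_mem hx)]
  · rw [mul_smul, ← hxQ, inv_smul_smul]

theorem card_twoPoint (hQ : Q ≠ P) : Nat.card (twoPoint P Q) = 2400 := by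
  have h1 : Function.Bijective fun y : P × twoPoint P Q => (⟨y.1 * y.2, by
      rw [MulAction.mem_stabilizer_iff, mul_smul, (mem_twoPoint.1 y.2.2).1,
        Sylow.smul_eq_of_mem y.1.2]⟩ : MulAction.stabilizer G P) := by
    constructor
    · rintro ⟨x, k⟩ ⟨y, l⟩ e
      have e' : (x : G) * k = y * l := congrArg Subtype.val e
      have hxy : (x : G) = y := by
        refine eq_of_smul_eq_smul hQ x.2 y.2 ?_
        have := congrArg (· • Q) e'
        simpa only [mul_smul, (mem_twoPoint.1 k.2).2, (mem_twoPoint.1 l.2).2] using this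
      rw [hxy] at e'
      exact Prod.ext (Subtype.ext hxy) (Subtype.ext (mul_left_cancel e'))
    · rintro ⟨g, hg⟩
      obtain ⟨x, hx, k, hk, rfl⟩ := exists_mul_of_smul_eq hQ hg
      exact ⟨(⟨x, hx⟩, ⟨k, hk⟩), rfl⟩
  have h2 := Nat.card_eq_of_bijective _ h1
  rw [Nat.card_prod, card_stabilizer] at h2
  have h3 := card_sylow P
  change Nat.card P = _ at h3
  have h4 : Nat.card P * Nat.card (twoPoint P Q) = 7 ^ 6 * 2400 := h2
  rw [h3] at h4
  exact Nat.eq_of_mul_eq_mul_left (by norm_num) h4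

theorem pow_eq_one_of_mem_twoPoint (hQ : Q ≠ P) {k : G} (hk : k ∈ twoPoint P Q) : k ^ 2400 = 1 := by
  rw [← card_twoPoint hQ]
  exact congrArg Subtype.val (pow_card_eq_one' (x := (⟨k, hk⟩ : twoPoint P Q)))

/-- A two-point stabilizer acts semiregularly on the noncentral elements. -/
theorem eq_one_of_commute (hQ : Q ≠ P) {k x : G} (hk : k ∈ twoPoint P Q) (hx : x ∈ P)
    (hxc : x ∉ P.cen) (hc : k * x = x * k) : k = 1 := by
  have h1 := Subgroup.orderOf_dvd_natCard (x := k) (Subgroup.centralizer {x})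
    (Subgroup.mem_centralizer_singleton_iff.2 hc)
  rw [card_centralizer_notMem_cen P x hx hxc] at h1
  have h2 := orderOf_dvd_of_pow_eq_one (pow_eq_one_of_mem_twoPoint hQ hk)
  exact orderOf_eq_one_iff.1 (Nat.eq_one_of_dvd_coprimes (by norm_num) h1 h2)

/-- A two-point stabilizer acts semiregularly on the nontrivial cosets of the centre. -/
theorem eq_one_of_commute_mod (hQ : Q ≠ P) {k x : G} (hk : k ∈ twoPoint P Q) (hx : x ∈ P)
    (hxc : x ∉ P.cen) (hc : x⁻¹ * (k * x * k⁻¹) ∈ P.cen) : k = 1 := by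
  by_contra hk1
  obtain ⟨p, hp, hpk⟩ := Nat.exists_prime_and_dvd (n := orderOf k) (by rwa [Ne, orderOf_eq_one_iff])
  have hf : Fact p.Prime := ⟨hp⟩
  set l := k ^ (orderOf k / p) with hl
  have hl1 : l ≠ 1 := by
    refine pow_ne_one_of_lt_orderOf ?_ ?_
    · exact (Nat.div_pos (Nat.le_of_dvd (orderOf_pos k) hpk) hp.pos).ne'
    · exact Nat.div_lt_self (orderOf_pos k) hp.one_lt
  have hlp : l ^ p = 1 := by rw [hl, ← pow_mul, Nat.div_mul_cancel hpk, pow_orderOf_eq_one]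
  have hlH : l ∈ twoPoint P Q := pow_mem hk _
  have key : ∀ n : ℕ, ∀ y, x⁻¹ * y ∈ P.cen → x⁻¹ * (k ^ n * y * (k ^ n)⁻¹) ∈ P.cen := by
    intro n
    induction n with
    | zero => intro y hy; simpa using hy
    | succ n ih =>
      intro y hy
      have h1 := ih _ hy
      have h2 := conj_mem_cen_of_smul_eq (mem_twoPoint.1 hk).1 h1
      have := mul_mem hc h2
      convert this using 1
      rw [pow_succ']
      group
  have key2 : ∀ y, x⁻¹ * y ∈ P.cen → x⁻¹ * (l * y * l⁻¹) ∈ P.cen := key _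
  let T := {y : G // x⁻¹ * y ∈ P.cen}
  have hT : Nat.card T = 49 := by
    rw [← card_cen P]
    exact Nat.card_congr ((Equiv.mulLeft x⁻¹).subtypeEquiv fun y => Iff.rfl)
  let σf : T → T := fun y => ⟨l * y * l⁻¹, key2 y y.2⟩
  have hσi : Function.Injective σf := fun a b e => Subtype.ext
    (mul_left_cancel (mul_right_cancel (congrArg Subtype.val e)))
  let σ : Equiv.Perm T := Equiv.ofBijective σf (Finite.injective_iff_bijective.1 hσi)
  have hpow : ∀ n : ℕ, ∀ y : T, ((σ ^ n) y : G) = l ^ n * y * (l ^ n)⁻¹ := by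
    intro n
    induction n with
    | zero => intro y; simp
    | succ n ih =>
      intro y
      rw [pow_succ', Equiv.Perm.mul_apply]
      change l * ((σ ^ n) y : G) * l⁻¹ = _
      rw [ih, pow_succ']
      group
  have hσp : σ ^ p ^ 1 = 1 := by
    ext y
    rw [pow_one, hpow, hlp]
    simp
  have := Fintype.ofFinite T
  have hnd : ¬ p ∣ Fintype.card T := by
    rw [← Nat.card_eq_fintype_card, hT]
    intro hd
    have h1 : p ∣ 2400 := hpk.trans (orderOf_dvd_of_pow_eq_one (pow_eq_one_of_mem_twoPoint hQ hk))
    have := Nat.dvd_gcd hd h1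
    norm_num at this
    exact hp.one_lt.ne' this
  obtain ⟨y, hy⟩ := Equiv.Perm.exists_fixed_point_of_prime hnd hσp
  have hy' : l * y * l⁻¹ = y := congrArg Subtype.val hy
  have hyP : (y : G) ∈ P := by
    have := mul_mem hx (cen_le y.2)
    rwa [mul_inv_cancel_left] at this
  refine hl1 (eq_one_of_commute hQ hlH hyP (fun hyc => hxc ?_) (mul_inv_eq_iff_eq_mul.1 hy'))
  have := mul_mem hyc (inv_mem y.2)
  simpa using this

end SevenTI

section SevenTI

open scoped Pointwise
open IsSevenTI

variable {G : Type*} [Group G] [Finite G] [IsSevenTI G]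

/-- The central quotient of a Sylow subgroup. -/
abbrev CenQuo (P : Sylow 7 G) := P ⧸ Subgroup.center P

theorem CenQuo.mk_eq_iff {P : Sylow 7 G} {x y : P} :
    (x : CenQuo P) = y ↔ (x : G)⁻¹ * y ∈ P.cen := by
  refine QuotientGroup.eq.trans (Subgroup.mem_center_iff.trans ?_)
  rw [Subgroup.mem_cen]
  constructor
  · exact fun h => ⟨(x⁻¹ * y).2, fun g hg => congrArg Subtype.val (h ⟨g, hg⟩)⟩
  · exact fun h g => Subtype.ext (h.2 g g.2)

theorem CenQuo.mk_eq_one_iff {P : Sylow 7 G} {x : P} : (x : CenQuo P) = 1 ↔ (x : G) ∈ P.cen := by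
  rw [eq_comm, ← QuotientGroup.mk_one, CenQuo.mk_eq_iff]
  simp

/-- Conjugation on `P` by an element stabilizing `P`. -/
def stabConj {P : Sylow 7 G} {g : G} (hg : g • P = P) : P →* P where
  toFun := fun x => ⟨g * x * g⁻¹, conj_mem_of_smul_eq hg x.2⟩
  map_one' := Subtype.ext (by simp)
  map_mul' := fun x y => Subtype.ext (by simp)

/-- Conjugation on the central quotient of `P` by an element stabilizing `P`. -/
def stabConjQuo {P : Sylow 7 G} {g : G} (hg : g • P = P) : CenQuo P →* CenQuo P :=
  QuotientGroup.map _ _ (stabConj hg) (fun x hx => by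
    have h1 := CenQuo.mk_eq_one_iff.1 ((QuotientGroup.eq_one_iff x).2 hx)
    exact (QuotientGroup.eq_one_iff (stabConj hg x)).1
      (CenQuo.mk_eq_one_iff.2 (conj_mem_cen_of_smul_eq hg h1)))

theorem stabConjQuo_mk {P : Sylow 7 G} {g : G} (hg : g • P = P) (x : P) :
    stabConjQuo hg x = ((⟨g * x * g⁻¹, conj_mem_of_smul_eq hg x.2⟩ : P) : CenQuo P) := rfl

theorem stabConjQuo_mul {P : Sylow 7 G} {g k : G} (hg : g • P = P) (hk : k • P = P)
    (hgk : (g * k) • P = P) (x : CenQuo P) :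
    stabConjQuo hgk x = stabConjQuo hg (stabConjQuo hk x) := by
  induction x using QuotientGroup.induction_on with | H x => ?_
  rw [stabConjQuo_mk, stabConjQuo_mk, stabConjQuo_mk]
  refine congrArg _ (Subtype.ext ?_)
  simp [mul_assoc]

/-- `t` is an involution fixing the distinct points `P` and `Q`. -/
structure IsFrame (P Q : Sylow 7 G) (t : G) : Prop where
  ne : Q ≠ P
  mem : t ∈ twoPoint P Q
  mul_self : t * t = 1
  ne_one : t ≠ 1

variable {P Q : Sylow 7 G} {t : G}

theorem exists_isFrame (hQ : Q ≠ P) : ∃ t : G, IsFrame P Q t := by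
  obtain ⟨t, ht⟩ := exists_prime_orderOf_dvd_card' (G := twoPoint P Q) 2
    (by rw [card_twoPoint hQ]; norm_num)
  refine ⟨t, hQ, t.2, ?_, ?_⟩
  · rw [← sq, ← Subgroup.orderOf_coe] at *
    rw [← ht, pow_orderOf_eq_one]
  · intro e
    rw [← Subgroup.orderOf_coe, e, orderOf_one] at ht
    norm_num at ht

theorem mem_cen_of_commute (hQ : Q ≠ P) {k x : G} (hk : k ∈ twoPoint P Q) (hk1 : k ≠ 1)
    (hx : x ∈ P) (hc : k * x = x * k) : x ∈ P.cen := by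
  by_contra hxc
  exact hk1 (eq_one_of_commute hQ hk hx hxc hc)

theorem exists_conj_cen (hQ : Q ≠ P) {x y : G} (hx : x ∈ P.cen) (hx1 : x ≠ 1) (hy : y ∈ P.cen)
    (hy1 : y ≠ 1) : ∃ k ∈ twoPoint P Q, k * x * k⁻¹ = y := by
  obtain ⟨g, rfl⟩ := isConj_iff.1 (isConj_cen P x hx hx1 y hy hy1)
  obtain ⟨a, ha, k, hk, rfl⟩ := exists_mul_of_smul_eq hQ
    (eq_of_mem (g • P) P _ hy1 (Sylow.conj_mem_smul_iff.2 (cen_le hx)) (cen_le hy))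
  refine ⟨k, hk, ?_⟩
  have h1 := commute_of_mem_cen (conj_mem_cen_of_smul_eq (mem_twoPoint.1 hk).1 hx) ha
  calc k * x * k⁻¹ = k * x * k⁻¹ * a * a⁻¹ := by group
    _ = a * (k * x * k⁻¹) * a⁻¹ := by rw [h1]
    _ = _ := by group

namespace IsFrame

variable (hF : IsFrame P Q t)

include hF

theorem inv_eq : t⁻¹ = t := inv_eq_of_mul_eq_one_left hF.mul_self

theorem smul_left : t • P = P := hF.mem.1

theorem smul_right : t • Q = Q := hF.mem.2

theorem stabConjQuo_fixedPointFree {k : G} (hk : k ∈ twoPoint P Q) (hk1 : k ≠ 1) :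
    MonoidHom.FixedPointFree (stabConjQuo (smul_eq_left hk)) := by
  intro x
  induction x using QuotientGroup.induction_on with | H x => ?_
  intro e
  rw [stabConjQuo_mk, eq_comm, CenQuo.mk_eq_iff] at e
  rw [CenQuo.mk_eq_one_iff]
  by_contra hxc
  exact hk1 (eq_one_of_commute_mod hF.ne hk x.2 hxc e)

theorem stabConjQuo_involutive : Function.Involutive (stabConjQuo hF.smul_left) := by
  intro x
  rw [← stabConjQuo_mul hF.smul_left hF.smul_left (by rw [hF.mul_self, one_smul])]
  induction x using QuotientGroup.induction_on with | H x => ?_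
  rw [stabConjQuo_mk]
  refine congrArg _ (Subtype.ext ?_)
  simp [hF.mul_self]

/-- An involution inverts the central quotient. -/
theorem stabConjQuo_eq_inv (x : CenQuo P) : stabConjQuo hF.smul_left x = x⁻¹ :=
  congrFun ((hF.stabConjQuo_fixedPointFree hF.mem hF.ne_one).coe_eq_inv_of_involutive
    hF.stabConjQuo_involutive) x

theorem cenQuo_comm (x y : CenQuo P) : x * y = y * x :=
  (hF.stabConjQuo_fixedPointFree hF.mem hF.ne_one).commute_all_of_involutive
    hF.stabConjQuo_involutive x y

theorem conj_mul_mem_cen {x : G} (hx : x ∈ P) : t * x * t⁻¹ * x ∈ P.cen := by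
  have h1 := hF.stabConjQuo_eq_inv ((⟨x, hx⟩ : P) : CenQuo P)
  rw [← mul_eq_one_iff_eq_inv, stabConjQuo_mk, ← QuotientGroup.mk_mul, CenQuo.mk_eq_one_iff] at h1
  exact h1

omit hF in
theorem _root_.exists_notMem_cen (P : Sylow 7 G) : ∃ x ∈ P, x ∉ P.cen := by
  by_contra! hall
  have h1 : (P : Subgroup G) ≤ P.cen := hall
  have h2 := Subgroup.card_le_of_le h1
  have h3 : Nat.card (P : Subgroup G) = _ := card_sylow P
  rw [h3, card_cen] at h2
  norm_num at h2

/-- A two-point stabilizer contains only one involution. -/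
theorem eq_of_isFrame {s : G} (hs : IsFrame P Q s) : s = t := by
  obtain ⟨x, hx, hxc⟩ := exists_notMem_cen P
  by_contra hne
  have hst : s * t ≠ 1 := fun e => hne (by rw [mul_eq_one_iff_eq_inv.1 e, hF.inv_eq])
  refine hxc (CenQuo.mk_eq_one_iff.1 (hF.stabConjQuo_fixedPointFree (mul_mem hs.mem hF.mem) hst
    ((⟨x, hx⟩ : P) : CenQuo P) ?_))
  rw [stabConjQuo_mul hs.smul_left hF.smul_left, hF.stabConjQuo_eq_inv, hs.stabConjQuo_eq_inv,
    inv_inv]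

theorem conj {g : G} : IsFrame (g • P) (g • Q) (g * t * g⁻¹) where
  ne := by rw [Ne, smul_left_cancel_iff]; exact hF.ne
  mem := by
    rw [mem_twoPoint, mul_smul, mul_smul, mul_smul, mul_smul, inv_smul_smul, inv_smul_smul,
      hF.smul_left, hF.smul_right]
    exact ⟨rfl, rfl⟩
  mul_self := by
    calc g * t * g⁻¹ * (g * t * g⁻¹) = g * (t * t) * g⁻¹ := by group
      _ = 1 := by rw [hF.mul_self]; group
  ne_one := by simpa using hF.ne_one

/-- The involution of a two-point stabilizer is central. -/
theorem commute {k : G} (hk : k ∈ twoPoint P Q) : k * t = t * k := by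
  have h1 := hF.conj (g := k)
  rw [hk.1, hk.2] at h1
  exact mul_inv_eq_iff_eq_mul.1 (hF.eq_of_isFrame h1)

/-- The involution of a two-point stabilizer centralizes the centre. -/
theorem commute_cen {v : G} (hv : v ∈ P.cen) : t * v = v * t := by
  obtain ⟨v₀, hv₀, hv₀1, h₀⟩ : ∃ v₀ ∈ P.cen, v₀ ≠ 1 ∧ t * v₀ = v₀ * t := by
    by_contra! hall
    have h1 : MonoidHom.FixedPointFree (stabConj hF.smul_left) := by
      intro x e
      have h2 : t * x = x * t := mul_inv_eq_iff_eq_mul.1 (congrArg Subtype.val e)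
      by_contra hx1
      exact hall x (mem_cen_of_commute hF.ne hF.mem hF.ne_one x.2 h2)
        (fun e => hx1 (Subtype.ext e)) h2
    have h2 : Function.Involutive (stabConj hF.smul_left) := by
      intro x
      refine Subtype.ext ?_
      change t * (t * x * t⁻¹) * t⁻¹ = x
      calc t * (t * x * t⁻¹) * t⁻¹ = (t * t) * x * (t * t)⁻¹ := by group
        _ = x := by rw [hF.mul_self]; group
    obtain ⟨x, hx, hxc⟩ := exists_notMem_cen P
    exact hxc (Subgroup.mem_cen.2 ⟨hx, fun y hy => congrArg Subtype.val
      (h1.commute_all_of_involutive h2 ⟨y, hy⟩ ⟨x, hx⟩)⟩)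
  by_cases hv1 : v = 1
  · simp [hv1]
  obtain ⟨k, hk, rfl⟩ := exists_conj_cen hF.ne hv₀ hv₀1 hv hv1
  have h2 := hF.commute hk
  have h3 := hF.commute (inv_mem hk)
  calc t * (k * v₀ * k⁻¹) = (t * k) * v₀ * k⁻¹ := by group
    _ = k * (t * v₀) * k⁻¹ := by rw [← h2]; group
    _ = k * v₀ * (t * k⁻¹) := by rw [h₀]; group
    _ = _ := by rw [← h3]; group

end IsFrame

end SevenTI

section SevenTI

open scoped Pointwise
open IsSevenTI

variable {G : Type*} [Group G] [Finite G] [IsSevenTI G] {P Q R : Sylow 7 G} {t : G}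

omit [Finite G] [IsSevenTI G] in
theorem smul_smul_of_smul_eq {k x : G} (hk : k • Q = Q) : k • x • Q = (k * x * k⁻¹) • Q := by
  rw [mul_smul, mul_smul, inv_smul_eq_iff.2 hk.symm]

theorem smul_smul_eq_iff (hQ : Q ≠ P) {k x : G} (hk : k ∈ twoPoint P Q) (hx : x ∈ P) :
    k • x • Q = x • Q ↔ k * x = x * k := by
  rw [smul_smul_of_smul_eq (smul_eq_right hk), ← mul_inv_eq_iff_eq_mul]
  exact ⟨eq_of_smul_eq_smul hQ (conj_mem_of_smul_eq (smul_eq_left hk) hx) hx,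
    fun e => by rw [e]⟩

theorem smul_ne_left (hQ : Q ≠ P) {x : G} (hx : x ∈ P) : x • Q ≠ P := fun e => hQ (by
  rw [← smul_left_cancel_iff x, e, Sylow.smul_eq_of_mem hx])

/-- An element of order dividing `25` stabilizing `P` centralizes its centre. -/
theorem commute_cen_of_pow_eq_one {k v : G} (hk : k • P = P) (hk25 : k ^ 25 = 1) (hv : v ∈ P.cen) :
    k * v = v * k := by
  classical
  let f : Function.End P.cen := fun v => ⟨k * v * k⁻¹, conj_mem_cen_of_smul_eq hk v.2⟩
  have hpow : ∀ n : ℕ, ∀ v : P.cen, ((f ^ n) v : G) = k ^ n * v * (k ^ n)⁻¹ := by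
    intro n
    induction n with
    | zero =>
      intro v
      rw [pow_zero]
      change (v : G) = _
      simp
    | succ n ih =>
      intro v
      rw [pow_succ']
      change k * ((f ^ n) v : G) * k⁻¹ = _
      rw [ih, pow_succ']
      group
  have hf : f ^ 5 ^ 2 = 1 := by
    funext v
    refine Subtype.ext ?_
    rw [hpow]
    change _ = (v : G)
    norm_num [hk25]
  have := Fintype.ofFinite P.cen
  have h5 : Fact (Nat.Prime 5) := ⟨by norm_num⟩
  have hfix := Equiv.Perm.card_fixedPoints_modEq hf
  rw [← Nat.card_eq_fintype_card, ← Nat.card_eq_fintype_card, card_cen] at hfix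
  set D : Subgroup G := P.cen ⊓ Subgroup.centralizer {k}
  have hD : Nat.card f.fixedPoints = Nat.card D :=
    Nat.card_congr ⟨fun x => ⟨x.1, x.1.2, Subgroup.mem_centralizer_singleton_iff.2
        (mul_inv_eq_iff_eq_mul.1 (congrArg Subtype.val x.2)).symm⟩,
      fun x => ⟨⟨x, x.2.1⟩, Subtype.ext (mul_inv_eq_iff_eq_mul.2
        (Subgroup.mem_centralizer_singleton_iff.1 x.2.2).symm)⟩, fun _ => rfl, fun _ => rfl⟩
  rw [hD] at hfix
  obtain ⟨j, hj, hj'⟩ := (Nat.dvd_prime_pow (p := 7) (m := 2) (by norm_num)).1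
    ((by norm_num : 49 = 7 ^ 2) ▸ card_cen P ▸ Subgroup.card_dvd_of_le (inf_le_left : D ≤ P.cen))
  rw [hj'] at hfix
  have hj2 : j = 2 := by interval_cases j <;> revert hfix <;> decide
  have hDe : D = P.cen := Subgroup.eq_of_le_of_card_ge inf_le_left
    (by rw [hj', hj2, card_cen]; norm_num)
  have : v ∈ D := by rw [hDe]; exact hv
  exact (Subgroup.mem_centralizer_singleton_iff.1 this.2).symm

/-- The pointwise stabilizer of the fixed points of `t`. -/
def axisKer (t : G) : Subgroup G := fixingSubgroup G {R : Sylow 7 G | t • R = R}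

omit [Finite G] [IsSevenTI G] in
theorem mem_axisKer {k : G} : k ∈ axisKer t ↔ ∀ R : Sylow 7 G, t • R = R → k • R = R :=
  mem_fixingSubgroup_iff G

namespace IsFrame

variable (hF : IsFrame P Q t)

include hF

theorem exists_cen_smul_eq (hR : R ≠ P) (ht : t • R = R) : ∃ v ∈ P.cen, v • Q = R := by
  obtain ⟨x, hx, rfl⟩ := exists_mem_smul_eq hF.ne hR
  exact ⟨x, mem_cen_of_commute hF.ne hF.mem hF.ne_one hx
    ((smul_smul_eq_iff hF.ne hF.mem hx).1 ht), rfl⟩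

theorem smul_cen_smul {v : G} (hv : v ∈ P.cen) : t • v • Q = v • Q :=
  (smul_smul_eq_iff hF.ne hF.mem (cen_le hv)).2 (hF.commute_cen hv)

theorem axisKer_le_twoPoint : axisKer t ≤ twoPoint P Q := fun _ hk =>
  ⟨mem_axisKer.1 hk P hF.smul_left, mem_axisKer.1 hk Q hF.smul_right⟩

theorem mem_axisKer_iff {k : G} : k ∈ axisKer t ↔ k ∈ twoPoint P Q ∧ ∀ v ∈ P.cen, k * v = v * k := by
  refine ⟨fun hk => ⟨hF.axisKer_le_twoPoint hk, fun v hv => ?_⟩, fun hk => ?_⟩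
  · exact (smul_smul_eq_iff hF.ne (hF.axisKer_le_twoPoint hk) (cen_le hv)).1
      (mem_axisKer.1 hk _ (hF.smul_cen_smul hv))
  · refine mem_axisKer.2 fun R hR => ?_
    by_cases hRP : R = P
    · rw [hRP, smul_eq_left hk.1]
    · obtain ⟨v, hv, rfl⟩ := hF.exists_cen_smul_eq hRP hR
      exact (smul_smul_eq_iff hF.ne hk.1 (cen_le hv)).2 (hk.2 v hv)

theorem mem_axisKer_self : t ∈ axisKer t := mem_axisKer.2 fun _ h => h

theorem sq_eq_one {k : G} (hk : k ∈ twoPoint P Q) (h2 : k * k = 1) : k = 1 ∨ k = t := by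
  by_cases h1 : k = 1
  · exact Or.inl h1
  · exact Or.inr (hF.eq_of_isFrame ⟨hF.ne, hk, h2, h1⟩)

/-- An element of a two-point stabilizer centralizing a central element fixes all of the axis. -/
theorem mem_axisKer_of_commute {k v : G} (hk : k ∈ twoPoint P Q) (hv : v ∈ P.cen) (hv1 : v ≠ 1)
    (hc : k * v = v * k) : k ∈ axisKer t := by
  have h50 : k ^ 50 = 1 := by
    have h1 := Subgroup.orderOf_dvd_natCard (x := k) (Subgroup.centralizer {v})
      (Subgroup.mem_centralizer_singleton_iff.2 hc)
    rw [card_centralizer_cen P v hv hv1] at h1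
    have h2 := Nat.dvd_gcd h1
      (orderOf_dvd_of_pow_eq_one (pow_eq_one_of_mem_twoPoint hF.ne hk))
    exact orderOf_dvd_iff_pow_eq_one.1 (by norm_num at h2; exact h2)
  have h25 : k ^ 25 ∈ axisKer t := by
    rcases hF.sq_eq_one (pow_mem hk 25) (by rw [← pow_add, h50]) with e | e <;> rw [e]
    · exact one_mem _
    · exact hF.mem_axisKer_self
  have h26 : k ^ 26 ∈ axisKer t := hF.mem_axisKer_iff.2 ⟨pow_mem hk _, fun w hw =>
    commute_cen_of_pow_eq_one (smul_eq_left (pow_mem hk _)) (by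
      rw [← pow_mul, show 26 * 25 = 50 * 13 by norm_num, pow_mul, h50, one_pow]) hw⟩
  have h1 := mul_mem (inv_mem h25) h26
  have h2 : (k ^ 25)⁻¹ * k ^ 26 = k := by rw [pow_succ k 25, inv_mul_cancel_left]
  rwa [h2] at h1

theorem smul_eq_self_of_mem_axisKer {k : G} (hk : k ∈ axisKer t) (hk1 : k ≠ 1) (hR : k • R = R) :
    t • R = R := by
  by_cases hRP : R = P
  · rw [hRP, hF.smul_left]
  obtain ⟨x, hx, rfl⟩ := exists_mem_smul_eq hF.ne hRP
  have hkH := hF.axisKer_le_twoPoint hk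
  exact hF.smul_cen_smul (mem_cen_of_commute hF.ne hkH hk1 hx
    ((smul_smul_eq_iff hF.ne hkH hx).1 hR))

omit [Finite G] [IsSevenTI G] in
theorem of_smul_eq {P' Q' : Sylow 7 G} (hne : Q' ≠ P') (hP : t • P' = P') (hQ : t • Q' = Q') :
    IsFrame P' Q' t := ⟨hne, ⟨hP, hQ⟩, hF.mul_self, hF.ne_one⟩

theorem card_axisKer : Nat.card (axisKer t) = 50 := by
  obtain ⟨v, hv, hv1⟩ : ∃ v ∈ P.cen, v ≠ 1 := by
    have : Nontrivial P.cen := by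
      rw [← Finite.one_lt_card_iff_nontrivial, card_cen]
      norm_num
    obtain ⟨x, hx⟩ := exists_ne (1 : P.cen)
    exact ⟨x, x.2, fun e => hx (Subtype.ext e)⟩
  have hc : ∀ y : P × axisKer t, (y.1 * y.2 : G) ∈ Subgroup.centralizer {v} := fun y => by
    rw [Subgroup.mem_centralizer_singleton_iff, mul_assoc, (hF.mem_axisKer_iff.1 y.2.2).2 v hv,
      ← mul_assoc, commute_of_mem_cen hv y.1.2, mul_assoc]
  have h1 : Function.Bijective fun y : P × axisKer t =>
      (⟨y.1 * y.2, hc y⟩ : Subgroup.centralizer {v}) := by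
    constructor
    · rintro ⟨x, k⟩ ⟨y, l⟩ e
      have e' : (x : G) * k = y * l := congrArg Subtype.val e
      have hxy : (x : G) = y := by
        refine eq_of_smul_eq_smul hF.ne x.2 y.2 ?_
        have := congrArg (· • Q) e'
        simpa only [mul_smul, smul_eq_right (hF.axisKer_le_twoPoint k.2),
          smul_eq_right (hF.axisKer_le_twoPoint l.2)] using this
      rw [hxy] at e'
      exact Prod.ext (Subtype.ext hxy) (Subtype.ext (mul_left_cancel e'))
    · rintro ⟨g, hg⟩
      rw [Subgroup.mem_centralizer_singleton_iff] at hg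
      have hgP : g • P = P := by
        refine eq_of_mem _ _ v hv1 (Sylow.mem_smul_iff.2 ?_) (cen_le hv)
        rw [mul_assoc, ← hg, inv_mul_cancel_left]
        exact cen_le hv
      obtain ⟨x, hx, k, hk, rfl⟩ := exists_mul_of_smul_eq hF.ne hgP
      refine ⟨(⟨x, hx⟩, ⟨k, hF.mem_axisKer_of_commute hk hv hv1 ?_⟩), rfl⟩
      have h2 := commute_of_mem_cen hv hx
      rw [mul_assoc, ← mul_assoc v, ← h2, mul_assoc] at hg
      exact mul_left_cancel hg
  have h2 := Nat.card_eq_of_bijective _ h1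
  rw [Nat.card_prod, card_centralizer_cen P v hv hv1] at h2
  have h3 := card_sylow P
  change Nat.card P = _ at h3
  have h4 : Nat.card P * Nat.card (axisKer t) = 7 ^ 6 * 50 := h2
  rw [h3] at h4
  exact Nat.eq_of_mul_eq_mul_left (by norm_num) h4

theorem card_axis : Nat.card {R : Sylow 7 G // t • R = R ∧ R ≠ P} = 49 := by
  rw [← card_cen P]
  refine (Nat.card_eq_of_bijective (fun v : P.cen => ⟨(v : G) • Q, hF.smul_cen_smul v.2,
    smul_ne_left hF.ne (cen_le v.2)⟩) ⟨fun v w e => ?_, fun R => ?_⟩).symm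
  · exact Subtype.ext (eq_of_smul_eq_smul hF.ne (cen_le v.2) (cen_le w.2) (congrArg Subtype.val e))
  · obtain ⟨v, hv, e⟩ := hF.exists_cen_smul_eq R.2.2 R.2.1
    exact ⟨⟨v, hv⟩, Subtype.ext e⟩

/-- An involution commuting with `t`, but different from it, has no fixed point on the axis. -/
theorem smul_ne_of_commute {s : G} (hs2 : s * s = 1) (hs1 : s ≠ 1) (hst : s ≠ t)
    (hc : s * t = t * s) : s • P ≠ P := by
  intro hsP
  let T := {R : Sylow 7 G // t • R = R ∧ R ≠ P}
  let σf : T → T := fun R => ⟨s • R.1, by rw [← mul_smul, ← hc, mul_smul, R.2.1],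
    fun e => R.2.2 (by rw [← smul_left_cancel_iff s, e, hsP])⟩
  have hσ2 : Function.Involutive σf := fun R => Subtype.ext (by
    change s • s • R.1 = R.1
    rw [← mul_smul, hs2, one_smul])
  have := Fintype.ofFinite T
  have h2 : Fact (Nat.Prime 2) := ⟨Nat.prime_two⟩
  obtain ⟨R, hR⟩ := Equiv.Perm.exists_fixed_point_of_prime (p := 2) (n := 1)
    (by rw [← Nat.card_eq_fintype_card, hF.card_axis]; decide) (σ := hσ2.toPerm)
    (by rw [pow_one, sq]; exact Equiv.ext hσ2)
  have hR' : s • R.1 = R.1 := congrArg Subtype.val hR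
  exact hst ((hF.of_smul_eq R.2.2 hF.smul_left R.2.1).eq_of_isFrame ⟨R.2.2, ⟨hsP, hR'⟩, hs2, hs1⟩)

/-- The elements preserving the axis are those commuting with `t`. -/
theorem commute_of_smul_mem_axis {g : G} (hg : ∀ R : Sylow 7 G, t • R = R → t • g • R = g • R) :
    g * t = t * g := by
  have h1 := hF.conj (g := g)
  exact mul_inv_eq_iff_eq_mul.1 ((hF.of_smul_eq h1.ne (hg P hF.smul_left)
    (hg Q hF.smul_right)).eq_of_isFrame h1)

theorem commute_of_commute_mem {g k : G} (hk : k ∈ axisKer t) (hk1 : k ≠ 1) (hc : g * k = k * g) :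
    g * t = t * g := by
  refine hF.commute_of_smul_mem_axis fun R hR => ?_
  refine hF.smul_eq_self_of_mem_axisKer hk hk1 ?_
  rw [← mul_smul, ← hc, mul_smul, mem_axisKer.1 hk R hR]

omit hF [Finite G] [IsSevenTI G] in
theorem _root_.conj_mem_axisKer {g k : G} (hg : g * t = t * g) (hk : k ∈ axisKer t) :
    g * k * g⁻¹ ∈ axisKer t := by
  refine mem_axisKer.2 fun R hR => ?_
  have : t • g⁻¹ • R = g⁻¹ • R := by
    rw [← mul_smul, ← mul_inv_eq_iff_eq_mul.1 (show g⁻¹ * t * (g⁻¹)⁻¹ = t by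
      rw [inv_inv, mul_assoc, ← hg, inv_mul_cancel_left]), mul_smul, hR]
  rw [mul_smul, mul_smul, mem_axisKer.1 hk _ this, smul_inv_smul]

/-- The subgroup of order `25` of the pointwise stabilizer of the axis. -/
theorem exists_five : ∃ F : Subgroup G, Nat.card F = 25 ∧ ∀ k, k ∈ F ↔ k ∈ axisKer t ∧ k ^ 25 = 1 := by
  obtain ⟨F, hF1, hF2, hF3⟩ := Subgroup.exists_le_of_card_eq_two_mul (C := axisKer t) (m := 25)
    (by decide) (by rw [hF.card_axisKer])
  refine ⟨F, hF2, fun k => ⟨fun hk => ⟨hF1 hk, ?_⟩, fun hk => ?_⟩⟩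
  · rw [← hF2]
    exact congrArg Subtype.val (pow_card_eq_one' (x := (⟨k, hk⟩ : F)))
  · refine hF3 (Subgroup.zpowers k) (Subgroup.zpowers_le.2 hk.1) ?_ (Subgroup.mem_zpowers k)
    rw [Nat.card_zpowers]
    exact Odd.of_dvd_nat (by decide : Odd 25) (orderOf_dvd_of_pow_eq_one hk.2)

end IsFrame

end SevenTI

section SevenTI

open scoped Pointwise
open IsSevenTI

theorem IsPGroup.exists_forall_commute {G : Type*} [Group G] [Finite G] {p : ℕ} [Fact p.Prime]
    {H : Subgroup G} (hH : IsPGroup p H) (S : Set G) (hS : ∀ h ∈ H, ∀ x ∈ S, h * x * h⁻¹ ∈ S)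
    (hp : ¬ p ∣ Nat.card S) : ∃ x ∈ S, ∀ h ∈ H, h * x = x * h := by
  let : MulAction H S :=
    { smul := fun h x => ⟨h * x * h⁻¹, hS h h.2 x x.2⟩
      one_smul := fun x => Subtype.ext (by change ((1 : H) : G) * x * ((1 : H) : G)⁻¹ = x; simp)
      mul_smul := fun h k x => Subtype.ext (by
        change ((h * k : H) : G) * x * ((h * k : H) : G)⁻¹ = h * (k * x * (k : G)⁻¹) * (h : G)⁻¹
        simp [mul_assoc]) }
  obtain ⟨x, hx⟩ := hH.nonempty_fixed_point_of_prime_not_dvd_card S hp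
  exact ⟨x, x.2, fun h hh => mul_inv_eq_iff_eq_mul.1 (congrArg Subtype.val (hx ⟨h, hh⟩))⟩

variable {G : Type*} [Group G] [Finite G] [IsSevenTI G] {P Q R : Sylow 7 G} {t : G}

namespace IsFrame

variable (hF : IsFrame P Q t)

include hF

theorem mem_axisKer_of_pow_eq_one {k : G} (hk : k ∈ twoPoint P Q) (h25 : k ^ 25 = 1) :
    k ∈ axisKer t :=
  hF.mem_axisKer_iff.2 ⟨hk, fun _ hv => commute_cen_of_pow_eq_one (smul_eq_left hk) h25 hv⟩

theorem card_fixed : Nat.card {R : Sylow 7 G // t • R = R} = 50 := by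
  classical
  have := Fintype.ofFinite (Sylow 7 G)
  have h1 := hF.card_axis
  rw [Nat.card_eq_fintype_card, Fintype.card_subtype] at h1 ⊢
  rw [← Finset.filter_filter, Finset.filter_ne', Finset.card_erase_of_mem
    (by simpa using hF.smul_left)] at h1
  omega

theorem card_fixed_of_mem {k : G} (hk : k ∈ axisKer t) (hk1 : k ≠ 1) :
    Nat.card {R : Sylow 7 G // k • R = R} = 50 := by
  rw [← hF.card_fixed]
  exact Nat.card_congr (Equiv.subtypeEquivRight fun R =>
    ⟨hF.smul_eq_self_of_mem_axisKer hk hk1, mem_axisKer.1 hk R⟩)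

end IsFrame

/-- An element of `5`-power order fixing a point fixes the axis of an involution. -/
theorem exists_isFrame_of_pow_five {x : G} (hx : x ^ 5 ^ 4 = 1) (hP : x • P = P) :
    ∃ Q t, IsFrame P Q t ∧ x ∈ axisKer t ∧ x ^ 25 = 1 := by
  classical
  have h5 : Fact (Nat.Prime 5) := ⟨by norm_num⟩
  have := Fintype.ofFinite (Sylow 7 G)
  obtain ⟨Q, hQ, hQP⟩ := Equiv.Perm.exists_fixed_point_of_prime' (p := 5) (n := 4)
    (by rw [← Nat.card_eq_fintype_card, card_points]; norm_num)
    (σ := MulAction.toPermHom G (Sylow 7 G) x) (by rw [← map_pow, hx, map_one]) (a := P) hP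
  obtain ⟨t, ht⟩ := exists_isFrame hQP
  have hk : x ∈ twoPoint P Q := ⟨hP, hQ⟩
  have h25 : x ^ 25 = 1 := by
    have h2 := Nat.dvd_gcd (orderOf_dvd_of_pow_eq_one hx)
      (orderOf_dvd_of_pow_eq_one (pow_eq_one_of_mem_twoPoint hQP hk))
    exact orderOf_dvd_iff_pow_eq_one.1 (by norm_num at h2; exact h2)
  exact ⟨Q, t, ht, ht.mem_axisKer_of_pow_eq_one hk h25, h25⟩

/-- The number of nontrivial elements with fixed points in a Sylow `5`-subgroup. -/
theorem card_five_modEq (S : Subgroup G) (hS : Nat.card S = 5 ^ 4) :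
    Nat.card {x : G | x ∈ S ∧ x ≠ 1 ∧ ∃ R : Sylow 7 G, x • R = R} ≡ 2 [MOD 5] := by
  classical
  have := Fintype.ofFinite G
  have := Fintype.ofFinite (Sylow 7 G)
  have : Fintype (Quotient (MulAction.orbitRel S (Sylow 7 G))) := Fintype.ofFinite _
  have hx5 : ∀ x ∈ S, x ^ 5 ^ 4 = 1 := fun x hx => by
    rw [← hS]
    exact congrArg Subtype.val (pow_card_eq_one' (x := (⟨x, hx⟩ : S)))
  have hB := MulAction.sum_card_fixedBy_eq_card_orbits_mul_card_group S (Sylow 7 G)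
  rw [← Nat.card_eq_fintype_card (α := S), hS] at hB
  have h1 : ∀ x : S, Fintype.card (MulAction.fixedBy (Sylow 7 G) x) =
      (if x = 1 then 117650 else 0) +
        if (x : G) ∈ {x : G | x ∈ S ∧ x ≠ 1 ∧ ∃ R : Sylow 7 G, x • R = R} then 50 else 0 := by
    intro x
    rw [← Nat.card_eq_fintype_card]
    by_cases hx1 : x = 1
    · subst hx1
      rw [if_pos rfl, if_neg (by simp), add_zero, ← card_points (G := G)]
      exact Nat.card_congr (Equiv.subtypeUnivEquiv fun R => one_smul _ R)
    · rw [if_neg hx1, zero_add]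
      by_cases hR : ∃ R : Sylow 7 G, (x : G) • R = R
      · rw [if_pos ⟨x.2, fun e => hx1 (Subtype.ext e), hR⟩]
        obtain ⟨R, hR⟩ := hR
        obtain ⟨Q, t, ht, hxt, -⟩ := exists_isFrame_of_pow_five (hx5 x x.2) hR
        exact ht.card_fixed_of_mem hxt fun e => hx1 (Subtype.ext e)
      · rw [if_neg fun h => hR h.2.2]
        exact Nat.card_eq_zero.2 (Or.inl ⟨fun R => hR ⟨R.1, R.2⟩⟩)
  rw [Finset.sum_congr rfl fun x _ => h1 x, Finset.sum_add_distrib, Finset.sum_ite_eq' ,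
    if_pos (Finset.mem_univ _), ← Finset.sum_filter, Finset.sum_const, smul_eq_mul] at hB
  have h2 : Nat.card {x : G | x ∈ S ∧ x ≠ 1 ∧ ∃ R : Sylow 7 G, x • R = R} =
      (Finset.univ.filter fun x : S =>
        (x : G) ∈ {x : G | x ∈ S ∧ x ≠ 1 ∧ ∃ R : Sylow 7 G, x • R = R}).card := by
    rw [← Fintype.card_subtype, ← Nat.card_eq_fintype_card]
    exact Nat.card_congr ⟨fun x => ⟨⟨x, x.2.1⟩, x.2⟩, fun x => ⟨x.1, x.2⟩, fun _ => rfl,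
      fun _ => rfl⟩
  rw [h2, Nat.ModEq]
  omega

/-- There is an involution `w` commuting with, but different from `t`, which centralizes the
elements of order dividing `25` of the pointwise stabilizer of the axis of `t`. -/
theorem exists_commuting_involution (hG : Nat.card G = 2 ^ 6 * 3 * 5 ^ 4 * 7 ^ 6 * 13 * 181) :
    ∃ (P Q : Sylow 7 G) (t w : G), IsFrame P Q t ∧ w * w = 1 ∧ w ≠ 1 ∧ w ≠ t ∧ w * t = t * w ∧
      ∀ k ∈ axisKer t, k ^ 25 = 1 → w * k = k * w := by
  classical
  have h5 : Fact (Nat.Prime 5) := ⟨by norm_num⟩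
  obtain ⟨S, hS⟩ := Sylow.exists_subgroup_card_pow_prime (G := G) 5 (n := 4)
    (by rw [hG]; norm_num)
  have hSp : IsPGroup 5 S := IsPGroup.of_card hS
  have hx5 : ∀ x ∈ S, x ^ 5 ^ 4 = 1 := fun x hx => by
    rw [← hS]
    exact congrArg Subtype.val (pow_card_eq_one' (x := (⟨x, hx⟩ : S)))
  have hN := card_five_modEq S hS
  set X := {x : G | x ∈ S ∧ x ≠ 1 ∧ ∃ R : Sylow 7 G, x • R = R} with hX
  have hXc : ∀ h ∈ S, ∀ x ∈ X, h * x * h⁻¹ ∈ X := by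
    rintro h hh x ⟨hxS, hx1, R, hR⟩
    refine ⟨mul_mem (mul_mem hh hxS) (inv_mem hh), fun e => hx1 ?_, h • R, ?_⟩
    · rwa [mul_inv_eq_one, mul_eq_left] at e
    · rw [mul_smul, mul_smul, inv_smul_smul, hR]
  obtain ⟨x, ⟨hxS, hx1, P, hxP⟩, hxc⟩ := hSp.exists_forall_commute X hXc (fun h => by
    rw [← Nat.modEq_zero_iff_dvd] at h
    exact absurd (hN.symm.trans h) (by decide))
  obtain ⟨Q, t, ht, hxt, -⟩ := exists_isFrame_of_pow_five (hx5 x hxS) hxP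
  have hSt : ∀ h ∈ S, h * t = t * h := fun h hh => ht.commute_of_commute_mem hxt hx1 (hxc h hh)
  obtain ⟨F, hF25, hF⟩ := ht.exists_five
  have hSF : ∀ h ∈ S, ∀ k ∈ F, h * k * h⁻¹ ∈ F := fun h hh k hk => (hF _).2
    ⟨conj_mem_axisKer (hSt h hh) ((hF k).1 hk).1, by
      rw [conj_pow, ((hF k).1 hk).2, mul_one, mul_inv_cancel]⟩
  have hFS : F ≤ S := by
    have h1 : S ≤ Subgroup.normalizer (F : Set G) := fun h hh => by
      refine Subgroup.mem_normalizer_iff.2 fun k => ⟨hSF h hh k, fun hk => ?_⟩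
      have := hSF _ (inv_mem hh) _ hk
      rwa [inv_inv, mul_assoc, mul_assoc, mul_assoc, inv_mul_cancel, mul_one,
        inv_mul_cancel_left] at this
    have h2 := hSp.to_sup_of_normal_right' (IsPGroup.of_card (n := 2) hF25) h1
    obtain ⟨n, hn⟩ := IsPGroup.iff_card.1 h2
    have h3 : Nat.card ↥(S ⊔ F) ∣ Nat.card S := by
      rw [hn, hS]
      refine Nat.pow_dvd_pow 5 ?_
      have h4 : 5 ^ n ∣ 5 ^ 4 * (2 ^ 6 * 3 * 7 ^ 6 * 13 * 181) := by
        rw [← hn]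
        convert Subgroup.card_subgroup_dvd_card (S ⊔ F)
        rw [hG]
        norm_num
      exact (Nat.pow_dvd_pow_iff_le_right (by norm_num)).1
        ((Nat.Coprime.pow_left n (by norm_num)).dvd_of_dvd_mul_right h4)
    exact le_sup_right.trans (Subgroup.eq_of_le_of_card_ge le_sup_left
      (Nat.le_of_dvd Nat.card_pos h3)).ge
  have hFX : (F : Set G) \ {1} ⊆ X := fun k hk =>
    ⟨hFS hk.1, hk.2, P, mem_axisKer.1 ((hF k).1 hk.1).1 P ht.smul_left⟩
  have hcard : Nat.card ↥(X \ F) ≡ 3 [MOD 5] := by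
    have h1 : (F : Set G).ncard = 25 := hF25
    have h2 := Set.ncard_sdiff_singleton_add_one (s := (F : Set G)) (one_mem F)
    have h3 := Set.ncard_sdiff_add_ncard_of_subset hFX
    have h4 : X \ ((F : Set G) \ {1}) = X \ F := by
      ext y
      simp only [Set.mem_sdiff, Set.mem_singleton_iff, not_and, not_not]
      exact ⟨fun h => ⟨h.1, fun h' => h.1.2.1 (h.2 h')⟩, fun h => ⟨h.1, fun h' => absurd h' h.2⟩⟩
    rw [h4] at h3
    change X.ncard ≡ _ [MOD 5] at hN
    change (X \ F).ncard ≡ _ [MOD 5]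
    rw [Nat.ModEq] at *
    omega
  obtain ⟨y, ⟨⟨hyS, hy1, R, hyR⟩, hyF⟩, hyc⟩ := hSp.exists_forall_commute (X \ F)
    (fun h hh y hy => ⟨hXc h hh y hy.1, fun h' => hy.2 (by
      have := hSF _ (inv_mem hh) _ h'
      rwa [inv_inv, mul_assoc, mul_assoc, mul_assoc, inv_mul_cancel, mul_one,
        inv_mul_cancel_left] at this)⟩) (fun h => by
    rw [← Nat.modEq_zero_iff_dvd] at h
    exact absurd (hcard.symm.trans h) (by decide))
  obtain ⟨R', w, hw, hyw, hy25⟩ := exists_isFrame_of_pow_five (hx5 y hyS) hyR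
  have hwc : ∀ k ∈ F, w * k = k * w := fun k hk =>
    (hw.commute_of_commute_mem hyw hy1 (hyc k (hFS hk))).symm
  refine ⟨P, Q, t, w, ht, hw.mul_self, hw.ne_one, fun e => hyF ((hF y).2 ⟨e ▸ hyw, hy25⟩), ?_,
    fun k hk hk25 => hwc k ((hF k).2 ⟨hk, hk25⟩)⟩
  obtain ⟨k, hk, hk1⟩ : ∃ k ∈ F, k ≠ 1 := F.bot_or_exists_ne_one.resolve_left
    (fun e => by rw [e, Subgroup.card_bot] at hF25; norm_num at hF25)
  exact ht.commute_of_commute_mem ((hF k).1 hk).1 hk1 (hwc k hk)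

end SevenTI

section SevenTI

open scoped Pointwise
open IsSevenTI

variable {G : Type*} [Group G] [Finite G] [IsSevenTI G] {P Q R : Sylow 7 G} {t w : G}

namespace IsFrame

variable (hF : IsFrame P Q t)

include hF

theorem commute_axisKer {k l : G} (hk : k ∈ axisKer t) (hl : l ∈ axisKer t) : k * l = l * k := by
  have h5 : Fact (Nat.Prime 5) := ⟨by norm_num⟩
  obtain ⟨F, hF25, hFm⟩ := hF.exists_five
  have hcomm : ∀ a ∈ F, ∀ b ∈ F, a * b = b * a := fun a ha b hb =>
    congrArg Subtype.val ((IsPGroup.isMulCommutative_of_card_eq_prime_sq (p := 5)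
      (by rw [hF25]; norm_num)).is_comm.comm (⟨a, ha⟩ : F) ⟨b, hb⟩)
  have h50 : ∀ k ∈ axisKer t, k ^ 50 = 1 := fun k hk => by
    rw [← hF.card_axisKer]
    exact congrArg Subtype.val (pow_card_eq_one' (x := (⟨k, hk⟩ : axisKer t)))
  have hdec : ∀ k ∈ axisKer t, ∃ a ∈ F, k = a ∨ k = t * a := by
    intro k hk
    have hkH := hF.axisKer_le_twoPoint hk
    have h26 : k ^ 26 ∈ F := (hFm _).2 ⟨pow_mem hk _, by
      rw [← pow_mul, show 26 * 25 = 50 * 13 by norm_num, pow_mul, h50 k hk, one_pow]⟩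
    have h2 : k = (k ^ 25)⁻¹ * k ^ 26 := by rw [pow_succ k 25, inv_mul_cancel_left]
    refine ⟨_, h26, ?_⟩
    rcases hF.sq_eq_one (pow_mem hkH 25) (by rw [← pow_add, h50 k hk]) with e | e <;>
      rw [e] at h2
    · exact Or.inl (by rwa [inv_one, one_mul] at h2)
    · exact Or.inr (by rwa [hF.inv_eq] at h2)
  have ht : ∀ a ∈ F, a * t = t * a := fun a ha =>
    hF.commute (hF.axisKer_le_twoPoint ((hFm a).1 ha).1)
  obtain ⟨a, ha, hka⟩ := hdec k hk
  obtain ⟨b, hb, hlb⟩ := hdec l hl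
  have h1 : Commute a b := hcomm a ha b hb
  have h2 : Commute a t := ht a ha
  have h3 : Commute b t := ht b hb
  change Commute k l
  rcases hka with rfl | rfl <;> rcases hlb with rfl | rfl
  · exact h1
  · exact h2.mul_right h1
  · exact h3.symm.mul_left h1
  · exact ((Commute.refl t).mul_right h3.symm).mul_left (h2.mul_right h1)

theorem mem_axisKer_of_smul_eq {k : G} (hP : k • P = P) (hQ : k • Q = Q) (hRP : R ≠ P) (hRQ : R ≠ Q)
    (htR : t • R = R) (hR : k • R = R) : k ∈ axisKer t := by
  obtain ⟨v, hv, rfl⟩ := hF.exists_cen_smul_eq hRP htR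
  exact hF.mem_axisKer_of_commute ⟨hP, hQ⟩ hv (fun e => hRQ (by rw [e, one_smul]))
    ((smul_smul_eq_iff hF.ne ⟨hP, hQ⟩ (cen_le hv)).1 hR)

theorem exists_ne_one_mem_cen : ∃ v ∈ P.cen, v ≠ 1 := by
  have : Nontrivial P.cen := by
    rw [← Finite.one_lt_card_iff_nontrivial, card_cen]
    norm_num
  obtain ⟨x, hx⟩ := exists_ne (1 : P.cen)
  exact ⟨x, x.2, fun e => hx (Subtype.ext e)⟩

/-- An element whose square, but not itself, fixes the axis pointwise inverts the centre. -/
theorem conj_eq_inv {y v : G} (hy : y ∈ twoPoint P Q) (hy1 : y ∉ axisKer t)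
    (hy2 : y * y ∈ axisKer t) (hv : v ∈ P.cen) : y * v * y⁻¹ = v⁻¹ := by
  have hyv := conj_mem_cen_of_smul_eq (smul_eq_left hy) hv
  have hc := commute_of_mem_cen hv (cen_le hyv)
  have h1 : y * (v * (y * v * y⁻¹)) = v * (y * v * y⁻¹) * y := by
    have h2 : y * y * v = v * (y * y) := (hF.mem_axisKer_iff.1 hy2).2 v hv
    calc y * (v * (y * v * y⁻¹)) = y * v * y⁻¹ * (y * y * v) * y⁻¹ := by group
      _ = y * v * y⁻¹ * v * y := by rw [h2]; group
      _ = _ := by rw [hc]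
  by_contra hne
  refine hy1 (hF.mem_axisKer_of_commute hy (mul_mem hv hyv) (fun e => hne ?_) h1)
  exact eq_inv_of_mul_eq_one_right e

theorem exists_conj_eq_inv : ∃ y ∈ twoPoint P Q, y ∉ axisKer t ∧ y * y ∈ axisKer t := by
  obtain ⟨v, hv, hv1⟩ := hF.exists_ne_one_mem_cen
  obtain ⟨y, hy, hyv⟩ := exists_conj_cen hF.ne hv hv1 (inv_mem hv) (inv_ne_one.2 hv1)
  have hyv' : y * v = v⁻¹ * y := mul_inv_eq_iff_eq_mul.1 hyv
  refine ⟨y, hy, fun h => hv1 ?_, hF.mem_axisKer_of_commute (mul_mem hy hy) hv hv1 ?_⟩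
  · have h1 := (hF.mem_axisKer_iff.1 h).2 v hv
    rw [h1] at hyv'
    have h2 : v * v = 1 := by
      rw [← mul_inv_eq_one, inv_inv, mul_assoc] at hyv
      have : v * y = v⁻¹ * y := hyv'
      rw [mul_left_inj] at this
      rw [← eq_inv_iff_mul_eq_one]
      exact this
    have h3 : v ^ 49 = 1 := by
      rw [← card_cen P]
      exact congrArg Subtype.val (pow_card_eq_one' (x := (⟨v, hv⟩ : P.cen)))
    rw [show 49 = 2 * 24 + 1 by norm_num, pow_succ, pow_mul, sq, h2, one_pow, one_mul] at h3
    exact h3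
  · have h1 := conj_inv (a := v) (b := y)
    rw [hyv, inv_inv] at h1
    rw [mul_assoc, hyv', ← mul_assoc, mul_inv_eq_iff_eq_mul.1 h1.symm, mul_assoc]

omit hF [Finite G] [IsSevenTI G] in
/-- Elements commuting with `t` normalize the centralizer of the pointwise stabilizer. -/
theorem _root_.conj_mem_centralizer_axisKer {t y z : G} (hy : y * t = t * y)
    (hz : z ∈ Subgroup.centralizer (axisKer t : Set G)) :
    y * z * y⁻¹ ∈ Subgroup.centralizer (axisKer t : Set G) := by
  rw [Subgroup.mem_centralizer_iff] at hz ⊢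
  intro k hk
  have h1 := hz _ (conj_mem_axisKer (g := y⁻¹) (by
    rw [inv_mul_eq_iff_eq_mul, ← mul_assoc, hy, mul_inv_cancel_right]) hk)
  rw [inv_inv] at h1
  calc k * (y * z * y⁻¹) = y * (y⁻¹ * k * y * z) * y⁻¹ := by group
    _ = _ := by rw [h1]; group

end IsFrame

/-- A frame together with an involution moving `P` to `Q` and centralizing the pointwise
stabilizer of the axis. -/
structure IsBase (P : Sylow 7 G) (t w : G) : Prop where
  frame : IsFrame P (w • P) t
  mul_self : w * w = 1
  ne_one : w ≠ 1
  ne : w ≠ t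
  commute : w * t = t * w
  commute_five : ∀ k ∈ axisKer t, k ^ 25 = 1 → w * k = k * w

theorem exists_isBase (hG : Nat.card G = 2 ^ 6 * 3 * 5 ^ 4 * 7 ^ 6 * 13 * 181) :
    ∃ (P : Sylow 7 G) (t w : G), IsBase P t w := by
  obtain ⟨P, Q, t, w, hF, h1, h2, h3, h4, h5⟩ := exists_commuting_involution hG
  exact ⟨P, t, w, hF.of_smul_eq (hF.smul_ne_of_commute h1 h2 h3 h4) hF.smul_left
    (by rw [← mul_smul, ← h4, mul_smul, hF.smul_left]), h1, h2, h3, h4, h5⟩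

namespace IsBase

variable (hB : IsBase P t w)

include hB

theorem inv_eq : w⁻¹ = w := inv_eq_of_mul_eq_one_left hB.mul_self

omit [Finite G] [IsSevenTI G] in
theorem smul_smul (R : Sylow 7 G) : w • w • R = R := by rw [← mul_smul, hB.mul_self, one_smul]

theorem smul_axis (h : t • R = R) : t • w • R = w • R := by
  rw [← mul_smul, ← hB.commute, mul_smul, h]

theorem smul_ne (h : t • R = R) : w • R ≠ R := by
  by_cases hRP : R = P
  · exact hRP ▸ hB.frame.ne
  · exact (hB.frame.of_smul_eq (Ne.symm hRP) h hB.frame.smul_left).smul_ne_of_commute hB.mul_self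
      hB.ne_one hB.ne hB.commute

theorem commute_axisKer {k : G} (hk : k ∈ axisKer t) : w * k = k * w := by
  have hkH := hB.frame.axisKer_le_twoPoint hk
  have h50 : k ^ 50 = 1 := by
    rw [← hB.frame.card_axisKer]
    exact congrArg Subtype.val (pow_card_eq_one' (x := (⟨k, hk⟩ : axisKer t)))
  have h26 : Commute w (k ^ 26) := hB.commute_five _ (pow_mem hk _) (by
      rw [← pow_mul, show 26 * 25 = 50 * 13 by norm_num, pow_mul, h50, one_pow])
  have h25 : Commute w (k ^ 25) := by
    rcases hB.frame.sq_eq_one (pow_mem hkH 25) (by rw [← pow_add, h50]) with e | e <;> rw [e]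
    · exact Commute.one_right w
    · exact hB.commute
  have h2 : k = (k ^ 25)⁻¹ * k ^ 26 := by rw [pow_succ k 25, inv_mul_cancel_left]
  have := h25.inv_right.mul_right h26
  rwa [← h2] at this

theorem conj_mem_twoPoint {h : G} (hh : h ∈ twoPoint P (w • P)) :
    w * h * w ∈ twoPoint P (w • P) :=
  ⟨by change (w * h * w) • P = P; rw [mul_smul, mul_smul, smul_eq_right hh, hB.smul_smul],
    by
      change (w * h * w) • w • P = w • P
      rw [mul_smul, mul_smul, hB.smul_smul, smul_eq_left hh]⟩

/-- The elements `h` of the two-point stabilizer for which `w * h` is conjugate, by an element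
centralizing the pointwise stabilizer of the axis, to an element inverting the centre, and fixes
a point of the axis. -/
theorem exists_mul_smul_eq {y p : G} (hy : y ∈ twoPoint P (w • P)) (hy1 : y ∉ axisKer t)
    (hy2 : y * y ∈ axisKer t) (hp : p ∈ P.cen) (hp1 : p ≠ 1) :
    ∃ h ∈ twoPoint P (w • P), h * y⁻¹ ∈ Subgroup.centralizer (axisKer t : Set G) ∧
      (w * h) • p • w • P = p • w • P := by
  have hF := hB.frame
  have hb49 : ∀ b ∈ P.cen, b ^ 49 = 1 := fun b hb => by
    rw [← card_cen P]
    exact congrArg Subtype.val (pow_card_eq_one' (x := (⟨b, hb⟩ : P.cen)))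
  have hpP : p • P = P := Sylow.smul_eq_of_mem (cen_le hp)
  have hpi : p⁻¹ • P = P := Sylow.smul_eq_of_mem (inv_mem (cen_le hp))
  obtain ⟨b, hb, hbe⟩ : ∃ b ∈ P.cen, b • w • P = w • p⁻¹ • w • P := by
    refine hF.exists_cen_smul_eq (fun e => hp1 ?_) (hB.smul_axis (hF.smul_cen_smul (inv_mem hp)))
    have e' : p⁻¹ • w • P = (1 : G) • w • P := by
      rw [← smul_left_cancel_iff w, e, one_smul, hB.smul_smul]
    exact inv_eq_one.1 (eq_of_smul_eq_smul hF.ne (inv_mem (cen_le hp)) (one_mem _) e')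
  obtain ⟨m, hm, hmb⟩ : ∃ m ∈ P.cen, m * m = b := ⟨b ^ 25, pow_mem hb _, by
    rw [← pow_add, show 25 + 25 = 49 + 1 by norm_num, pow_succ, hb49 b hb, one_mul]⟩
  have hmP : m • P = P := Sylow.smul_eq_of_mem (cen_le hm)
  have hmi : m⁻¹ • P = P := Sylow.smul_eq_of_mem (inv_mem (cen_le hm))
  have hym : y * m = m⁻¹ * y := mul_inv_eq_iff_eq_mul.1 (hF.conj_eq_inv hy hy1 hy2 hm)
  have hym' : y * m⁻¹ = m * y := by
    have := mul_inv_eq_iff_eq_mul.1 (hF.conj_eq_inv hy hy1 hy2 (inv_mem hm))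
    rwa [inv_inv] at this
  have hyP := smul_eq_left hy
  have hyQ := smul_eq_right hy
  have hmQ : m • m • w • P = w • p⁻¹ • w • P := by rw [← mul_smul, hmb, hbe]
  have hZ : ∀ v ∈ P.cen, v ∈ Subgroup.centralizer (axisKer t : Set G) := fun v hv =>
    Subgroup.mem_centralizer_iff.2 fun k hk => (hF.mem_axisKer_iff.1 hk).2 v hv
  have hwZ : w ∈ Subgroup.centralizer (axisKer t : Set G) :=
    Subgroup.mem_centralizer_iff.2 fun k hk => (hB.commute_axisKer hk).symm
  have hc : p * w * m ∈ Subgroup.centralizer (axisKer t : Set G) :=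
    mul_mem (mul_mem (hZ p hp) hwZ) (hZ m hm)
  have hci : (p * w * m)⁻¹ = m⁻¹ * w * p⁻¹ := by
    rw [mul_inv_rev, mul_inv_rev, hB.inv_eq, mul_assoc]
  refine ⟨w * ((p * w * m) * y * (p * w * m)⁻¹), ⟨?_, ?_⟩, ?_, ?_⟩
  · change (w * ((p * w * m) * y * (p * w * m)⁻¹)) • P = P
    rw [hci]
    simp only [mul_smul, hpi]
    rw [← mul_smul y, hym', mul_smul, hyQ, hmQ, hB.smul_smul, smul_inv_smul, hB.smul_smul]
  · change (w * ((p * w * m) * y * (p * w * m)⁻¹)) • w • P = w • P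
    rw [hci]
    simp only [mul_smul]
    rw [← hmQ, inv_smul_smul, ← mul_smul y, hym, mul_smul, hyQ, smul_inv_smul, hB.smul_smul, hpP]
  · have h1 : w * ((p * w * m) * y * (p * w * m)⁻¹) * y⁻¹ =
        w * (p * w * m) * (y * (p * w * m)⁻¹ * y⁻¹) := by group
    rw [h1]
    exact mul_mem (mul_mem hwZ hc) (conj_mem_centralizer_axisKer (hF.commute hy) (inv_mem hc))
  · rw [← mul_assoc, hB.mul_self, one_mul, hci]
    simp only [mul_smul, inv_smul_smul, hB.smul_smul, hmi, hyP, hmP]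

end IsBase

end SevenTI

section SevenTI

open scoped Pointwise
open IsSevenTI

variable {G : Type*} [Group G] [Finite G] [IsSevenTI G] {P Q R : Sylow 7 G} {t w : G}

namespace IsBase

variable (hB : IsBase P t w)

include hB

theorem notMem_axisKer {h : G} (hR : t • R = R) (hw : (w * h) • R = R) : h ∉ axisKer t := fun hk =>
  hB.smul_ne hR (by rwa [mul_smul, mem_axisKer.1 hk R hR] at hw)

/-- A count of the elements `h` of a coset for which `w * h` fixes a point of the axis. -/
theorem le_ncard {y : G} (hy : y ∈ twoPoint P (w • P)) (hy1 : y ∉ axisKer t)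
    (hy2 : y * y ∈ axisKer t) :
    1200 ≤ {h : G | h ∈ twoPoint P (w • P) ∧ h * y⁻¹ ∈ Subgroup.centralizer (axisKer t : Set G) ∧
      ∃ R : Sylow 7 G, R ≠ P ∧ R ≠ w • P ∧ t • R = R ∧ (w * h) • R = R}.ncard := by
  classical
  have := Fintype.ofFinite G
  have hF := hB.frame
  set Y := {h : G | h ∈ twoPoint P (w • P) ∧ h * y⁻¹ ∈ Subgroup.centralizer (axisKer t : Set G) ∧
      ∃ R : Sylow 7 G, R ≠ P ∧ R ≠ w • P ∧ t • R = R ∧ (w * h) • R = R} with hY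
  set S : Finset G := (P.cen : Set G).toFinset.erase 1 with hS
  have hScard : S.card = 48 := by
    rw [Finset.card_erase_of_mem (by simpa using one_mem P.cen), ← Set.ncard_eq_toFinset_card']
    change Nat.card P.cen - 1 = 48
    rw [card_cen]
  have hmS : ∀ {p}, p ∈ S ↔ p ≠ 1 ∧ p ∈ P.cen := by simp [hS]
  have hpt : ∀ {p}, p ∈ P.cen → p ≠ 1 → p • w • P ≠ P ∧ p • w • P ≠ w • P ∧
      t • p • w • P = p • w • P := fun {p} hp hp1 =>
    ⟨smul_ne_left hF.ne (cen_le hp), fun e => hp1 (eq_of_smul_eq_smul hF.ne (cen_le hp) (one_mem _)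
      (by rw [e, one_smul])), hF.smul_cen_smul hp⟩
  have hcount := Finset.card_mul_le_card_mul (s := S) (t := Y.toFinset) (m := 50) (n := 2)
    (fun p h => (w * h) • p • w • P = p • w • P) ?_ ?_
  · rw [hScard, ← Set.ncard_eq_toFinset_card'] at hcount
    omega
  · intro p hp
    obtain ⟨hp1, hp⟩ := hmS.1 hp
    obtain ⟨h, hh, hhy, hhp⟩ := hB.exists_mul_smul_eq hy hy1 hy2 hp hp1
    obtain ⟨h1, h2, h3⟩ := hpt hp hp1
    rw [← hF.card_axisKer]
    have hK : Nat.card (axisKer t) = (axisKer t : Set G).toFinset.card := by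
      rw [← Set.ncard_eq_toFinset_card']
      rfl
    rw [hK, ← Finset.card_image_of_injective _ (mul_right_injective h)]
    refine Finset.card_le_card fun g hg => ?_
    obtain ⟨k, hk, rfl⟩ := Finset.mem_image.1 hg
    have hk' : k ∈ axisKer t := by simpa using hk
    have hr : (w * (h * k)) • p • w • P = p • w • P := by
      rw [← mul_assoc, mul_smul, mem_axisKer.1 hk' _ h3, hhp]
    refine (Finset.mem_bipartiteAbove _).2 ⟨Set.mem_toFinset.2 ⟨mul_mem hh
      (hF.axisKer_le_twoPoint hk'), ?_, _, h1, h2, h3, hr⟩, hr⟩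
    have e : h * k * y⁻¹ = h * y⁻¹ * (y * k * y⁻¹) := by group
    rw [e]
    refine mul_mem hhy (Subgroup.mem_centralizer_iff.2 fun l hl => ?_)
    exact hF.commute_axisKer hl (conj_mem_axisKer (hF.commute hy) hk')
  · intro h hh
    obtain ⟨hh, -⟩ := Set.mem_toFinset.1 hh
    by_contra! hcon
    obtain ⟨a, b, c, ha, hb, hc, hab, hac, hbc⟩ := Finset.two_lt_card_iff.1 hcon
    obtain ⟨ha, har⟩ := (Finset.mem_bipartiteBelow _).1 ha
    obtain ⟨hb, hbr⟩ := (Finset.mem_bipartiteBelow _).1 hb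
    obtain ⟨hc, hcr⟩ := (Finset.mem_bipartiteBelow _).1 hc
    have hinj : ∀ {a b}, a ∈ S → b ∈ S → a ≠ b → a • w • P ≠ b • w • P := fun ha hb hab e =>
      hab (eq_of_smul_eq_smul hF.ne (cen_le (hmS.1 ha).2) (cen_le (hmS.1 hb).2) e)
    have hat := (hpt (hmS.1 ha).2 (hmS.1 ha).1).2.2
    have hbt := (hpt (hmS.1 hb).2 (hmS.1 hb).1).2.2
    have hct := (hpt (hmS.1 hc).2 (hmS.1 hc).1).2.2
    have hk := (hF.of_smul_eq (hinj hb ha (Ne.symm hab)) hat hbt).mem_axisKer_of_smul_eq har hbr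
      (hinj hc ha (Ne.symm hac)) (hinj hc hb (Ne.symm hbc)) hct hcr
    have := mem_axisKer.1 hk P hF.smul_left
    rw [mul_smul, smul_eq_left hh] at this
    exact hF.ne this

theorem twoPoint_le_centralizer :
    twoPoint P (w • P) ≤ Subgroup.centralizer (axisKer t : Set G) := by
  classical
  have hF := hB.frame
  obtain ⟨y, hy, hy1, hy2⟩ := hF.exists_conj_eq_inv
  have hN := hB.le_ncard hy hy1 hy2
  set Y := {h : G | h ∈ twoPoint P (w • P) ∧ h * y⁻¹ ∈ Subgroup.centralizer (axisKer t : Set G) ∧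
      ∃ R : Sylow 7 G, R ≠ P ∧ R ≠ w • P ∧ t • R = R ∧ (w * h) • R = R} with hY
  set H1 := twoPoint P (w • P) ⊓ Subgroup.centralizer (axisKer t : Set G) with hH1
  have hK : axisKer t ≤ H1 := fun k hk => ⟨hF.axisKer_le_twoPoint hk,
    Subgroup.mem_centralizer_iff.2 fun l hl => hF.commute_axisKer hl hk⟩
  have h1 : 1200 ≤ Nat.card H1 := hN.trans (by
    change _ ≤ (H1 : Set G).ncard
    exact Set.ncard_le_ncard_of_injOn (· * y⁻¹) (fun h hh =>
        Subgroup.mem_inf.2 ⟨mul_mem hh.1 (inv_mem hy), hh.2.1⟩)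
      (mul_left_injective y⁻¹).injOn)
  have h2 : Nat.card H1 ∣ 2400 := by
    rw [← card_twoPoint hF.ne]
    exact Subgroup.card_dvd_of_le inf_le_left
  have h16 : 16 ∣ Nat.card H1 := by
    obtain ⟨d, hd⟩ := h2
    have : d ≤ 2 := by
      by_contra! hd2
      have := Nat.mul_le_mul h1 hd2
      omega
    interval_cases d <;> omega
  have hyH : y ∈ H1 := by
    have h2p : Fact (Nat.Prime 2) := ⟨Nat.prime_two⟩
    obtain ⟨S, hS⟩ := Sylow.exists_subgroup_card_pow_prime (G := H1) 2 (n := 4) h16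
    obtain ⟨x, hxS, hxK⟩ : ∃ x ∈ S, (x : G) ∉ axisKer t := by
      by_contra! hcon
      have h3 : S.map H1.subtype ≤ axisKer t := by
        rintro _ ⟨x, hx, rfl⟩
        exact hcon x hx
      have h4 := Subgroup.card_dvd_of_le h3
      rw [Subgroup.card_map_of_injective H1.subtype_injective, hS, hF.card_axisKer] at h4
      norm_num at h4
    have hx16 : ∃ n, (x : G) ^ 2 ^ n ∈ axisKer t := ⟨4, by
      rw [← hS]
      have := congrArg (fun z : S => ((z : H1) : G)) (pow_card_eq_one' (x := (⟨x, hxS⟩ : S)))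
      exact (show (x : G) ^ Nat.card S = 1 from this) ▸ one_mem _⟩
    obtain ⟨n, hn⟩ : ∃ n, Nat.find hx16 = n + 1 := Nat.exists_eq_succ_of_ne_zero fun h0 => hxK (by
      have := Nat.find_spec hx16
      rwa [h0, pow_zero, pow_one] at this)
    have hn1 : (x : G) ^ 2 ^ n ∉ axisKer t := Nat.find_min hx16 (by omega)
    have hn2 := Nat.find_spec hx16
    rw [hn, pow_succ, pow_mul, sq] at hn2
    have hz := pow_mem x.2 (2 ^ n)
    set z := (x : G) ^ 2 ^ n
    have h3 : z⁻¹ * y ∈ axisKer t := by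
      refine hF.mem_axisKer_iff.2 ⟨mul_mem (inv_mem hz.1) hy, fun v hv => ?_⟩
      have e1 := hF.conj_eq_inv hy hy1 hy2 hv
      have e2 := hF.conj_eq_inv hz.1 hn1 hn2 hv
      have e3 : z⁻¹ * y * v * (z⁻¹ * y)⁻¹ = z⁻¹ * (y * v * y⁻¹) * z := by group
      exact mul_inv_eq_iff_eq_mul.1 (by rw [e3, e1, ← e2]; group)
    have := mul_mem hz (hK h3)
    rwa [mul_inv_cancel_left] at this
  have h3 : 1250 ≤ Nat.card H1 := by
    have h4 : Y ∪ axisKer t ⊆ H1 := by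
      rintro h (hh | hh)
      · refine ⟨hh.1, ?_⟩
        have := mul_mem hh.2.1 hyH.2
        rwa [inv_mul_cancel_right] at this
      · exact hK hh
    have h5 := Set.ncard_le_ncard h4
    rw [Set.ncard_union_eq (Set.disjoint_left.2 fun h hh => by
      obtain ⟨-, -, R, -, -, h6, h7⟩ := hh
      exact hB.notMem_axisKer h6 h7)] at h5
    have h6 : (axisKer t : Set G).ncard = 50 := hF.card_axisKer
    change _ ≤ Nat.card H1 at h5
    omega
  have h4 : H1 = twoPoint P (w • P) := Subgroup.eq_of_le_of_card_ge inf_le_left (by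
    rw [card_twoPoint hF.ne]
    obtain ⟨d, hd⟩ := h2
    have : d ≤ 1 := by
      by_contra! hd2
      have := Nat.mul_le_mul h3 hd2
      omega
    interval_cases d <;> omega)
  exact h4 ▸ inf_le_right

theorem commute_twoPoint {h k : G} (hh : h ∈ twoPoint P (w • P)) (hk : k ∈ axisKer t) :
    h * k = k * h :=
  (Subgroup.mem_centralizer_iff.1 (hB.twoPoint_le_centralizer hh) k hk).symm

end IsBase

end SevenTI

instance factPrimeFive : Fact (Nat.Prime 5) := ⟨by norm_num⟩

/-- The field with `2401` elements. -/
abbrev F2401 := GaloisField 7 4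

theorem natCard_F2401 : Nat.card F2401 = 2401 := by
  rw [GaloisField.card 7 4 (by norm_num)]
  norm_num

section RegularAction

variable {M H : Type*} [AddCommGroup M] [Finite M] [Group H] [Finite H] (φ : H →* AddMonoid.End M)

/-- A fixed-point-free automorphism of order five of an abelian group of order `7 ^ 4` acts
irreducibly. -/
theorem AddSubgroup.eq_bot_or_eq_top_of_pow_five (hM : Nat.card M = 2401) {f : AddMonoid.End M}
    (hf5 : f ^ 5 = 1) (hf : ∀ m, f m = m → m = 0) {K : AddSubgroup M} (hK : ∀ m ∈ K, f m ∈ K) :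
    K = ⊥ ∨ K = ⊤ := by
  classical
  let g : Function.End K := fun m => ⟨f m, hK m m.2⟩
  have hpow : ∀ n : ℕ, ∀ m : K, ((g ^ n) m : M) = (f ^ n) m := by
    intro n
    induction n with
    | zero => intro m; rfl
    | succ n ih =>
      intro m
      rw [pow_succ', pow_succ']
      change f ((g ^ n) m : M) = f ((f ^ n) m)
      rw [ih]
  have hg : g ^ 5 ^ 1 = 1 := by
    funext m
    refine Subtype.ext ?_
    rw [hpow, pow_one, hf5]
    rfl
  have := Fintype.ofFinite K
  have hfix := Equiv.Perm.card_fixedPoints_modEq hg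
  have h1 : Fintype.card g.fixedPoints = 1 := by
    rw [Fintype.card_eq_one_iff]
    refine ⟨⟨0, Subtype.ext (map_zero f)⟩, fun m => Subtype.ext (Subtype.ext ?_)⟩
    exact hf _ (congrArg Subtype.val m.2)
  rw [h1, ← Nat.card_eq_fintype_card] at hfix
  obtain ⟨j, hj, hj'⟩ := (Nat.dvd_prime_pow (p := 7) (m := 4) (by norm_num)).1
    ((by norm_num : 2401 = 7 ^ 4) ▸ hM ▸ AddSubgroup.card_addSubgroup_dvd_card K)
  rw [hj'] at hfix
  have hj2 : j = 0 ∨ j = 4 := by interval_cases j <;> revert hfix <;> decide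
  rcases hj2 with rfl | rfl
  · exact Or.inl (AddSubgroup.eq_bot_of_card_eq K (by rw [hj', pow_zero]))
  · exact Or.inr (AddSubgroup.eq_top_of_card_eq K (by rw [hj', hM]; norm_num))

theorem AddMonoid.End.injective_of_commute (hM : Nat.card M = 2401) {f d : AddMonoid.End M}
    (hf5 : f ^ 5 = 1) (hf : ∀ m, f m = m → m = 0) (hd : f * d = d * f) (hd0 : d ≠ 0) :
    Function.Injective d := by
  have hmK : ∀ {m}, m ∈ AddMonoidHom.ker d ↔ d m = 0 := AddMonoidHom.mem_ker
  have hker : ∀ m ∈ AddMonoidHom.ker d, f m ∈ AddMonoidHom.ker d := fun m hm => by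
    have := DFunLike.congr_fun hd m
    change f (d m) = d (f m) at this
    rw [hmK, ← this, hmK.1 hm, map_zero]
  rcases AddSubgroup.eq_bot_or_eq_top_of_pow_five hM hf5 hf hker with h | h
  · exact (AddMonoidHom.ker_eq_bot_iff d).1 h
  · exact absurd (AddMonoidHom.ext fun m => hmK.1 (h ▸ AddSubgroup.mem_top m)) hd0

/-- A group of order `2400` acting freely on an abelian group of order `2401`, with a central
element of order five, acts as the multiplicative group of a field. -/
theorem exists_field_model (hM : Nat.card M = 2401) (hH : Nat.card H = 2400)
    (hfix : ∀ h, h ≠ 1 → ∀ m, φ h m = m → m = 0) {f : H} (hf5 : f ^ 5 = 1) (hf1 : f ≠ 1)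
    (hf : ∀ h, f * h = h * f) :
    ∃ (e : M ≃+ F2401) (c : H ≃* F2401ˣ), ∀ h m, e (φ h m) = c h * e m := by
  classical
  set D : Subring (AddMonoid.End M) := Subring.centralizer {φ f} with hD
  have hmD : ∀ {d}, d ∈ D ↔ φ f * d = d * φ f := by
    intro d
    rw [hD, Subring.mem_centralizer_iff]
    simp
  have hinj : ∀ d : D, d ≠ 0 → Function.Injective (d : AddMonoid.End M) := fun d hd =>
    AddMonoid.End.injective_of_commute hM (by rw [← map_pow, hf5, map_one]) (hfix f hf1)
      (hmD.1 d.2) (fun e => hd (Subtype.ext e))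
  have : Nontrivial M := by
    rw [← Finite.one_lt_card_iff_nontrivial, hM]
    norm_num
  obtain ⟨m0, hm0⟩ := exists_ne (0 : M)
  have : Finite (AddMonoid.End M) := Finite.of_injective (fun d => (d : M → M))
    DFunLike.coe_injective
  have : Finite D := Finite.of_injective (fun d : D => (d : AddMonoid.End M))
    Subtype.val_injective
  have : Nontrivial D := ⟨0, 1, fun e => hm0 (by
    have := DFunLike.congr_fun (congrArg Subtype.val e) m0
    exact this.symm)⟩
  have : NoZeroDivisors D := ⟨fun {a b} hab => by
    by_contra! h
    obtain ⟨m, hm⟩ : ∃ m, (b : AddMonoid.End M) m ≠ 0 := by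
      by_contra! hb
      exact h.2 (Subtype.ext (AddMonoidHom.ext hb))
    refine hm (hinj a h.1 ?_)
    have := DFunLike.congr_fun (congrArg Subtype.val hab) m
    rw [map_zero]
    exact this⟩
  have : IsDomain D := NoZeroDivisors.to_isDomain D
  let : Field D := (Finite.isDomain_to_isField D).toField
  let ψ : H →* D := φ.codRestrict D fun h => hmD.2 (by rw [← map_mul, hf, map_mul])
  have hψinj : Function.Injective ψ := by
    rw [injective_iff_map_eq_one]
    intro h hh
    by_contra h1
    refine hm0 (hfix h h1 m0 ?_)
    exact DFunLike.congr_fun (congrArg Subtype.val hh) m0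
  let ev : D →+ M :=
    { toFun := fun d => (d : AddMonoid.End M) m0
      map_zero' := rfl
      map_add' := fun _ _ => rfl }
  have hev : Function.Injective ev := by
    rw [injective_iff_map_eq_zero]
    intro d hd
    by_contra h
    exact hm0 (hinj d h (hd.trans (map_zero _).symm))
  have hunit : Function.Injective ψ.toHomUnits := fun a b e => hψinj (by
    have := congrArg Units.val e
    simpa using this)
  have hcard1 : 2400 ≤ Nat.card Dˣ := hH ▸ Nat.card_le_card_of_injective _ hunit
  have hcard2 : Nat.card D ≤ 2401 := hM ▸ Nat.card_le_card_of_injective _ hev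
  have hcard3 : Nat.card Dˣ = Nat.card D - 1 := Nat.card_units D
  have hcard : Nat.card D = 2401 := by omega
  have := Fintype.ofFinite D
  have := Fintype.ofFinite F2401
  let r : D ≃+* F2401 := FiniteField.ringEquivOfCardEq (by
    rw [← Nat.card_eq_fintype_card, ← Nat.card_eq_fintype_card, hcard, natCard_F2401])
  let e1 : D ≃+ M := AddEquiv.ofBijective ev
    ((Nat.bijective_iff_injective_and_card _).2 ⟨hev, by rw [hcard, hM]⟩)
  let c1 : H ≃* Dˣ := MulEquiv.ofBijective ψ.toHomUnits
    ((Nat.bijective_iff_injective_and_card _).2 ⟨hunit, by rw [hcard3, hcard, hH]⟩)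
  refine ⟨e1.symm.trans r.toAddEquiv, c1.trans (Units.mapEquiv r.toMulEquiv), fun h m => ?_⟩
  obtain ⟨d, rfl⟩ := e1.surjective m
  have h1 : φ h (e1 d) = e1 (ψ h * d) := rfl
  rw [h1]
  simp only [AddEquiv.trans_apply, AddEquiv.symm_apply_apply]
  exact map_mul r _ _

end RegularAction

section SevenTI

open scoped Pointwise
open IsSevenTI

variable {G : Type*} [Group G] [Finite G] [IsSevenTI G] {P Q R : Sylow 7 G} {t w : G}

theorem IsFrame.mem_axisKer_iff_pow (hF : IsFrame P Q t) {k : G} (hk : k ∈ twoPoint P Q) :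
    k ∈ axisKer t ↔ k ^ 50 = 1 := by
  refine ⟨fun hk => ?_, fun h50 => ?_⟩
  · rw [← hF.card_axisKer]
    exact congrArg Subtype.val (pow_card_eq_one' (x := (⟨k, hk⟩ : axisKer t)))
  have h25 : k ^ 25 ∈ axisKer t := by
    rcases hF.sq_eq_one (pow_mem hk 25) (by rw [← pow_add, h50]) with e | e <;> rw [e]
    · exact one_mem _
    · exact hF.mem_axisKer_self
  have h26 : k ^ 26 ∈ axisKer t := hF.mem_axisKer_of_pow_eq_one (pow_mem hk _) (by
    rw [← pow_mul, show 26 * 25 = 50 * 13 by norm_num, pow_mul, h50, one_pow])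
  have h1 := mul_mem (inv_mem h25) h26
  have h2 : (k ^ 25)⁻¹ * k ^ 26 = k := by rw [pow_succ k 25, inv_mul_cancel_left]
  rwa [h2] at h1

/-- Coordinates for the central quotient of `P` and for the stabilizer of `P` and `w • P` by the
field of order `2401`. -/
structure IsModel (P : Sylow 7 G) (t w : G) (π : G → F2401) (η : F2401ˣ →* G) : Prop where
  base : IsBase P t w
  map_mul : ∀ x ∈ P, ∀ y ∈ P, π (x * y) = π x + π y
  eq_zero_iff : ∀ x ∈ P, π x = 0 ↔ x ∈ P.cen
  exists_eq : ∀ a, ∃ x ∈ P, π x = a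
  injective : Function.Injective η
  mem_twoPoint : ∀ a, η a ∈ twoPoint P (w • P)
  exists_of_mem : ∀ h ∈ twoPoint P (w • P), ∃ a, η a = h
  map_conj : ∀ a, ∀ x ∈ P, π (η a * x * (η a)⁻¹) = a * π x

theorem IsBase.exists_isModel (hB : IsBase P t w) : ∃ π η, IsModel P t w π η := by
  classical
  have hF := hB.frame
  let : CommGroup (CenQuo P) :=
    { (inferInstance : Group (CenQuo P)) with mul_comm := hF.cenQuo_comm }
  have hM : Nat.card (Additive (CenQuo P)) = 2401 := by
    have h1 := Subgroup.card_eq_card_quotient_mul_card_subgroup (Subgroup.center P)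
    have h2 : Nat.card (Subgroup.center P) = 49 := by
      rw [← card_cen P]
      refine Nat.card_congr ⟨fun x => ⟨x.1, CenQuo.mk_eq_one_iff.1
        ((QuotientGroup.eq_one_iff x.1).2 x.2)⟩, fun x => ⟨⟨x.1, cen_le x.2⟩,
        (QuotientGroup.eq_one_iff _).1 (CenQuo.mk_eq_one_iff.2 x.2)⟩, fun _ => rfl, fun _ => rfl⟩
    have h3 : Nat.card P = 7 ^ 6 := card_sylow P
    rw [h2, h3] at h1
    change Nat.card (CenQuo P) = 2401
    change _ = Nat.card (CenQuo P) * 49 at h1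
    omega
  let φ : twoPoint P (w • P) →* AddMonoid.End (Additive (CenQuo P)) :=
    { toFun := fun h => MonoidHom.toAdditive (stabConjQuo (smul_eq_left h.2))
      map_one' := by
        refine AddMonoidHom.ext fun x => ?_
        change CenQuo P at x
        induction x using QuotientGroup.induction_on with | H x => ?_
        change stabConjQuo _ (x : CenQuo P) = (x : CenQuo P)
        rw [stabConjQuo_mk]
        exact congrArg _ (Subtype.ext (by simp))
      map_mul' := fun h k => AddMonoidHom.ext fun x =>
        stabConjQuo_mul (smul_eq_left h.2) (smul_eq_left k.2) _ x }
  obtain ⟨F, hF25, hFm⟩ := hF.exists_five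
  obtain ⟨f, hf⟩ := exists_prime_orderOf_dvd_card' (G := F) 5 (by rw [hF25]; norm_num)
  have hfH := hF.axisKer_le_twoPoint ((hFm f).1 f.2).1
  have hf5 : (f : G) ^ 5 = 1 := by rw [← hf, ← Subgroup.coe_pow, pow_orderOf_eq_one, Subgroup.coe_one]
  obtain ⟨e, c, hec⟩ := exists_field_model φ hM (card_twoPoint hF.ne) (fun h hh m hm =>
      hF.stabConjQuo_fixedPointFree h.2 (fun e => hh (Subtype.ext e)) m hm)
    (f := ⟨f, hfH⟩) (Subtype.ext hf5) (fun e => by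
      have : f = 1 := Subtype.ext (show (f : G) = 1 from congrArg Subtype.val e)
      rw [this, orderOf_one] at hf
      norm_num at hf) (fun h => Subtype.ext (hB.commute_twoPoint h.2 ((hFm f).1 f.2).1).symm)
  let π : G → F2401 := fun x => if hx : x ∈ P then e (Additive.ofMul ((⟨x, hx⟩ : P) : CenQuo P)) else 0
  have hπ : ∀ x, ∀ hx : x ∈ P, π x = e (Additive.ofMul ((⟨x, hx⟩ : P) : CenQuo P)) :=
    fun x hx => dif_pos hx
  refine ⟨π, (twoPoint P (w • P)).subtype.comp c.symm.toMonoidHom, hB, ?_, ?_, ?_, ?_, ?_, ?_, ?_⟩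
  · intro x hx y hy
    rw [hπ x hx, hπ y hy, hπ _ (mul_mem hx hy), ← map_add]
    rfl
  · intro x hx
    rw [hπ x hx, map_eq_zero_iff _ e.injective]
    exact CenQuo.mk_eq_one_iff
  · intro a
    obtain ⟨m, rfl⟩ := e.surjective a
    change CenQuo P at m
    induction m using QuotientGroup.induction_on with | H x => ?_
    exact ⟨x, x.2, hπ x x.2⟩
  · exact (twoPoint P (w • P)).subtype_injective.comp c.symm.injective
  · exact fun a => (c.symm a).2
  · exact fun h hh => ⟨c ⟨h, hh⟩, congrArg Subtype.val (c.symm_apply_apply _)⟩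
  · intro a x hx
    have h1 := hec (c.symm a) (Additive.ofMul ((⟨x, hx⟩ : P) : CenQuo P))
    rw [c.apply_symm_apply] at h1
    rw [hπ x hx, ← h1]
    exact hπ _ (conj_mem_of_smul_eq (smul_eq_left (c.symm a).2) hx)

end SevenTI

section SevenTI

open scoped Pointwise
open IsSevenTI

theorem natCard_units_F2401 : Nat.card F2401ˣ = 2400 := by
  rw [Nat.card_units, natCard_F2401]

variable {G : Type*} [Group G] [Finite G] [IsSevenTI G] {P Q R : Sylow 7 G} {t w : G}

/-- An element `h` for which `w * h` fixes a point of the axis satisfies `w * h * w * h ∈ K`, where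
`K` fixes the axis pointwise. -/
theorem IsBase.conj_mul_mem (hB : IsBase P t w) {h : G} (hh : h ∈ twoPoint P (w • P))
    (hRP : R ≠ P) (hRQ : R ≠ w • P) (htR : t • R = R) (hR : (w * h) • R = R) :
    w * h * w * h ∈ axisKer t := by
  refine hB.frame.mem_axisKer_of_smul_eq ?_ ?_ hRP hRQ htR ?_
  · simp only [mul_smul, smul_eq_left hh, smul_eq_right hh, hB.smul_smul]
  · simp only [mul_smul, smul_eq_left hh, smul_eq_right hh, hB.smul_smul]
  · rw [mul_assoc (w * h), mul_smul, hR, hR]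

namespace IsModel

variable {π : G → F2401} {η : F2401ˣ →* G} (hM : IsModel P t w π η)

include hM

theorem conj_mul_mem (a : F2401ˣ) : w * η a * w * η a ∈ axisKer t := by
  classical
  have hB := hM.base
  have hF := hB.frame
  obtain ⟨y, hy, hy1, hy2⟩ := hF.exists_conj_eq_inv
  have hN := hB.le_ncard hy hy1 hy2
  set Y := {h : G | h ∈ twoPoint P (w • P) ∧ h * y⁻¹ ∈ Subgroup.centralizer (axisKer t : Set G) ∧
      ∃ R : Sylow 7 G, R ≠ P ∧ R ≠ w • P ∧ t • R = R ∧ (w * h) • R = R} with hY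
  have hcomm : ∀ h ∈ twoPoint P (w • P), ∀ k ∈ twoPoint P (w • P), h * k = k * h := by
    intro h hh k hk
    obtain ⟨a, rfl⟩ := hM.exists_of_mem h hh
    obtain ⟨b, rfl⟩ := hM.exists_of_mem k hk
    rw [← _root_.map_mul, mul_comm, _root_.map_mul]
  let T : Subgroup G :=
    { carrier := {h | h ∈ twoPoint P (w • P) ∧ w * h * w * h ∈ axisKer t}
      one_mem' := ⟨one_mem _, by rw [mul_one, mul_one, hB.mul_self]; exact one_mem _⟩
      mul_mem' := by
        rintro h k ⟨hh, hh'⟩ ⟨hk, hk'⟩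
        refine ⟨mul_mem hh hk, ?_⟩
        have e := hcomm _ hh _ (hB.conj_mem_twoPoint hk)
        have : w * (h * k) * w * (h * k) = w * h * w * h * (w * k * w * k) := by
          calc w * (h * k) * w * (h * k) = w * h * (w * w) * k * w * (h * k) := by
                rw [hB.mul_self]; group
            _ = w * h * w * (w * k * w * h) * k := by group
            _ = _ := by rw [← e]; group
        rw [this]
        exact mul_mem hh' hk'
      inv_mem' := by
        rintro h ⟨hh, hh'⟩
        refine ⟨inv_mem hh, ?_⟩
        have e := hcomm _ hh _ (hB.conj_mem_twoPoint hh)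
        have : w * h⁻¹ * w * h⁻¹ = (w * h * w * h)⁻¹ := by
          rw [← e, mul_inv_rev, mul_inv_rev, mul_inv_rev, hB.inv_eq, mul_assoc w h⁻¹]
        rw [this]
        exact inv_mem hh' }
  have hTle : T ≤ twoPoint P (w • P) := fun h hh => hh.1
  have h4 : Y ∪ axisKer t ⊆ T := by
    rintro h (hh | hh)
    · obtain ⟨h1, -, R, h2, h3, h5, h6⟩ := hh
      exact ⟨h1, hB.conj_mul_mem h1 h2 h3 h5 h6⟩
    · refine ⟨hF.axisKer_le_twoPoint hh, ?_⟩
      rw [hB.commute_axisKer hh, mul_assoc h, hB.mul_self, mul_one]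
      exact mul_mem hh hh
  have h5 := Set.ncard_le_ncard h4
  rw [Set.ncard_union_eq (Set.disjoint_left.2 fun h hh => by
    obtain ⟨-, -, R, -, -, h6, h7⟩ := hh
    exact hB.notMem_axisKer h6 h7)] at h5
  have h6 : (axisKer t : Set G).ncard = 50 := hF.card_axisKer
  change _ ≤ Nat.card T at h5
  have h7 : T = twoPoint P (w • P) := Subgroup.eq_of_le_of_card_ge hTle (by
    rw [card_twoPoint hF.ne]
    obtain ⟨d, hd⟩ := Subgroup.card_dvd_of_le hTle
    rw [card_twoPoint hF.ne] at hd
    have : d ≤ 1 := by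
      by_contra! hd2
      have := Nat.mul_le_mul (h6 ▸ h5) hd2
      omega
    interval_cases d <;> omega)
  have h8 : η a ∈ T := h7 ▸ hM.mem_twoPoint a
  exact h8.2

theorem mem_axisKer_iff {a : F2401ˣ} : η a ∈ axisKer t ↔ a ^ 50 = 1 := by
  rw [hM.base.frame.mem_axisKer_iff_pow (hM.mem_twoPoint a), ← map_pow, map_eq_one_iff η hM.injective]

theorem map_neg_one : η (-1) = t := by
  refine hM.base.frame.eq_of_isFrame (s := η (-1)) ⟨hM.base.frame.ne, hM.mem_twoPoint _, ?_, ?_⟩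
  · rw [← _root_.map_mul, neg_mul_neg, mul_one, map_one]
  · rw [ne_eq, map_eq_one_iff η hM.injective]
    have h7 : (7 : F2401) = 0 := CharP.cast_eq_zero F2401 7
    intro e
    have e1 : (-1 : F2401) = 1 := congrArg Units.val e
    have : (1 : F2401) = 0 := by linear_combination h7 + 3 * e1
    exact one_ne_zero this

/-- The involution `w` acts on the two-point stabilizer by inverting and conjugating. -/
theorem conj_eq (a : F2401ˣ) : w * η a * w = η (a ^ 49)⁻¹ := by
  have hB := hM.base
  have hF := hB.frame
  obtain ⟨ζ, hζ⟩ := IsCyclic.exists_generator (α := F2401ˣ)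
  have hord : orderOf ζ = 2400 := by
    rw [orderOf_eq_card_of_forall_mem_zpowers hζ, natCard_units_F2401]
  have hpow : ∀ b : F2401ˣ, ∃ n : ℕ, b = ζ ^ n := fun b => by
    obtain ⟨n, hn⟩ := (mem_powers_iff_mem_zpowers.2 (hζ b) : b ∈ Submonoid.powers ζ)
    exact ⟨n, hn.symm⟩
  have hmod : ∀ m n : ℕ, ζ ^ m = ζ ^ n ↔ m % 2400 = n % 2400 := fun m n => by
    rw [pow_eq_pow_iff_modEq, hord, Nat.ModEq]
  obtain ⟨b, hb⟩ := hM.exists_of_mem _ (hB.conj_mem_twoPoint (hM.mem_twoPoint ζ))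
  obtain ⟨e, rfl⟩ := hpow b
  have hconj : ∀ n : ℕ, w * η (ζ ^ n) * w = η (ζ ^ (e * n)) := by
    intro n
    rw [pow_mul, map_pow, map_pow, hb]
    have := conj_pow (a := w) (b := η ζ) (i := n)
    rw [hB.inv_eq] at this
    exact this.symm
  have h1 : (e * 48) % 2400 = 48 := by
    have h2 : η (ζ ^ 48) ∈ axisKer t := hM.mem_axisKer_iff.2 (by
      rw [← pow_mul, ← pow_zero ζ, hmod])
    have h3 := hB.commute_axisKer h2
    have h4 := hconj 48
    rw [h3, mul_assoc, hB.mul_self, mul_one] at h4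
    exact ((hmod _ _).1 (hM.injective h4)).symm
  have h2 : ((e + 1) * 50) % 2400 = 0 := by
    have h3 := hM.conj_mul_mem ζ
    rw [← hb, ← _root_.map_mul, ← pow_succ, hM.mem_axisKer_iff, ← pow_mul, ← pow_zero ζ, hmod] at h3
    exact h3
  have h3 : e % 2400 ≠ 1151 := by
    intro he
    obtain ⟨y, hy, hy1, hy2⟩ := hF.exists_conj_eq_inv
    have hN := hB.le_ncard hy hy1 hy2
    obtain ⟨h, hh, -, R, hRP, hRQ, htR, hR⟩ := Set.nonempty_of_ncard_ne_zero
      (Nat.pos_iff_ne_zero.1 (lt_of_lt_of_le (by norm_num) hN))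
    obtain ⟨b, rfl⟩ := hM.exists_of_mem h hh
    obtain ⟨n, rfl⟩ := hpow b
    have hk : η (ζ ^ (n * 576)) ∈ axisKer t := hM.mem_axisKer_iff.2 (by
      rw [← pow_mul, ← pow_zero ζ, hmod]
      omega)
    have hsplit : w * η (ζ ^ n) = w * η (ζ ^ (n * 1825)) * η (ζ ^ (n * 576)) := by
      rw [mul_assoc, ← _root_.map_mul, ← pow_add]
      congr 2
      rw [hmod]
      omega
    rw [hsplit, mul_smul, mem_axisKer.1 hk R htR] at hR
    set s := w * η (ζ ^ (n * 1825)) with hs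
    have hsP : s • P = w • P := by rw [hs, mul_smul, smul_eq_left (hM.mem_twoPoint _)]
    have hs1 : s ≠ 1 := fun e => hF.ne (by rw [← hsP, e, one_smul])
    have hst : s ≠ t := fun e => hF.ne (by rw [← hsP, e, hF.smul_left])
    have hs2 : s * s = 1 := by
      rw [hs, ← mul_assoc, hconj, ← _root_.map_mul, ← pow_add, ← map_one η, ← pow_zero ζ]
      congr 1
      rw [hmod, show e * (n * 1825) + n * 1825 = 25 * (e + 1) * (n * 73) by ring, Nat.mul_mod,
        show 25 * (e + 1) % 2400 = 0 by omega, Nat.zero_mul]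
    have hsc : s * t = t * s := by
      rw [hs, mul_assoc, hF.commute (hM.mem_twoPoint _), ← mul_assoc, hB.commute, mul_assoc]
    exact (hF.of_smul_eq (Ne.symm hRP) htR hF.smul_left).smul_ne_of_commute hs2 hs1 hst hsc hR
  have h4 : e % 2400 = 2351 := by omega
  obtain ⟨n, rfl⟩ := hpow a
  rw [hconj]
  refine congrArg η ?_
  rw [eq_inv_iff_mul_eq_one, ← pow_mul, ← pow_add, ← pow_zero ζ, hmod,
    show e * n + n * 49 = (e + 49) * n by ring, Nat.mul_mod, show (e + 49) % 2400 = 0 by omega,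
    Nat.zero_mul]

end IsModel

end SevenTI

/-- The automorphism of order two of the field with `2401` elements. -/
noncomputable def bar : F2401 →+* F2401 := iterateFrobenius F2401 7 2

theorem bar_apply (x : F2401) : bar x = x ^ 49 := by
  rw [bar, iterateFrobenius_def]
  norm_num

theorem bar_bar (x : F2401) : bar (bar x) = x := by
  have := Fintype.ofFinite F2401
  rw [bar_apply, bar_apply, ← pow_mul, show 49 * 49 = Fintype.card F2401 by
    rw [← Nat.card_eq_fintype_card, natCard_F2401], FiniteField.pow_card]

theorem bar_mul_bar (x : F2401) : bar (x * bar x) = x * bar x := by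
  rw [map_mul, bar_bar, mul_comm]

theorem bar_ne_zero {x : F2401} (hx : x ≠ 0) : bar x ≠ 0 := (map_ne_zero bar).2 hx

theorem mul_bar_ne_zero {x : F2401} (hx : x ≠ 0) : x * bar x ≠ 0 := mul_ne_zero hx (bar_ne_zero hx)

theorem two_ne_zero_F2401 : (2 : F2401) ≠ 0 := by
  intro h
  have h7 : (7 : F2401) = 0 := CharP.cast_eq_zero F2401 7
  have : (1 : F2401) = 0 := by linear_combination h7 - 3 * h
  exact one_ne_zero this

instance : NeZero (2 : F2401) := ⟨two_ne_zero_F2401⟩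

theorem exists_generator_F2401 : ∃ ζ : F2401ˣ, orderOf ζ = 2400 ∧ ∀ b, ∃ n : ℕ, b = ζ ^ n := by
  obtain ⟨ζ, hζ⟩ := IsCyclic.exists_generator (α := F2401ˣ)
  refine ⟨ζ, by rw [orderOf_eq_card_of_forall_mem_zpowers hζ, natCard_units_F2401], fun b => ?_⟩
  obtain ⟨n, hn⟩ := (mem_powers_iff_mem_zpowers.2 (hζ b) : b ∈ Submonoid.powers ζ)
  exact ⟨n, hn.symm⟩

theorem exists_mul_bar_eq {c : F2401} (hc : bar c = c) (hc0 : c ≠ 0) :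
    ∃ a : F2401ˣ, (a : F2401) * bar a = c := by
  obtain ⟨ζ, hord, hpow⟩ := exists_generator_F2401
  obtain ⟨n, hn⟩ := hpow (Units.mk0 c hc0)
  have h1 : ζ ^ (n * 49) = ζ ^ n := by
    rw [pow_mul, ← hn]
    exact Units.ext (by rw [Units.val_pow_eq_pow_val, Units.val_mk0, ← bar_apply, hc])
  rw [pow_eq_pow_iff_modEq, hord, Nat.ModEq] at h1
  refine ⟨ζ ^ (n / 50), ?_⟩
  rw [bar_apply, ← pow_succ', ← Units.val_pow_eq_pow_val, ← pow_mul]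
  have : n / 50 * (49 + 1) = n := by omega
  rw [this, ← hn, Units.val_mk0]

theorem exists_bar_eq_neg : ∃ v : F2401, v ≠ 0 ∧ bar v = -v := by
  obtain ⟨ζ, hord, -⟩ := exists_generator_F2401
  refine ⟨(ζ : F2401) ^ 25, pow_ne_zero _ ζ.ne_zero, ?_⟩
  have h1 : (ζ : F2401) ^ 1200 * (ζ : F2401) ^ 1200 = 1 := by
    rw [← pow_add, ← Units.val_pow_eq_pow_val, show 1200 + 1200 = orderOf ζ by rw [hord],
      pow_orderOf_eq_one, Units.val_one]
  have h2 : (ζ : F2401) ^ 1200 ≠ 1 := by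
    rw [← Units.val_pow_eq_pow_val, ne_eq, Units.val_eq_one, ← orderOf_dvd_iff_pow_eq_one, hord]
    norm_num
  rw [bar_apply, ← pow_mul, show 25 * 49 = 1200 + 25 by norm_num, pow_add,
    (mul_self_eq_one_iff.1 h1).resolve_left h2, neg_one_mul]

section Form

variable {A : Type*} [AddCommGroup A] {D : F2401 → F2401 → A}

/-- An alternating `2`-cocycle with values in a group without `2`-torsion is biadditive. -/
theorem map_add_of_cocycle (hA : ∀ a b : A, a + a = b + b → a = b)
    (hc : ∀ x y z, D (x + y) z + D x y = D x (y + z) + D y z) (ha : ∀ x y, D y x = -D x y)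
    (x y z : F2401) : D (x + z) y = D x y + D z y := by
  have h1 := hc x y z
  have h2 := hc y z x
  have h3 := hc z x y
  rw [ha x (y + z), ha (z + x) y, ha x z] at h2
  rw [ha (x + y) z, ha x z] at h3
  rw [add_comm z x] at h2 h3
  rw [ha y z]
  refine hA _ _ ?_
  have e1 : D (x + z) y = D x (y + z) - D (x + y) z := by
    refine hA _ _ ?_
    linear_combination (norm := module) h1 + h2 + h3
  have e2 : D (x + z) y = D x y + -D y z := by
    rw [e1]
    linear_combination (norm := module) h1.symm
  rw [e2]

theorem exists_form (hA : ∀ a b : A, a + a = b + b → a = b)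
    (hc : ∀ x y z, D (x + y) z + D x y = D x (y + z) + D y z) (ha : ∀ x y, D y x = -D x y)
    (hinv : ∀ a x y, a * bar a = 1 → D (a * x) (a * y) = D x y) :
    ∃ L : F2401 →+ A, (∀ x y, D x y = L (bar x * y)) ∧ ∀ z, L (bar z) = -L z := by
  have hadd := fun x y z => map_add_of_cocycle hA hc ha x y z
  have hadd' : ∀ x y z, D x (y + z) = D x y + D x z := fun x y z => by
    rw [ha (y + z) x, hadd, neg_add, ← ha y x, ← ha z x]
  have hzero : ∀ y, D 0 y = 0 := fun y => by
    have := hadd 0 y 0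
    rwa [add_zero, left_eq_add] at this
  let L : F2401 →+ A := AddMonoidHom.mk' (D 1) (hadd' 1)
  have hone : ∀ a, a * bar a = 1 → ∀ y, D a y = L (bar a * y) := fun a h y => by
    change D a y = D 1 (bar a * y)
    rw [← hinv a 1 (bar a * y) h, mul_one, ← mul_assoc, h, one_mul]
  obtain ⟨ζ, hord, -⟩ := exists_generator_F2401
  set e : F2401 := (ζ : F2401) ^ 480 with he
  have hpow : ∀ n : ℕ, (ζ : F2401) ^ n = 1 ↔ 2400 ∣ n := fun n => by
    rw [← Units.val_pow_eq_pow_val, Units.val_eq_one, ← orderOf_dvd_iff_pow_eq_one, hord]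
  have he1 : e * bar e = 1 := by
    rw [bar_apply, ← pow_succ', he, ← pow_mul, hpow]
    norm_num
  let S : AddSubgroup F2401 :=
    { carrier := {x | ∀ y, D x y = L (bar x * y)}
      zero_mem' := fun y => by rw [hzero, map_zero, zero_mul, map_zero]
      add_mem' := fun {a b} ha hb y => by rw [hadd, ha y, hb y, map_add, add_mul, map_add]
      neg_mem' := fun {a} ha y => by
        have h := hadd a y (-a)
        rw [add_neg_cancel, hzero, ha y] at h
        rw [map_neg, neg_mul, map_neg, eq_neg_iff_add_eq_zero, add_comm, h] }
  set f : AddMonoid.End F2401 := AddMonoidHom.mulLeft e with hf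
  have hS : S = ⊤ := by
    refine (AddSubgroup.eq_bot_or_eq_top_of_pow_five natCard_F2401
      (f := f) ?_ ?_ (K := S) ?_).resolve_left ?_
    · have h5 : ∀ n : ℕ, ∀ m : F2401, (f ^ n) m = e ^ n * m := by
        intro n
        induction n with
        | zero => intro m; rw [pow_zero, pow_zero, one_mul]; rfl
        | succ n ih =>
          intro m
          rw [pow_succ', pow_succ', mul_assoc, ← ih]
          rfl
      refine AddMonoidHom.ext fun m => ?_
      refine (h5 5 m).trans ?_
      rw [he, ← pow_mul, (hpow _).2 (by norm_num), one_mul]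
      rfl
    · intro m hm
      by_contra hm0
      have h1 : e * m = m := hm
      rw [mul_eq_right₀ hm0, he, hpow] at h1
      norm_num at h1
    · intro x hx y
      change D (e * x) y = L (bar (e * x) * y)
      have hy : y = e * (bar e * y) := by rw [← mul_assoc, he1, one_mul]
      conv_lhs => rw [hy]
      rw [hinv e _ _ he1, hx, map_mul bar, ← mul_assoc, mul_comm (bar x)]
    · intro h
      have h1 : (1 : F2401) ∈ S := fun y => hone 1 (by rw [map_one, one_mul]) y
      rw [h, AddSubgroup.mem_bot] at h1
      exact one_ne_zero h1
  have hD : ∀ x y, D x y = L (bar x * y) := fun x y => (hS ▸ AddSubgroup.mem_top x : x ∈ S) y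
  refine ⟨L, hD, fun z => ?_⟩
  have := hD z 1
  rw [mul_one] at this
  rw [← this, ha 1 z]
  rfl

end Form

section SevenTI

open scoped Pointwise
open IsSevenTI

variable {G : Type*} [Group G] [Finite G] [IsSevenTI G] {P Q R : Sylow 7 G} {t w : G}

theorem mul_self_pow_of_mem_cen {v : G} (hv : v ∈ P.cen) : (v * v) ^ 25 = v := by
  have h1 : v ^ 49 = 1 := by
    rw [← card_cen P]
    exact congrArg Subtype.val (pow_card_eq_one' (x := (⟨v, hv⟩ : P.cen)))
  rw [← sq, ← pow_mul, show 2 * 25 = 49 + 1 by norm_num, pow_succ, h1, one_mul]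

theorem eq_of_mul_self_eq_of_mem_cen {u v : G} (hu : u ∈ P.cen) (hv : v ∈ P.cen)
    (h : u * u = v * v) : u = v := by
  rw [← mul_self_pow_of_mem_cen hu, h, mul_self_pow_of_mem_cen hv]

/-- Coordinates of the stabilizer of `P`: the points `E x s`, with `s` skew, of `P` multiply as in a
Heisenberg group over the field, on which the two-point stabilizer acts by scalars. -/
structure IsCoord (P : Sylow 7 G) (t w : G) (η : F2401ˣ →* G) (E : F2401 → F2401 → G) : Prop where
  base : IsBase P t w
  injective : Function.Injective η
  mem_twoPoint : ∀ a, η a ∈ twoPoint P (w • P)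
  exists_of_mem : ∀ h ∈ twoPoint P (w • P), ∃ a, η a = h
  map_neg_one : η (-1) = t
  conj_eq : ∀ a, w * η a * w = η (a ^ 49)⁻¹
  mem : ∀ x s, E x s ∈ P
  mul : ∀ x y s r, bar s = -s → bar r = -r →
    E x s * E y r = E (x + y) (s + r + (bar x * y - x * bar y) / 2)
  conj : ∀ (a : F2401ˣ) x s, bar s = -s → η a * E x s * (η a)⁻¹ = E (a * x) (a * bar a * s)
  exists_eq : ∀ u ∈ P, ∃ x s, bar s = -s ∧ u = E x s
  ext : ∀ x y s r, bar s = -s → bar r = -r → E x s = E y r → x = y ∧ s = r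

namespace IsModel

variable {π : G → F2401} {η : F2401ˣ →* G} (hM : IsModel P t w π η)

include hM

theorem map_one : π 1 = 0 := (hM.eq_zero_iff 1 (one_mem _)).2 (one_mem _)

theorem map_inv {x : G} (hx : x ∈ P) : π x⁻¹ = -π x := by
  rw [eq_neg_iff_add_eq_zero, ← hM.map_mul _ (inv_mem hx) _ hx, inv_mul_cancel, hM.map_one]

theorem map_eq_iff {x y : G} (hx : x ∈ P) (hy : y ∈ P) : π x = π y ↔ x⁻¹ * y ∈ P.cen := by
  rw [← hM.eq_zero_iff _ (mul_mem (inv_mem hx) hy), hM.map_mul _ (inv_mem hx) _ hy, hM.map_inv hx,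
    neg_add_eq_zero]

theorem existsUnique_inverted (a : F2401) : ∃! u, u ∈ P ∧ t * u * t⁻¹ = u⁻¹ ∧ π u = a := by
  have hF := hM.base.frame
  obtain ⟨x, hx, rfl⟩ := hM.exists_eq a
  have hz := hF.conj_mul_mem_cen hx
  set z := t * x * t⁻¹ * x with hz'
  have hv : (z ^ 25)⁻¹ ∈ P.cen := inv_mem (pow_mem hz _)
  refine ⟨x * (z ^ 25)⁻¹, ⟨mul_mem hx (cen_le hv), ?_, ?_⟩, ?_⟩
  · have h1 := hF.commute_cen hv
    have h2 := commute_of_mem_cen hz hx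
    have h3 : (z ^ 25) * (z ^ 25) = z := by
      rw [← (Commute.refl z).mul_pow, mul_self_pow_of_mem_cen hz]
    have h4 : t * x = z * x⁻¹ * t := by rw [hz']; group
    rw [← mul_assoc, h4, mul_assoc (z * x⁻¹), h1, mul_inv_rev, inv_inv, mul_assoc, mul_assoc (z ^ 25)⁻¹,
      mul_inv_cancel, mul_one, ← commute_of_mem_cen (pow_mem hz 25) (inv_mem hx), ]
    have h5 : z * x⁻¹ = x⁻¹ * z := (commute_of_mem_cen hz (inv_mem hx)).symm
    rw [h5, mul_assoc]
    congr 1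
    nth_rw 1 [← h3]
    rw [mul_inv_cancel_right]
  · rw [hM.map_mul _ hx _ (cen_le hv), (hM.eq_zero_iff _ (cen_le hv)).2 hv, add_zero]
  · rintro u ⟨hu, hut, hux⟩
    have h1 := (hM.map_eq_iff hx hu).1 hux.symm
    set v := x⁻¹ * u with hv'
    have hu' : u = x * v := by rw [hv', mul_inv_cancel_left]
    have h2 := hF.commute_cen h1
    rw [hu'] at hut ⊢
    rw [mul_right_inj]
    refine eq_inv_of_mul_eq_one_left (eq_of_mul_self_eq_of_mem_cen (P := P)
      (mul_mem h1 (pow_mem hz _)) (one_mem _) ?_)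
    have h3 : z * (v * v) = 1 := by
      have h4 : v * z = z * v := commute_of_mem_cen hz (cen_le h1)
      have h5 : t * (x * v) * t⁻¹ = t * x * t⁻¹ * v := by
        have h6 : t⁻¹ * v = v * t⁻¹ := (show Commute t v from h2).inv_left.eq
        rw [← mul_assoc, mul_assoc (t * x), ← h6, ← mul_assoc]
      have h6 : (t * x * t⁻¹ * v) * (x * v) = 1 := by
        rw [← h5, hut, inv_mul_cancel]
      rw [← h6, hz', mul_assoc _ x, mul_assoc _ v, ← mul_assoc x, ← mul_assoc v,
        commute_of_mem_cen h1 hx]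
    have h4 : Commute v z := commute_of_mem_cen hz (cen_le h1)
    have h5 : z ^ 25 * z ^ 25 = z := by
      rw [← (Commute.refl z).mul_pow, mul_self_pow_of_mem_cen hz]
    rw [one_mul, (h4.pow_right 25).symm.mul_mul_mul_comm, h5, ← h3, ← (h4.mul_left h4).eq]

theorem exists_isCoord : ∃ E, IsCoord P t w η E := by
  have hF := hM.base.frame
  choose i hi huniq using hM.existsUnique_inverted
  have hiP : ∀ a, i a ∈ P := fun a => (hi a).1
  have hiπ : ∀ a, π (i a) = a := fun a => (hi a).2.2
  have hconj : ∀ (a : F2401ˣ) x, η a * i x * (η a)⁻¹ = i (a * x) := fun a x => by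
    have hc : t * η a = η a * t := (hF.commute (hM.mem_twoPoint a)).symm
    have hc' : (η a)⁻¹ * t⁻¹ = t⁻¹ * (η a)⁻¹ := by rw [← mul_inv_rev, ← mul_inv_rev, hc]
    refine huniq _ _ ⟨conj_mem_of_smul_eq (smul_eq_left (hM.mem_twoPoint a)) (hiP x), ?_, ?_⟩
    · calc t * (η a * i x * (η a)⁻¹) * t⁻¹ = (t * η a) * i x * ((η a)⁻¹ * t⁻¹) := by group
        _ = η a * (t * i x * t⁻¹) * (η a)⁻¹ := by rw [hc, hc']; group
        _ = _ := by rw [(hi x).2.1]; group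
    · rw [hM.map_conj _ _ (hiP x), hiπ]
  set δ : F2401 → F2401 → G := fun x y => (i (x + y))⁻¹ * (i x * i y) with hδ
  have hδc : ∀ x y, δ x y ∈ P.cen := fun x y => by
    refine (hM.map_eq_iff (hiP _) (mul_mem (hiP _) (hiP _))).1 ?_
    rw [hM.map_mul _ (hiP _) _ (hiP _), hiπ, hiπ, hiπ]
  have hmul : ∀ x y, i x * i y = i (x + y) * δ x y := fun x y => by
    rw [hδ, mul_inv_cancel_left]
  have halt : ∀ x y, δ y x = (δ x y)⁻¹ := fun x y => by
    have h1 : t * (i x * i y) * t⁻¹ = t * (i (x + y) * δ x y) * t⁻¹ := by rw [hmul]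
    have h2 : δ x y * t⁻¹ = t⁻¹ * δ x y :=
      ((show Commute t (δ x y) from hF.commute_cen (hδc x y)).inv_left.eq).symm
    have h3 : t * (i x * i y) * t⁻¹ = (t * i x * t⁻¹) * (t * i y * t⁻¹) := by group
    have h4 : t * (i (x + y) * δ x y) * t⁻¹ = (t * i (x + y) * t⁻¹) * δ x y := by
      rw [← mul_assoc t, mul_assoc _ _ t⁻¹, h2, ← mul_assoc]
    rw [h3, h4, (hi x).2.1, (hi y).2.1, (hi (x + y)).2.1, ← mul_inv_rev, hmul, add_comm y,
      mul_inv_rev, ← commute_of_mem_cen (inv_mem (hδc y x)) (inv_mem (hiP _)), mul_right_inj] at h1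
    rw [← h1, inv_inv]
  have hcoc : ∀ x y z, δ (x + y) z * δ x y = δ x (y + z) * δ y z := fun x y z => by
    have h1 : i x * i y * i z = i (x + y + z) * (δ (x + y) z * δ x y) := by
      rw [hmul x y, mul_assoc, ← commute_of_mem_cen (hδc x y) (hiP z), ← mul_assoc, hmul (x + y) z,
        mul_assoc]
    have h2 : i x * (i y * i z) = i (x + y + z) * (δ x (y + z) * δ y z) := by
      rw [hmul y z, ← mul_assoc, hmul x (y + z), mul_assoc, add_assoc]
    exact mul_left_cancel (h1.symm.trans ((mul_assoc _ _ _).trans h2))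
  have hδconj : ∀ (a : F2401ˣ) x y, η a * δ x y * (η a)⁻¹ = δ (a * x) (a * y) := fun a x y => by
    simp only [hδ]
    rw [← mul_add, ← hconj, ← hconj, ← hconj]
    group
  let : CommGroup P.cen :=
    { (inferInstance : Group P.cen) with
      mul_comm := fun a b => Subtype.ext (commute_of_mem_cen b.2 (cen_le a.2)) }
  obtain ⟨L, hL, hLbar⟩ := exists_form (A := Additive P.cen)
    (D := fun x y => Additive.ofMul ⟨δ x y, hδc x y⟩)
    (fun a b h => by
      have h1 := congrArg (fun v : Additive P.cen => ((Additive.toMul v : P.cen) : G)) h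
      exact congrArg Additive.ofMul (Subtype.ext
        (eq_of_mul_self_eq_of_mem_cen (Additive.toMul a).2 (Additive.toMul b).2 h1)))
    (fun x y z => congrArg Additive.ofMul (Subtype.ext (hcoc x y z)))
    (fun x y => congrArg Additive.ofMul (Subtype.ext (halt x y)))
    (fun a x y ha => congrArg Additive.ofMul (Subtype.ext (by
      have ha0 : a ≠ 0 := left_ne_zero_of_mul_eq_one ha
      have h1 := hδconj (Units.mk0 a ha0) x y
      have h2 : η (Units.mk0 a ha0) ∈ axisKer t := hM.mem_axisKer_iff.2 (Units.ext (by
        rw [Units.val_pow_eq_pow_val, Units.val_mk0, pow_succ', ← bar_apply, ha, Units.val_one]))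
      rw [(hF.mem_axisKer_iff.1 h2).2 _ (hδc x y), mul_inv_cancel_right] at h1
      exact h1.symm)))
  set l : F2401 → G := fun z => ((Additive.toMul (L z) : P.cen) : G) with hl
  have hlc : ∀ z, l z ∈ P.cen := fun z => (Additive.toMul (L z)).2
  have hladd : ∀ x y, l (x + y) = l x * l y := fun x y => by
    simp only [hl, map_add]
    rfl
  have hlδ : ∀ x y, δ x y = l (bar x * y) := fun x y =>
    congrArg (fun v : Additive P.cen => ((Additive.toMul v : P.cen) : G)) (hL x y)
  have hlbar : ∀ z, l (bar z) = (l z)⁻¹ := fun z =>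
    congrArg (fun v : Additive P.cen => ((Additive.toMul v : P.cen) : G)) (hLbar z)
  have hl0 : l 0 = 1 := by
    have := hladd 0 0
    rwa [add_zero, left_eq_mul] at this
  have hlconj : ∀ (a : F2401ˣ) z, η a * l z * (η a)⁻¹ = l (a * bar a * z) := fun a z => by
    have h1 := hδconj a 1 z
    rw [hlδ, hlδ, _root_.map_one, one_mul, mul_one] at h1
    rw [h1]
    congr 1
    ring
  have hlskew : ∀ z, l z = l ((z - bar z) / 2) := fun z => by
    have h1 : l ((z + bar z) / 2) = 1 := by
      refine eq_of_mul_self_eq_of_mem_cen (hlc _) (one_mem _) ?_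
      have h2 := hlbar ((z + bar z) / 2)
      rw [map_div₀, map_add, bar_bar, map_ofNat, add_comm] at h2
      nth_rw 1 [h2]
      rw [inv_mul_cancel, one_mul]
    conv_lhs => rw [show z = (z - bar z) / 2 + (z + bar z) / 2 by
      field_simp
      ring]
    rw [hladd, h1, mul_one]
  have hlcomm : ∀ z, ∀ x ∈ P, x * l z = l z * x := fun z x hx => commute_of_mem_cen (hlc z) hx
  have hlinj : ∀ s, bar s = -s → l s = 1 → s = 0 := by
    intro s hs hls
    by_contra hs0
    have h1 : ∀ r, bar r = -r → l r = 1 := fun r hr => by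
      by_cases hr0 : r = 0
      · rw [hr0, hl0]
      obtain ⟨a, ha⟩ := exists_mul_bar_eq (c := r / s) (by rw [map_div₀, hr, hs, neg_div_neg_eq])
        (div_ne_zero hr0 hs0)
      have h2 := hlconj a s
      rwa [ha, div_mul_cancel₀ _ hs0, hls, mul_one, mul_inv_cancel, eq_comm] at h2
    have h2 : ∀ z, l z = 1 := fun z => by
      rw [hlskew]
      refine h1 _ ?_
      rw [map_div₀, map_sub, bar_bar, map_ofNat, ← neg_sub, neg_div]
    have h3 : ∀ x y, i x * i y = i y * i x := fun x y => by
      rw [hmul, hmul, hlδ, hlδ, h2, h2, add_comm]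
    obtain ⟨x, hx, hxc⟩ := exists_notMem_cen P
    have h4 : ∀ u ∈ P, (i (π u))⁻¹ * u ∈ P.cen := fun u hu => (hM.map_eq_iff (hiP _) hu).1 (hiπ _)
    refine hxc ?_
    rw [← mul_inv_cancel_left (i (π x)) x]
    refine mul_mem (Subgroup.mem_cen.2 ⟨hiP _, fun y hy => ?_⟩) (h4 x hx)
    have h5 : ∀ v, i (π x) * v = v * i (π x) → i (π y) * v * i (π x) = i (π x) * (i (π y) * v) :=
      fun v hv => by rw [mul_assoc, ← hv, ← mul_assoc, ← mul_assoc, h3]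
    have h6 := h5 _ (commute_of_mem_cen (h4 y hy) (hiP (π x)))
    rwa [mul_inv_cancel_left] at h6
  refine ⟨fun x s => i x * l s, hM.base, hM.injective, hM.mem_twoPoint, hM.exists_of_mem,
    hM.map_neg_one, hM.conj_eq, fun x s => mul_mem (hiP x) (cen_le (hlc s)), ?_, ?_, ?_, ?_⟩
  · intro x y s r hs hr
    have h1 : bar (bar x * y) = x * bar y := by rw [_root_.map_mul, bar_bar]
    rw [← h1, hladd, hladd, ← hlskew, ← hlδ]
    calc i x * l s * (i y * l r) = i x * (i y * l s) * l r := by rw [hlcomm s _ (hiP y)]; group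
      _ = i (x + y) * (δ x y * (l s * l r)) := by
        rw [← mul_assoc, hmul]
        group
      _ = _ := by rw [← commute_of_mem_cen (hδc x y) (mul_mem (cen_le (hlc s)) (cen_le (hlc r)))]
  · intro a x s _
    rw [← hconj, ← hlconj]
    group
  · intro u hu
    have hv : (i (π u))⁻¹ * u ∈ P.cen := (hM.map_eq_iff (hiP _) hu).1 (hiπ _)
    by_cases hv1 : (i (π u))⁻¹ * u = 1
    · refine ⟨π u, 0, by rw [map_zero, neg_zero], ?_⟩
      rw [hl0, mul_one]
      exact (inv_mul_eq_one.1 hv1).symm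
    · obtain ⟨s, hs0, hs⟩ := exists_bar_eq_neg
      obtain ⟨k, hk, hkv⟩ := exists_conj_cen hF.ne (hlc s) (fun e => hs0 (hlinj s hs e)) hv hv1
      obtain ⟨a, rfl⟩ := hM.exists_of_mem k hk
      refine ⟨π u, a * bar a * s, by rw [_root_.map_mul, bar_mul_bar, hs, mul_neg], ?_⟩
      rw [← hlconj, hkv, mul_inv_cancel_left]
  · intro x y s r hs hr h
    have h1 : x = y := by
      have h2 := congrArg π h
      rw [hM.map_mul _ (hiP _) _ (cen_le (hlc _)), hM.map_mul _ (hiP _) _ (cen_le (hlc _)), hiπ, hiπ,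
        (hM.eq_zero_iff _ (cen_le (hlc _))).2 (hlc _),
        (hM.eq_zero_iff _ (cen_le (hlc _))).2 (hlc _), add_zero, add_zero] at h2
      exact h2
    refine ⟨h1, sub_eq_zero.1 (hlinj _ (by rw [map_sub, hs, hr]; ring) ?_)⟩
    subst h1
    rw [mul_right_inj] at h
    have h3 := hladd (s - r) r
    rwa [sub_add_cancel, h, right_eq_mul] at h3

end IsModel

end SevenTI

/-- The identities satisfied by the coordinates `(X x s, S x s)` of the image of the nontrivial
point `(x, s)` of a Heisenberg group under the inversion swapping the two base points. -/
structure IsInversion (X S : F2401 → F2401 → F2401) : Prop where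
  skew : ∀ x s, bar s = -s → (x ≠ 0 ∨ s ≠ 0) → bar (S x s) = -S x s
  inv_left : ∀ x s, bar s = -s → (x ≠ 0 ∨ s ≠ 0) → X (X x s) (S x s) = x ∧ S (X x s) (S x s) = s
  ne_zero : ∀ x s, bar s = -s → (x ≠ 0 ∨ s ≠ 0) → X x s ≠ 0 ∨ S x s ≠ 0
  smul : ∀ a x s, a ≠ 0 → bar s = -s → (x ≠ 0 ∨ s ≠ 0) →
    X (a * x) (a * bar a * s) = X x s / bar a ∧ S (a * x) (a * bar a * s) = S x s / (a * bar a)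
  exists_mul : ∀ x s, bar s = -s → (x ≠ 0 ∨ s ≠ 0) → ∃ c, c ≠ 0 ∧
    S (-X x s) (-S x s) = -(c * bar c * S (-x) (-s)) ∧ X (-X x s) (-S x s) = -(c * X (-x) (-s)) ∧
    ∀ y r, bar r = -r → (y ≠ 0 ∨ r ≠ 0) →
      (x + y ≠ 0 ∨ s + r + (bar x * y - x * bar y) / 2 ≠ 0) →
      X (x + y) (s + r + (bar x * y - x * bar y) / 2) = X x s +
        X (c * (-X (-x) (-s) + X y r)) (c * bar c * (-S (-x) (-s) + S y r +
          (bar (-X (-x) (-s)) * X y r - -X (-x) (-s) * bar (X y r)) / 2))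

namespace IsInversion

theorem one_add_two_mul_ne_zero {s : F2401} (hs : bar s = -s) : 1 + 2 * s ≠ 0 := by
  intro h
  have h1 : bar (1 + 2 * s) = 1 - 2 * s := by
    rw [map_add, map_mul, map_one, map_ofNat, hs]
    ring
  rw [h, map_zero] at h1
  exact two_ne_zero_F2401 (by linear_combination h + (-h1))

theorem one_sub_two_mul_ne_zero {s : F2401} (hs : bar s = -s) : 1 - 2 * s ≠ 0 := by
  have := one_add_two_mul_ne_zero (s := -s) (by rw [map_neg, hs])
  rwa [mul_neg, ← sub_eq_add_neg] at this

theorem bar_one_add {s : F2401} (hs : bar s = -s) : bar (1 + 2 * s) = 1 - 2 * s := by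
  rw [map_add, map_mul, map_one, map_ofNat, hs]
  ring

theorem bar_one_sub {s : F2401} (hs : bar s = -s) : bar (1 - 2 * s) = 1 + 2 * s := by
  rw [map_sub, map_mul, map_one, map_ofNat, hs]
  ring

variable {X S : F2401 → F2401 → F2401} (h : IsInversion X S)

include h

theorem eq_div {x s : F2401} (hx : x ≠ 0) (hs : bar s = -s) :
    X x s = X 1 (s / (x * bar x)) / bar x ∧ S x s = S 1 (s / (x * bar x)) / (x * bar x) := by
  have h0 := mul_bar_ne_zero hx
  have h1 := h.smul x 1 (s / (x * bar x)) hx (by rw [map_div₀, bar_mul_bar, hs, neg_div])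
    (Or.inl one_ne_zero)
  rwa [mul_one, mul_div_cancel₀ _ h0] at h1

theorem fst_zero {s : F2401} (hs : bar s = -s) (hs0 : s ≠ 0) : X 0 s = 0 := by
  have h1 := (h.smul (-1) 0 s (neg_ne_zero.2 one_ne_zero) hs (Or.inr hs0)).1
  rw [mul_zero, map_neg, map_one, neg_mul_neg, one_mul, one_mul, div_neg, div_one] at h1
  have h2 : 2 * X 0 s = 0 := by linear_combination h1
  exact (mul_eq_zero.1 h2).resolve_left two_ne_zero_F2401

theorem snd_mul {s k : F2401} (hs : bar s = -s) (hs0 : s ≠ 0) (hk : bar k = k) (hk0 : k ≠ 0) :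
    S 0 (k * s) = S 0 s / k := by
  obtain ⟨a, rfl⟩ := exists_mul_bar_eq hk hk0
  have h1 := (h.smul a 0 s a.ne_zero hs (Or.inr hs0)).2
  rwa [mul_zero] at h1

theorem fst_one_ne_zero {s : F2401} (hs : bar s = -s) : X 1 s ≠ 0 := by
  intro e
  have h1 := (h.inv_left 1 s hs (Or.inl one_ne_zero)).1
  have h2 := (h.ne_zero 1 s hs (Or.inl one_ne_zero)).resolve_left (fun h2 => h2 e)
  rw [e, h.fst_zero (h.skew 1 s hs (Or.inl one_ne_zero)) h2] at h1
  exact zero_ne_one h1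

theorem skew_one : bar (S 1 0) = -S 1 0 :=
  h.skew 1 0 (by rw [map_zero, neg_zero]) (Or.inl one_ne_zero)

theorem fst_aux : ∃ γ, X (-X 1 0) (-S 1 0) = γ * X 1 0 ∧ bar γ * bar (X 1 0) = -1 ∧
    ∀ s, bar s = -s → X 1 s * (1 + 2 * s) = X 1 0 := by
  have h0 : bar (0 : F2401) = -0 := by rw [map_zero, neg_zero]
  have hA := h.fst_one_ne_zero h0
  have hA' := bar_ne_zero hA
  obtain ⟨γ, hγ, -, h1, h2⟩ := h.exists_mul 1 0 h0 (Or.inl one_ne_zero)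
  have hγ' := bar_ne_zero hγ
  have h3 := h.eq_div (neg_ne_zero.2 (one_ne_zero' F2401)) h0
  rw [map_neg, map_one, neg_mul_neg, mul_one, div_one, div_one, div_neg, div_one] at h3
  rw [neg_zero] at h1 h2
  rw [h3.1] at h1 h2
  rw [h3.2] at h2
  have key : ∀ s, bar s = -s → X 1 s * (1 + 2 * s) / 2 =
      X 1 0 + X 1 s * (1 + 2 * s) / (2 * (bar γ * bar (X 1 0))) := by
    intro s hs
    have hd := one_sub_two_mul_ne_zero hs
    have he := one_add_two_mul_ne_zero hs
    have hd' := bar_one_sub hs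
    have he' := bar_one_add hs
    set x := (1 + 2 * s) / (1 - 2 * s) with hx
    have hx0 : x ≠ 0 := div_ne_zero he hd
    have hxb : bar x = (1 - 2 * s) / (1 + 2 * s) := by rw [hx, map_div₀, hd', he']
    have hN : x * bar x = 1 := by rw [hxb, hx]; field_simp
    have h1x : 1 + x = 2 / (1 - 2 * s) := by rw [hx]; field_simp; ring
    have h1xb : bar (1 + x) = 2 / (1 + 2 * s) := by rw [h1x, map_div₀, hd', map_ofNat]
    have h1x0 : 1 + x ≠ 0 := by rw [h1x]; exact div_ne_zero two_ne_zero_F2401 hd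
    have h4 := h2 x 0 h0 (Or.inl hx0) (Or.inl h1x0)
    have h5 := h.eq_div hx0 h0
    rw [zero_div, hN, div_one] at h5
    rw [h5.1, h5.2] at h4
    have hx' : 1 / bar x = x := by rw [hxb, one_div_div]
    have hA2 : X 1 0 / bar x = X 1 0 * x := by rw [← mul_one_div, hx']
    have e1 : 0 + 0 + (bar 1 * x - 1 * bar x) / 2 = (1 + x) * bar (1 + x) * s := by
      rw [map_one, one_mul, one_mul, h1xb, h1x, hxb, hx]
      field_simp
      ring
    have e2 : γ * (- -X 1 0 + X 1 0 / bar x) = γ * X 1 0 * (1 + x) := by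
      rw [hA2]
      ring
    have e3 : γ * bar γ * (-S 1 0 + S 1 0 + (bar (- -X 1 0) * (X 1 0 / bar x) -
        - -X 1 0 * bar (X 1 0 / bar x)) / 2) =
        γ * X 1 0 * (1 + x) * bar (γ * X 1 0 * (1 + x)) * s := by
      rw [hA2, map_mul, map_mul, map_mul, h1xb, h1x, neg_neg, hxb, hx]
      field_simp
      ring
    have h6 : γ * X 1 0 * (1 + x) ≠ 0 := mul_ne_zero (mul_ne_zero hγ hA) h1x0
    have h7 := (h.smul _ 1 s h1x0 hs (Or.inl one_ne_zero)).1
    have h8 := (h.smul _ 1 s h6 hs (Or.inl one_ne_zero)).1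
    rw [mul_one] at h7 h8
    rw [e1, e2, e3, h7, h8, map_mul, map_mul, h1xb] at h4
    have l1 : X 1 s * (1 + 2 * s) / 2 = X 1 s / (2 / (1 + 2 * s)) := by field_simp
    have l2 : X 1 s * (1 + 2 * s) / (2 * (bar γ * bar (X 1 0))) =
        X 1 s / (bar γ * bar (X 1 0) * (2 / (1 + 2 * s))) := by field_simp
    rw [l1, l2, h4]
  have hk := key 0 h0
  have hk' : bar γ * bar (X 1 0) = -1 := by
    rw [mul_zero, add_zero, mul_one] at hk
    field_simp at hk
    linear_combination -hk
  refine ⟨γ, ?_, hk', fun s hs => ?_⟩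
  · rw [h1]
    ring
  · have := key s hs
    rw [hk'] at this
    field_simp at this
    refine mul_left_cancel₀ two_ne_zero_F2401 ?_
    linear_combination this

theorem fst_one_mul {s : F2401} (hs : bar s = -s) : X 1 s * (1 + 2 * s) = X 1 0 := by
  obtain ⟨γ, -, -, h3⟩ := h.fst_aux
  exact h3 s hs

theorem fst_mul {s x : F2401} (hs : bar s = -s) (hx : x ≠ 0) :
    X x s * bar x * (1 + 2 * (s / (x * bar x))) = X 1 0 := by
  rw [(h.eq_div hx hs).1, div_mul_cancel₀ _ (bar_ne_zero hx),
    h.fst_one_mul (by rw [map_div₀, bar_mul_bar, hs, neg_div])]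

theorem bar_fst_one : bar (X 1 0) = X 1 0 := by
  have h0 : bar (0 : F2401) = -0 := by rw [map_zero, neg_zero]
  have hA := h.fst_one_ne_zero h0
  obtain ⟨γ, h1, h2, -⟩ := h.fst_aux
  have h3 : γ * X 1 0 = -1 := by
    have := congrArg bar h2
    rwa [map_mul, bar_bar, bar_bar, map_neg, map_one] at this
  have h4 := h.fst_mul (s := -S 1 0) (x := -X 1 0) (by rw [map_neg, h.skew_one]) (neg_ne_zero.2 hA)
  have h5 := h.fst_mul (s := S 1 0) (x := X 1 0) h.skew_one hA
  rw [(h.inv_left 1 0 h0 (Or.inl one_ne_zero)).1] at h5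
  rw [h1, h3, map_neg, neg_mul_neg, neg_div] at h4
  have h6 : 2 * bar (X 1 0) = 2 * X 1 0 := by linear_combination h4 + h5
  exact mul_left_cancel₀ two_ne_zero_F2401 h6

theorem snd_one {s : F2401} (hs : bar s = -s) : S 1 s = -(s * (X 1 s * bar (X 1 s))) := by
  have hX := h.fst_one_ne_zero hs
  have hS := h.skew 1 s hs (Or.inl one_ne_zero)
  have h1 := h.fst_mul hS hX
  rw [(h.inv_left 1 s hs (Or.inl one_ne_zero)).1, one_mul] at h1
  have h2 := congrArg bar (h.fst_one_mul hs)
  rw [map_mul, h.bar_fst_one, ← h1, bar_one_add hs] at h2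
  have h3 := mul_left_cancel₀ (bar_ne_zero hX) h2
  have h4 : S 1 s / (X 1 s * bar (X 1 s)) = -s := mul_left_cancel₀ two_ne_zero_F2401 (by
    linear_combination -h3)
  rw [div_eq_iff (mul_bar_ne_zero hX)] at h4
  rw [h4, neg_mul]

theorem snd_zero_aux {v : F2401} (hv : bar v = -v) (hv0 : v ≠ 0) :
    (4 * (v * S 0 v) - X 1 0 ^ 2) * (v * S 0 v + X 1 0 ^ 2 * v ^ 2) = 0 := by
  have h0 : bar (0 : F2401) = -0 := by rw [map_zero, neg_zero]
  have hA := h.fst_one_ne_zero h0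
  have hn1 : ∀ {s}, bar s = -s → s ≠ 0 → S 0 (-s) = -S 0 s := fun hs hs0 => by
    have := h.snd_mul (k := -1) hs hs0 (by rw [map_neg, map_one]) (neg_ne_zero.2 one_ne_zero)
    rwa [neg_one_mul, div_neg, div_one] at this
  obtain ⟨c, hc, h1, -, h2⟩ := h.exists_mul 0 v hv (Or.inr hv0)
  have hg := h.skew 0 v hv (Or.inr hv0)
  have hinv := (h.inv_left 0 v hv (Or.inr hv0)).2
  have hX := h.fst_zero hv hv0
  have hg0 := (h.ne_zero 0 v hv (Or.inr hv0)).resolve_left (fun h2 => h2 hX)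
  have hXn : X 0 (-v) = 0 := h.fst_zero (by rw [map_neg, hv]) (neg_ne_zero.2 hv0)
  rw [neg_zero, hX, neg_zero, hn1 hg hg0, hn1 hv hv0] at h1
  rw [hX] at hinv
  rw [hinv] at h1
  have h3 := h2 1 0 h0 (Or.inl one_ne_zero) (Or.inl (by rw [zero_add]; exact one_ne_zero))
  have hS0 : S 1 0 = 0 := by rw [h.snd_one h0, zero_mul, neg_zero]
  rw [neg_zero, hn1 hv hv0, hXn, hX, hS0] at h3
  simp only [map_zero, neg_zero, zero_mul, sub_zero, zero_div, add_zero, zero_add, neg_neg,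
    mul_one] at h3
  set g := S 0 v with hgdef
  have hcA : c * X 1 0 ≠ 0 := mul_ne_zero hc hA
  have hcg : bar (c * bar c * g) = -(c * bar c * g) := by rw [map_mul, bar_mul_bar, hg, mul_neg]
  have h4 := h.fst_mul hcg hcA
  rw [← h3, map_mul, h.bar_fst_one] at h4
  have h5 := h.fst_one_mul hv
  have hX1 := h.fst_one_ne_zero hv
  have hc' := bar_ne_zero hc
  have h6 : c * bar c * g / (c * X 1 0 * (bar c * X 1 0)) = g / X 1 0 ^ 2 := by field_simp
  have hb := h.bar_fst_one
  set A := X 1 0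
  have h7 : bar c * (A * (1 + 2 * (g / A ^ 2))) = 1 + 2 * v := by
    refine mul_left_cancel₀ hX1 ?_
    rw [h5]
    rw [h6] at h4
    linear_combination h4
  have h8 : bar c * (A ^ 2 + 2 * g) = A * (1 + 2 * v) := by
    rw [← h7]
    field_simp
  have h9 : c * (A ^ 2 - 2 * g) = A * (1 - 2 * v) := by
    have := congrArg bar h8
    rw [map_mul, map_mul, bar_bar, bar_one_add hv, map_add, map_pow, map_mul, map_ofNat, hb, hg] at this
    rw [← this]
    ring
  linear_combination (v * g) * (bar c * (A ^ 2 + 2 * g) * h9 + A * (1 - 2 * v) * h8) +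
    v * (A ^ 4 - 4 * g ^ 2) * h1

theorem snd_zero {v : F2401} (hv : bar v = -v) (hv0 : v ≠ 0) : 4 * (v * S 0 v) = X 1 0 ^ 2 := by
  by_contra hne
  have hA : X 1 0 ≠ 0 := h.fst_one_ne_zero (by rw [map_zero, neg_zero])
  have h2 : bar (2 : F2401) = 2 := map_ofNat bar 2
  have h1 := (mul_eq_zero.1 (h.snd_zero_aux hv hv0)).resolve_left (sub_ne_zero.2 hne)
  have h3 := h.snd_zero_aux (v := 2 * v) (by rw [map_mul, h2, hv, mul_neg])
    (mul_ne_zero two_ne_zero_F2401 hv0)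
  have h4 : 2 * v * S 0 (2 * v) = v * S 0 v := by
    rw [h.snd_mul hv hv0 h2 two_ne_zero_F2401]
    field_simp
  rw [h4] at h3
  have h5 := (mul_eq_zero.1 h3).resolve_left (sub_ne_zero.2 hne)
  have h7 : (7 : F2401) = 0 := CharP.cast_eq_zero F2401 7
  have h6 : X 1 0 ^ 2 * v ^ 2 = 0 := by
    linear_combination 2 * h1 - 2 * h5 + X 1 0 ^ 2 * v ^ 2 * h7
  exact mul_ne_zero (pow_ne_zero 2 hA) (pow_ne_zero 2 hv0) h6

/-- The inversion is determined by the coordinate of the image of a single point. -/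
theorem eq_formula {x s : F2401} (hs : bar s = -s) (hne : x ≠ 0 ∨ s ≠ 0) :
    X x s = X 1 0 * x / (x * bar x + 2 * s) ∧
      S x s = -(X 1 0 ^ 2 * s / ((x * bar x + 2 * s) * (x * bar x - 2 * s))) := by
  by_cases hx : x = 0
  · subst hx
    have hs0 : s ≠ 0 := hne.resolve_left (fun e => e rfl)
    refine ⟨by rw [h.fst_zero hs hs0, mul_zero, zero_div], ?_⟩
    rw [← h.snd_zero hs hs0, zero_mul]
    have := two_ne_zero_F2401
    field_simp
    ring
  · have hσ : bar (s / (x * bar x)) = -(s / (x * bar x)) := by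
      rw [map_div₀, bar_mul_bar, hs, neg_div]
    have hN := mul_bar_ne_zero hx
    have hx' := bar_ne_zero hx
    obtain ⟨h1, h2⟩ := h.eq_div hx hs
    rw [h.snd_one hσ] at h2
    have h3 := h.fst_one_mul hσ
    have h4 := one_add_two_mul_ne_zero hσ
    have h5 := one_sub_two_mul_ne_zero hσ
    have h6 := bar_one_add hσ
    have h7 : x * bar x + 2 * s = x * bar x * (1 + 2 * (s / (x * bar x))) := by field_simp
    have h8 : x * bar x - 2 * s = x * bar x * (1 - 2 * (s / (x * bar x))) := by field_simp
    have h9 := h.bar_fst_one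
    have h10 : s = x * bar x * (s / (x * bar x)) := (mul_div_cancel₀ s hN).symm
    set σ := s / (x * bar x)
    have h11 : X 1 σ = X 1 0 / (1 + 2 * σ) := by rw [eq_div_iff h4, h3]
    have h12 : bar (X 1 σ) = X 1 0 / (1 - 2 * σ) := by rw [h11, map_div₀, h9, h6]
    rw [h12, h11] at h2
    rw [h11] at h1
    rw [h1, h2, h7, h8]
    constructor
    · field_simp
    · rw [h10]
      field_simp

end IsInversion

section SevenTI

open scoped Pointwise
open IsSevenTI

variable {G : Type*} [Group G] [Finite G] [IsSevenTI G] {P : Sylow 7 G} {t w : G}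

theorem bar_heisenberg {x y s r : F2401} (hs : bar s = -s) (hr : bar r = -r) :
    bar (s + r + (bar x * y - x * bar y) / 2) = -(s + r + (bar x * y - x * bar y) / 2) := by
  rw [map_add, map_add, map_div₀, map_sub, map_mul, map_mul, bar_bar, bar_bar, map_ofNat, hs, hr]
  ring

theorem bar_norm_mul {a s : F2401} (hs : bar s = -s) : bar (a * bar a * s) = -(a * bar a * s) := by
  rw [map_mul, bar_mul_bar, hs, mul_neg]

theorem bar_zero_eq : bar (0 : F2401) = -0 := by rw [map_zero, neg_zero]

theorem bar_neg_eq {s : F2401} (hs : bar s = -s) : bar (-s) = - -s := by rw [map_neg, hs]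


namespace IsCoord

variable {η : F2401ˣ →* G} {E : F2401 → F2401 → G} (hC : IsCoord P t w η E)

include hC

theorem zero_zero : E 0 0 = 1 := by
  have h1 := hC.mul 0 0 0 0 bar_zero_eq bar_zero_eq
  simpa using h1

theorem inv {x s : F2401} (hs : bar s = -s) : (E x s)⁻¹ = E (-x) (-s) := by
  refine inv_eq_of_mul_eq_one_right ?_
  rw [hC.mul x (-x) s (-s) hs (bar_neg_eq hs), add_neg_cancel, add_neg_cancel, map_neg,
    show (0 + (bar x * -x - x * -bar x) / 2 : F2401) = 0 by ring, hC.zero_zero]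

theorem ne_one {x s : F2401} (hs : bar s = -s) (hne : x ≠ 0 ∨ s ≠ 0) : E x s ≠ 1 := by
  intro e
  rw [← hC.zero_zero] at e
  obtain ⟨rfl, rfl⟩ := hC.ext _ _ _ _ hs bar_zero_eq e
  exact hne.elim (fun h => h rfl) (fun h => h rfl)

theorem exists_swap : ∃ X S : F2401 → F2401 → F2401, ∀ x s, bar s = -s → (x ≠ 0 ∨ s ≠ 0) →
    bar (S x s) = -S x s ∧ E (X x s) (S x s) • w • P = w • E x s • w • P := by
  have h1 : ∀ x s, ∃ y r, bar s = -s → (x ≠ 0 ∨ s ≠ 0) →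
      bar r = -r ∧ E y r • w • P = w • E x s • w • P := by
    intro x s
    by_cases hne : bar s = -s ∧ (x ≠ 0 ∨ s ≠ 0)
    · obtain ⟨hs, hne⟩ := hne
      have hwP := hC.base.frame.ne
      obtain ⟨v, hv, hvQ⟩ := exists_mem_smul_eq hwP (R := w • E x s • w • P) (fun e => by
        refine hC.ne_one hs hne (eq_of_smul_eq_smul hwP (hC.mem x s) (one_mem _) ?_)
        rw [one_smul]
        nth_rw 2 [← e]
        rw [hC.base.smul_smul])
      obtain ⟨y, r, hr, rfl⟩ := hC.exists_eq v hv
      exact ⟨y, r, fun _ _ => ⟨hr, hvQ⟩⟩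
    · exact ⟨0, 0, fun h2 h3 => absurd ⟨h2, h3⟩ hne⟩
  choose X S h using h1
  exact ⟨X, S, h⟩

variable {X S : F2401 → F2401 → F2401} (hXS : ∀ x s, bar s = -s → (x ≠ 0 ∨ s ≠ 0) →
    bar (S x s) = -S x s ∧ E (X x s) (S x s) • w • P = w • E x s • w • P)

include hXS

theorem eq_of_swap {x s y r : F2401} (hs : bar s = -s) (hne : x ≠ 0 ∨ s ≠ 0) (hr : bar r = -r)
    (h : E y r • w • P = w • E x s • w • P) : X x s = y ∧ S x s = r := by
  obtain ⟨h1, h2⟩ := hXS x s hs hne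
  exact hC.ext _ _ _ _ h1 hr (eq_of_smul_eq_smul hC.base.frame.ne (hC.mem _ _) (hC.mem _ _)
    (h2.trans h.symm))

theorem swap_ne_zero {x s : F2401} (hs : bar s = -s) (hne : x ≠ 0 ∨ s ≠ 0) :
    X x s ≠ 0 ∨ S x s ≠ 0 := by
  by_contra! h
  obtain ⟨-, h2⟩ := hXS x s hs hne
  rw [h.1, h.2, hC.zero_zero, one_smul, smul_left_cancel_iff] at h2
  exact smul_ne_left hC.base.frame.ne (hC.mem x s) h2.symm

theorem exists_mul_of_swap {x s : F2401} (hs : bar s = -s) (hne : x ≠ 0 ∨ s ≠ 0) :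
    ∃ c : F2401ˣ, (E (X x s) (S x s))⁻¹ * (w * E x s * w) =
      w * (η c * E (-X (-x) (-s)) (-S (-x) (-s)) * (η c)⁻¹) * η c ∧
      E (X (-X x s) (-S x s)) (S (-X x s) (-S x s)) =
        η c * E (-X (-x) (-s)) (-S (-x) (-s)) * (η c)⁻¹ := by
  have hB := hC.base
  have hwP := hB.frame.ne
  obtain ⟨hSs, hu⟩ := hXS x s hs hne
  have hs' := bar_neg_eq hs
  have hne' : -x ≠ 0 ∨ -s ≠ 0 := by rwa [neg_ne_zero, neg_ne_zero]
  obtain ⟨hSs', hu'⟩ := hXS (-x) (-s) hs' hne'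
  have hX := hC.swap_ne_zero hXS hs hne
  obtain ⟨hF', hF⟩ := hXS (-X x s) (-S x s) (bar_neg_eq hSs) (by rwa [neg_ne_zero, neg_ne_zero])
  rw [← hC.inv hs] at hu'
  rw [← hC.inv hSs'] 
  rw [← hC.inv hSs] at hF
  set u := E x s
  set F := E (X x s) (S x s)
  set F' := E (X (-x) (-s)) (S (-x) (-s)) with hF'def
  have hFP : F⁻¹ • P = P := Sylow.smul_eq_of_mem (inv_mem (hC.mem _ _))
  have hg : (w * F⁻¹ * w * u * w) • P = P := by
    simp only [mul_smul]
    rw [← hu, inv_smul_smul, hB.smul_smul]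
  obtain ⟨p, hp, k, hk, hpk⟩ := exists_mul_of_smul_eq hwP hg
  obtain ⟨c, rfl⟩ := hC.exists_of_mem k hk
  have h1 : F⁻¹ * (w * u * w) = w * p * η c := by
    rw [mul_assoc w p, ← hpk]
    simp only [← mul_assoc, hB.mul_self, one_mul]
  have h2 : p • w • P = w • F⁻¹ • w • P := by
    have h3 : (p * η c) • w • P = (w * F⁻¹ * w * u * w) • w • P := by rw [hpk]
    simp only [mul_smul] at h3
    rwa [smul_eq_right hk, hB.smul_smul, Sylow.smul_eq_of_mem (hC.mem x s)] at h3
  have h3 : p * (η c * F' * (η c)⁻¹) = 1 := by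
    refine eq_of_smul_eq_smul hwP (mul_mem hp (conj_mem_of_smul_eq (smul_eq_left hk) (hC.mem _ _)))
      (one_mem _) ?_
    rw [mul_smul, ← smul_smul_of_smul_eq (smul_eq_right hk), hu', one_smul]
    have h4 : (w * p * η c) • w • u⁻¹ • w • P = P := by
      rw [← h1, mul_smul, mul_smul, mul_smul, hB.smul_smul, smul_inv_smul, hB.smul_smul, hFP]
    rw [mul_smul, mul_smul] at h4
    rw [← hB.smul_smul (p • _), h4]
  have h4 : p = η c * F'⁻¹ * (η c)⁻¹ := by
    rw [mul_eq_one_iff_eq_inv.1 h3]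
    group
  rw [h4] at h1 h2
  refine ⟨c, h1, ?_⟩
  exact eq_of_smul_eq_smul hwP (hC.mem _ _) (conj_mem_of_smul_eq (smul_eq_left hk)
    (inv_mem (hC.mem _ _))) (hF.trans h2.symm)

theorem isInversion : IsInversion X S where
  skew x s hs hne := (hXS x s hs hne).1
  ne_zero x s hs hne := hC.swap_ne_zero hXS hs hne
  inv_left x s hs hne := by
    obtain ⟨h1, h2⟩ := hXS x s hs hne
    refine hC.eq_of_swap hXS h1 (hC.swap_ne_zero hXS hs hne) hs ?_
    rw [h2, hC.base.smul_smul]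
  smul a x s ha hs hne := by
    obtain ⟨h1, h2⟩ := hXS x s hs hne
    have hne' : a * x ≠ 0 ∨ a * bar a * s ≠ 0 := hne.imp (mul_ne_zero ha)
      (mul_ne_zero (mul_bar_ne_zero ha))
    have h3 := hC.conj (Units.mk0 a ha) x s hs
    have h4 := hC.conj (Units.mk0 a ha ^ 49)⁻¹ (X x s) (S x s) h1
    have h5 : (((Units.mk0 a ha ^ 49)⁻¹ : F2401ˣ) : F2401) = (bar a)⁻¹ := by
      rw [Units.val_inv_eq_inv_val, Units.val_pow_eq_pow_val, Units.val_mk0, bar_apply]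
    rw [h5, map_inv₀, bar_bar] at h4
    rw [Units.val_mk0] at h3
    have h6 := hC.eq_of_swap hXS (bar_norm_mul hs) hne'
      (r := (bar a)⁻¹ * a⁻¹ * S x s) (y := (bar a)⁻¹ * X x s) (by
        rw [map_mul, map_mul, map_inv₀, map_inv₀, bar_bar, h1]
        ring) (by
        rw [← h3, ← h4, ← smul_smul_of_smul_eq (smul_eq_right (hC.mem_twoPoint _)),
          ← smul_smul_of_smul_eq (smul_eq_right (hC.mem_twoPoint _)), h2, ← hC.conj_eq, mul_smul,
          mul_smul, hC.base.smul_smul])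
    rw [h6.1, h6.2, div_eq_inv_mul, div_eq_inv_mul, mul_inv_rev]
    exact ⟨rfl, rfl⟩
  exists_mul x s hs hne := by
    have hB := hC.base
    have hwP := hB.frame.ne
    obtain ⟨c, h1, h2⟩ := hC.exists_mul_of_swap hXS hs hne
    obtain ⟨hSs, hu⟩ := hXS x s hs hne
    have hne' : -x ≠ 0 ∨ -s ≠ 0 := by rwa [neg_ne_zero, neg_ne_zero]
    obtain ⟨hSs', hu'⟩ := hXS (-x) (-s) (bar_neg_eq hs) hne'
    have hX := hC.swap_ne_zero hXS hs hne
    obtain ⟨hF', -⟩ := hXS (-X x s) (-S x s) (bar_neg_eq hSs) (by rwa [neg_ne_zero, neg_ne_zero])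
    rw [hC.conj _ _ _ (bar_neg_eq hSs')] at h2
    obtain ⟨h3, h4⟩ := hC.ext _ _ _ _ hF' (bar_norm_mul (bar_neg_eq hSs')) h2
    refine ⟨c, c.ne_zero, by rw [h4, mul_neg], by rw [h3, mul_neg], fun y r hr hne1 hne2 => ?_⟩
    obtain ⟨hSr, hv⟩ := hXS y r hr hne1
    have hxy := bar_heisenberg (x := x) (y := y) hs hr
    have hab := bar_heisenberg (x := -X (-x) (-s)) (y := X y r) (bar_neg_eq hSs') hSr
    have h5 := hC.mul x y s r hs hr
    have h6 := hC.mul (-X (-x) (-s)) (X y r) (-S (-x) (-s)) (S y r) (bar_neg_eq hSs') hSr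
    have h7 := hC.conj c (-X (-x) (-s) + X y r) _ hab
    rw [← h6] at h7
    set a := c * (-X (-x) (-s) + X y r)
    set b := c * bar c * (-S (-x) (-s) + S y r +
          (bar (-X (-x) (-s)) * X y r - -X (-x) (-s) * bar (X y r)) / 2)
    have hb : bar b = -b := bar_norm_mul hab
    have hcw : (η c)⁻¹ • w • P = w • P := inv_smul_eq_iff.2 (smul_eq_right (hC.mem_twoPoint c)).symm
    have h8 : w • (E x s * E y r) • w • P = E (X x s) (S x s) • w • E a b • w • P := by
      rw [← inv_smul_eq_iff]
      calc (E (X x s) (S x s))⁻¹ • w • (E x s * E y r) • w • P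
          = ((E (X x s) (S x s))⁻¹ * (w * E x s * w)) • w • E y r • w • P := by
            simp only [mul_smul, hB.smul_smul]
        _ = w • E a b • w • P := by
            rw [h1, ← hv, ← h7]
            simp only [mul_smul, hcw, inv_smul_smul]
    have hne3 : a ≠ 0 ∨ b ≠ 0 := by
      by_contra! h
      rw [h.1, h.2, hC.zero_zero, one_smul, hB.smul_smul, Sylow.smul_eq_of_mem (hC.mem _ _), h5,
        ← hB.smul_smul P, smul_left_cancel_iff, hB.smul_smul] at h8
      exact hC.ne_one hxy hne2 (eq_of_smul_eq_smul hwP (hC.mem _ _) (one_mem _)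
        (by rw [h8, one_smul]))
    obtain ⟨hSab, hab'⟩ := hXS a b hb hne3
    rw [← hab', ← mul_smul (E (X x s) (S x s)), hC.mul _ _ _ _ hSs hSab, h5] at h8
    exact (hC.eq_of_swap hXS hxy hne2 (bar_heisenberg hSs hSab) h8.symm).1

end IsCoord

end SevenTI

section SevenTI

open scoped Pointwise
open IsSevenTI

variable {G : Type*} [Group G] [Finite G] [IsSevenTI G] {P : Sylow 7 G} {t w : G}

/-- Coordinates in which the action of `w` on the points other than `P` is given by a fixed
formula. -/
structure IsNormalCoord (P : Sylow 7 G) (t w : G) (η : F2401ˣ →* G) (E : F2401 → F2401 → G) : Prop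
    extends IsCoord P t w η E where
  swap : ∀ x s, bar s = -s → (x ≠ 0 ∨ s ≠ 0) →
    E (2 * x / (x * bar x + 2 * s))
      (-(4 * s / ((x * bar x + 2 * s) * (x * bar x - 2 * s)))) • w • P = w • E x s • w • P

namespace IsCoord

variable {η : F2401ˣ →* G} {E : F2401 → F2401 → G} (hC : IsCoord P t w η E)

include hC

theorem rescale (b : F2401ˣ) : IsCoord P t w η (fun x s => E (b * x) (b * bar b * s)) where
  base := hC.base
  injective := hC.injective
  mem_twoPoint := hC.mem_twoPoint
  exists_of_mem := hC.exists_of_mem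
  map_neg_one := hC.map_neg_one
  conj_eq := hC.conj_eq
  mem _ _ := hC.mem _ _
  mul x y s r hs hr := by
    rw [hC.mul _ _ _ _ (bar_norm_mul hs) (bar_norm_mul hr), map_mul, map_mul]
    congr 1 <;> ring
  conj a x s hs := by
    rw [hC.conj _ _ _ (bar_norm_mul hs), mul_left_comm, mul_left_comm (b * bar b : F2401)]
  exists_eq u hu := by
    obtain ⟨x, s, hs, rfl⟩ := hC.exists_eq u hu
    have hN := mul_bar_ne_zero b.ne_zero
    refine ⟨x / b, s / (b * bar b), by rw [map_div₀, bar_mul_bar, hs, neg_div], ?_⟩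
    rw [mul_div_cancel₀ _ b.ne_zero, mul_div_cancel₀ _ hN]
  ext x y s r hs hr h := by
    obtain ⟨h1, h2⟩ := hC.ext _ _ _ _ (bar_norm_mul hs) (bar_norm_mul hr) h
    exact ⟨mul_left_cancel₀ b.ne_zero h1, mul_left_cancel₀ (mul_bar_ne_zero b.ne_zero) h2⟩

theorem exists_isNormalCoord : ∃ E, IsNormalCoord P t w η E := by
  obtain ⟨X, S, hXS⟩ := hC.exists_swap
  have hI := hC.isInversion hXS
  obtain ⟨b, hb⟩ := exists_mul_bar_eq (c := X 1 0 / 2) (by rw [map_div₀, hI.bar_fst_one, map_ofNat])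
    (div_ne_zero (hI.fst_one_ne_zero bar_zero_eq) two_ne_zero_F2401)
  refine ⟨_, hC.rescale b, fun x s hs hne => ?_⟩
  have hN := mul_bar_ne_zero b.ne_zero
  have hA : X 1 0 = 2 * (b * bar b) := by rw [hb, mul_div_cancel₀ _ two_ne_zero_F2401]
  have hne' : b * x ≠ 0 ∨ b * bar b * s ≠ 0 := hne.imp (mul_ne_zero b.ne_zero) (mul_ne_zero hN)
  obtain ⟨h1, h2⟩ := hI.eq_formula (bar_norm_mul hs) hne'
  obtain ⟨-, h3⟩ := hXS _ _ (bar_norm_mul hs) hne'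
  have hp : b * x * bar (b * x) + 2 * (b * bar b * s) = b * bar b * (x * bar x + 2 * s) := by
    rw [map_mul]; ring
  have hm : b * x * bar (b * x) - 2 * (b * bar b * s) = b * bar b * (x * bar x - 2 * s) := by
    rw [map_mul]; ring
  rw [hp, hA] at h1
  rw [hp, hm, hA] at h2
  have h4 : b * (2 * x / (x * bar x + 2 * s)) = X (b * x) (b * bar b * s) := by
    rw [h1, mul_assoc 2, mul_left_comm, mul_div_mul_left _ _ hN, mul_div_assoc', mul_left_comm]
  have h5 : b * bar b * -(4 * s / ((x * bar x + 2 * s) * (x * bar x - 2 * s))) =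
      S (b * x) (b * bar b * s) := by
    rw [h2, mul_neg, show (2 * (b * bar b)) ^ 2 * (b * bar b * s) =
      b * bar b * (b * bar b) * (b * bar b * (4 * s)) by ring, mul_mul_mul_comm _ (x * bar x + 2 * s),
      mul_div_mul_left _ _ (mul_ne_zero hN hN), mul_div_assoc']
  change E (b * (2 * x / (x * bar x + 2 * s))) _ • w • P = w • E (b * x) (b * bar b * s) • w • P
  rw [h4, h5, h3]

end IsCoord

end SevenTI

section SevenTI

open scoped Pointwise
open IsSevenTI

variable {G : Type*} [Group G] [Finite G] [IsSevenTI G] {P : Sylow 7 G} {t w : G}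
  {η : F2401ˣ →* G} {E : F2401 → F2401 → G}
  {G' : Type*} [Group G'] [Finite G'] [IsSevenTI G'] {P' : Sylow 7 G'} {t' w' : G'}
  {η' : F2401ˣ →* G'} {E' : F2401 → F2401 → G'}

theorem IsCoord.eq_or_exists (hC : IsCoord P t w η E) (R : Sylow 7 G) :
    R = P ∨ ∃ x s, bar s = -s ∧ R = E x s • w • P := by
  by_cases hR : R = P
  · exact Or.inl hR
  · obtain ⟨u, hu, rfl⟩ := exists_mem_smul_eq hC.base.frame.ne hR
    obtain ⟨x, s, hs, rfl⟩ := hC.exists_eq u hu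
    exact Or.inr ⟨x, s, hs, rfl⟩

/-- Two points correspond if they have the same coordinates. -/
def PointRel (P : Sylow 7 G) (w : G) (E : F2401 → F2401 → G) (P' : Sylow 7 G') (w' : G')
    (E' : F2401 → F2401 → G') (R : Sylow 7 G) (R' : Sylow 7 G') : Prop :=
  (R = P ∧ R' = P') ∨ ∃ x s, bar s = -s ∧ R = E x s • w • P ∧ R' = E' x s • w' • P'

namespace PointRel

theorem symm {R : Sylow 7 G} {R' : Sylow 7 G'} (h : PointRel P w E P' w' E' R R') :
    PointRel P' w' E' P w E R' R :=
  h.imp And.symm fun ⟨x, s, hs, h1, h2⟩ => ⟨x, s, hs, h2, h1⟩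

theorem right_unique (hC : IsCoord P t w η E) {R : Sylow 7 G} {R₁ R₂ : Sylow 7 G'}
    (h₁ : PointRel P w E P' w' E' R R₁) (h₂ : PointRel P w E P' w' E' R R₂) : R₁ = R₂ := by
  have hwP := hC.base.frame.ne
  obtain ⟨h1, rfl⟩ | ⟨x, s, hs, h1, rfl⟩ := h₁ <;> obtain ⟨h2, rfl⟩ | ⟨y, r, hr, h2, rfl⟩ := h₂
  · rfl
  · exact absurd (h2.symm.trans h1) (smul_ne_left hwP (hC.mem y r))
  · exact absurd (h1.symm.trans h2) (smul_ne_left hwP (hC.mem x s))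
  · obtain ⟨rfl, rfl⟩ := hC.ext _ _ _ _ hs hr
      (eq_of_smul_eq_smul hwP (hC.mem _ _) (hC.mem _ _) (h1.symm.trans h2))
    rfl

theorem exists_right (hC : IsCoord P t w η E) (R : Sylow 7 G) :
    ∃ R', PointRel P w E P' w' E' R R' := by
  obtain h | ⟨x, s, hs, h⟩ := hC.eq_or_exists R
  · exact ⟨P', Or.inl ⟨h, rfl⟩⟩
  · exact ⟨_, Or.inr ⟨x, s, hs, h, rfl⟩⟩

end PointRel

/-- Two group elements correspond if they act in the same way in coordinates. -/
def ElemRel (P : Sylow 7 G) (w : G) (E : F2401 → F2401 → G) (P' : Sylow 7 G') (w' : G')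
    (E' : F2401 → F2401 → G') (g : G) (g' : G') : Prop :=
  ∀ R R', PointRel P w E P' w' E' R R' ↔ PointRel P w E P' w' E' (g • R) (g' • R')

namespace ElemRel

theorem symm {g : G} {g' : G'} (h : ElemRel P w E P' w' E' g g') :
    ElemRel P' w' E' P w E g' g := fun R R' =>
  ⟨fun h1 => ((h R' R).1 h1.symm).symm, fun h1 => ((h R' R).2 h1.symm).symm⟩

theorem mul {g k : G} {g' k' : G'} (h : ElemRel P w E P' w' E' g g')
    (h' : ElemRel P w E P' w' E' k k') : ElemRel P w E P' w' E' (g * k) (g' * k') := fun R R' => by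
  rw [h' R R', h, mul_smul, mul_smul]

theorem of_forall {g k : G} {g' k' : G'} (hg : k * g = 1) (hg' : k' * g' = 1)
    (h : ∀ R R', PointRel P w E P' w' E' R R' → PointRel P w E P' w' E' (g • R) (g' • R'))
    (h' : ∀ R R', PointRel P w E P' w' E' R R' → PointRel P w E P' w' E' (k • R) (k' • R')) :
    ElemRel P w E P' w' E' g g' := fun R R' =>
  ⟨h R R', fun h1 => by
    have h2 := h' _ _ h1
    rwa [← mul_smul, ← mul_smul, hg, hg', one_smul, one_smul] at h2⟩

theorem eq_one (hC : IsCoord P t w η E) (hC' : IsCoord P' t' w' η' E') {g' : G'}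
    (h : ElemRel P w E P' w' E' 1 g') : g' = 1 := by
  have h1 : ∀ R' : Sylow 7 G', g' • R' = R' := by
    intro R'
    obtain ⟨R, hR⟩ := PointRel.exists_right (P' := P) (w' := w) (E' := E) hC' R'
    have h2 := (h R R').1 hR.symm
    rw [one_smul] at h2
    exact PointRel.right_unique hC h2 hR.symm
  have hwP := hC'.base.frame.ne
  obtain ⟨x, hx, hxc⟩ := exists_notMem_cen P'
  have hk := mem_twoPoint.2 ⟨h1 P', h1 (w' • P')⟩
  exact eq_one_of_commute hwP hk hx hxc ((smul_smul_eq_iff hwP hk hx).1 (h1 _))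

theorem unique (hC : IsCoord P t w η E) (hC' : IsCoord P' t' w' η' E') {g : G} {g' k' : G'}
    (h : ElemRel P w E P' w' E' g g') (h' : ElemRel P w E P' w' E' g k') : g' = k' := by
  rw [← inv_mul_eq_one]
  refine eq_one hC hC' fun R R' => ?_
  rw [one_smul, h R ((g'⁻¹ * k') • R'), ← mul_smul g', mul_inv_cancel_left]
  exact h' R R'

variable (hC : IsNormalCoord P t w η E) (hC' : IsNormalCoord P' t' w' η' E')

include hC hC'

theorem coord {x s : F2401} (hs : bar s = -s) : ElemRel P w E P' w' E' (E x s) (E' x s) := by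
  have h : ∀ x s, bar s = -s → ∀ R R', PointRel P w E P' w' E' R R' →
      PointRel P w E P' w' E' (E x s • R) (E' x s • R') := by
    rintro x s hs R R' (⟨rfl, rfl⟩ | ⟨y, r, hr, rfl, rfl⟩)
    · exact Or.inl ⟨Sylow.smul_eq_of_mem (hC.mem x s), Sylow.smul_eq_of_mem (hC'.mem x s)⟩
    · refine Or.inr ⟨x + y, _, bar_heisenberg (x := x) (y := y) hs hr, ?_, ?_⟩
      · rw [← hC.mul _ _ _ _ hs hr, mul_smul]
      · rw [← hC'.mul _ _ _ _ hs hr, mul_smul]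
  refine of_forall (k := E (-x) (-s)) (k' := E' (-x) (-s)) ?_ ?_ (h x s hs)
    (h (-x) (-s) (bar_neg_eq hs))
  · rw [← hC.inv hs, inv_mul_cancel]
  · rw [← hC'.inv hs, inv_mul_cancel]

theorem torus (a : F2401ˣ) : ElemRel P w E P' w' E' (η a) (η' a) := by
  have h : ∀ a R R', PointRel P w E P' w' E' R R' →
      PointRel P w E P' w' E' (η a • R) (η' a • R') := by
    rintro a R R' (⟨rfl, rfl⟩ | ⟨y, r, hr, rfl, rfl⟩)
    · exact Or.inl ⟨smul_eq_left (hC.mem_twoPoint a), smul_eq_left (hC'.mem_twoPoint a)⟩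
    · refine Or.inr ⟨a * y, _, bar_norm_mul (a := a) hr, ?_, ?_⟩
      · rw [← hC.conj a y r hr, ← smul_smul_of_smul_eq (smul_eq_right (hC.mem_twoPoint a))]
      · rw [← hC'.conj a y r hr, ← smul_smul_of_smul_eq (smul_eq_right (hC'.mem_twoPoint a))]
  refine of_forall (k := η a⁻¹) (k' := η' a⁻¹) ?_ ?_ (h a) (h a⁻¹)
  · rw [← map_mul, inv_mul_cancel, map_one]
  · rw [← map_mul, inv_mul_cancel, map_one]

theorem weyl : ElemRel P w E P' w' E' w w' := by
  have h : ∀ R R', PointRel P w E P' w' E' R R' → PointRel P w E P' w' E' (w • R) (w' • R') := by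
    rintro R R' (⟨rfl, rfl⟩ | ⟨x, s, hs, rfl, rfl⟩)
    · exact Or.inr ⟨0, 0, bar_zero_eq, by rw [hC.zero_zero, one_smul],
        by rw [hC'.zero_zero, one_smul]⟩
    · by_cases hne : x ≠ 0 ∨ s ≠ 0
      · refine Or.inr ⟨_, _, ?_, (hC.swap x s hs hne).symm, (hC'.swap x s hs hne).symm⟩
        rw [map_neg, map_div₀, map_mul, map_mul, map_add, map_sub, bar_mul_bar, map_mul, map_ofNat,
          map_ofNat, hs]
        ring
      · push Not at hne
        rw [hne.1, hne.2, hC.zero_zero, hC'.zero_zero, one_smul, one_smul, hC.base.smul_smul,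
          hC'.base.smul_smul]
        exact Or.inl ⟨rfl, rfl⟩
  exact of_forall hC.base.mul_self hC'.base.mul_self h h

theorem exists_right (g : G) : ∃ g', ElemRel P w E P' w' E' g g' := by
  have hwP := hC.base.frame.ne
  have h1 : ∀ g : G, g • P = P → ∃ g', ElemRel P w E P' w' E' g g' := by
    intro g hg
    obtain ⟨u, hu, k, hk, rfl⟩ := exists_mul_of_smul_eq hwP hg
    obtain ⟨x, s, hs, rfl⟩ := hC.exists_eq u hu
    obtain ⟨a, rfl⟩ := hC.exists_of_mem k hk
    exact ⟨_, (coord hC hC' hs).mul (torus hC hC' a)⟩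
  obtain h | ⟨x, s, hs, h⟩ := hC.eq_or_exists (g • P)
  · exact h1 g h
  · obtain ⟨k', hk'⟩ := h1 (w * ((E x s)⁻¹ * g)) (by
      rw [mul_smul, mul_smul, h, inv_smul_smul, hC.base.smul_smul])
    refine ⟨E' x s * (w' * k'), ?_⟩
    have h2 := (coord hC hC' (x := x) hs).mul ((weyl hC hC').mul hk')
    rwa [← mul_assoc w, hC.base.mul_self, one_mul, mul_inv_cancel_left] at h2

end ElemRel

theorem IsNormalCoord.nonempty_mulEquiv (hC : IsNormalCoord P t w η E)
    (hC' : IsNormalCoord P' t' w' η' E') : Nonempty (G ≃* G') := by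
  choose φ hφ using ElemRel.exists_right hC hC'
  have hu {g : G} {g' k' : G'} (h : ElemRel P w E P' w' E' g g')
    (h' : ElemRel P w E P' w' E' g k') := ElemRel.unique hC.toIsCoord hC'.toIsCoord h h'
  refine ⟨MulEquiv.ofBijective (MonoidHom.mk' φ fun a b => hu (hφ _) ((hφ a).mul (hφ b)))
    ⟨fun a b hab => ?_, fun g' => ?_⟩⟩
  · have h1 := hφ b
    rw [← show φ a = φ b from hab] at h1
    exact ElemRel.unique hC'.toIsCoord hC.toIsCoord (hφ a).symm h1.symm
  · obtain ⟨g, hg⟩ := ElemRel.exists_right hC' hC g'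
    exact ⟨g, hu (hφ g) hg.symm⟩

end SevenTI

theorem exists_isNormalCoord_of_gkDegree {G : Type*} [Group G] [Finite G]
    (hG : Nat.card G = 2 ^ 6 * 3 * 5 ^ 4 * 7 ^ 6 * 13 * 181) (h2 : gkDegree G 2 = 3)
    (h3 : gkDegree G 3 = 2) (h5 : gkDegree G 5 = 3) (h13 : gkDegree G 13 = 1)
    (h181 : gkDegree G 181 = 1) :
    ∃ _ : IsSevenTI G, ∃ (P : Sylow 7 G) (t w : G) (η : F2401ˣ →* G) (E : F2401 → F2401 → G),
      IsNormalCoord P t w η E := by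
  obtain ⟨z, u, hL⟩ := exists_isSevenLocal_of_gkDegree hG h2 h3 h5 h13 h181
  have hTI := hL.isSevenTI hG
  obtain ⟨P, t, w, hB⟩ := exists_isBase hG
  obtain ⟨π, η, hM⟩ := hB.exists_isModel
  obtain ⟨E, hE⟩ := hM.exists_isCoord
  exact ⟨hTI, P, t, w, η, hE.exists_isNormalCoord⟩

/-- Any two finite groups of order `2^6 * 3 * 5^4 * 7^6 * 13 * 181` whose prime graphs have
vertex degrees deg 2 = 3, deg 3 = 2, deg 5 = 3, deg 7 = 2, deg 13 = 1, deg 181 = 1 are isomorphic (the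
order and degree pattern of the simple unitary group `U_3(49)`). -/
theorem od_characterization_U_3_49
    (G H : Type*) [Group G] [Finite G] [Group H] [Finite H]
    (hG : Nat.card G = 2^6 * 3 * 5^4 * 7^6 * 13 * 181)
    (hH : Nat.card H = 2^6 * 3 * 5^4 * 7^6 * 13 * 181)
    (hG2 : gkDegree G 2 = 3)
    (hG3 : gkDegree G 3 = 2)
    (hG5 : gkDegree G 5 = 3)
    (hG7 : gkDegree G 7 = 2)
    (hG13 : gkDegree G 13 = 1)
    (hG181 : gkDegree G 181 = 1)
    (hH2 : gkDegree H 2 = 3)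
    (hH3 : gkDegree H 3 = 2)
    (hH5 : gkDegree H 5 = 3)
    (hH7 : gkDegree H 7 = 2)
    (hH13 : gkDegree H 13 = 1)
    (hH181 : gkDegree H 181 = 1) :
    Nonempty (G ≃* H) := by
  obtain ⟨_, P, t, w, η, E, hE⟩ := exists_isNormalCoord_of_gkDegree hG hG2 hG3 hG5 hG13 hG181
  obtain ⟨_, P', t', w', η', E', hE'⟩ := exists_isNormalCoord_of_gkDegree hH hH2 hH3 hH5 hH13 hH181
  exact hE.nonempty_mulEquiv hE'
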